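/- π_{2n}(U(n)) is a cyclic group of order n!, generated by the image of the connecting homomorphism ∂ : π_{2n+1}(S^{2n+1}) → π_{2n}(U(n)) of the fibration U(n) → U(n+1) → S^{2n+1}. -/

import Mathlib

section part1
open scoped unitInterval Topology
set_option linter.unusedVariables false
set_option linter.unusedSimpArgs false
namespace PU

variable {E E' : Type*} [TopologicalSpace E] [TopologicalSpace E']

variable {X Y : Type*} [TopologicalSpace X] [TopologicalSpace Y]

/-- The cube. -/
abbrev Q (k : ℕ) := Fin k → I

/-- The boundary of the cube. -/
abbrev bdQ (k : ℕ) : Set (Q k) := Cube.boundary (Fin k)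

/-- The boundary of `I × (X, A)`. -/
def sus (A : Set X) : Set (I × X) := {p | p.1 = 0 ∨ p.1 = 1 ∨ p.2 ∈ A}

/-- Continuous maps on a pair, with values in a set `S`. -/
structure Lp (A : Set X) (S : Set E) (e : E) (f : X → E) : Prop where
  cont : Continuous f
  mem : ∀ x, f x ∈ S
  bd : ∀ x ∈ A, f x = e

/-- Homotopy of loops inside `S`. -/
def Ht (A : Set X) (S : Set E) (e : E) (f g : X → E) : Prop :=
  ∃ H : I × X → E, Continuous H ∧ (∀ p, H p ∈ S) ∧ (∀ x, H (0, x) = f x) ∧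
    (∀ x, H (1, x) = g x) ∧ ∀ s, ∀ x ∈ A, H (s, x) = e

section
variable {A : Set X} {S : Set E} {e : E} {f g h : X → E}

theorem Ht.lp_left (h : Ht A S e f g) : Lp A S e f := by
  obtain ⟨H, h1, h2, h3, h4, h5⟩ := h
  have : f = fun x => H (0, x) := by ext x; rw [h3]
  subst this
  exact ⟨by fun_prop, fun x => h2 _, fun x hx => h5 _ _ hx⟩

theorem Ht.symm (h : Ht A S e f g) : Ht A S e g f := by
  obtain ⟨H, h1, h2, h3, h4, h5⟩ := h
  exact ⟨fun p => H (σ p.1, p.2), by fun_prop, fun p => h2 _, fun x => by simp [h4],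
    fun x => by simp [h3], fun s x hx => h5 _ _ hx⟩

theorem Ht.lp_right (h : Ht A S e f g) : Lp A S e g := h.symm.lp_left

theorem Ht.refl (hf : Lp A S e f) : Ht A S e f f :=
  ⟨fun p => f p.2, by have := hf.cont; fun_prop, fun p => hf.mem _, fun _ => rfl, fun _ => rfl,
    fun _ x hx => hf.bd x hx⟩

theorem Ht.trans (h1 : Ht A S e f g) (h2 : Ht A S e g h) : Ht A S e f h := by
  obtain ⟨H, a1, a2, a3, a4, a5⟩ := h1
  obtain ⟨K, b1, b2, b3, b4, b5⟩ := h2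
  let F1 : ContinuousMap.Homotopy (⟨fun x => H (0, x), by fun_prop⟩ : C(X, E))
    ⟨fun x => H (1, x), by fun_prop⟩ := ⟨⟨H, a1⟩, fun _ => rfl, fun _ => rfl⟩
  let F2 : ContinuousMap.Homotopy (⟨fun x => H (1, x), by fun_prop⟩ : C(X, E))
    ⟨fun x => K (1, x), by fun_prop⟩ := ⟨⟨K, b1⟩, fun x => by simp [a4, b3], fun _ => rfl⟩
  have key : ∀ p, (∃ s, (F1.trans F2) p = H (s, p.2)) ∨ ∃ s, (F1.trans F2) p = K (s, p.2) := by
    rintro ⟨t, x⟩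
    rw [ContinuousMap.Homotopy.trans_apply]
    split_ifs
    · exact Or.inl ⟨_, rfl⟩
    · exact Or.inr ⟨_, rfl⟩
  refine ⟨fun p => (F1.trans F2) p, by fun_prop, fun p => ?_, fun x => ?_, fun x => ?_,
    fun s x hx => ?_⟩
  · rcases key p with ⟨s, h⟩ | ⟨s, h⟩ <;> simp only [h, a2, b2]
  · exact ((F1.trans F2).apply_zero x).trans (a3 x)
  · exact ((F1.trans F2).apply_one x).trans (b4 x)
  · rcases key (s, x) with ⟨s, h⟩ | ⟨s, h⟩
    · exact h.trans (a5 _ _ hx)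
    · exact h.trans (b5 _ _ hx)

theorem Lp.map (h : Lp A S e f) {S' : Set E'} {φ : E → E'} (hc : ContinuousOn φ S)
    (hm : Set.MapsTo φ S S') {e' : E'} (he : φ e = e') : Lp A S' e' (fun x => φ (f x)) :=
  ⟨hc.comp_continuous h.cont h.mem, fun x => hm (h.mem x), fun x hx => by rw [h.bd x hx, he]⟩

theorem Ht.map (h : Ht A S e f g) {S' : Set E'} {φ : E → E'} (hc : ContinuousOn φ S)
    (hm : Set.MapsTo φ S S') {e' : E'} (he : φ e = e') :
    Ht A S' e' (fun x => φ (f x)) (fun x => φ (g x)) := by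
  obtain ⟨H, h1, h2, h3, h4, h5⟩ := h
  exact ⟨fun p => φ (H p), hc.comp_continuous h1 h2, fun p => hm (h2 p),
    fun x => congrArg φ (h3 x), fun x => congrArg φ (h4 x),
    fun s x hx => (congrArg φ (h5 s x hx)).trans he⟩

/-- Precomposition with a map of pairs. -/
theorem Lp.comp (h : Lp A S e f) {B : Set Y} {φ : Y → X} (hc : Continuous φ)
    (hm : ∀ y ∈ B, φ y ∈ A) : Lp B S e (fun y => f (φ y)) :=
  ⟨h.cont.comp hc, fun y => h.mem _, fun y hy => h.bd _ (hm y hy)⟩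

theorem Ht.comp (h : Ht A S e f g) {B : Set Y} {φ : Y → X} (hc : Continuous φ)
    (hm : ∀ y ∈ B, φ y ∈ A) : Ht B S e (fun y => f (φ y)) (fun y => g (φ y)) := by
  obtain ⟨H, h1, h2, h3, h4, h5⟩ := h
  exact ⟨fun p => H (p.1, φ p.2), by fun_prop, fun p => h2 _, fun x => h3 _, fun x => h4 _,
    fun s x hx => h5 _ _ (hm _ hx)⟩

/-- A homotopy from a one-parameter family indexed by `I`. -/
theorem Ht.mk (H : I → X → E) (hc : Continuous fun p : I × X => H p.1 p.2)
    (hm : ∀ s x, H s x ∈ S) (hb : ∀ s, ∀ x ∈ A, H s x = e) : Ht A S e (H 0) (H 1) :=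
  ⟨fun p => H p.1 p.2, hc, fun p => hm _ _, fun _ => rfl, fun _ => rfl, hb⟩

theorem Ht.congr (h : Ht A S e f g) {f' g' : X → E} (hf : ∀ x, f' x = f x)
    (hg : ∀ x, g' x = g x) : Ht A S e f' g' := by
  rw [funext hf, funext hg]; exact h

/-- Binary map of homotopies. -/
theorem Ht.map₂ {F F' : Type*} [TopologicalSpace F] [TopologicalSpace F'] {T : Set F} {b : F}
    {f' g' : X → F} (h : Ht A S e f g) (h' : Ht A T b f' g') {U : Set F'} {φ : E × F → F'}
    (hc : ContinuousOn φ (S ×ˢ T)) (hm : ∀ x ∈ S, ∀ y ∈ T, φ (x, y) ∈ U) {c : F'}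
    (he : φ (e, b) = c) :
    Ht A U c (fun x => φ (f x, f' x)) (fun x => φ (g x, g' x)) := by
  obtain ⟨H, h1, h2, h3, h4, h5⟩ := h
  obtain ⟨K, k1, k2, k3, k4, k5⟩ := h'
  refine ⟨fun p => φ (H p, K p), hc.comp_continuous (by fun_prop) (fun p => ⟨h2 p, k2 p⟩),
    fun p => hm _ (h2 p) _ (k2 p), fun x => by simp [h3, k3], fun x => by simp [h4, k4],
    fun s x hx => by simp [h5 s x hx, k5 s x hx, he]⟩

end

/-- subdivision lemma -/
theorem exists_subdiv {K B : Type*} [TopologicalSpace K] [CompactSpace K] [TopologicalSpace B]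
    (f : K × I → B) (hf : Continuous f) (O : Set (B × B))
    (hO : ∀ p, O ∈ 𝓝 (f p, f p)) :
    ∃ n : ℕ, 0 < n ∧ ∀ k : K, ∀ s t : I, |(s:ℝ) - t| ≤ 1 / n → (f (k, s), f (k, t)) ∈ O := by
  let c : K × I × I → B × B := fun p => (f (p.1, p.2.1), f (p.1, p.2.2))
  have hc : Continuous c := by fun_prop
  let C : Set (K × I × I) := (c ⁻¹' interior O)ᶜ
  have hC : IsCompact C := ((isOpen_interior.preimage hc).isClosed_compl).isCompact
  have key : ∃ δ > 0, ∀ p ∈ C, δ ≤ |((p.2.1 : I) : ℝ) - p.2.2| := by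
    by_cases hne : C.Nonempty
    · obtain ⟨p, hp, hmin⟩ := hC.exists_isMinOn hne
        (f := fun p : K × I × I => |((p.2.1 : I) : ℝ) - p.2.2|) (by fun_prop)
      refine ⟨_, ?_, fun q hq => hmin hq⟩
      rw [gt_iff_lt, abs_pos, sub_ne_zero]
      intro h
      apply hp
      have h' : p.2.1 = p.2.2 := Subtype.ext h
      show c p ∈ interior O
      simp only [c, h']
      exact mem_interior_iff_mem_nhds.2 (hO _)
    · exact ⟨1, one_pos, fun p hp => (hne ⟨p, hp⟩).elim⟩
  obtain ⟨δ, hδ, h⟩ := key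
  obtain ⟨n, hn⟩ := exists_nat_one_div_lt hδ
  refine ⟨n+1, Nat.succ_pos _, fun k s t hst => ?_⟩
  by_contra hno
  have : (k, s, t) ∈ C := fun hh => hno (interior_subset hh)
  have := h _ this
  push_cast at hst
  simp only at this
  linarith

/-- Transport along paths. -/
theorem transport {K B M : Type*} [TopologicalSpace K] [CompactSpace K] [TopologicalSpace B]
    [Monoid M] [TopologicalSpace M] [ContinuousMul M]
    (f : K × I → B) (hf : Continuous f) (O : Set (B × B)) (hO : ∀ p, O ∈ 𝓝 (f p, f p))
    (R : B × B → M) (hR : ContinuousOn R O) (T : M → B → B → Prop)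
    (hR1 : ∀ v, R (v, v) = 1)
    (hT1 : ∀ v, T 1 v v) (hTm : ∀ m m' v w z, T m v w → T m' w z → T (m' * m) v z)
    (hRT : ∀ v w, (v, w) ∈ O → T (R (v, w)) v w) :
    ∃ u : K × I → M, Continuous u ∧ (∀ k, u (k, 0) = 1) ∧
      (∀ k t, T (u (k, t)) (f (k, 0)) (f (k, t))) ∧
      ∀ k, (∀ t, f (k, t) = f (k, 0)) → ∀ t, u (k, t) = 1 := by
  obtain ⟨n, hn, h⟩ := exists_subdiv f hf O hO
  let pt : ℕ → I → I := fun j t => ⟨min (t:ℝ) (j / n),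
    le_min t.2.1 (by positivity), (min_le_left _ _).trans t.2.2⟩
  have hpt : ∀ j, Continuous (pt j) := fun j => by
    refine Continuous.subtype_mk ?_ _; fun_prop
  have key : ∀ j : ℕ, ∃ u : K × I → M, Continuous u ∧ (∀ k, u (k, 0) = 1) ∧
      (∀ k t, T (u (k, t)) (f (k, 0)) (f (k, pt j t))) ∧
      ∀ k, (∀ t, f (k, t) = f (k, 0)) → ∀ t, u (k, t) = 1 := by
    intro j
    induction j with
    | zero =>
      refine ⟨fun _ => 1, continuous_const, fun _ => rfl, fun k t => ?_, fun _ _ _ => rfl⟩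
      have : pt 0 t = 0 := Subtype.ext (by simp [pt, t.2.1])
      rw [this]; exact hT1 _
    | succ j ih =>
      obtain ⟨u, h1, h2, h3, h4⟩ := ih
      have hin : ∀ k t, (f (k, pt j t), f (k, pt (j+1) t)) ∈ O := by
        intro k t
        apply h
        simp only [pt]
        have := abs_min_sub_min_le_max (t:ℝ) (j/n) t ((j+1:ℕ)/n)
        refine this.trans ?_
        rw [sub_self, abs_zero, max_eq_right (abs_nonneg _), abs_sub_comm]
        push_cast
        rw [← sub_div, add_sub_cancel_left, abs_of_nonneg (by positivity)]
      refine ⟨fun p => R (f (p.1, pt j p.2), f (p.1, pt (j+1) p.2)) * u p, ?_, ?_, ?_, ?_⟩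
      · refine Continuous.mul ?_ h1
        refine hR.comp_continuous ?_ (fun p => hin p.1 p.2)
        have a1 := hpt j
        have a2 := hpt (j+1)
        fun_prop
      · intro k
        have e : ∀ i, pt i 0 = 0 := fun i => Subtype.ext (by simp only [pt]; simp; positivity)
        simp only [e, hR1, h2, one_mul]
      · intro k t
        exact hTm _ _ _ _ _ (h3 k t) (hRT _ _ (hin k t))
      · intro k hk t
        simp only [hk (pt _ _), hR1, h4 k hk t, one_mul]
  obtain ⟨u, h1, h2, h3, h4⟩ := key n
  refine ⟨u, h1, h2, fun k t => ?_, h4⟩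
  have : pt n t = t := Subtype.ext (by
    have : (n:ℝ) ≠ 0 := by positivity
    simp only [pt]; rw [div_self this]; simp [t.2.2])
  rw [← this]
  have := h3 k t
  rwa [‹pt n t = t›] at *

end PU
end part1

section part2
open scoped unitInterval Topology
set_option linter.unusedVariables false
set_option linter.unusedSimpArgs false
namespace PU

variable {E E' : Type*} [TopologicalSpace E] [TopologicalSpace E']

theorem cons_mem_bdQ {k : ℕ} (t : I) (x : Q k) :
    (Fin.cons t x : Q (k+1)) ∈ bdQ (k+1) ↔ (t, x) ∈ sus (bdQ k) := by
  simp only [Cube.boundary, sus, Set.mem_ofPred_eq, Fin.exists_fin_succ, Fin.cons_zero,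
    Fin.cons_succ, or_assoc]

theorem continuous_consQ {k : ℕ} :
    Continuous (fun p : I × Q k => (Fin.cons p.1 p.2 : Q (k+1))) := by
  refine continuous_pi fun i => ?_
  refine Fin.cases ?_ (fun j => ?_) i
  · simpa using continuous_fst
  · simp only [Fin.cons_succ]; fun_prop

theorem continuous_tailQ {k : ℕ} : Continuous (fun x : Q (k+1) => (x 0, (Fin.tail x : Q k))) := by
  refine (continuous_apply 0).prodMk (continuous_pi fun i => ?_)
  exact continuous_apply i.succ

theorem tail_mem {k : ℕ} (x : Q (k+1)) (hx : x ∈ bdQ (k+1)) :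
    (x 0, (Fin.tail x : Q k)) ∈ sus (bdQ k) := by
  rw [← cons_mem_bdQ, Fin.cons_self_tail]; exact hx

theorem ht_cons {S : Set E} {e : E} {k : ℕ} {f g : Q (k+1) → E} :
    Ht (bdQ (k+1)) S e f g ↔ Ht (sus (bdQ k)) S e (fun p => f (Fin.cons p.1 p.2))
      (fun p => g (Fin.cons p.1 p.2)) := by
  constructor
  · exact fun h => h.comp continuous_consQ (fun p hp => (cons_mem_bdQ _ _).2 hp)
  · intro h
    refine (h.comp continuous_tailQ tail_mem).congr ?_ ?_ <;> simp

theorem lp_cons {S : Set E} {e : E} {k : ℕ} {f : Q (k+1) → E} :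
    Lp (bdQ (k+1)) S e f ↔ Lp (sus (bdQ k)) S e (fun p => f (Fin.cons p.1 p.2)) := by
  constructor
  · exact fun h => h.comp continuous_consQ (fun p hp => (cons_mem_bdQ _ _).2 hp)
  · intro h
    have := h.comp continuous_tailQ tail_mem
    simpa using this

section cls
variable {S : Set E} {e : E} {k : ℕ}

/-- The generalized loop attached to a loop. -/
def Lp.gl {f : Q k → E} (h : Lp (bdQ k) S e f) (he : e ∈ S) :
    GenLoop (Fin k) S ⟨e, he⟩ :=
  ⟨⟨fun x => ⟨f x, h.mem x⟩, by have := h.cont; fun_prop⟩, fun x hx => Subtype.ext (h.bd x hx)⟩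

theorem ht_iff {f g : Q k → E} (hf : Lp (bdQ k) S e f) (hg : Lp (bdQ k) S e g)
    (he : e ∈ S) : Ht (bdQ k) S e f g ↔ GenLoop.Homotopic (hf.gl he) (hg.gl he) := by
  constructor
  · rintro ⟨H, h1, h2, h3, h4, h5⟩
    refine ⟨⟨⟨⟨fun p => ⟨H p, h2 p⟩, by fun_prop⟩, fun x => Subtype.ext (h3 x),
      fun x => Subtype.ext (h4 x)⟩, ?_⟩⟩
    intro t x hx
    refine Subtype.ext ((h5 t x hx).trans (hf.bd x hx).symm)
  · rintro ⟨H⟩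
    refine ⟨fun p => (H p).1, by fun_prop, fun p => (H p).2, fun x => ?_, fun x => ?_, ?_⟩
    · exact congrArg Subtype.val (H.apply_zero x)
    · exact congrArg Subtype.val (H.apply_one x)
    · intro s x hx
      exact (congrArg Subtype.val (H.eq_fst s hx)).trans (hf.bd x hx)

/-- Homotopy group with base point in a set. -/
abbrev Pg (k : ℕ) {S : Set E} {e : E} (he : e ∈ S) := HomotopyGroup (Fin k) S ⟨e, he⟩

theorem lp_const {X : Type*} [TopologicalSpace X] {A : Set X} (he : e ∈ S) :
    Lp A S e (fun _ => e) := ⟨continuous_const, fun _ => he, fun _ _ => rfl⟩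

open Classical in
/-- The class of a loop (junk if not a loop). -/
noncomputable def cls (he : e ∈ S) (f : Q k → E) : Pg k he :=
  if h : Lp (bdQ k) S e f then Quotient.mk _ (h.gl he) else
    Quotient.mk _ ((lp_const he : Lp (bdQ k) S e _).gl he)

theorem cls_of {f : Q k → E} (he : e ∈ S) (h : Lp (bdQ k) S e f) :
    cls he f = Quotient.mk _ (h.gl he) := dif_pos h

theorem cls_eq {f g : Q k → E} {he : e ∈ S} (hf : Lp (bdQ k) S e f) (hg : Lp (bdQ k) S e g) :
    cls he f = cls he g ↔ Ht (bdQ k) S e f g := by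
  rw [cls_of he hf, cls_of he hg, ht_iff hf hg he]
  exact Quotient.eq

theorem Ht.cls_eq {f g : Q k → E} {he : e ∈ S} (h : Ht (bdQ k) S e f g) :
    cls he f = cls he g := (PU.cls_eq h.lp_left h.lp_right).2 h

theorem exists_cls {he : e ∈ S} (x : Pg k he) : ∃ f, Lp (bdQ k) S e f ∧ cls he f = x := by
  induction x using Quotient.inductionOn with
  | _ a =>
    have : Lp (bdQ k) S e (fun x => (a x).1) :=
      ⟨by fun_prop, fun x => (a x).2, fun x hx => congrArg Subtype.val (a.2 x hx)⟩
    refine ⟨_, this, ?_⟩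
    rw [cls_of he this]
    rfl

/-- Concatenation. -/
noncomputable def tr (i : Fin k) (f g : Q k → E) : Q k → E := fun t =>
  if (t i : ℝ) ≤ 1/2
    then f (Function.update t i (Set.projIcc 0 1 zero_le_one (2 * t i)))
    else g (Function.update t i (Set.projIcc 0 1 zero_le_one (2 * t i - 1)))

theorem Lp.tr {f g : Q k → E} (hf : Lp (bdQ k) S e f) (hg : Lp (bdQ k) S e g) (he : e ∈ S)
    (i : Fin k) : Lp (bdQ k) S e (tr i f g) := by
  let a := GenLoop.transAt i (hf.gl he) (hg.gl he)
  have : PU.tr i f g = fun x => (a x).1 := by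
    funext x
    simp only [PU.tr, a, GenLoop.transAt, GenLoop.copy]
    show _ = Subtype.val (ite _ _ _)
    split_ifs <;> rfl
  rw [this]
  exact ⟨by fun_prop, fun x => (a x).2, fun x hx => congrArg Subtype.val (a.2 x hx)⟩

theorem cls_mul {f g : Q (k+1) → E} {he : e ∈ S} (hf : Lp (bdQ (k+1)) S e f)
    (hg : Lp (bdQ (k+1)) S e g) (i : Fin (k+1)) :
    cls he f * cls he g = cls he (tr i g f) := by
  rw [cls_of he hf, cls_of he hg, cls_of he (hg.tr hf he i)]
  refine (HomotopyGroup.mul_spec (i := i)).trans ?_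
  congr 1
  apply GenLoop.ext
  intro x
  apply Subtype.ext
  simp only [tr, GenLoop.transAt, GenLoop.copy]
  show Subtype.val (ite _ _ _) = ite _ _ _
  split_ifs <;> rfl

theorem cls_one {he : e ∈ S} : cls he (fun _ : Q (k+1) => e) = 1 := by
  rw [cls_of he (lp_const he), HomotopyGroup.one_def]
  rfl

theorem cls_eq_one {f : Q (k+1) → E} {he : e ∈ S} (hf : Lp (bdQ (k+1)) S e f) :
    cls he f = 1 ↔ Ht (bdQ (k+1)) S e f (fun _ => e) := by
  rw [← cls_one, cls_eq hf (lp_const he)]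

/-- A homomorphism of homotopy groups from a relation between loops. -/
theorem exists_hom {S' : Set E'} {e' : E'} {l : ℕ} (he : e ∈ S) (he' : e' ∈ S')
    (r : (Q (k+1) → E) → (Q (l+1) → E') → Prop) (i : Fin (k+1)) (j : Fin (l+1))
    (hlp : ∀ f a, Lp (bdQ (k+1)) S e f → r f a → Lp (bdQ (l+1)) S' e' a)
    (htot : ∀ f, Lp (bdQ (k+1)) S e f → ∃ a, r f a)
    (hfun : ∀ f g a b, Ht (bdQ (k+1)) S e f g → r f a → r g b → Ht (bdQ (l+1)) S' e' a b)
    (hmul : ∀ f g a b, Lp (bdQ (k+1)) S e f → Lp (bdQ (k+1)) S e g → r f a → r g b →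
      r (tr i f g) (tr j a b)) :
    ∃ h : Pg (k+1) he →* Pg (l+1) he', ∀ f a, Lp (bdQ (k+1)) S e f → r f a →
      h (cls he f) = cls he' a := by
  choose F hF1 hF2 using fun x : Pg (k+1) he => exists_cls x
  choose a ha using fun x : Pg (k+1) he => htot (F x) (hF1 x)
  have key : ∀ f b, Lp (bdQ (k+1)) S e f → r f b → cls he' (a (cls he f)) = cls he' b := by
    intro f b hf hb
    apply Ht.cls_eq
    refine hfun _ _ _ _ ?_ (ha _) hb
    rw [← cls_eq (he := he) (hF1 _) hf, hF2]
  refine ⟨MonoidHom.mk' (fun x => cls he' (a x)) ?_, key⟩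
  intro x y
  show cls he' (a (x * y)) = cls he' (a x) * cls he' (a y)
  rw [cls_mul (hlp _ _ (hF1 _) (ha x)) (hlp _ _ (hF1 _) (ha y)) j]
  rw [← key (tr i (F y) (F x)) _ ((hF1 _).tr (hF1 _) he i) (hmul _ _ _ _ (hF1 _) (hF1 _) (ha _) (ha _)),
    ← cls_mul (hF1 x) (hF1 y) i, hF2, hF2]

/-- Induced homomorphism. -/
theorem exists_ind {S' : Set E'} {e' : E'} (he : e ∈ S) (he' : e' ∈ S') (φ : E → E')
    (hc : ContinuousOn φ S) (hm : Set.MapsTo φ S S') (h0 : φ e = e') :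
    ∃ h : Pg (k+1) he →* Pg (k+1) he', ∀ f, Lp (bdQ (k+1)) S e f →
      h (cls he f) = cls he' (fun x => φ (f x)) := by
  obtain ⟨h, hh⟩ := exists_hom (k := k) (l := k) he he' (fun f a => a = fun x => φ (f x)) 0 0
    (by rintro f a hf rfl; exact hf.map hc hm h0) (fun f _ => ⟨_, rfl⟩)
    (by rintro f g a b h rfl rfl; exact h.map hc hm h0)
    (by
      rintro f g a b hf hg rfl rfl
      funext x; simp only [tr]; split_ifs <;> rfl)
  exact ⟨h, fun f hf => hh f _ hf rfl⟩

/-- In a set closed under multiplication, concatenation is the pointwise product. -/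
theorem ht_tr_mul {M : Type*} [TopologicalSpace M] [Monoid M] [ContinuousMul M] {S : Set M}
    (hS : ∀ a ∈ S, ∀ b ∈ S, a * b ∈ S) {f g : Q k → M} (hf : Lp (bdQ k) S 1 f)
    (hg : Lp (bdQ k) S 1 g) (i : Fin k) :
    Ht (bdQ k) S 1 (fun x => f x * g x) (tr i f g) := by
  have hpc : Continuous (Set.projIcc (0:ℝ) 1 zero_le_one) := continuous_projIcc
  have c1 := hf.cont
  have c2 := hg.cont
  let P : ℝ → I := Set.projIcc (0:ℝ) 1 zero_le_one
  have hz : ∀ x : Q k, ∀ t : I, t = 0 ∨ t = 1 → Function.update x i t ∈ bdQ k := by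
    intro x t ht
    exact ⟨i, by simpa using ht⟩
  have hP0 : ∀ r : ℝ, r ≤ 0 → P r = 0 := fun r hr => Set.projIcc_of_le_left _ hr
  have hP1 : ∀ r : ℝ, 1 ≤ r → P r = 1 := fun r hr => Set.projIcc_of_right_le _ hr
  refine (Ht.mk (A := bdQ k) (S := S) (e := 1) (fun s x => f (Function.update x i (P ((1 + s) * x i))) *
      g (Function.update x i (P ((1 + s) * x i - s)))) ?_ ?_ ?_).congr ?_ ?_
  · have : Continuous P := hpc
    fun_prop
  · exact fun s x => hS _ (hf.mem _) _ (hg.mem _)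
  · intro s x hx
    obtain ⟨j, hj⟩ := hx
    by_cases hji : j = i
    · subst hji
      have h1 : (0:ℝ) ≤ s := s.2.1
      rcases hj with hj | hj <;> rw [hj] <;> simp only [Set.Icc.coe_zero, Set.Icc.coe_one]
      · rw [hf.bd _ (hz _ _ (Or.inl (hP0 _ (by linarith)))),
          hg.bd _ (hz _ _ (Or.inl (hP0 _ (by linarith)))), one_mul]
      · rw [hf.bd _ (hz _ _ (Or.inr (hP1 _ (by linarith)))),
          hg.bd _ (hz _ _ (Or.inr (hP1 _ (by linarith)))), one_mul]
    · have : ∀ t, Function.update x i t ∈ bdQ k := fun t =>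
        ⟨j, by rw [Function.update_of_ne hji]; exact hj⟩
      rw [hf.bd _ (this _), hg.bd _ (this _), one_mul]
  · intro x
    have : P (x i) = x i := Set.projIcc_val _ _
    simp [this]
  · intro x
    simp only [tr, Set.Icc.coe_one]
    split_ifs with h
    · rw [hg.bd _ (hz _ _ (Or.inl (hP0 _ (by linarith)))), mul_one]
      norm_num [P]
    · rw [hf.bd _ (hz _ _ (Or.inr (hP1 _ (by linarith)))), one_mul]
      norm_num [P]

end cls
end PU
end part2

section part3
open scoped unitInterval Topology
set_option linter.unusedVariables false
set_option linter.unusedSimpArgs false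
namespace PU

section GP
variable {G : Type*} [NormedAddCommGroup G] [NormedSpace ℝ G] [FiniteDimensional ℝ G]

theorem gp_smooth {j : ℕ} (hj : j + 2 < 2 * Module.finrank ℝ G) (g0 : ℝ × (Fin j → ℝ) → G)
    (hg0 : Continuous g0) {δ : ℝ} (hδ : 0 < δ) :
    ∃ g : ℝ × (Fin j → ℝ) → G, Continuous g ∧
      (∀ t ∈ Set.Icc (0:ℝ) 1, ∀ x, ‖g (t, x) - g0 (t, x)‖ < δ) ∧
      ∀ x s t, s < t → g (s, x) = 0 → g (t, x) ≠ 0 := by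
  obtain ⟨g1, hg1, hg1a, -⟩ := hg0.exists_contDiff_approx 1 (ε := fun _ => δ / 2)
    continuous_const (fun _ => by positivity)
  let Φ : ℝ × ℝ × (Fin j → ℝ) → G × G := fun p =>
    ((p.2.1 - p.1)⁻¹ • (g1 (p.2.1, p.2.2) - g1 (p.1, p.2.2)),
      g1 (p.1, p.2.2) - p.1 • (p.2.1 - p.1)⁻¹ • (g1 (p.2.1, p.2.2) - g1 (p.1, p.2.2)))
  let U : Set (ℝ × ℝ × (Fin j → ℝ)) := {p | p.1 < p.2.1}
  have hU : Convex ℝ U := by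
    intro p hp q hq a b ha hb hab
    simp only [U, Set.mem_ofPred_eq, Prod.fst_add, Prod.snd_add, Prod.smul_fst, Prod.smul_snd,
      smul_eq_mul] at *
    rcases eq_or_lt_of_le ha with h | h
    · subst h; simp at hab; subst hab; simpa using hq
    · nlinarith
  have hΦ : ContDiffOn ℝ 1 Φ U := by
    have h1 : ContDiffOn ℝ 1 (fun p : ℝ × ℝ × (Fin j → ℝ) => (p.2.1 - p.1)⁻¹) U := by
      refine ContDiffOn.inv (f := fun p : ℝ × ℝ × (Fin j → ℝ) => p.2.1 - p.1) (by fun_prop) ?_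
      intro p hp
      have : p.1 < p.2.1 := hp
      exact (sub_pos.2 this).ne'
    have hg1' : ContDiff ℝ 1 g1 := hg1
    fun_prop
  have hd : Dense (Set.image Φ U)ᶜ := by
    apply hΦ.dense_compl_image_of_dimH_lt_finrank hU subset_rfl
    have h1 : dimH U ≤ dimH (Set.univ : Set (ℝ × ℝ × (Fin j → ℝ))) := dimH_mono (Set.subset_univ _)
    rw [Real.dimH_univ_eq_finrank] at h1
    refine h1.trans_lt ?_
    simp only [Module.finrank_prod, Module.finrank_self, Module.finrank_fin_fun]
    exact_mod_cast (by omega)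
  obtain ⟨⟨b, a⟩, hab, hball⟩ := hd.exists_mem_open (Metric.isOpen_ball (x := (0 : G × G)) (ε := δ/4))
    ⟨0, by simp; positivity⟩
  have hn : ‖b‖ < δ/4 ∧ ‖a‖ < δ/4 := by
    simpa [Prod.norm_def] using hball
  refine ⟨fun p => g1 p - a - p.1 • b, by have := hg1.continuous; fun_prop, ?_, ?_⟩
  · intro t ht x
    have h1 := hg1a (t, x)
    rw [dist_eq_norm] at h1
    have h2 : ‖t • b‖ ≤ ‖b‖ := by
      rw [norm_smul, Real.norm_eq_abs, abs_of_nonneg ht.1]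
      nlinarith [norm_nonneg b, ht.2]
    have : g1 (t, x) - a - t • b - g0 (t, x) = (g1 (t, x) - g0 (t, x)) - a - t • b := by abel
    simp only [this]
    have h3 := norm_sub_le (g1 (t, x) - g0 (t, x) - a) (t • b)
    have h4 := norm_sub_le (g1 (t, x) - g0 (t, x)) a
    linarith [hn.1, hn.2]
  · intro x s t hst h1 h2
    apply hab
    refine ⟨(s, t, x), hst, ?_⟩
    have e1 : g1 (s, x) = a + s • b := by
      have h1 : g1 (s, x) - a - s • b = 0 := h1
      rw [sub_sub, sub_eq_zero] at h1; exact h1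
    have e2 : g1 (t, x) = a + t • b := by
      have h2 : g1 (t, x) - a - t • b = 0 := h2
      rw [sub_sub, sub_eq_zero] at h2; exact h2
    have hne : t - s ≠ 0 := (sub_pos.2 hst).ne'
    have e3 : (t - s)⁻¹ • (g1 (t, x) - g1 (s, x)) = b := by
      rw [e1, e2, add_sub_add_left_eq_sub, ← sub_smul, smul_smul, inv_mul_cancel₀ hne, one_smul]
    simp only [Φ]
    rw [e3, e1, add_sub_cancel_right]

/-- General position: perturb so that each line meets the axis at most once. -/
theorem gp {j : ℕ} (hj : j + 2 < 2 * Module.finrank ℝ G) (F : I × Q j → G × ℝ)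
    (hF : Continuous F) {e : G} (he : e ≠ 0) {δ : ℝ} (hδ : 0 < δ) :
    ∃ F' : I × Q j → G × ℝ, Continuous F' ∧ (∀ p, ‖F' p - F p‖ < δ) ∧
      (∀ p, (F p).1 = e → F' p = F p) ∧
      ∀ x s t, s < t → (F' (s, x)).1 = 0 → (F' (t, x)).1 ≠ 0 := by
  have hen : 0 < ‖e‖ := norm_pos_iff.2 he
  let P : ℝ → I := Set.projIcc (0:ℝ) 1 zero_le_one
  have hP : Continuous P := continuous_projIcc
  obtain ⟨g, hg1, hg2, hg3⟩ := gp_smooth hj (fun p => (F (P p.1, fun i => P (p.2 i))).1)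
    (by fun_prop) (δ := min δ (‖e‖/4)) (by positivity)
  let g' : I × Q j → G := fun p => g (p.1, fun i => p.2 i)
  have hg' : ∀ p, ‖g' p - (F p).1‖ < min δ (‖e‖/4) := by
    rintro ⟨t, x⟩
    have := hg2 t t.2 (fun i => x i)
    simpa [P, Set.projIcc_val] using this
  let c : ℝ → ℝ := fun r => max 0 (min 1 (2 - 3 * r / ‖e‖))
  have hc0 : ∀ r, 0 ≤ c r := fun r => le_max_left _ _
  have hc1 : ∀ r, c r ≤ 1 := fun r => max_le zero_le_one (min_le_left _ _)
  let χ : I × Q j → ℝ := fun p => c ‖(F p).1‖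
  have hcont : Continuous χ := by simp only [χ, c]; fun_prop
  refine ⟨fun p => ((F p).1 + χ p • (g' p - (F p).1), (F p).2), by fun_prop, ?_, ?_, ?_⟩
  · intro p
    have h1 : ‖χ p • (g' p - (F p).1)‖ < δ := by
      rw [norm_smul, Real.norm_eq_abs, abs_of_nonneg (hc0 _)]
      have := (hg' p).trans_le (min_le_left _ _)
      have h3 : χ p ≤ 1 := hc1 _
      have h4 : 0 ≤ χ p := hc0 _
      nlinarith [norm_nonneg (g' p - (F p).1)]
    have h2 : ((F p).1 + χ p • (g' p - (F p).1), (F p).2) - F p = (χ p • (g' p - (F p).1), 0) := by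
      ext <;> simp
    rw [h2, Prod.norm_def]
    simpa using h1
  · intro p hp
    have : χ p = 0 := by
      simp only [χ, c, hp]
      rw [mul_div_assoc, div_self hen.ne']; norm_num
    simp [this]
  · have key : ∀ p, (F p).1 + χ p • (g' p - (F p).1) = 0 → g' p = 0 := by
      intro p hp
      have h1 : ‖(F p).1‖ < ‖e‖/4 := by
        have h1 : (F p).1 = - (χ p • (g' p - (F p).1)) := eq_neg_of_add_eq_zero_left hp
        have h2 : ‖χ p • (g' p - (F p).1)‖ < ‖e‖/4 := by
          rw [norm_smul, Real.norm_eq_abs, abs_of_nonneg (hc0 _)]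
          have := (hg' p).trans_le (min_le_right _ _)
          have h3 : χ p ≤ 1 := hc1 _
          have h4 : 0 ≤ χ p := hc0 _
          nlinarith [norm_nonneg (g' p - (F p).1)]
        rw [h1, norm_neg]; exact h2
      have h2 : χ p = 1 := by
        simp only [χ, c]
        have : 3 * ‖(F p).1‖ / ‖e‖ ≤ 1 := by
          rw [div_le_one hen]; linarith
        rw [min_eq_left (by linarith), max_eq_right zero_le_one]
      rw [h2] at hp
      simpa using hp
    intro x s t hst h1 h2
    exact hg3 (fun i => x i) s t hst (key _ h1) (key _ h2)

end GP

section CutS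
variable {G : Type*} [NormedAddCommGroup G]

/-- Admissibility of a cut at level `κ`. -/
def Cut {X : Type*} (F : I × X → G × ℝ) (x : X) (κ : ℝ) : Prop :=
  κ ∈ Set.Icc (0:ℝ) 1 ∧ (∀ t : I, (t:ℝ) ≤ κ → (F (t, x)).1 ≠ 0 ∨ (F (t, x)).2 < 0) ∧
    (∀ t : I, κ ≤ t → (F (t, x)).1 ≠ 0 ∨ 0 < (F (t, x)).2)

theorem Cut.ne {X : Type*} {F : I × X → G × ℝ} {x : X} {κ : I} (h : Cut F x κ) :
    (F (κ, x)).1 ≠ 0 := by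
  rcases h.2.1 κ le_rfl with h1 | h1
  · exact h1
  · rcases h.2.2 κ le_rfl with h2 | h2
    · exact h2
    · linarith

theorem Cut.convex {X : Type*} {F : I × X → G × ℝ} {x : X} {a b c : ℝ} (ha : Cut F x a)
    (hb : Cut F x b) (h1 : a ≤ c) (h2 : c ≤ b) : Cut F x c :=
  ⟨⟨ha.1.1.trans h1, h2.trans hb.1.2⟩, fun t ht => hb.2.1 t (ht.trans h2),
    fun t ht => ha.2.2 t (h1.trans ht)⟩

theorem isOpen_cut {X : Type*} [TopologicalSpace X] {F : I × X → G × ℝ} (hF : Continuous F)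
    (κ : ℝ) : IsOpen {x | Cut F x κ} := by
  have hcl : ∀ (C : Set (I × X)), IsClosed C → IsOpen {x : X | ∀ t : I, (t, x) ∉ C} := by
    intro C hC
    have := isClosedMap_snd_of_compactSpace (X := I) (Y := X) C hC
    have h2 : {x : X | ∀ t : I, (t, x) ∉ C} = (Set.image Prod.snd C)ᶜ := by
      ext x; simp
    rw [h2]; exact this.isOpen_compl
  by_cases hκ : κ ∈ Set.Icc (0:ℝ) 1
  · have h1 := hcl ({p | (p.1:ℝ) ≤ κ} ∩ ({p | (F p).1 = 0} ∩ {p | 0 ≤ (F p).2}))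
      ((isClosed_le (by fun_prop) (by fun_prop)).inter ((isClosed_eq (by fun_prop) (by fun_prop)).inter
        (isClosed_le (by fun_prop) (by fun_prop))))
    have h2 := hcl ({p | κ ≤ (p.1:ℝ)} ∩ ({p | (F p).1 = 0} ∩ {p | (F p).2 ≤ 0}))
      ((isClosed_le (by fun_prop) (by fun_prop)).inter ((isClosed_eq (by fun_prop) (by fun_prop)).inter
        (isClosed_le (by fun_prop) (by fun_prop))))
    convert h1.inter h2 using 1
    ext x
    simp only [Cut, hκ, true_and, Set.mem_ofPred_eq, Set.mem_inter_iff, not_and, not_le]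
    refine and_congr (forall_congr' fun t => ?_) (forall_congr' fun t => ?_) <;> tauto
  · simp [Cut, hκ]

theorem exists_cut {X : Type*} [TopologicalSpace X] [CompactSpace X] [T2Space X]
    {F : I × X → G × ℝ} (hF : Continuous F) (hF0 : ∀ p, F p ≠ 0)
    (h0 : ∀ x, (F (0, x)).1 ≠ 0) (h1 : ∀ x, (F (1, x)).1 ≠ 0)
    (hu : ∀ x s t, s < t → (F (s, x)).1 = 0 → (F (t, x)).1 ≠ 0) :
    ∃ κ : X → I, Continuous κ ∧ ∀ x, Cut F x (κ x) := by
  obtain ⟨κ, hκ⟩ := exists_continuous_forall_mem_convex_of_local_const (E := ℝ)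
    (t := fun x => {c | Cut F x c}) (fun x => by
      apply Set.OrdConnected.convex
      exact ⟨fun a ha b hb c hc => ha.convex hb hc.1 hc.2⟩) (fun x => by
      have : ∃ c, Cut F x c := by
        by_cases hz : ∃ t : I, (F (t, x)).1 = 0 ∧ (F (t, x)).2 < 0
        · obtain ⟨t, ht, ht'⟩ := hz
          refine ⟨1, by simp, fun s _ => ?_, fun s hs => ?_⟩
          · by_cases hst : s = t
            · subst hst; exact Or.inr ht'
            · left
              intro hs
              rcases lt_or_gt_of_ne hst with h | h
              · exact hu x s t h hs ht
              · exact hu x t s h ht hs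
          · left
            have : s = 1 := le_antisymm s.2.2 hs
            rw [this]; exact h1 x
        · refine ⟨0, by simp, fun s hs => ?_, fun s _ => ?_⟩
          · left
            have : s = 0 := le_antisymm hs s.2.1
            rw [this]; exact h0 x
          · by_contra hcon
            push Not at hcon
            refine hz ⟨s, hcon.1, lt_of_le_of_ne hcon.2 fun h => ?_⟩
            exact hF0 (s, x) (Prod.ext hcon.1 h)
      obtain ⟨c, hc⟩ := this
      exact ⟨c, (isOpen_cut hF c).mem_nhds hc⟩)
  exact ⟨fun x => ⟨κ x, (hκ x).1⟩, by fun_prop, hκ⟩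

end CutS
end PU
end part3

section part4
open scoped unitInterval Topology
set_option linter.unusedVariables false
set_option linter.unusedSimpArgs false
set_option linter.unusedSectionVars false
namespace PU

/-- Nonzero vectors. -/
def nz (W : Type*) [Zero W] : Set W := {w | w ≠ 0}

@[simp] theorem mem_nz {W : Type*} [Zero W] {w : W} : w ∈ nz W ↔ w ≠ 0 := Iff.rfl

theorem isClosed_sus {X : Type*} [TopologicalSpace X] {A : Set X} (hA : IsClosed A) :
    IsClosed (sus A) := by
  have : sus A = (Prod.fst ⁻¹' {0}) ∪ ((Prod.fst ⁻¹' {1}) ∪ (Prod.snd ⁻¹' A)) := by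
    ext p; rfl
  rw [this]
  exact (isClosed_singleton.preimage continuous_fst).union
    ((isClosed_singleton.preimage continuous_fst).union (hA.preimage continuous_snd))

theorem isClosed_bdQ (k : ℕ) : IsClosed (bdQ k) := by
  have : bdQ k = ⋃ i : Fin k, ((fun y : Q k => y i) ⁻¹' {0, 1}) := by
    ext x; simp [Cube.boundary]
  rw [this]
  refine isClosed_iUnion_of_finite fun i => IsClosed.preimage (by fun_prop) ?_
  exact (Set.toFinite _).isClosed

theorem isOpen_forall {X K : Type*} [TopologicalSpace X] [TopologicalSpace K] [CompactSpace K]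
    {C : Set (K × X)} (hC : IsClosed C) : IsOpen {x : X | ∀ t : K, (t, x) ∉ C} := by
  have := isClosedMap_snd_of_compactSpace (X := K) (Y := X) C hC
  have h2 : {x : X | ∀ t : K, (t, x) ∉ C} = (Set.image Prod.snd C)ᶜ := by
    ext x; simp
  rw [h2]; exact this.isOpen_compl

section sides
variable {G : Type*} [NormedAddCommGroup G]

/-- Being on the good side. -/
def sd (t : I) (y : G × ℝ) : Prop := y.1 ≠ 0 ∨ 0 < ((t:ℝ) - 1/2) * y.2

theorem sd.ne {t : I} {y : G × ℝ} (h : sd t y) : y ≠ 0 := by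
  rintro rfl; simp [sd] at h

theorem sd.half {t : I} {y : G × ℝ} (h : sd t y) (ht : (t:ℝ) = 1/2) : y.1 ≠ 0 := by
  rcases h with h | h
  · exact h
  · simp [ht] at h

theorem sd.cut {X : Type*} {F : I × X → G × ℝ} {x : X} (h : ∀ t, sd t (F (t, x))) :
    Cut F x (1/2) := by
  refine ⟨by norm_num, fun t ht => ?_, fun t ht => ?_⟩
  · refine (h t).imp id fun h => ?_
    by_contra hc; push Not at hc; nlinarith
  · refine (h t).imp id fun h => ?_
    by_contra hc; push Not at hc; nlinarith

theorem sd_margin {X : Type*} [TopologicalSpace X] [CompactSpace X] [Nonempty X]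
    {p : I × X → G × ℝ} (hp : Continuous p) (h : ∀ z, sd z.1 (p z)) :
    ∃ m > 0, ∀ z y, ‖y - p z‖ < m → sd z.1 y := by
  obtain ⟨z0, -, hz⟩ := isCompact_univ.exists_isMinOn (Set.univ_nonempty (α := I × X))
    (f := fun z : I × X => max ‖(p z).1‖ (((z.1:ℝ) - 1/2) * (p z).2)) (by fun_prop)
  refine ⟨max ‖(p z0).1‖ (((z0.1:ℝ) - 1/2) * (p z0).2), ?_, fun z y hy => ?_⟩
  · show 0 < max ‖(p z0).1‖ (((z0.1:ℝ) - 1/2) * (p z0).2)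
    rcases h z0 with h | h
    · exact lt_max_of_lt_left (norm_pos_iff.2 h)
    · exact lt_max_of_lt_right h
  · have h1 := hy.trans_le (hz (Set.mem_univ z))
    have ha : ‖y.1 - (p z).1‖ ≤ ‖y - p z‖ := norm_fst_le (y - p z)
    have hb : |y.2 - (p z).2| ≤ ‖y - p z‖ := norm_snd_le (y - p z)
    rcases lt_max_iff.1 h1 with h2 | h2
    · left
      intro h0
      rw [h0, zero_sub, norm_neg] at ha
      linarith
    · right
      have h3 := abs_le.1 (hb.trans h2.le)
      have h4 := abs_lt.1 (hb.trans_lt h2)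
      have := z.1.2.1
      have := z.1.2.2
      rcases lt_or_ge (z.1:ℝ) (1/2) with h5 | h5 <;> nlinarith [norm_nonneg (y - p z)]

variable [NormedSpace ℝ G]

theorem side_ne {t : I} {y : G × ℝ} (h : sd t y) {r w : ℝ} (h0 : 0 ≤ r) (h1 : r ≤ 1)
    (hw : w = if (t:ℝ) ≤ 1/2 then -r else r) (ht : (t:ℝ) = 1/2 → r = 0) :
    (1 - r) • y + (0, w) ≠ 0 := by
  intro hc
  have e1 : (1 - r) • y.1 = 0 := by simpa using congrArg Prod.fst hc
  have e2 : (1 - r) * y.2 + w = 0 := by simpa using congrArg Prod.snd hc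
  rcases smul_eq_zero.1 e1 with h2 | h2
  · have : r = 1 := by linarith
    subst this
    split_ifs at hw <;> subst hw <;> norm_num at e2
  · have h3 := h.resolve_left (by simpa using h2)
    rcases eq_or_lt_of_le h1 with h4 | h4
    · subst h4; split_ifs at hw <;> subst hw <;> norm_num at e2
    split_ifs at hw with h5 <;> subst hw
    · have : y.2 < 0 := by by_contra hcc; push Not at hcc; nlinarith
      nlinarith
    · have : 0 < y.2 := by by_contra hcc; push Not at hcc; nlinarith
      nlinarith

theorem ht_of_sides {X : Type*} [TopologicalSpace X] [CompactSpace X] [T2Space X] {A : Set X}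
    (hA : IsClosed A) {e : G} {p q : I × X → G × ℝ} (hp : Lp (sus A) (nz (G × ℝ)) (e, 0) p)
    (hq : Lp (sus A) (nz (G × ℝ)) (e, 0) q) (he : e ≠ 0)
    (hps : ∀ z, sd z.1 (p z)) (hqs : ∀ z, sd z.1 (q z))
    (hw : ∀ (t : I) x, (t:ℝ) = 1/2 → (p (t, x)).1 = (q (t, x)).1) :
    Ht (sus A) (nz (G × ℝ)) (e, 0) p q := by
  have cp := hp.cont
  have cq := hq.cont
  let sg : I × (I × X) → G × ℝ := fun w => (1 - (w.1:ℝ)) • p w.2 + (w.1:ℝ) • q w.2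
  have csg : Continuous sg := by fun_prop
  let C : Set (I × (I × X)) := {w | (sg w).1 = 0} ∩ {w | ((w.2.1:ℝ) - 1/2) * (sg w).2 ≤ 0}
  have hC : IsClosed C := (isClosed_eq (by fun_prop) (by fun_prop)).inter
    (isClosed_le (by fun_prop) (by fun_prop))
  let N : Set (I × X) := {z | ∀ s : I, (s, z) ∉ C}
  have hN : IsOpen N := isOpen_forall hC
  have hNs : ∀ z ∈ N, ∀ s : I, sd z.1 (sg (s, z)) := by
    intro z hz s
    have := hz s
    simp only [C, Set.mem_inter_iff, Set.mem_ofPred_eq, not_and, not_le] at this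
    by_cases h : (sg (s, z)).1 = 0
    · exact Or.inr (this h)
    · exact Or.inl h
  let B : Set (I × X) := {z | (z.1:ℝ) = 1/2} ∪ sus A
  have hB : IsClosed B := (isClosed_eq (by fun_prop) (by fun_prop)).union (isClosed_sus hA)
  have hBN : Disjoint B Nᶜ := by
    rw [Set.disjoint_compl_right_iff_subset]
    rintro z hz s ⟨h1, h2⟩
    simp only [sg, Set.mem_ofPred_eq, Prod.fst_add, Prod.smul_fst] at h1
    rcases hz with hz | hz
    · rw [hw z.1 z.2 hz, ← add_smul, sub_add_cancel, one_smul] at h1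
      exact (hqs z).half hz h1
    · rw [hp.bd z hz, hq.bd z hz, ← add_smul, sub_add_cancel, one_smul] at h1
      exact he h1
  obtain ⟨ρ, hρ0, hρ1, hρ⟩ := exists_continuous_zero_one_of_isClosed hB hN.isClosed_compl hBN
  let ω : I × X → ℝ := fun z => if (z.1:ℝ) ≤ 1/2 then - ρ z else ρ z
  have cω : Continuous ω := by
    refine Continuous.if_le (by fun_prop) (by fun_prop) (by fun_prop) (by fun_prop) fun z hz => ?_
    have : ρ z = 0 := hρ0 (Or.inl hz)
    simp [this]
  have hωA : ∀ z ∈ sus A, ρ z = 0 ∧ ω z = 0 := fun z hz => by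
    have : ρ z = 0 := hρ0 (Or.inr hz)
    simp [ω, this]
  have hh : ∀ z : I × X, (z.1:ℝ) = 1/2 → ρ z = 0 := fun z hz => hρ0 (Or.inl hz)
  have step1 : ∀ f : I × X → G × ℝ, Lp (sus A) (nz (G × ℝ)) (e, 0) f → (∀ z, sd z.1 (f z)) →
      Ht (sus A) (nz (G × ℝ)) (e, 0) f (fun z => (1 - ρ z) • f z + (0, ω z)) := by
    intro f hf hfs
    have cf := hf.cont
    refine (Ht.mk (A := sus A) (S := nz (G × ℝ)) (e := (e, 0)) (fun s z => (1 - s * ρ z) • f z + (0, s * ω z))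
      (by fun_prop) (fun s z => ?_) (fun s z hz => ?_)).congr ?_ ?_
    · apply side_ne (hfs z) (mul_nonneg s.2.1 (hρ z).1) (mul_le_one₀ s.2.2 (hρ z).1 (hρ z).2)
      · simp only [ω]; split_ifs <;> ring
      · intro h; simp [hh z h]
    · simp [hωA z hz, hf.bd z hz]
    · intro z; simp
    · intro z; simp
  refine (step1 p hp hps).trans (Ht.trans ?_ (step1 q hq hqs).symm)
  refine (Ht.mk (A := sus A) (S := nz (G × ℝ)) (e := (e, 0)) (fun s z => (1 - ρ z) • sg (s, z) + (0, ω z))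
      (by fun_prop) (fun s z => ?_) (fun s z hz => ?_)).congr ?_ ?_
  · by_cases hz : z ∈ N
    · exact side_ne (hNs z hz s) (hρ z).1 (hρ z).2 rfl (hh z)
    · have : ρ z = 1 := hρ1 hz
      simp only [ω, this, sub_self, zero_smul, zero_add]
      intro h
      have := congrArg Prod.snd h
      simp only [Prod.snd_zero] at this
      split_ifs at this <;> norm_num at this
  · simp only [sg, hωA z hz, hp.bd z hz, hq.bd z hz, ← add_smul]
    simp
  · intro z; simp [sg]
  · intro z; simp [sg]

theorem Cut.lerp {X : Type*} {F : I × X → G × ℝ} {x : X} {a b : ℝ} (ha : Cut F x a)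
    (hb : Cut F x b) (r : I) : Cut F x ((1 - r) * a + r * b) := by
  have h0 := r.2.1
  have h1 := r.2.2
  rcases le_total a b with h | h
  · exact ha.convex hb (by nlinarith) (by nlinarith)
  · exact hb.convex ha (by nlinarith) (by nlinarith)

theorem ht_reparam {X : Type*} [TopologicalSpace X] {A : Set X}
    {e : G} {F : I × X → G × ℝ} (hF : Lp (sus A) (nz (G × ℝ)) (e, 0) F) {κ : X → I}
    (hκ : Continuous κ) (hc : ∀ x, Cut F x (κ x)) :
    ∃ f : I × X → G × ℝ, Ht (sus A) (nz (G × ℝ)) (e, 0) F f ∧ (∀ z, sd z.1 (f z)) ∧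
      ∀ (t : I) x, (t:ℝ) = 1/2 → f (t, x) = F (κ x, x) := by
  let P : ℝ → I := Set.projIcc (0:ℝ) 1 zero_le_one
  have hP : Continuous P := continuous_projIcc
  have hPc : ∀ r : ℝ, r ∈ Set.Icc (0:ℝ) 1 → (P r : ℝ) = r := fun r hr => by
    simp only [P, Set.projIcc_of_mem zero_le_one hr]
  have hPi : ∀ t : I, P t = t := fun t => Set.projIcc_val _ _
  let r : I × X → ℝ := fun z => 2 * κ z.2 * min (z.1:ℝ) (1/2) + (1 - κ z.2) * (2 * max (z.1:ℝ) (1/2) - 1)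
  have cr : Continuous r := by fun_prop
  have hlow : ∀ (t : I) x, (t:ℝ) ≤ 1/2 → r (t, x) = 2 * κ x * t := fun t x ht => by
    simp only [r, min_eq_left ht, max_eq_right ht]; ring
  have hhigh : ∀ (t : I) x, 1/2 ≤ (t:ℝ) → r (t, x) = κ x + (1 - κ x) * (2 * t - 1) := fun t x ht => by
    simp only [r, min_eq_right ht, max_eq_left ht]; ring
  refine ⟨fun z => F (P (r z), z.2), ?_, ?_, ?_⟩
  · have cF := hF.cont
    refine (Ht.mk (A := sus A) (S := nz (G × ℝ)) (e := (e, 0))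
      (fun s z => F (P ((1 - s) * z.1 + s * r z), z.2)) (by fun_prop) (fun s z => hF.mem _)
      (fun s z hz => ?_)).congr ?_ ?_
    · apply hF.bd
      rcases hz with hz | hz | hz
      · left
        obtain ⟨t, x⟩ := z
        simp only at hz
        subst hz
        rw [hlow 0 x (by simp)]
        simpa using hPi 0
      · right; left
        obtain ⟨t, x⟩ := z
        simp only at hz
        subst hz
        rw [hhigh 1 x (by norm_num)]
        norm_num
        simpa using hPi 1
      · right; right; exact hz
    · rintro ⟨t, x⟩; simp [hPi]
    · rintro ⟨t, x⟩; simp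
  · rintro ⟨t, x⟩
    have k0 := (κ x).2.1
    have k1 := (κ x).2.2
    have t0 := t.2.1
    have t1 := t.2.2
    simp only [sd]
    rcases lt_trichotomy (t:ℝ) (1/2) with h | h | h
    · have e1 := hlow t x h.le
      have e2 : (P (r (t, x)) : ℝ) = 2 * κ x * t := by
        rw [e1, hPc]; constructor <;> nlinarith
      refine ((hc x).2.1 (P (r (t, x))) (by rw [e2]; nlinarith)).imp id fun h' => ?_
      nlinarith
    · left
      have e1 := hlow t x h.le
      have e2 : P (r (t, x)) = κ x := by
        rw [e1, h]
        have : 2 * (κ x : ℝ) * (1/2) = κ x := by ring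
        rw [this]; exact hPi _
      rw [e2]; exact (hc x).ne
    · have e1 := hhigh t x h.le
      have e2 : (P (r (t, x)) : ℝ) = κ x + (1 - κ x) * (2 * t - 1) := by
        rw [e1, hPc]; constructor <;> nlinarith
      refine ((hc x).2.2 (P (r (t, x))) (by rw [e2]; nlinarith)).imp id fun h' => ?_
      nlinarith
  · intro t x h
    have e1 := hlow t x h.le
    have e2 : P (r (t, x)) = κ x := by
      rw [e1, h]
      have : 2 * (κ x : ℝ) * (1/2) = κ x := by ring
      rw [this]; exact hPi _
    simp only [e2]

/-- Suspension. -/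
noncomputable def Sg {X : Type*} (e : G) (γ : X → G) : I × X → G × ℝ := fun p =>
  (e + (1 - |2 * (p.1:ℝ) - 1|) • (γ p.2 - e), ((p.1:ℝ) - 1/2) * ((1 - |2 * (p.1:ℝ) - 1|) * ‖γ p.2 - e‖))

theorem sd_Sg {X : Type*} {e : G} {γ : X → G} (he : e ≠ 0) (hγ : ∀ x, γ x ≠ 0) (z : I × X) :
    sd z.1 (Sg e γ z) := by
  by_cases h : (Sg e γ z).1 = 0
  · right
    simp only [Sg] at h ⊢
    have t0 := z.1.2.1
    have t1 := z.1.2.2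
    have h1 : 0 < 1 - |2 * (z.1:ℝ) - 1| := by
      have h2 : 0 ≤ 1 - |2 * (z.1:ℝ) - 1| := by
        rw [sub_nonneg, abs_le]; constructor <;> linarith
      refine lt_of_le_of_ne h2 fun h3 => ?_
      rw [← h3] at h; simp at h; exact he h
    have h2 : 0 < ‖γ z.2 - e‖ := by
      rw [norm_pos_iff]
      intro h3; rw [h3] at h; simp at h; exact he h
    have h3 : (z.1:ℝ) - 1/2 ≠ 0 := by
      intro h3
      have h4 : (z.1:ℝ) = 1/2 := by linarith
      rw [h4] at h
      norm_num at h
      exact hγ _ h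
    have := mul_pos h1 h2
    have := sq_pos_of_ne_zero h3
    have h5 : ((z.1:ℝ) - 1/2) * (((z.1:ℝ) - 1/2) * ((1 - |2 * (z.1:ℝ) - 1|) * ‖γ z.2 - e‖)) =
      ((z.1:ℝ) - 1/2)^2 * ((1 - |2 * (z.1:ℝ) - 1|) * ‖γ z.2 - e‖) := by ring
    rw [h5]; positivity
  · exact Or.inl h

theorem Sg_half {X : Type*} {e : G} {γ : X → G} {t : I} (ht : (t:ℝ) = 1/2) (x : X) :
    Sg e γ (t, x) = (γ x, 0) := by simp [Sg, ht]

variable {X : Type*} [TopologicalSpace X] {A : Set X}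

theorem Sg_bd {e : G} {γ : X → G} (h : ∀ x ∈ A, γ x = e) : ∀ z ∈ sus A, Sg e γ z = (e, 0) := by
  rintro ⟨t, x⟩ (hz | hz | hz)
  · simp only at hz; subst hz; simp [Sg]
  · simp only at hz; subst hz; norm_num [Sg]
  · simp [Sg, h x hz]

theorem Lp.Sg {e : G} {γ : X → G} (he : e ≠ 0) (h : Lp A (nz G) e γ) :
    Lp (sus A) (nz (G × ℝ)) (e, 0) (Sg e γ) := by
  have := h.cont
  exact ⟨by unfold PU.Sg; fun_prop, fun z => (sd_Sg he h.mem z).ne, Sg_bd h.bd⟩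

theorem Ht.Sg {e : G} {γ γ' : X → G} (he : e ≠ 0) (h : Ht A (nz G) e γ γ') :
    Ht (sus A) (nz (G × ℝ)) (e, 0) (Sg e γ) (Sg e γ') := by
  obtain ⟨H, h1, h2, h3, h4, h5⟩ := h
  refine (Ht.mk (fun s => PU.Sg e (fun x => H (s, x))) ?_ ?_ ?_).congr ?_ ?_
  · unfold PU.Sg; fun_prop
  · exact fun s z => (sd_Sg he (fun x => h2 _) z).ne
  · exact fun s => Sg_bd (h5 s)
  · intro z; simp [PU.Sg, h3]
  · intro z; simp [PU.Sg, h4]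

variable [FiniteDimensional ℝ G]

theorem gp_cut {j : ℕ} (hj : j + 2 < 2 * Module.finrank ℝ G) {F : I × Q j → G × ℝ}
    (hF : Continuous F) (hF0 : ∀ p, F p ≠ 0) {e : G} (he : e ≠ 0) {δ : ℝ} (hδ : 0 < δ)
    (h0 : ∀ x, (F (0, x)).1 = e) (h1 : ∀ x, (F (1, x)).1 = e) :
    ∃ F' : I × Q j → G × ℝ, Continuous F' ∧ (∀ p, ‖F' p - F p‖ < δ) ∧
      (∀ p, (F p).1 = e → F' p = F p) ∧ (∀ (s : I) p, (1 - (s:ℝ)) • F p + (s:ℝ) • F' p ≠ 0) ∧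
      ∃ κ : Q j → I, Continuous κ ∧ ∀ x, Cut F' x (κ x) := by
  obtain ⟨z0, -, hz⟩ := isCompact_univ.exists_isMinOn (Set.univ_nonempty (α := I × Q j))
    (f := fun z : I × Q j => ‖F z‖) (by fun_prop)
  have hm : 0 < ‖F z0‖ := norm_pos_iff.2 (hF0 z0)
  obtain ⟨F', a1, a2, a3, a4⟩ := gp hj F hF he (δ := min δ ‖F z0‖) (by positivity)
  have hseg : ∀ (s : I) p, (1 - (s:ℝ)) • F p + (s:ℝ) • F' p ≠ 0 := by
    intro s p hs
    have h1 : F p = - ((s:ℝ) • (F' p - F p)) := by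
      rw [eq_neg_iff_add_eq_zero, ← hs, smul_sub, sub_smul, one_smul]; abel
    have h2 : ‖F p‖ < ‖F z0‖ := by
      rw [h1, norm_neg, norm_smul, Real.norm_eq_abs, abs_of_nonneg s.2.1]
      have := (a2 p).trans_le (min_le_right _ _)
      have := s.2.2
      have := s.2.1
      nlinarith [norm_nonneg (F' p - F p)]
    exact (hz (Set.mem_univ p)).not_gt h2
  refine ⟨F', a1, fun p => (a2 p).trans_le (min_le_left _ _), a3, hseg, exists_cut a1 ?_ ?_ ?_ a4⟩
  · intro p; simpa using hseg 1 p
  · intro x; rw [a3 _ (h0 x), h0]; exact he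
  · intro x; rw [a3 _ (h1 x), h1]; exact he

theorem susp_surj {j : ℕ} (hj : j + 2 < 2 * Module.finrank ℝ G) {e : G} (he : e ≠ 0)
    {f : I × Q j → G × ℝ} (hf : Lp (sus (bdQ j)) (nz (G × ℝ)) (e, 0) f) :
    ∃ γ, Lp (bdQ j) (nz G) e γ ∧ Ht (sus (bdQ j)) (nz (G × ℝ)) (e, 0) f (Sg e γ) := by
  have cf := hf.cont
  obtain ⟨F, a1, a2, a3, a4, κ, hκ, hc⟩ := gp_cut hj hf.cont hf.mem he one_pos
    (fun x => by rw [hf.bd _ (Or.inl rfl)]) (fun x => by rw [hf.bd _ (Or.inr (Or.inl rfl))])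
  have hb : ∀ z ∈ sus (bdQ j), F z = (e, 0) := fun z hz => by
    rw [a3 z (by rw [hf.bd z hz]), hf.bd z hz]
  have h1 : Ht (sus (bdQ j)) (nz (G × ℝ)) (e, 0) f F := by
    refine (Ht.mk (A := sus (bdQ j)) (S := nz (G × ℝ)) (e := (e, 0))
      (fun s z => (1 - (s:ℝ)) • f z + (s:ℝ) • F z) (by fun_prop) a4
      (fun s z hz => ?_)).congr ?_ ?_
    · simp only [hf.bd z hz, hb z hz, ← add_smul]; simp
    · intro z; simp
    · intro z; simp
  obtain ⟨f1, b1, b2, b3⟩ := ht_reparam h1.lp_right hκ hc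
  have hγ : Lp (bdQ j) (nz G) e (fun x => (F (κ x, x)).1) :=
    ⟨by fun_prop, fun x => (hc x).ne, fun x hx => by rw [hb _ (Or.inr (Or.inr hx))]⟩
  refine ⟨_, hγ, h1.trans (b1.trans ?_)⟩
  refine ht_of_sides (isClosed_bdQ j) b1.lp_right (hγ.Sg he) he b2 (sd_Sg he hγ.mem) ?_
  intro t x ht
  rw [b3 t x ht, Sg_half ht]

theorem susp_inj {j : ℕ} (hj : j + 3 < 2 * Module.finrank ℝ G) {e : G} (he : e ≠ 0)
    {γ₀ γ₁ : Q j → G} (hγ₀ : Lp (bdQ j) (nz G) e γ₀) (hγ₁ : Lp (bdQ j) (nz G) e γ₁)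
    (h : Ht (sus (bdQ j)) (nz (G × ℝ)) (e, 0) (Sg e γ₀) (Sg e γ₁)) :
    Ht (bdQ j) (nz G) e γ₀ γ₁ := by
  obtain ⟨m₀, hm₀, hs₀⟩ := sd_margin (hγ₀.Sg he).cont (sd_Sg he hγ₀.mem)
  obtain ⟨m₁, hm₁, hs₁⟩ := sd_margin (hγ₁.Sg he).cont (sd_Sg he hγ₁.mem)
  obtain ⟨H, h1, h2, h3, h4, h5⟩ := h
  let F : I × Q (j+1) → G × ℝ := fun p => H (p.2 0, (p.1, Fin.tail p.2))
  have cF : Continuous F := by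
    have : Continuous (fun p : I × Q (j+1) => (Fin.tail p.2 : Q j)) :=
      (continuous_snd.comp continuous_tailQ).comp continuous_snd
    fun_prop
  obtain ⟨F', a1, a2, a3, a4, κ, hκ, hc⟩ := gp_cut (j := j+1) (by omega) cF (fun p => h2 _) he
    (lt_min hm₀ hm₁) (fun x => by simp only [F]; rw [h5 _ _ (Or.inl rfl)])
    (fun x => by simp only [F]; rw [h5 _ _ (Or.inr (Or.inl rfl))])
  have hb : ∀ s t, ∀ x ∈ bdQ j, F' (t, Fin.cons s x) = (e, 0) := fun s t x hx => by
    have : F (t, Fin.cons s x) = (e, 0) := by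
      simp only [F, Fin.cons_zero, Fin.tail_cons]
      exact h5 _ _ (Or.inr (Or.inr hx))
    rw [a3 _ (by rw [this]), this]
  have hcc : ∀ s : I, Continuous (fun x : Q j => (Fin.cons s x : Q (j+1))) := fun s =>
    continuous_consQ.comp (Continuous.prodMk_right s)
  have hcc2 : Continuous (fun p : I × Q j => (Fin.cons p.1 p.2 : Q (j+1))) := continuous_consQ
  let hf : I := ⟨1/2, by norm_num, by norm_num⟩
  -- end slices
  have key : ∀ (s : I) (γ : Q j → G), Lp (bdQ j) (nz G) e γ →
      (∀ z, F (z.1, Fin.cons s z.2) = Sg e γ z) →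
      (∀ z y, ‖y - Sg e γ z‖ < min m₀ m₁ → sd z.1 y) →
      Ht (bdQ j) (nz G) e γ (fun x => (F' (κ (Fin.cons s x), Fin.cons s x)).1) := by
    intro s γ hγ hFs hsd
    have cγ := hγ.cont
    have hcs := hcc s
    have hg : ∀ x, F (hf, Fin.cons s x) = (γ x, 0) := fun x => by
      rw [hFs (hf, x), Sg_half rfl]
    have step1 : Ht (bdQ j) (nz G) e γ (fun x => (F' (hf, Fin.cons s x)).1) := by
      refine (Ht.mk (A := bdQ j) (S := nz G) (e := e)
        (fun r x => (1 - (r:ℝ)) • γ x + (r:ℝ) • (F' (hf, Fin.cons s x)).1) (by fun_prop) ?_ ?_).congr ?_ ?_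
      · intro r x
        have : sd hf ((1 - (r:ℝ)) • F (hf, Fin.cons s x) + (r:ℝ) • F' (hf, Fin.cons s x)) := by
          apply hsd (hf, x)
          rw [← hFs]
          have : (1 - (r:ℝ)) • F (hf, Fin.cons s x) + (r:ℝ) • F' (hf, Fin.cons s x) - F (hf, Fin.cons s x)
            = (r:ℝ) • (F' (hf, Fin.cons s x) - F (hf, Fin.cons s x)) := by
            rw [sub_smul, one_smul, smul_sub]; abel
          rw [this, norm_smul, Real.norm_eq_abs, abs_of_nonneg r.2.1]
          have := a2 (hf, Fin.cons s x)
          have := r.2.2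
          have := r.2.1
          nlinarith [norm_nonneg (F' (hf, Fin.cons s x) - F (hf, Fin.cons s x))]
        have h6 := this.half rfl
        rw [hg] at h6
        exact h6
      · intro r x hx
        simp only [hγ.bd x hx, hb s _ x hx, ← add_smul]; simp
      · intro x; simp
      · intro x; simp
    refine step1.trans ?_
    refine (Ht.mk (A := bdQ j) (S := nz G) (e := e)
        (fun r x => (F' (⟨(1 - (r:ℝ)) * (1/2) + r * κ (Fin.cons s x), ?_⟩, Fin.cons s x)).1) ?_ ?_ ?_).congr ?_ ?_
    · exact ((sd.cut fun t => hsd (t, x) _ (by rw [← hFs]; exact a2 _)).lerp (hc (Fin.cons s x)) r).1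
    · fun_prop
    · intro r x
      exact Cut.ne (F := F') (κ := ⟨_, _⟩)
        ((sd.cut fun t => hsd (t, x) _ (by rw [← hFs]; exact a2 _)).lerp (hc (Fin.cons s x)) r)
    · intro r x hx
      rw [hb s _ x hx]
    · intro x; simp [hf]
    · intro x; simp
  refine (key 0 γ₀ hγ₀ (fun z => by simp [F, h3]) (fun z y hy => hs₀ z y (hy.trans_le (min_le_left _ _)))).trans
    (Ht.trans ?_ (key 1 γ₁ hγ₁ (fun z => by simp [F, h4])
      (fun z y hy => hs₁ z y (hy.trans_le (min_le_right _ _)))).symm)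
  exact Ht.mk (fun s x => (F' (κ (Fin.cons s x), Fin.cons s x)).1) (by fun_prop)
    (fun s x => (hc _).ne) (fun s x hx => by rw [hb s _ x hx])

end sides
end PU
end part4

section part5
open scoped unitInterval Topology
set_option linter.unusedVariables false
set_option linter.unusedSimpArgs false
set_option linter.unusedSectionVars false
namespace PU

section spheres
variable {W W' : Type} [NormedAddCommGroup W] [NormedSpace ℝ W] [FiniteDimensional ℝ W]
  [NormedAddCommGroup W'] [NormedSpace ℝ W'] [FiniteDimensional ℝ W']

theorem exists_equiv (h : Module.finrank ℝ W = Module.finrank ℝ W') {e : W} {e' : W'}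
    (he : e ≠ 0) (he' : e' ≠ 0) : ∃ L : W ≃L[ℝ] W', L e = e' := by
  let L0 : W ≃L[ℝ] W' := ContinuousLinearEquiv.ofFinrankEq h
  obtain ⟨A, hA⟩ := SeparatingDual.exists_continuousLinearEquiv_apply_eq (R := ℝ)
    (x := L0 e) (y := e') (by simpa using he) he'
  exact ⟨L0.trans A, by simpa using hA⟩

theorem Lp.lin {X : Type*} [TopologicalSpace X] {A : Set X} {e : W} {f : X → W}
    (h : Lp A (nz W) e f) (L : W ≃L[ℝ] W') : Lp A (nz W') (L e) (fun x => L (f x)) :=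
  h.map L.continuous.continuousOn (fun w hw => by simpa using hw) rfl

theorem Ht.lin {X : Type*} [TopologicalSpace X] {A : Set X} {e : W} {f g : X → W}
    (h : Ht A (nz W) e f g) (L : W ≃L[ℝ] W') :
    Ht A (nz W') (L e) (fun x => L (f x)) (fun x => L (g x)) :=
  h.map L.continuous.continuousOn (fun w hw => by simpa using hw) rfl

/-- Suspension on cubes. -/
noncomputable def SgQ {G : Type*} [NormedAddCommGroup G] [NormedSpace ℝ G] {k : ℕ} (e : G)
    (f : Q k → G) : Q (k+1) → G × ℝ := fun x => Sg e f (x 0, Fin.tail x)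

variable {G : Type} [NormedAddCommGroup G] [NormedSpace ℝ G] [FiniteDimensional ℝ G]

theorem Lp.SgQ {k : ℕ} {e : G} {γ : Q k → G} (he : e ≠ 0) (h : Lp (bdQ k) (nz G) e γ) :
    Lp (bdQ (k+1)) (nz (G × ℝ)) (e, 0) (SgQ e γ) := by
  rw [lp_cons]; simpa [PU.SgQ] using h.Sg he

theorem ht_SgQ {k : ℕ} {e : G} {γ γ' : Q k → G} :
    Ht (bdQ (k+1)) (nz (G × ℝ)) (e, 0) (SgQ e γ) (SgQ e γ') ↔
    Ht (sus (bdQ k)) (nz (G × ℝ)) (e, 0) (Sg e γ) (Sg e γ') := by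
  rw [ht_cons]; simp [PU.SgQ]

theorem exists_SgQ {k : ℕ} (hk : k + 2 < 2 * Module.finrank ℝ G) {e : G} (he : e ≠ 0)
    {f : Q (k+1) → G × ℝ} (hf : Lp (bdQ (k+1)) (nz (G × ℝ)) (e, 0) f) :
    ∃ γ, Lp (bdQ k) (nz G) e γ ∧ Ht (bdQ (k+1)) (nz (G × ℝ)) (e, 0) f (SgQ e γ) := by
  obtain ⟨γ, h1, h2⟩ := susp_surj hk he (lp_cons.1 hf)
  refine ⟨γ, h1, ?_⟩
  rw [ht_cons]; simpa [PU.SgQ] using h2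

theorem sphere_null (k : ℕ) : ∀ {W : Type} [NormedAddCommGroup W] [NormedSpace ℝ W]
    [FiniteDimensional ℝ W], k + 1 < Module.finrank ℝ W → ∀ {e : W}, e ≠ 0 →
    ∀ {f : Q k → W}, Lp (bdQ k) (nz W) e f → Ht (bdQ k) (nz W) e f (fun _ => e) := by
  induction k with
  | zero =>
    intro W _ _ _ hk e he f hf
    have hr : 1 < Module.rank ℝ W := by
      rw [← Module.finrank_eq_rank]; exact_mod_cast hk
    have h1 := isPathConnected_compl_singleton_of_one_lt_rank hr (0:W)
    obtain ⟨p, hp⟩ := h1.joinedIn (f 0) (hf.mem 0) e he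
    refine ⟨fun z => p z.1, by fun_prop, fun z => hp z.1, fun x => ?_, fun x => by simp, ?_⟩
    · simp; congr 1; exact Subsingleton.elim _ _
    · intro s x hx
      obtain ⟨i, _⟩ := hx
      exact i.elim0
  | succ k ih =>
    intro W _ _ _ hk e he f hf
    let G := Fin (Module.finrank ℝ W - 1) → ℝ
    have hG : Module.finrank ℝ G = Module.finrank ℝ W - 1 := by simp [G]
    have : Nontrivial G := by
      apply Module.nontrivial_of_finrank_pos (R := ℝ); omega
    obtain ⟨e0, he0⟩ := exists_ne (0 : G)
    obtain ⟨L, hL⟩ := exists_equiv (W := W) (W' := G × ℝ) (e := e) (e' := (e0, 0))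
      (by rw [Module.finrank_prod, hG]; simp; omega) he (by simp [he0])
    have h1 := hf.lin L
    rw [hL] at h1
    obtain ⟨γ, h2, h3⟩ := exists_SgQ (by omega) he0 h1
    have h4 := ih (W := G) (by omega) he0 h2
    have h5 := h3.trans (ht_SgQ.2 (h4.Sg he0))
    have h6 := h5.lin L.symm
    have hs : L.symm (e0, 0) = e := by rw [← hL]; simp
    rw [hs] at h6
    refine h6.congr (by simp) ?_
    intro x; simp [SgQ, Sg, hs]

theorem exists_susp_hom {k : ℕ} {e : G} (he : e ∈ nz G) (he' : (e, (0:ℝ)) ∈ nz (G × ℝ)) :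
    ∃ h : Pg (k+1) he →* Pg (k+2) he', ∀ f, Lp (bdQ (k+1)) (nz G) e f →
      h (cls he f) = cls he' (SgQ e f) := by
  obtain ⟨h, hh⟩ := exists_hom (k := k) (l := k+1) he he' (fun f a => a = SgQ e f) 0 1
    (by rintro f a hf rfl; exact hf.SgQ he) (fun f _ => ⟨_, rfl⟩)
    (by rintro f g a b h rfl rfl; exact ht_SgQ.2 (h.Sg he))
    (by
      rintro f g a b hf hg rfl rfl
      funext x
      have e1 : ∀ v, (Fin.tail (Function.update x 1 v) : Q (k+1)) = Function.update (Fin.tail x) 0 v :=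
        fun v => Fin.tail_update_succ x 0 v
      have e2 : (Fin.tail x : Q (k+1)) 0 = x 1 := rfl
      simp only [tr, SgQ, Sg, e1, e2]
      have e3 : ∀ v, Function.update x 1 v 0 = x 0 := fun v =>
        Function.update_of_ne (by simp) _ _
      simp only [e3]
      split_ifs <;> rfl)
  exact ⟨h, fun f hf => hh _ _ hf rfl⟩

theorem susp_hom_surj {k : ℕ} (hG : Module.finrank ℝ G = k + 2) {e : G} (he : e ∈ nz G)
    (he' : (e, (0:ℝ)) ∈ nz (G × ℝ)) {h : Pg (k+1) he →* Pg (k+2) he'}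
    (hh : ∀ f, Lp (bdQ (k+1)) (nz G) e f → h (cls he f) = cls he' (SgQ e f)) :
    Function.Surjective h := by
  intro x
  obtain ⟨f, hf, rfl⟩ := exists_cls x
  obtain ⟨γ, h1, h2⟩ := exists_SgQ (by omega) he hf
  exact ⟨cls he γ, by rw [hh γ h1, h2.cls_eq]⟩

theorem susp_hom_inj {k : ℕ} (hG : Module.finrank ℝ G = k + 2) (hk : 1 ≤ k) {e : G} (he : e ∈ nz G)
    (he' : (e, (0:ℝ)) ∈ nz (G × ℝ)) {h : Pg (k+1) he →* Pg (k+2) he'}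
    (hh : ∀ f, Lp (bdQ (k+1)) (nz G) e f → h (cls he f) = cls he' (SgQ e f)) :
    Function.Injective h := by
  intro x y hxy
  obtain ⟨f, hf, rfl⟩ := exists_cls x
  obtain ⟨g, hg, rfl⟩ := exists_cls y
  rw [hh f hf, hh g hg, cls_eq (hf.SgQ he) (hg.SgQ he), ht_SgQ] at hxy
  exact (susp_inj (by omega) he hf hg hxy).cls_eq

/-- Isomorphisms of punctured spaces induce isomorphisms of homotopy groups. -/
theorem lin_equiv {k : ℕ} (L : W ≃L[ℝ] W') {e : W} {e' : W'} (he : e ∈ nz W) (he' : e' ∈ nz W')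
    (hL : L e = e') : ∃ h : Pg (k+1) he ≃* Pg (k+1) he', ∀ f, Lp (bdQ (k+1)) (nz W) e f →
      h (cls he f) = cls he' (fun x => L (f x)) := by
  obtain ⟨a, ha⟩ := exists_ind (k := k) he he' L L.continuous.continuousOn
    (fun w hw => by simpa using hw) hL
  obtain ⟨b, hb⟩ := exists_ind (k := k) he' he L.symm L.symm.continuous.continuousOn
    (fun w hw => by simpa using hw) (by simp [← hL])
  subst hL
  refine ⟨MonoidHom.toMulEquiv a b ?_ ?_, ?_⟩
  · ext x
    obtain ⟨f, hf, rfl⟩ := exists_cls x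
    simp [ha f hf, hb _ (hf.lin L)]
  · ext x
    obtain ⟨f, hf, rfl⟩ := exists_cls x
    have := hf.lin L.symm
    simp only [ContinuousLinearEquiv.symm_apply_apply] at this
    simp [hb f hf, ha _ this]
  · exact fun f hf => ha f hf

end spheres
end PU
end part5

section part6
open scoped unitInterval Topology
set_option linter.unusedVariables false
set_option linter.unusedSimpArgs false
set_option linter.unusedSectionVars false
namespace PU

theorem exists_log {K : Type*} [TopologicalSpace K] [CompactSpace K] (f : K × I → ℂ)
    (hf : Continuous f) (h0 : ∀ p, f p ≠ 0) :
    ∃ l : K × I → ℂ, Continuous l ∧ (∀ k, l (k, 0) = 0) ∧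
      (∀ k t, f (k, t) = f (k, 0) * Complex.exp (l (k, t))) ∧
      ∀ k, (∀ t, f (k, t) = f (k, 0)) → ∀ t, l (k, t) = 0 := by
  obtain ⟨u, h1, h2, h3, h4⟩ := transport (M := Multiplicative ℂ) f hf
    {p | p.1 ≠ 0 ∧ p.2 / p.1 ∈ Complex.slitPlane} (fun p => by
      have h : ContinuousAt (fun q : ℂ × ℂ => q.2 / q.1) (f p, f p) :=
        continuousAt_snd.div continuousAt_fst (h0 p)
      refine Filter.inter_mem (continuousAt_fst.eventually_ne (h0 p)) ?_
      refine h.preimage_mem_nhds (Complex.isOpen_slitPlane.mem_nhds ?_)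
      simp [div_self (h0 p), Complex.one_mem_slitPlane])
    (fun p => Multiplicative.ofAdd (Complex.log (p.2 / p.1))) (by
      rw [Set.ofPred_and]
      refine continuous_ofAdd.comp_continuousOn ?_
      refine ContinuousOn.clog (continuousOn_snd.div continuousOn_fst fun p hp => hp.1)
        fun p hp => hp.2)
    (fun m v w => v * Complex.exp m.toAdd = w)
    (fun v => by
      rcases eq_or_ne v 0 with rfl | h
      · simp
      · simp [div_self h]) (by simp)
    (by
      rintro m m' v w z rfl rfl
      rw [toAdd_mul, add_comm, Complex.exp_add, mul_assoc])
    (by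
      rintro v w ⟨hv, hw⟩
      simp only [toAdd_ofAdd]
      simp only at hv hw
      rw [Complex.exp_log (Complex.slitPlane_ne_zero hw)]
      field_simp)
  exact ⟨fun p => (u p).toAdd, continuous_toAdd.comp h1, fun k => by simp [h2],
    fun k t => (h3 k t).symm, fun k hk t => by simp [h4 k hk t]⟩

theorem exp_const {K : Type*} [TopologicalSpace K] [PreconnectedSpace K] {g : K → ℂ}
    (hg : Continuous g) (h : ∀ k, Complex.exp (g k) = 1) (x y : K) : g x = g y := by
  choose z hz using fun k => Complex.exp_eq_one_iff.1 (h k)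
  have hp : (2 * Real.pi : ℝ) ≠ 0 := by positivity
  have h1 : ∀ k, ((z k : ℤ) : ℝ) = (g k).im / (2 * Real.pi) := by
    intro k
    rw [hz k]; simp
  have hc : Continuous z := by
    rw [Int.isClosedEmbedding_coe_real.isInducing.continuous_iff]
    have : (fun n : ℤ => (n:ℝ)) ∘ z = fun k => (g k).im / (2 * Real.pi) := funext h1
    rw [this]; fun_prop
  rw [hz x, hz y, PreconnectedSpace.constant ‹_› hc]

/-- The standard loop. -/
noncomputable def gam (j : ℤ) : Q 1 → ℂ := fun x => Complex.exp (2 * Real.pi * Complex.I * j * (x 0 : ℝ))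

theorem mem_bdQ1 {x : Q 1} (hx : x ∈ bdQ 1) : x 0 = 0 ∨ x 0 = 1 := by
  obtain ⟨i, hi⟩ := hx
  rwa [Subsingleton.elim i 0] at hi

theorem lp_gam (j : ℤ) : Lp (bdQ 1) (nz ℂ) 1 (gam j) := by
  refine ⟨by unfold gam; fun_prop, fun x => Complex.exp_ne_zero _, fun x hx => ?_⟩
  rcases mem_bdQ1 hx with h | h
  · simp [gam, h]
  · simp only [gam, h]
    rw [Complex.exp_eq_one_iff]
    exact ⟨j, by push_cast; ring⟩

theorem gam_add (i j : ℤ) (x : Q 1) : gam (i + j) x = gam i x * gam j x := by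
  simp only [gam, ← Complex.exp_add]
  congr 1; push_cast; ring

theorem ht_gam {f : Q 1 → ℂ} (hf : Lp (bdQ 1) (nz ℂ) 1 f) : ∃ j, Ht (bdQ 1) (nz ℂ) 1 f (gam j) := by
  have cf := hf.cont
  have hb0 : f (fun _ => 0) = 1 := hf.bd _ ⟨0, by simp⟩
  have hb1 : f (fun _ => 1) = 1 := hf.bd _ ⟨0, by simp⟩
  obtain ⟨l, h1, h2, h3, -⟩ := exists_log (K := Unit) (fun p => f (fun _ => p.2)) (by fun_prop)
    (fun p => hf.mem _)
  have h4 : ∀ t, f (fun _ => t) = Complex.exp (l ((), t)) := fun t => by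
    have := h3 () t
    simpa [hb0] using this
  have h5 : Complex.exp (l ((), 1)) = 1 := by rw [← h4, hb1]
  obtain ⟨j, hj⟩ := Complex.exp_eq_one_iff.1 h5
  refine ⟨j, (Ht.mk (fun (s : I) (x : Q 1) => Complex.exp ((1 - (s:ℝ)) * l ((), x 0) +
    (s:ℝ) * (2 * Real.pi * Complex.I * j * (x 0 : ℝ)))) (by fun_prop)
    (fun s x => Complex.exp_ne_zero _) ?_).congr ?_ ?_⟩
  · intro s x hx
    rcases mem_bdQ1 hx with h | h
    · simp [h, h2]
    · rw [h, hj, Complex.exp_eq_one_iff]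
      exact ⟨j, by push_cast; ring⟩
  · intro x
    have : x = fun _ => x 0 := by funext i; rw [Subsingleton.elim i 0]
    simp [← h4, ← this]
  · intro x; simp [gam]

theorem gam_null {j : ℤ} (h : Ht (bdQ 1) (nz ℂ) 1 (gam j) (fun _ => 1)) : j = 0 := by
  obtain ⟨H, h1, h2, h3, h4, h5⟩ := h
  obtain ⟨l, l1, l2, l3, l4⟩ := exists_log (K := I) (fun p => H (p.1, fun _ => p.2)) (by fun_prop)
    (fun p => h2 _)
  have e0 : ∀ s, H (s, fun _ => 0) = 1 := fun s => h5 _ _ ⟨0, by simp⟩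
  have e1 : ∀ s, H (s, fun _ => 1) = 1 := fun s => h5 _ _ ⟨0, by simp⟩
  simp only [e0, one_mul] at l3
  have a1 : l (0, 1) = l (1, 1) := exp_const (g := fun s => l (s, 1)) (by fun_prop)
    (fun s => by rw [← l3, e1]) 0 1
  have a2 : l (1, 1) = 0 := l4 1 (fun t => by simp [h4]) 1
  have a3 := exp_const (g := fun t : I => l (0, t) - 2 * Real.pi * Complex.I * j * (t : ℝ))
    (by fun_prop) (fun t => by
      rw [Complex.exp_sub, ← l3, h3]
      simp only [gam]
      exact div_self (Complex.exp_ne_zero _)) 0 1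
  simp only [l2, a1, a2] at a3
  simp at a3
  exact a3

theorem isCyclic_circle (he : (1:ℂ) ∈ nz ℂ) : IsCyclic (Pg 1 he) := by
  have hm : ∀ a ∈ nz ℂ, ∀ b ∈ nz ℂ, a * b ∈ nz ℂ := fun a ha b hb => mul_ne_zero ha hb
  let φ : Multiplicative ℤ →* Pg 1 he := MonoidHom.mk' (fun j => cls he (gam j.toAdd)) (by
    intro a b
    rw [cls_mul (lp_gam _) (lp_gam _) 0, ← (ht_tr_mul hm (lp_gam _) (lp_gam _) 0).cls_eq]
    congr 1
    funext x
    rw [toAdd_mul, gam_add, mul_comm])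
  refine isCyclic_of_surjective φ ?_
  intro x
  obtain ⟨f, hf, rfl⟩ := exists_cls x
  obtain ⟨j, hj⟩ := ht_gam hf
  exact ⟨Multiplicative.ofAdd j, hj.cls_eq.symm⟩

/-- Idempotent matrices. -/
abbrev Idem (ι : Type*) [Fintype ι] := {P : Matrix ι ι ℂ // P * P = P}

/-- Transport along idempotents. -/
theorem transport_idem {ι : Type*} [Fintype ι] [DecidableEq ι] {K : Type*} [TopologicalSpace K]
    [CompactSpace K] (f : K × I → Matrix ι ι ℂ) (hf : Continuous f) (hi : ∀ p, f p * f p = f p) :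
    ∃ u : K × I → Matrix ι ι ℂ, Continuous u ∧ (∀ k, u (k, 0) = 1) ∧
      (∀ p, (u p).det ≠ 0) ∧ (∀ k t, u (k, t) * f (k, 0) = f (k, t) * u (k, t)) ∧
      ∀ k, (∀ t, f (k, t) = f (k, 0)) → ∀ t, u (k, t) = 1 := by
  let R : Idem ι × Idem ι → Matrix ι ι ℂ := fun p => p.2.1 * p.1.1 + (1 - p.2.1) * (1 - p.1.1)
  have c1 : Continuous fun p : Idem ι × Idem ι => p.1.1 := continuous_subtype_val.comp continuous_fst
  have c2 : Continuous fun p : Idem ι × Idem ι => p.2.1 := continuous_subtype_val.comp continuous_snd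
  have hR : Continuous R :=
    (c2.mul c1).add ((continuous_const.sub c2).mul (continuous_const.sub c1))
  have hR1 : ∀ v, R (v, v) = 1 := by
    rintro ⟨v, hv⟩
    simp only [R]
    simp [mul_sub, sub_mul, hv]
  obtain ⟨u, h1, h2, h3, h4⟩ := transport (B := Idem ι) (fun p => ⟨f p, hi p⟩) (by fun_prop)
    {p | (R p).det ≠ 0} (fun p => by
      refine (hR.matrix_det.continuousAt).eventually_ne ?_
      simp [hR1]) R hR.continuousOn (fun m v w => m.det ≠ 0 ∧ m * v.1 = w.1 * m) hR1
      (by simp) (by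
        rintro m m' v w z ⟨ha, hb⟩ ⟨hc, hd⟩
        refine ⟨by rw [Matrix.det_mul]; exact mul_ne_zero hc ha, ?_⟩
        rw [mul_assoc, hb, ← mul_assoc, hd, mul_assoc]) (by
        rintro ⟨v, hv⟩ ⟨w, hw⟩ h
        refine ⟨h, ?_⟩
        simp only [R]
        have : (1 - v) * v = 0 := by rw [sub_mul, hv]; simp
        have h' : w * (1 - w) = 0 := by rw [mul_sub, hw]; simp
        rw [add_mul, mul_add, mul_assoc, mul_assoc, this, hv, ← mul_assoc, ← mul_assoc, hw, h']
        simp)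
  exact ⟨u, h1, h2, fun p => (h3 p.1 p.2).1, fun k t => (h3 k t).2,
    fun k hk t => h4 k (fun t => Subtype.ext (hk t)) t⟩

/-- The spectral projection. -/
noncomputable def spj (w : ℂ × ℝ) : Matrix (Fin 2) (Fin 2) ℂ :=
  (1/2 : ℂ) • (1 + ((√(Complex.normSq w.1 + w.2 ^ 2) : ℝ) : ℂ)⁻¹ •
    !![(w.2 : ℂ), star w.1; w.1, -(w.2 : ℂ)])

theorem spj_pos {w : ℂ × ℝ} (hw : w ∈ nz (ℂ × ℝ)) : 0 < Complex.normSq w.1 + w.2 ^ 2 := by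
  by_contra h
  push Not at h
  have h1 := Complex.normSq_nonneg w.1
  have h2 := sq_nonneg w.2
  apply hw
  have h3 : Complex.normSq w.1 = 0 := by linarith
  have h4 : w.2 ^ 2 = 0 := by linarith
  exact Prod.ext (Complex.normSq_eq_zero.1 h3) (by simpa using h4)

theorem continuousOn_spj : ContinuousOn spj (nz (ℂ × ℝ)) := by
  have h1 : Continuous fun w : ℂ × ℝ => ((√(Complex.normSq w.1 + w.2 ^ 2) : ℝ) : ℂ) := by
    have := Complex.continuous_normSq
    fun_prop
  have h2 : Continuous fun w : ℂ × ℝ => !![(w.2 : ℂ), star w.1; w.1, -(w.2 : ℂ)] := by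
    refine continuous_matrix fun i j => ?_
    fin_cases i <;> fin_cases j <;> simp <;> fun_prop
  refine (continuousOn_const (c := (1/2:ℂ))).smul (continuousOn_const.add ?_)
  refine ContinuousOn.smul (h1.continuousOn.inv₀ fun w hw => ?_) h2.continuousOn
  have := Real.sqrt_pos.2 (spj_pos hw)
  exact_mod_cast this.ne'

theorem spj_idem {w : ℂ × ℝ} (hw : w ∈ nz (ℂ × ℝ)) : spj w * spj w = spj w := by
  have h0 := spj_pos hw
  have h1 := Real.sqrt_pos.2 h0
  have h2 := Real.sq_sqrt h0.le
  unfold spj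
  generalize √(Complex.normSq w.1 + w.2 ^ 2) = r at *
  have h3 : (r:ℂ) ≠ 0 := by exact_mod_cast h1.ne'
  have h4 : (r:ℂ)^2 = w.1 * (starRingEnd ℂ) w.1 + (w.2:ℂ)^2 := by
    rw [Complex.mul_conj]; exact_mod_cast h2
  ext i j
  fin_cases i <;> fin_cases j <;> simp [Matrix.mul_apply, Fin.sum_univ_two] <;> field_simp <;>
    first | ring1 | linear_combination (-1:ℂ) * h4 | linear_combination h4

/-- Vector lifting a loop of the two sphere. -/
noncomputable def hv (j : ℤ) (y : Q 2) : Fin 2 → ℂ :=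
  ![(Real.cos (Real.pi / 2 * y 0) : ℂ) ^ 2 + (Real.sin (Real.pi / 2 * y 0) : ℂ) ^ 2 * gam j (Fin.tail y),
    (Real.sin (Real.pi / 2 * y 0) : ℂ) * (Real.cos (Real.pi / 2 * y 0) : ℂ) * (gam j (Fin.tail y) - 1)]

/-- The loop in the two-sphere. -/
noncomputable def hf (j : ℤ) (y : Q 2) : ℂ × ℝ :=
  (2 * hv j y 1 * star (hv j y 0), Complex.normSq (hv j y 0) - Complex.normSq (hv j y 1))

theorem gam_conj (j : ℤ) (x : Q 1) : (starRingEnd ℂ) (gam j x) = gam (-j) x := by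
  simp only [gam, ← Complex.exp_conj]
  congr 1; simp [Complex.conj_ofReal, Complex.conj_ofNat]

theorem gam_mul_conj (j : ℤ) (x : Q 1) : gam j x * (starRingEnd ℂ) (gam j x) = 1 := by
  rw [gam_conj, ← gam_add]; simp [gam]

theorem hv_unit (j : ℤ) (y : Q 2) : hv j y 0 * star (hv j y 0) + hv j y 1 * star (hv j y 1) = 1 := by
  have h1 := gam_mul_conj j (Fin.tail y)
  have h2 : (Real.sin (Real.pi / 2 * y 0) : ℂ) ^ 2 + (Real.cos (Real.pi / 2 * y 0) : ℂ) ^ 2 = 1 := by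
    exact_mod_cast Real.sin_sq_add_cos_sq (Real.pi / 2 * y 0)
  simp only [hv, Matrix.cons_val_zero, Matrix.cons_val_one, Complex.star_def, map_add, map_mul,
    map_pow, map_sub, map_one, Complex.conj_ofReal]
  generalize (Real.sin (Real.pi / 2 * y 0) : ℂ) = s at *
  generalize (Real.cos (Real.pi / 2 * y 0) : ℂ) = c at *
  generalize gam j (Fin.tail y) = α at *
  generalize (starRingEnd ℂ) α = β at *
  linear_combination (s^4 + s^2*c^2) * h1 + (s^2+c^2+1) * h2

theorem hf_norm (j : ℤ) (y : Q 2) : Complex.normSq (hf j y).1 + (hf j y).2 ^ 2 = 1 := by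
  have h := hv_unit j y
  have h1 : Complex.normSq (hv j y 0) + Complex.normSq (hv j y 1) = 1 := by
    rw [Complex.star_def, Complex.mul_conj, Complex.mul_conj] at h
    exact_mod_cast h
  simp only [hf, Complex.star_def, map_mul, Complex.normSq_conj]
  have : Complex.normSq 2 = 4 := by norm_num [Complex.normSq_apply]
  rw [this]
  linear_combination (Complex.normSq (hv j y 0) + Complex.normSq (hv j y 1) + 1) * h1

theorem spj_hf (j : ℤ) (y : Q 2) (a b : Fin 2) : spj (hf j y) a b = hv j y a * star (hv j y b) := by
  have h := hv_unit j y
  unfold spj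
  rw [hf_norm]
  have e1 := Complex.mul_conj (hv j y 0)
  have e2 := Complex.mul_conj (hv j y 1)
  simp only [Complex.star_def] at h
  fin_cases a <;> fin_cases b <;> simp [hf, ← e1, ← e2]
  all_goals first | ring1 | linear_combination (-1/2) * h

theorem continuous_hv (j : ℤ) : Continuous (hv j) := by
  have h1 : Continuous (fun y : Q 2 => (Fin.tail y : Q 1)) := continuous_snd.comp continuous_tailQ
  have h2 := (lp_gam j).cont
  unfold hv
  refine continuous_pi fun i => ?_
  fin_cases i <;> simp <;> fun_prop

theorem hv_bd (j : ℤ) {y : Q 2} (hy : y ∈ bdQ 2) :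
    (hv j y 0 = if y 0 = 1 then gam j (Fin.tail y) else 1) ∧ hv j y 1 = 0 := by
  have h := tail_mem y hy
  rcases h with h | h | h
  · have h : y 0 = 0 := h
    simp [hv, h]
  · have h : y 0 = 1 := h
    simp [hv, h]
  · have := (lp_gam j).bd _ h
    have h2 : (Real.cos (Real.pi / 2 * y 0) : ℂ) ^ 2 + (Real.sin (Real.pi / 2 * y 0) : ℂ) ^ 2 = 1 := by
      exact_mod_cast Real.cos_sq_add_sin_sq (Real.pi / 2 * y 0)
    simp only [hv, this, mul_one]
    simp only [Matrix.cons_val_zero, h2]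
    simp

theorem lp_hf (j : ℤ) : Lp (bdQ 2) (nz (ℂ × ℝ)) (0, 1) (hf j) := by
  have h1 := continuous_hv j
  have h2 := Complex.continuous_normSq
  refine ⟨by unfold hf; fun_prop, fun y => ?_, fun y hy => ?_⟩
  · intro h0
    have := hf_norm j y
    rw [h0] at this
    simp at this
  · obtain ⟨a, b⟩ := hv_bd j hy
    simp only [hf, b]
    have h3 : Complex.normSq (hv j y 0) = 1 := by
      have h := hv_unit j y
      rw [b] at h
      rw [Complex.star_def, Complex.mul_conj] at h
      simp at h
      exact_mod_cast h
    simp [h3]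

theorem hf_inj {j l : ℤ} (h : Ht (bdQ 2) (nz (ℂ × ℝ)) (0, 1) (hf j) (hf l)) : j = l := by
  obtain ⟨H, h1, h2, h3, h4, h5⟩ := h
  obtain ⟨u, u1, u2, u3, u4, u5⟩ := transport_idem (K := Q 2) (fun p => spj (H (p.2, p.1)))
    (continuousOn_spj.comp_continuous (by fun_prop) (fun p => h2 _)) (fun p => spj_idem (h2 _))
  let c : Q 2 → ℂ := fun y => ∑ a, star (hv l y a) * ((u (y, 1)).mulVec (hv j y)) a
  have hj := continuous_hv j
  have hl := continuous_hv l
  have hc : Continuous c := by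
    refine continuous_finsetSum _ fun a _ => ?_
    refine Continuous.mul (by fun_prop) ?_
    have : Continuous fun y => (u (y, 1)).mulVec (hv j y) :=
      Continuous.matrix_mulVec (by fun_prop) hj
    fun_prop
  have hPj : ∀ y, (spj (hf j y)).mulVec (hv j y) = hv j y := fun y => by
    funext a
    have := hv_unit j y
    simp only [Matrix.mulVec, dotProduct, Fin.sum_univ_two, spj_hf]
    linear_combination (hv j y a) * this
  have hPl : ∀ y v, (spj (hf l y)).mulVec v = fun a => (∑ b, star (hv l y b) * v b) * hv l y a :=
    fun y v => by
      funext a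
      simp only [Matrix.mulVec, dotProduct, Fin.sum_univ_two, spj_hf]
      ring
  have key : ∀ y, (u (y, 1)).mulVec (hv j y) = fun a => c y * hv l y a := fun y => by
    have := u4 y 1
    simp only [h3, h4] at this
    conv_lhs => rw [← hPj y]
    rw [Matrix.mulVec_mulVec, this, ← Matrix.mulVec_mulVec, hPl]
  have hc0 : ∀ y, c y ≠ 0 := fun y h0 => by
    have k := key y
    rw [h0] at k
    have := Matrix.eq_zero_of_mulVec_eq_zero (u3 (y, 1)) (k.trans (by funext; simp))
    have hu := hv_unit j y
    rw [this] at hu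
    simp at hu
  have hcb : ∀ y ∈ bdQ 2, c y = if y 0 = 1 then gam (j - l) (Fin.tail y) else 1 := by
    intro y hy
    have := u5 y (fun t => by rw [h5 _ _ hy, h5 _ _ hy]) 1
    simp only [c, this, Matrix.one_mulVec, Fin.sum_univ_two, (hv_bd j hy).1, (hv_bd j hy).2,
      (hv_bd l hy).1, (hv_bd l hy).2]
    split_ifs
    · simp only [Complex.star_def, gam_conj]
      rw [sub_eq_add_neg, gam_add]
      ring
    · simp
  have : Ht (bdQ 1) (nz ℂ) 1 (fun _ => 1) (gam (j - l)) := by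
    refine (Ht.mk (fun (s : I) (x : Q 1) => c (Fin.cons s x)) (hc.comp continuous_consQ)
      (fun s x => hc0 _) ?_).congr ?_ ?_
    · intro s x hx
      rw [hcb _ ((cons_mem_bdQ s x).2 (Or.inr (Or.inr hx)))]
      simp [(lp_gam (j-l)).bd x hx]
    · intro x
      rw [hcb _ ((cons_mem_bdQ 0 x).2 (Or.inl rfl))]
      simp
    · intro x
      rw [hcb _ ((cons_mem_bdQ 1 x).2 (Or.inr (Or.inl rfl)))]
      simp
  exact sub_eq_zero.1 (gam_null this.symm)

theorem sphere_cyclic (k : ℕ) : ∀ {W : Type} [NormedAddCommGroup W] [NormedSpace ℝ W]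
    [FiniteDimensional ℝ W], Module.finrank ℝ W = k + 2 → ∀ {e : W} (he : e ∈ nz W),
    IsCyclic (Pg (k+1) he) := by
  induction k with
  | zero =>
    intro W _ _ _ hk e he
    obtain ⟨L, hL⟩ := exists_equiv (W := ℂ) (W' := W) (by rw [hk]; simp) one_ne_zero he
    obtain ⟨h, -⟩ := lin_equiv (k := 0) L (show (1:ℂ) ∈ nz ℂ from one_ne_zero) he hL
    have := isCyclic_circle (show (1:ℂ) ∈ nz ℂ from one_ne_zero)
    exact isCyclic_of_surjective h h.surjective
  | succ k ih =>
    intro W _ _ _ hk e he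
    let G := Fin (k + 2) → ℝ
    have he0 : (Pi.single 0 1 : G) ≠ 0 := by simp
    have he1 : ((Pi.single 0 1 : G), (0:ℝ)) ∈ nz (G × ℝ) := fun h => he0 (congrArg Prod.fst h)
    obtain ⟨L, hL⟩ := exists_equiv (W := G × ℝ) (W' := W) (by rw [hk]; simp [G]) he1 he
    obtain ⟨h, -⟩ := lin_equiv (k := k+1) L he1 he hL
    obtain ⟨S, hS⟩ := exists_susp_hom (k := k) (show (Pi.single 0 1 : G) ∈ nz G from he0) he1
    have := ih (W := G) (by simp [G]) he0
    have := isCyclic_of_surjective S (susp_hom_surj (by simp [G]) he0 he1 hS)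
    exact isCyclic_of_surjective h h.surjective

theorem sphere_infinite (k : ℕ) : ∀ {W : Type} [NormedAddCommGroup W] [NormedSpace ℝ W]
    [FiniteDimensional ℝ W], Module.finrank ℝ W = k + 3 → ∀ {e : W} (he : e ∈ nz W),
    Infinite (Pg (k+2) he) := by
  induction k with
  | zero =>
    intro W _ _ _ hk e he
    have he1 : ((0:ℂ), (1:ℝ)) ∈ nz (ℂ × ℝ) := by simp
    obtain ⟨L, hL⟩ := exists_equiv (W := ℂ × ℝ) (W' := W) (by rw [hk]; simp) he1 he
    obtain ⟨h, -⟩ := lin_equiv (k := 1) L he1 he hL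
    refine Infinite.of_injective (fun j : ℤ => h (cls he1 (hf j))) fun j l hjl => ?_
    exact hf_inj ((cls_eq (lp_hf j) (lp_hf l)).1 (h.injective hjl))
  | succ k ih =>
    intro W _ _ _ hk e he
    let G := Fin (k + 3) → ℝ
    have he0 : (Pi.single 0 1 : G) ≠ 0 := by simp
    have he1 : ((Pi.single 0 1 : G), (0:ℝ)) ∈ nz (G × ℝ) := fun h => he0 (congrArg Prod.fst h)
    obtain ⟨L, hL⟩ := exists_equiv (W := G × ℝ) (W' := W) (by rw [hk]; simp [G]) he1 he
    obtain ⟨h, -⟩ := lin_equiv (k := k+2) L he1 he hL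
    obtain ⟨S, hS⟩ := exists_susp_hom (k := k+1) (show (Pi.single 0 1 : G) ∈ nz G from he0) he1
    have := ih (W := G) (by simp [G]) he0
    have h2 := susp_hom_inj (k := k+1) (by simp [G]) (by omega) he0 he1 hS
    exact Infinite.of_injective (fun x => h (S x)) (h.injective.comp h2)

end PU
end part6

section part7
open scoped unitInterval Topology
set_option linter.unusedVariables false
set_option linter.unusedSimpArgs false
set_option linter.unusedSectionVars false
namespace PU

section deg
variable {W W' G V : Type} [NormedAddCommGroup W] [NormedSpace ℝ W] [FiniteDimensional ℝ W]
  [NormedAddCommGroup W'] [NormedSpace ℝ W'] [FiniteDimensional ℝ W']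
  [NormedAddCommGroup G] [NormedSpace ℝ G] [FiniteDimensional ℝ G]
  [NormedAddCommGroup V] [NormedSpace ℝ V] [FiniteDimensional ℝ V]

/-- Self maps of a punctured space acting on loops as a power. -/
structure Deg (e : W) (ψ : W → W) (d : ℕ) : Prop where
  cont : Continuous ψ
  zero : ψ 0 = 0
  ne : ∀ w, w ≠ 0 → ψ w ≠ 0
  he : e ∈ nz W
  base : ψ e = e
  two : 2 ≤ Module.finrank ℝ W
  deg : ∀ k, Module.finrank ℝ W = k + 2 → ∀ f, Lp (bdQ (k+1)) (nz W) e f →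
    cls he (fun x => ψ (f x)) = (cls he f) ^ d

theorem Deg.lp {e : W} {ψ : W → W} {d : ℕ} (h : Deg e ψ d) {X : Type*} [TopologicalSpace X]
    {A : Set X} {f : X → W} (hf : Lp A (nz W) e f) : Lp A (nz W) e (fun x => ψ (f x)) :=
  hf.map h.cont.continuousOn (fun w hw => h.ne w hw) h.base

theorem Deg.comp {e : W} {ψ φ : W → W} {d d' : ℕ} (h : Deg e ψ d) (h' : Deg e φ d') :
    Deg e (fun w => ψ (φ w)) (d * d') where
  cont := h.cont.comp h'.cont
  zero := by rw [h'.zero, h.zero]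
  ne w hw := h.ne _ (h'.ne _ hw)
  he := h.he
  base := by rw [h'.base, h.base]
  two := h.two
  deg k hk f hf := by
    rw [h.deg k hk (fun x => φ (f x)) (h'.lp hf), h'.deg k hk f hf, ← pow_mul, mul_comm]

theorem Deg.conj {e : W} {ψ : W → W} {d : ℕ} (h : Deg e ψ d) (L : W ≃L[ℝ] W') {e' : W'}
    {ψ' : W' → W'} (he : L e = e') (hL : ∀ w, ψ' (L w) = L (ψ w)) : Deg e' ψ' d := by
  have hψ : ψ' = fun w => L (ψ (L.symm w)) := by
    funext w; rw [← hL]; simp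
  have hne : e' ∈ nz W' := by rw [← he]; simpa using h.he
  have hc := h.cont
  subst hψ
  refine ⟨?_, by simp [h.zero], fun w hw => ?_, hne, ?_, ?_, ?_⟩
  · fun_prop
  · simpa using h.ne (L.symm w) (by simpa using hw)
  · rw [← he]; simp [h.base]
  · rw [← L.toLinearEquiv.finrank_eq]; exact h.two
  · intro k hk f hf
    obtain ⟨a, ha⟩ := lin_equiv (k := k) L (show e ∈ nz W from h.he) hne he
    have h1 := hf.lin L.symm
    have h2 : L.symm e' = e := by simp [← he]
    rw [h2] at h1
    have h3 := ha _ (h.lp h1)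
    have h4 := ha _ h1
    simp only [ContinuousLinearEquiv.apply_symm_apply] at h4
    rw [← h3, h.deg k (by rw [L.toLinearEquiv.finrank_eq, hk]) _ h1, map_pow, h4]

theorem Deg.homotopy {e : W} {d : ℕ} (Ψ : I → W → W) (hc : Continuous fun p : I × W => Ψ p.1 p.2)
    (h0 : ∀ s, Ψ s 0 = 0) (hne : ∀ s w, w ≠ 0 → Ψ s w ≠ 0) (hb : ∀ s, Ψ s e = e)
    (h : Deg e (Ψ 0) d) : Deg e (Ψ 1) d where
  cont := hc.comp (Continuous.prodMk_right 1)
  zero := h0 1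
  ne := hne 1
  he := h.he
  base := hb 1
  two := h.two
  deg k hk f hf := by
    rw [← h.deg k hk f hf]
    symm
    apply Ht.cls_eq
    have cf := hf.cont
    exact Ht.mk (fun s x => Ψ s (f x)) (hc.comp (f := fun p : I × Q (k+1) => (p.1, f p.2))
      (by fun_prop)) (fun s x => hne _ _ (hf.mem x))
      (fun s x hx => by rw [hf.bd x hx, hb])

theorem Deg.susp {e : G} {ψ : G → G} {d : ℕ} (h : Deg e ψ d) :
    Deg (e, (0:ℝ)) (fun p => (ψ p.1, p.2)) d := by
  have hc := h.cont
  have hne : (e, (0:ℝ)) ∈ nz (G × ℝ) := fun h0 => h.he (congrArg Prod.fst h0)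
  refine ⟨by fun_prop, by simp [h.zero], fun w hw h0 => ?_, hne, by simp [h.base], ?_, ?_⟩
  · apply hw
    have h1 : ψ w.1 = 0 := congrArg Prod.fst h0
    have h2 : w.2 = 0 := congrArg Prod.snd h0
    refine Prod.ext ?_ h2
    by_contra h3
    exact h.ne _ h3 h1
  · rw [Module.finrank_prod]; have := h.two; omega
  · intro k hk f hf
    have hG : Module.finrank ℝ G = (k - 1) + 2 := by
      rw [Module.finrank_prod] at hk; have := h.two; simp at hk; omega
    obtain _ | k := k
    · rw [Module.finrank_prod] at hk; have := h.two; simp at hk; omega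
    simp only [Nat.add_sub_cancel] at hG
    obtain ⟨S, hS⟩ := exists_susp_hom (k := k) (show e ∈ nz G from h.he) hne
    obtain ⟨γ, hγ, h1⟩ := exists_SgQ (by omega) h.he hf
    have hm : Set.MapsTo (fun p : G × ℝ => (ψ p.1, p.2)) (nz (G × ℝ)) (nz (G × ℝ)) := by
      intro w hw h0
      apply hw
      have h1 : ψ w.1 = 0 := congrArg Prod.fst h0
      have h2 : w.2 = 0 := congrArg Prod.snd h0
      refine Prod.ext ?_ h2
      by_contra h3
      exact h.ne _ h3 h1
    have h2 : Ht (bdQ (k+2)) (nz (G × ℝ)) (e, 0) (fun x => (ψ (f x).1, (f x).2))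
        (fun x => (ψ (SgQ e γ x).1, (SgQ e γ x).2)) :=
      h1.map (φ := fun p : G × ℝ => (ψ p.1, p.2)) (by fun_prop) hm (by simp [h.base])
    have h3 : Ht (bdQ (k+2)) (nz (G × ℝ)) (e, 0) (fun x => (ψ (SgQ e γ x).1, (SgQ e γ x).2))
        (SgQ e (fun x => ψ (γ x))) := by
      rw [ht_cons]
      simp only [SgQ, Fin.cons_zero, Fin.tail_cons]
      refine ht_of_sides (isClosed_bdQ _) ((hγ.Sg h.he).map (φ := fun p : G × ℝ => (ψ p.1, p.2))
        (by fun_prop) hm (by simp [h.base])) ((h.lp hγ).Sg h.he) h.he ?_ ?_ ?_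
      · intro z
        exact (sd_Sg h.he hγ.mem z).imp (fun h1 => h.ne _ h1) id
      · intro z
        exact sd_Sg h.he (h.lp hγ).mem z
      · intro t x ht
        simp [Sg_half ht]
    rw [(h2.trans h3).cls_eq, ← hS _ (h.lp hγ), h.deg k hG _ hγ, map_pow, hS _ hγ, h1.cls_eq]

theorem Deg.prod_fin {e : G} {ψ : G → G} {d : ℕ} (h : Deg e ψ d) (r : ℕ) :
    Deg (e, (0 : Fin r → ℝ)) (fun p => (ψ p.1, p.2)) d := by
  induction r with
  | zero =>
    let L : G ≃L[ℝ] (G × (Fin 0 → ℝ)) :=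
      { toFun := fun g => (g, 0), invFun := Prod.fst, map_add' := by simp, map_smul' := by simp,
        left_inv := fun _ => rfl, right_inv := fun p => Prod.ext rfl (Subsingleton.elim _ _) }
    exact h.conj L rfl fun w => rfl
  | succ r ih =>
    let L : ((G × (Fin r → ℝ)) × ℝ) ≃L[ℝ] (G × (Fin (r+1) → ℝ)) :=
      { toFun := fun g => (g.1.1, Fin.cons g.2 g.1.2), invFun := fun p => ((p.1, Fin.tail p.2), p.2 0),
        map_add' := by
          rintro ⟨⟨a, b⟩, c⟩ ⟨⟨a', b'⟩, c'⟩
          refine Prod.ext rfl ?_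
          funext i
          refine Fin.cases ?_ (fun i => ?_) i <;> simp
        map_smul' := by
          rintro s ⟨⟨a, b⟩, c⟩
          refine Prod.ext rfl ?_
          funext i
          refine Fin.cases ?_ (fun i => ?_) i <;> simp
        left_inv := fun _ => by simp
        right_inv := fun p => by simp
        continuous_toFun := by
          refine Continuous.prodMk (by fun_prop) (continuous_pi fun i => ?_)
          refine Fin.cases ?_ (fun i => ?_) i
          · simpa using continuous_snd
          · simp; fun_prop
        continuous_invFun := by
          refine Continuous.prodMk (Continuous.prodMk (by fun_prop) (continuous_pi fun i => ?_)) (by fun_prop)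
          show Continuous fun p : G × (Fin (r+1) → ℝ) => p.2 i.succ
          fun_prop }
    refine ih.susp.conj L ?_ fun w => rfl
    refine Prod.ext rfl ?_
    funext i
    refine Fin.cases ?_ (fun i => ?_) i <;> simp [L]

theorem Deg.prod {e : G} {ψ : G → G} {d : ℕ} (h : Deg e ψ d) :
    Deg (e, (0 : V)) (fun p => (ψ p.1, p.2)) d := by
  let L0 : (Fin (Module.finrank ℝ V) → ℝ) ≃L[ℝ] V := ContinuousLinearEquiv.ofFinrankEq (by simp)
  exact (h.prod_fin (Module.finrank ℝ V)).conj ((ContinuousLinearEquiv.refl ℝ G).prodCongr L0)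
    (by simp) (fun w => rfl)

/-- Powers with unchanged absolute value. -/
noncomputable def pw (n : ℕ) (a : ℂ) : ℂ := (‖a‖ : ℂ) * (a / ‖a‖) ^ n

theorem norm_pw {n : ℕ} (a : ℂ) : ‖pw n a‖ = ‖a‖ := by
  rcases eq_or_ne a 0 with rfl | h
  · simp [pw]
  · have : ‖a‖ ≠ 0 := norm_ne_zero_iff.2 h
    simp [pw, div_self this]

theorem continuous_pw {n : ℕ} : Continuous (pw n) := by
  rw [continuous_iff_continuousAt]
  intro a
  rcases eq_or_ne a 0 with rfl | h
  · have h0 : pw n 0 = 0 := by simp [pw]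
    rw [ContinuousAt, h0, tendsto_zero_iff_norm_tendsto_zero]
    simp only [norm_pw]
    exact tendsto_norm_zero
  · have : (‖a‖:ℂ) ≠ 0 := by exact_mod_cast norm_ne_zero_iff.2 h
    have h1 : ContinuousAt (fun a : ℂ => (‖a‖:ℂ)) a := by fun_prop
    exact h1.mul ((continuousAt_id.div h1 this).pow n)

theorem pw_ofReal {n : ℕ} {r : ℝ} (hr : 0 ≤ r) : pw n (r:ℂ) = r := by
  rcases hr.eq_or_lt with rfl | h
  · simp [pw]
  · have : (r:ℂ) ≠ 0 := by exact_mod_cast h.ne'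
    simp [pw, abs_of_pos h, div_self this]

theorem cls_pow_circle (he : (1:ℂ) ∈ nz ℂ) {f : Q 1 → ℂ} (hf : Lp (bdQ 1) (nz ℂ) 1 f) (n : ℕ) :
    Lp (bdQ 1) (nz ℂ) 1 (fun x => f x ^ n) ∧ cls he (fun x => f x ^ n) = cls he f ^ n := by
  have hm : ∀ a ∈ nz ℂ, ∀ b ∈ nz ℂ, a * b ∈ nz ℂ := fun a ha b hb => mul_ne_zero ha hb
  induction n with
  | zero => simp only [pow_zero]; exact ⟨lp_const he, cls_one⟩
  | succ n ih =>
    have h1 := ht_tr_mul hm hf ih.1 0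
    simp only [pow_succ']
    refine ⟨h1.lp_left, ?_⟩
    rw [h1.cls_eq, ← cls_mul ih.1 hf, ih.2, ← pow_succ, ← pow_succ']

theorem deg_pw (n : ℕ) : Deg (1:ℂ) (pw n) n where
  cont := continuous_pw
  zero := by simp [pw]
  ne w hw := by rw [← norm_ne_zero_iff, norm_pw]; simpa using hw
  he := one_ne_zero
  base := by simpa using pw_ofReal (n := n) zero_le_one
  two := by simp
  deg k hk f hf := by
    have : k = 0 := by simpa using hk
    subst this
    refine Eq.trans ?_ (cls_pow_circle _ hf n).2
    apply Ht.cls_eq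
    have cf := hf.cont
    have cp := continuous_pw (n := n)
    have hn : ∀ x, (‖f x‖ : ℂ) ≠ 0 := fun x => by exact_mod_cast norm_ne_zero_iff.2 (hf.mem x)
    have hn' : ∀ x, 0 < ‖f x‖ := fun x => norm_pos_iff.2 (hf.mem x)
    have key : ∀ x, f x ^ n = ((‖f x‖ ^ n / ‖f x‖ : ℝ):ℂ) * pw n (f x) := by
      intro x
      have := hn x
      simp only [pw, div_pow]; push_cast; field_simp
    have h1 : ∀ (s : I) x, 0 < ((1 - (s:ℝ)) + s * (‖f x‖ ^ n / ‖f x‖)) := by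
      intro s x
      have a := s.2.1
      have b := s.2.2
      have c := hn' x
      rcases a.eq_or_lt with h | h
      · rw [← h]; simp
      · have : 0 < (s:ℝ) * (‖f x‖ ^ n / ‖f x‖) := by positivity
        linarith
    refine (Ht.mk (fun (s : I) x => (((1 - (s:ℝ)) + s * (‖f x‖ ^ n / ‖f x‖) : ℝ) : ℂ) * pw n (f x))
      ?_ ?_ ?_).congr ?_ ?_
    · refine Continuous.mul (Complex.continuous_ofReal.comp ?_) (by fun_prop)
      refine Continuous.add (by fun_prop) (Continuous.mul (by fun_prop) ?_)
      exact Continuous.div (by fun_prop) (by fun_prop) (fun p => (hn' p.2).ne')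
    · intro s x
      refine mul_ne_zero ?_ ?_
      · exact_mod_cast (h1 s x).ne'
      · rw [← norm_ne_zero_iff, norm_pw]; exact (hn' x).ne'
    · intro s x hx
      have := pw_ofReal (n := n) zero_le_one
      simp only [Complex.ofReal_one] at this
      simp [hf.bd x hx, this]
    · intro x; simp
    · intro x; rw [key x]; simp

/-- Rotations in `ℂ × ℝ`. -/
noncomputable def rt (s : ℝ) (p : ℂ × ℝ) : ℂ × ℝ :=
  (⟨Real.cos s * p.1.re - Real.sin s * p.2, p.1.im⟩, Real.sin s * p.1.re + Real.cos s * p.2)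

theorem rt_rt (s : ℝ) (p : ℂ × ℝ) : rt (-s) (rt s p) = p := by
  have := Real.sin_sq_add_cos_sq s
  refine Prod.ext (Complex.ext ?_ ?_) ?_
  · simp [rt]; linear_combination p.1.re * this
  · simp [rt]
  · simp [rt]; linear_combination p.2 * this

theorem continuous_rt {X : Type*} [TopologicalSpace X] {a : X → ℝ} {b : X → ℂ × ℝ} (ha : Continuous a)
    (hb : Continuous b) : Continuous fun x => rt (a x) (b x) := by
  have h : ∀ {c d : X → ℝ}, Continuous c → Continuous d → Continuous fun x => (⟨c x, d x⟩ : ℂ) := by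
    intro c d hc hd
    have : (fun x => (⟨c x, d x⟩ : ℂ)) = fun x => (c x : ℂ) + (d x : ℂ) * Complex.I := by
      funext x; exact Complex.mk_eq_add_mul_I _ _
    rw [this]; fun_prop
  have h1 : Continuous fun x => (b x).1.re := Complex.continuous_re.comp (by fun_prop)
  have h2 : Continuous fun x => (b x).1.im := Complex.continuous_im.comp (by fun_prop)
  have h3 : Continuous fun x => Real.cos (a x) := Real.continuous_cos.comp ha
  have h4 : Continuous fun x => Real.sin (a x) := Real.continuous_sin.comp ha
  exact (h (by fun_prop) h2).prodMk (by fun_prop)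

theorem deg_pw_prod1 (n : ℕ) : Deg ((0:ℂ), (1:ℝ)) (fun p => (pw n p.1, p.2)) n := by
  have h := (deg_pw n).susp
  have cp := continuous_pw (n := n)
  have r0 : ∀ s, rt s 0 = 0 := fun s => by
    refine Prod.ext (Complex.ext ?_ ?_) ?_ <;> simp [rt]
  have rn : ∀ s p, p ≠ 0 → rt s p ≠ 0 := fun s p hp h0 => hp (by rw [← rt_rt s p, h0, r0])
  have h1 := Deg.homotopy (d := n) (fun (s : I) p => rt (-(Real.pi / 2 * s))
      (pw n (rt (Real.pi / 2 * s) p).1, (rt (Real.pi / 2 * s) p).2))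
    (e := ((1:ℂ), (0:ℝ))) ?_ ?_ ?_ ?_ ?_
  · let L : (ℂ × ℝ) ≃L[ℝ] (ℂ × ℝ) :=
      { toFun := rt (Real.pi / 2)
        invFun := rt (-(Real.pi / 2))
        map_add' := fun p q => by
          refine Prod.ext (Complex.ext ?_ ?_) ?_ <;> simp [rt] <;> ring
        map_smul' := fun c p => by
          refine Prod.ext (Complex.ext ?_ ?_) ?_ <;> simp [rt] <;> ring
        left_inv := rt_rt _
        right_inv := fun p => by simpa using rt_rt (-(Real.pi / 2)) p
        continuous_toFun := continuous_rt continuous_const continuous_id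
        continuous_invFun := continuous_rt continuous_const continuous_id }
    refine h1.conj L ?_ ?_
    · show rt _ _ = _
      refine Prod.ext (Complex.ext ?_ ?_) ?_ <;> simp [rt]
    · intro w
      show _ = rt (Real.pi / 2) (rt _ _)
      have := rt_rt (-(Real.pi / 2)) (pw n (rt (Real.pi / 2) w).1, (rt (Real.pi / 2) w).2)
      rw [neg_neg] at this
      simp only [Set.Icc.coe_one, mul_one]
      rw [this]
      rfl
  · have c1 : Continuous fun p : I × (ℂ × ℝ) => rt (Real.pi / 2 * p.1) p.2 :=
      continuous_rt (by fun_prop) (by fun_prop)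
    exact continuous_rt (by fun_prop) ((cp.comp (continuous_fst.comp c1)).prodMk (continuous_snd.comp c1))
  · intro s
    have e0 : (pw n (rt (Real.pi / 2 * s) 0).1, (rt (Real.pi / 2 * s) 0).2) = 0 := by simp [r0, pw]
    rw [e0, r0]
  · intro s w hw
    exact rn _ _ (h.ne _ (rn _ _ hw))
  · intro s
    have hc : 0 ≤ Real.cos (Real.pi / 2 * s) := by
      have := s.2.1
      have := s.2.2
      have := Real.pi_pos
      apply Real.cos_nonneg_of_mem_Icc
      constructor <;> nlinarith
    have e1 : (rt (Real.pi / 2 * s) ((1:ℂ), (0:ℝ))).1 = ((Real.cos (Real.pi / 2 * s) : ℝ) : ℂ) := by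
      refine Complex.ext ?_ ?_
      · simp only [rt, Complex.ofReal_re]; simp
      · simp only [rt, Complex.ofReal_im]; simp
    rw [e1, pw_ofReal hc, ← e1]
    exact rt_rt _ _
  · have e : ∀ p, rt 0 p = p := fun p => by
      refine Prod.ext (Complex.ext ?_ ?_) ?_ <;> simp [rt]
    simpa [e] using h

theorem deg_pw_prod (n : ℕ) {v : V} (hv : v ≠ 0) : Deg ((0:ℂ), v) (fun p => (pw n p.1, p.2)) n := by
  have hV : 0 < Module.finrank ℝ V := by
    haveI : Nontrivial V := ⟨v, 0, hv⟩
    exact Module.finrank_pos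
  obtain ⟨L0, hL⟩ := exists_equiv (W := ℝ × (Fin (Module.finrank ℝ V - 1) → ℝ)) (W' := V)
    (e := (1, 0)) (e' := v) (by rw [Module.finrank_prod]; simp; omega) (by simp) hv
  let L : ((ℂ × ℝ) × (Fin (Module.finrank ℝ V - 1) → ℝ)) ≃L[ℝ] (ℂ × V) :=
    (ContinuousLinearEquiv.prodAssoc ℝ ℂ ℝ _).trans ((ContinuousLinearEquiv.refl ℝ ℂ).prodCongr L0)
  exact ((deg_pw_prod1 n).prod (V := Fin (Module.finrank ℝ V - 1) → ℝ)).conj L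
    (Prod.ext rfl hL) (fun w => rfl)

theorem Deg.prod' {e : G} {ψ : G → G} {d : ℕ} (h : Deg e ψ d) :
    Deg ((0 : V), e) (fun p => (p.1, ψ p.2)) d :=
  (h.prod (V := V)).conj (ContinuousLinearEquiv.prodComm ℝ G V) rfl (fun w => rfl)

end deg
end PU
end part7

section part8
open scoped unitInterval Topology Matrix ComplexOrder
set_option linter.unusedVariables false
set_option linter.unusedSimpArgs false
set_option linter.unusedSectionVars false
namespace PU

/-- Invertible matrices. -/
def Gl (ι : Type) [Fintype ι] [DecidableEq ι] : Set (Matrix ι ι ℂ) := {A | A.det ≠ 0}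

section gl
variable {ι κ μ : Type} [Fintype ι] [DecidableEq ι] [Fintype κ] [DecidableEq κ]
  [Fintype μ] [DecidableEq μ]
variable {X : Type*} [TopologicalSpace X] {A : Set X}

theorem mem_GL {A : Matrix ι ι ℂ} : A ∈ Gl ι ↔ A.det ≠ 0 := Iff.rfl

theorem Gl.one : (1 : Matrix ι ι ℂ) ∈ Gl ι := by simp [mem_GL]

theorem Gl.mul {A B : Matrix ι ι ℂ} (hA : A ∈ Gl ι) (hB : B ∈ Gl ι) : A * B ∈ Gl ι := by
  rw [mem_GL, Matrix.det_mul]; exact mul_ne_zero hA hB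

theorem Gl.isUnit {A : Matrix ι ι ℂ} (hA : A ∈ Gl ι) : IsUnit A.det := isUnit_iff_ne_zero.2 hA

theorem Gl.inv {A : Matrix ι ι ℂ} (hA : A ∈ Gl ι) : A⁻¹ ∈ Gl ι := by
  rw [mem_GL, Matrix.det_nonsing_inv, Ring.inverse_eq_inv']; exact inv_ne_zero hA

theorem Gl.inv_mul {A : Matrix ι ι ℂ} (hA : A ∈ Gl ι) : A⁻¹ * A = 1 :=
  Matrix.nonsing_inv_mul _ (Gl.isUnit hA)

theorem Gl.mul_inv {A : Matrix ι ι ℂ} (hA : A ∈ Gl ι) : A * A⁻¹ = 1 :=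
  Matrix.mul_nonsing_inv _ (Gl.isUnit hA)

theorem Gl.of_mul {A B : Matrix ι ι ℂ} (h : A * B = 1) : A ∈ Gl ι := by
  intro h0
  have := congrArg Matrix.det h
  rw [Matrix.det_mul, h0] at this
  simp at this

theorem Gl.of_mul' {A B : Matrix ι ι ℂ} (h : A * B = 1) : B ∈ Gl ι := by
  intro h0
  have := congrArg Matrix.det h
  rw [Matrix.det_mul, h0] at this
  simp at this

theorem continuousOn_inv : ContinuousOn (fun A : Matrix ι ι ℂ => A⁻¹) (Gl ι) := by
  have : (fun A : Matrix ι ι ℂ => A⁻¹) = fun A => (A.det)⁻¹ • A.adjugate := by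
    funext A; rw [Matrix.inv_def, Ring.inverse_eq_inv']
  rw [this]
  have h1 : Continuous fun A : Matrix ι ι ℂ => A.det := continuous_id.matrix_det
  have h2 : Continuous fun A : Matrix ι ι ℂ => A.adjugate := continuous_id.matrix_adjugate
  exact (h1.continuousOn.inv₀ fun A hA => hA).smul h2.continuousOn

theorem cont_inv {f : X → Matrix ι ι ℂ} (hf : Continuous f) (h : ∀ x, f x ∈ Gl ι) :
    Continuous fun x => (f x)⁻¹ := continuousOn_inv.comp_continuous hf h

theorem Gl.path {B : Matrix ι ι ℂ} (hB : B ∈ Gl ι) :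
    ∃ p : I → Matrix ι ι ℂ, Continuous p ∧ (∀ t, p t ∈ Gl ι) ∧ p 0 = B ∧ p 1 = 1 := by
  let P : Polynomial ℂ := (B.map Polynomial.C + (Polynomial.X : Polynomial ℂ) • (1 - B).map Polynomial.C).det
  have hP : ∀ z, P.eval z = (B + z • (1 - B)).det := by
    intro z
    have := RingHom.map_det (Polynomial.evalRingHom z)
      (B.map Polynomial.C + (Polynomial.X : Polynomial ℂ) • (1 - B).map Polynomial.C)
    rw [Polynomial.coe_evalRingHom] at this
    refine this.trans (congrArg Matrix.det ?_)
    ext i j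
    simp
  have h0 : P ≠ 0 := by
    intro h
    have := hP 0
    rw [h] at this
    simp at this
    exact hB this.symm
  have hfin : (P.rootSet ℂ).Countable := (P.rootSet_finite ℂ).countable
  have hpc := hfin.isPathConnected_compl_of_one_lt_rank (E := ℂ) (by
    rw [Complex.rank_real_complex]; norm_num)
  have hmem : ∀ z, z ∈ (P.rootSet ℂ)ᶜ ↔ B + z • (1 - B) ∈ Gl ι := by
    intro z
    rw [Set.mem_compl_iff, Polynomial.mem_rootSet, mem_GL, ← hP]
    simp [h0]
  obtain ⟨γ, hγ⟩ := hpc.joinedIn 0 ((hmem 0).2 (by simpa using hB)) 1 ((hmem 1).2 (by simp [mem_GL]))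
  refine ⟨fun t => B + γ t • (1 - B), by fun_prop, fun t => (hmem _).1 (hγ t), by simp, by simp⟩

/-- Transport along frames. -/
theorem transport_frame {K : Type*} [TopologicalSpace K] [CompactSpace K]
    (f : K × I → Matrix ι κ ℂ) (hf : Continuous f) (h0 : ∀ p, ((f p)ᴴ * f p).det ≠ 0) :
    ∃ u : K × I → Matrix ι ι ℂ, Continuous u ∧ (∀ k, u (k, 0) = 1) ∧ (∀ p, u p ∈ Gl ι) ∧
      (∀ k t, u (k, t) * f (k, 0) = f (k, t)) ∧
      ∀ k, (∀ t, f (k, t) = f (k, 0)) → ∀ t, u (k, t) = 1 := by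
  let R : Matrix ι κ ℂ × Matrix ι κ ℂ → Matrix ι ι ℂ := fun p =>
    1 + (p.2 - p.1) * ((p.1ᴴ * p.1)⁻¹ * p.1ᴴ)
  have hR : ContinuousOn R {p | (p.1ᴴ * p.1) ∈ Gl κ} := by
    have c1 : Continuous fun p : Matrix ι κ ℂ × Matrix ι κ ℂ => p.1ᴴ :=
      continuous_fst.matrix_conjTranspose
    have c2 : Continuous fun p : Matrix ι κ ℂ × Matrix ι κ ℂ => p.1ᴴ * p.1 :=
      c1.matrix_mul continuous_fst
    have c3 : ContinuousOn (fun p : Matrix ι κ ℂ × Matrix ι κ ℂ => (p.1ᴴ * p.1)⁻¹)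
      {p | (p.1ᴴ * p.1) ∈ Gl κ} := continuousOn_inv.comp c2.continuousOn (fun p hp => hp)
    rw [continuousOn_iff_continuous_domRestrict] at c3 ⊢
    refine Continuous.add continuous_const (Continuous.matrix_mul (by fun_prop)
      (Continuous.matrix_mul c3 ?_))
    exact c1.comp continuous_subtype_val
  have hO : IsOpen {p : Matrix ι κ ℂ × Matrix ι κ ℂ | (p.1ᴴ * p.1) ∈ Gl κ} := by
    have c2 : Continuous fun p : Matrix ι κ ℂ × Matrix ι κ ℂ => (p.1ᴴ * p.1).det :=
      (continuous_fst.matrix_conjTranspose.matrix_mul continuous_fst).matrix_det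
    exact c2.isOpen_preimage _ isOpen_ne
  have hR1 : ∀ v, R (v, v) = 1 := fun v => by simp [R]
  obtain ⟨u, h1, h2, h3, h4⟩ := transport f hf
    ({p | (p.1ᴴ * p.1) ∈ Gl κ} ∩ R ⁻¹' (Gl ι)) (fun p => by
      have hm : (f p, f p) ∈ {p : Matrix ι κ ℂ × Matrix ι κ ℂ | (p.1ᴴ * p.1) ∈ Gl κ} := h0 p
      refine Filter.inter_mem (hO.mem_nhds hm) ?_
      have hc : ContinuousAt R (f p, f p) := hR.continuousAt (hO.mem_nhds hm)
      have hd : ContinuousAt (fun q => (R q).det) (f p, f p) :=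
        (continuous_id.matrix_det.continuousAt).comp hc
      exact hd.eventually_ne (by simp [hR1])) R (hR.mono Set.inter_subset_left)
    (fun m v w => m ∈ Gl ι ∧ m * v = w) hR1 (by simp [Gl.one]) (by
      rintro m m' v w z ⟨a, rfl⟩ ⟨b, rfl⟩
      exact ⟨Gl.mul b a, Matrix.mul_assoc _ _ _⟩) (by
      rintro v w ⟨a, b⟩
      refine ⟨b, ?_⟩
      simp only [R]
      have a : vᴴ * v ∈ Gl κ := a
      rw [Matrix.add_mul, Matrix.mul_assoc, Matrix.mul_assoc, Gl.inv_mul a]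
      simp)
  exact ⟨u, h1, h2, fun p => (h3 p.1 p.2).1, fun k t => (h3 k t).2, h4⟩

theorem frame_of_inj {N : Matrix ι κ ℂ} (h : Function.Injective N.mulVec) : (Nᴴ * N).det ≠ 0 :=
  (Matrix.PosDef.conjTranspose_mul_self N h).det_pos.ne'

/-- Transport along vectors. -/
theorem transport_vec {K : Type*} [TopologicalSpace K] [CompactSpace K]
    (f : K × I → ι → ℂ) (hf : Continuous f) (h0 : ∀ p, f p ≠ 0) :
    ∃ u : K × I → Matrix ι ι ℂ, Continuous u ∧ (∀ k, u (k, 0) = 1) ∧ (∀ p, u p ∈ Gl ι) ∧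
      (∀ k t, u (k, t) *ᵥ f (k, 0) = f (k, t)) ∧
      ∀ k, (∀ t, f (k, t) = f (k, 0)) → ∀ t, u (k, t) = 1 := by
  obtain ⟨u, h1, h2, h3, h4, h5⟩ := transport_frame (κ := Unit)
    (fun p => Matrix.replicateCol Unit (f p)) (continuous_matrix fun i j => by
      simp only [Matrix.replicateCol_apply]; fun_prop) (fun p => by
      apply frame_of_inj
      intro v w hvw
      obtain ⟨i, hi⟩ := Function.ne_iff.1 (h0 p)
      have := congrFun hvw i
      simp [Matrix.mulVec, dotProduct] at this
      funext j
      exact this.resolve_right hi)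
  refine ⟨u, h1, h2, h3, fun k t => ?_, fun k hk => h5 k fun t => by rw [hk]⟩
  have := h4 k t
  rw [← Matrix.replicateCol_mulVec] at this
  funext i
  exact congrFun (congrFun this i) ()

/-- The distinguished vector. -/
abbrev ev (ι : Type) [DecidableEq ι] : ι ⊕ Unit → ℂ := Pi.single (Sum.inr ()) 1

theorem ev_ne : ev ι ∈ nz (ι ⊕ Unit → ℂ) := by simp [ev]

theorem col_eq (g : Matrix (ι ⊕ Unit) (ι ⊕ Unit) ℂ) : g *ᵥ ev ι = g.col (Sum.inr ()) := by
  simp [ev]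

theorem mulVec_ne {g : Matrix ι ι ℂ} (hg : g ∈ Gl ι) {v : ι → ℂ} (hv : v ≠ 0) : g *ᵥ v ≠ 0 :=
  fun h => hv (Matrix.eq_zero_of_mulVec_eq_zero hg h)

/-- Stabilization by one. -/
abbrev ex (B : Matrix ι ι ℂ) : Matrix (ι ⊕ κ) (ι ⊕ κ) ℂ := Matrix.fromBlocks B 0 0 1

theorem ex_mem {B : Matrix ι ι ℂ} : (ex B : Matrix (ι ⊕ κ) (ι ⊕ κ) ℂ) ∈ Gl (ι ⊕ κ) ↔ B ∈ Gl ι := by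
  rw [mem_GL, mem_GL, Matrix.det_fromBlocks_zero₂₁]; simp

theorem ex_one : (ex (1 : Matrix ι ι ℂ) : Matrix (ι ⊕ κ) (ι ⊕ κ) ℂ) = 1 := Matrix.fromBlocks_one

theorem cont_ex : Continuous fun B : Matrix ι ι ℂ => (ex B : Matrix (ι ⊕ κ) (ι ⊕ κ) ℂ) :=
  continuous_id.matrix_fromBlocks continuous_const continuous_const continuous_const

theorem fix_eq {h : Matrix (ι ⊕ Unit) (ι ⊕ Unit) ℂ} (hh : h *ᵥ ev ι = ev ι) :
    h = Matrix.fromBlocks h.toBlocks₁₁ 0 h.toBlocks₂₁ 1 := by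
  rw [col_eq] at hh
  ext i j
  rcases j with j | ⟨⟩
  · rcases i with i | i <;> rfl
  · have := congrFun hh i
    simp only [Matrix.col_apply] at this
    rw [this]
    rcases i with i | ⟨⟩ <;> simp [ev]

theorem fix_mem {h : Matrix (ι ⊕ Unit) (ι ⊕ Unit) ℂ} (hh : h *ᵥ ev ι = ev ι) (hg : h ∈ Gl _) :
    h.toBlocks₁₁ ∈ Gl ι := by
  rw [mem_GL, fix_eq hh, Matrix.det_fromBlocks_zero₁₂] at hg; rw [mem_GL]
  simpa using hg

theorem cont_blk : Continuous fun h : Matrix (ι ⊕ κ) (ι ⊕ κ) ℂ => h.toBlocks₁₁ :=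
  continuous_matrix fun i j => by simp only [Matrix.toBlocks₁₁, Matrix.of_apply]; fun_prop

theorem blk_one : (1 : Matrix (ι ⊕ κ) (ι ⊕ κ) ℂ).toBlocks₁₁ = 1 := by
  rw [← Matrix.fromBlocks_one, Matrix.toBlocks_fromBlocks₁₁]

/-- Trivializing the last column. -/
theorem col_core [CompactSpace X] {g : X → Matrix (ι ⊕ Unit) (ι ⊕ Unit) ℂ}
    (hc : Ht A (nz _) (ev ι) (fun x => g x *ᵥ ev ι) (fun _ => ev ι)) :
    ∃ u : I × X → Matrix (ι ⊕ Unit) (ι ⊕ Unit) ℂ, Continuous u ∧ (∀ p, u p ∈ Gl _) ∧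
      (∀ x, u (0, x) = 1) ∧ (∀ t, ∀ x ∈ A, u (t, x) = 1) ∧ ∀ x, (u (1, x) * g x) *ᵥ ev ι = ev ι := by
  obtain ⟨H, h1, h2, h3, h4, h5⟩ := hc
  obtain ⟨u, u1, u2, u3, u4, u5⟩ := transport_vec (K := X) (fun p => H (p.2, p.1)) (by fun_prop)
    (fun p => h2 _)
  refine ⟨fun p => u (p.2, p.1), by fun_prop, fun p => u3 _, fun x => u2 x, fun t x hx => ?_,
    fun x => ?_⟩
  · exact u5 x (fun t => by rw [h5 _ _ hx, h5 _ _ hx]) t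
  · have := u4 x 1
    simp only [h3, h4] at this
    rw [← Matrix.mulVec_mulVec]; exact this

theorem peel [CompactSpace X] {g : X → Matrix (ι ⊕ Unit) (ι ⊕ Unit) ℂ} (hg : Lp A (Gl _) 1 g)
    (hc : Ht A (nz _) (ev ι) (fun x => g x *ᵥ ev ι) (fun _ => ev ι)) :
    ∃ g', Lp A (Gl ι) 1 g' ∧ Ht A (Gl (ι ⊕ Unit)) 1 g (fun x => ex (g' x)) := by
  obtain ⟨u, u1, u2, u3, u4, u5⟩ := col_core hc
  have cg := hg.cont
  let h : X → Matrix (ι ⊕ Unit) (ι ⊕ Unit) ℂ := fun x => u (1, x) * g x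
  have ch : Continuous h := by fun_prop
  have hm : ∀ x, h x ∈ Gl _ := fun x => Gl.mul (u2 _) (hg.mem x)
  have hb : ∀ x ∈ A, h x = 1 := fun x hx => by simp [h, u4 1 x hx, hg.bd x hx]
  have k1 : Ht A (Gl _) 1 g h := by
    refine (Ht.mk (fun (s : I) x => u (s, x) * g x) (by fun_prop) (fun s x => Gl.mul (u2 _) (hg.mem x))
      (fun s x hx => by simp [u4 s x hx, hg.bd x hx])).congr ?_ ?_
    · intro x; simp [u3]
    · intro x; rfl
  have hB : ∀ x, (h x).toBlocks₁₁ ∈ Gl ι := fun x => fix_mem (u5 x) (hm x)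
  refine ⟨fun x => (h x).toBlocks₁₁, ⟨cont_blk.comp ch, hB, fun x hx => by rw [hb x hx, blk_one]⟩,
    k1.trans ?_⟩
  refine (Ht.mk (fun (s : I) x => Matrix.fromBlocks (h x).toBlocks₁₁ 0
    (((1 - (s:ℝ) : ℝ) : ℂ) • (h x).toBlocks₂₁) 1) ?_ ?_ ?_).congr ?_ ?_
  · have c2 : Continuous fun x => (h x).toBlocks₂₁ :=
      continuous_matrix fun i j => by simp only [Matrix.toBlocks₂₁, Matrix.of_apply]; fun_prop
    refine Continuous.matrix_fromBlocks (cont_blk.comp (ch.comp continuous_snd)) continuous_const ?_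
      continuous_const
    exact Continuous.smul (Complex.continuous_ofReal.comp (continuous_const.sub (continuous_subtype_val.comp continuous_fst))) (c2.comp continuous_snd)
  · intro s x
    rw [mem_GL, Matrix.det_fromBlocks_zero₁₂]
    have := hB x; rw [mem_GL] at this; simpa using this
  · intro s x hx
    simp only [hb x hx]
    rw [blk_one]
    have : (1 : Matrix (ι ⊕ Unit) (ι ⊕ Unit) ℂ).toBlocks₂₁ = 0 := by
      rw [← Matrix.fromBlocks_one, Matrix.toBlocks_fromBlocks₂₁]
    rw [this, smul_zero, Matrix.fromBlocks_one]
  · intro x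
    simpa using fix_eq (u5 x)
  · intro x
    simp

theorem unstab [CompactSpace X]
    (hs : ∀ b : I × X → (ι ⊕ Unit → ℂ), Lp (sus A) (nz _) (ev ι) b →
      Ht (sus A) (nz _) (ev ι) b (fun _ => ev ι))
    {g : X → Matrix ι ι ℂ} (h : Ht A (Gl (ι ⊕ Unit)) 1 (fun x => ex (g x)) (fun _ => 1)) :
    Ht A (Gl ι) 1 g (fun _ => 1) := by
  obtain ⟨H, h1, h2, h3, h4, h5⟩ := h
  have e1 : ∀ B : Matrix ι ι ℂ, ex B *ᵥ ev ι = ev ι := fun B => by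
    rw [col_eq]; funext i; rcases i with i | ⟨⟩ <;> simp [ev]
  have hb : Lp (sus A) (nz _) (ev ι) (fun p => H p *ᵥ ev ι) := by
    refine ⟨h1.matrix_mulVec continuous_const, fun p => mulVec_ne (h2 p) ev_ne, ?_⟩
    rintro ⟨s, x⟩ (h | h | h)
    · simp only at h; subst h; simp only [h3, e1]
    · simp only at h; subst h; simp only [h4, Matrix.one_mulVec]
    · simp only [h5 s x h, Matrix.one_mulVec]
  obtain ⟨u, u1, u2, u3, u4, u5⟩ := col_core (hs _ hb)
  refine (Ht.mk (fun (s : I) x => (u (1, (s, x)) * H (s, x)).toBlocks₁₁) ?_ ?_ ?_).congr ?_ ?_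
  · exact cont_blk.comp (by fun_prop)
  · exact fun s x => fix_mem (u5 (s, x)) (Gl.mul (u2 _) (h2 _))
  · intro s x hx
    rw [u4 1 (s, x) (Or.inr (Or.inr hx)), h5 s x hx, one_mul, blk_one]
  · intro x
    rw [u4 1 (0, x) (Or.inl rfl), h3, one_mul]
    simp
  · intro x
    rw [u4 1 (1, x) (Or.inr (Or.inl rfl)), h4, one_mul, blk_one]

end gl
end PU
end part8

section part9
open scoped unitInterval Topology Matrix
set_option linter.unusedVariables false
set_option linter.unusedSimpArgs false
set_option linter.unusedSectionVars false
namespace PU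

section st
variable {ι κ μ M : Type} [Fintype ι] [DecidableEq ι] [Fintype κ] [DecidableEq κ]
  [Fintype μ] [DecidableEq μ] [Fintype M] [DecidableEq M]
variable {X : Type*} [TopologicalSpace X] {A : Set X}

/-- General stabilization along a split injection. -/
def ext (J : Matrix M ι ℂ) (K : Matrix ι M ℂ) (B : Matrix ι ι ℂ) : Matrix M M ℂ := 1 + J * (B - 1) * K

theorem ext_one (J : Matrix M ι ℂ) (K : Matrix ι M ℂ) : ext J K 1 = 1 := by simp [ext]

theorem ext_mul {J : Matrix M ι ℂ} {K : Matrix ι M ℂ} (h : K * J = 1) (B C : Matrix ι ι ℂ) :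
    ext J K (B * C) = ext J K B * ext J K C := by
  have e : J * (B - 1) * K * (J * (C - 1) * K) = J * ((B - 1) * (C - 1)) * K := by
    calc _ = J * (B - 1) * (K * J) * ((C - 1) * K) := by simp only [Matrix.mul_assoc]
      _ = _ := by rw [h]; simp only [Matrix.mul_assoc, Matrix.mul_one]
  simp only [ext]
  rw [add_mul, mul_add, mul_add, e]
  have : B * C - 1 = (B - 1) + (C - 1) + (B - 1) * (C - 1) := by noncomm_ring
  rw [this]
  simp only [Matrix.mul_add, Matrix.add_mul, one_mul, mul_one]
  abel

theorem ext_mem {J : Matrix M ι ℂ} {K : Matrix ι M ℂ} (h : K * J = 1) {B : Matrix ι ι ℂ}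
    (hB : B ∈ Gl ι) : ext J K B ∈ Gl M :=
  Gl.of_mul (B := ext J K B⁻¹) (by rw [← ext_mul h, Gl.mul_inv hB, ext_one])

theorem ext_inv {J : Matrix M ι ℂ} {K : Matrix ι M ℂ} (h : K * J = 1) {B : Matrix ι ι ℂ}
    (hB : B ∈ Gl ι) : (ext J K B)⁻¹ = ext J K B⁻¹ :=
  Matrix.inv_eq_right_inv (by rw [← ext_mul h, Gl.mul_inv hB, ext_one])

theorem cont_ext3 {J : X → Matrix M ι ℂ} {K : X → Matrix ι M ℂ} {B : X → Matrix ι ι ℂ}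
    (h1 : Continuous J) (h2 : Continuous K) (h3 : Continuous B) :
    Continuous fun x => ext (J x) (K x) (B x) := by
  unfold ext
  exact continuous_const.add ((h1.matrix_mul (h3.sub continuous_const)).matrix_mul h2)

theorem ext_ext {J : Matrix M ι ℂ} {K : Matrix ι M ℂ} {J' : Matrix μ M ℂ} {K' : Matrix M μ ℂ}
    (B : Matrix ι ι ℂ) : ext J' K' (ext J K B) = ext (J' * J) (K * K') B := by
  simp [ext, Matrix.mul_assoc]

theorem Lp.ext {J : Matrix M ι ℂ} {K : Matrix ι M ℂ} (h : K * J = 1) {g : X → Matrix ι ι ℂ}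
    (hg : Lp A (Gl ι) 1 g) : Lp A (Gl M) 1 (fun x => ext J K (g x)) :=
  hg.map (cont_ext3 continuous_const continuous_const continuous_id).continuousOn
    (fun _ hB => ext_mem h hB) (ext_one _ _)

theorem Ht.ext {J : Matrix M ι ℂ} {K : Matrix ι M ℂ} (h : K * J = 1) {g g' : X → Matrix ι ι ℂ}
    (hg : Ht A (Gl ι) 1 g g') : Ht A (Gl M) 1 (fun x => ext J K (g x)) (fun x => ext J K (g' x)) :=
  hg.map (cont_ext3 continuous_const continuous_const continuous_id).continuousOn
    (fun _ hB => ext_mem h hB) (ext_one _ _)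

/-- Moving the embedding. -/
theorem ht_ext_path {g : X → Matrix ι ι ℂ} (hg : Lp A (Gl ι) 1 g) (J : I → Matrix M ι ℂ)
    (K : I → Matrix ι M ℂ) (hJ : Continuous J) (hK : Continuous K) (h : ∀ s, K s * J s = 1) :
    Ht A (Gl M) 1 (fun x => ext (J 0) (K 0) (g x)) (fun x => ext (J 1) (K 1) (g x)) := by
  have := hg.cont
  exact Ht.mk (fun s x => ext (J s) (K s) (g x)) (cont_ext3 (by fun_prop) (by fun_prop) (by fun_prop))
    (fun s x => ext_mem (h s) (hg.mem x)) (fun s x hx => by rw [hg.bd x hx, ext_one])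

theorem ht_ext_rot {g : X → Matrix ι ι ℂ} (hg : Lp A (Gl ι) 1 g) {J J' : Matrix M ι ℂ}
    {K K' : Matrix ι M ℂ} (h1 : K * J = 1) (h2 : K' * J' = 1) (h3 : K * J' = 0) (h4 : K' * J = 0) :
    Ht A (Gl M) 1 (fun x => ext J K (g x)) (fun x => ext J' K' (g x)) := by
  let c : I → ℂ := fun s => (Real.cos (Real.pi / 2 * s) : ℂ)
  let d : I → ℂ := fun s => (Real.sin (Real.pi / 2 * s) : ℂ)
  have cc : Continuous c := by fun_prop
  have cd : Continuous d := by fun_prop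
  refine (ht_ext_path hg (fun s => c s • J + d s • J') (fun s => c s • K + d s • K')
    (by fun_prop) (by fun_prop) ?_).congr ?_ ?_
  · intro s
    simp only [Matrix.add_mul, Matrix.mul_add, Matrix.smul_mul, Matrix.mul_smul, h1, h2, h3, h4]
    simp only [smul_zero, add_zero, zero_add, smul_smul, ← add_smul, c, d]
    rw [← Complex.ofReal_mul, ← Complex.ofReal_mul, ← Complex.ofReal_add]
    have := Real.cos_sq_add_sin_sq (Real.pi / 2 * s)
    rw [show ∀ a b : ℝ, a * a + b * b = a ^ 2 + b ^ 2 from fun a b => by ring, this]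
    simp
  · intro x; simp [c, d]
  · intro x; simp [c, d]

abbrev i1 (M μ : Type) [Fintype M] [DecidableEq M] [Fintype μ] [DecidableEq μ] : Matrix (M ⊕ μ) M ℂ := Matrix.fromRows 1 0
abbrev i2 (M μ : Type) [Fintype M] [DecidableEq M] [Fintype μ] [DecidableEq μ] : Matrix (M ⊕ μ) μ ℂ := Matrix.fromRows 0 1
abbrev p1 (M μ : Type) [Fintype M] [DecidableEq M] [Fintype μ] [DecidableEq μ] : Matrix M (M ⊕ μ) ℂ := Matrix.fromCols 1 0
abbrev p2 (M μ : Type) [Fintype M] [DecidableEq M] [Fintype μ] [DecidableEq μ] : Matrix μ (M ⊕ μ) ℂ := Matrix.fromCols 0 1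

theorem p1_i1 : p1 M μ * i1 M μ = 1 := by simp [Matrix.fromCols_mul_fromRows]
theorem p2_i2 : p2 M μ * i2 M μ = 1 := by simp [Matrix.fromCols_mul_fromRows]
theorem p1_i2 : p1 M μ * i2 M μ = 0 := by simp [Matrix.fromCols_mul_fromRows]
theorem p2_i1 : p2 M μ * i1 M μ = 0 := by simp [Matrix.fromCols_mul_fromRows]

theorem mid {a : Type*} [Fintype a] {b c d : Type*} [Fintype b] [Fintype c] [Fintype d]
    [DecidableEq d] (K : Matrix a b ℂ) (P : Matrix b c ℂ)
    (i : Matrix c b ℂ) (J : Matrix b d ℂ) [DecidableEq b] (h : P * i = 1) :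
    K * P * (i * J) = K * J := by
  rw [Matrix.mul_assoc, ← Matrix.mul_assoc P, h, Matrix.one_mul]

theorem mid0 {a b b' c d : Type*} [Fintype a] [Fintype b] [Fintype c] [Fintype d] [Fintype b']
    (K : Matrix a b ℂ) (P : Matrix b c ℂ)
    (i : Matrix c b' ℂ) (J : Matrix b' d ℂ) (h : P * i = 0) :
    K * P * (i * J) = 0 := by
  rw [Matrix.mul_assoc, ← Matrix.mul_assoc P, h, Matrix.zero_mul, Matrix.mul_zero]

theorem ext_i1 (B : Matrix M M ℂ) : ext (i1 M μ) (p1 M μ) B = ex B := by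
  simp only [ext, ex, i1, p1]
  rw [← Matrix.fromBlocks_one]
  ext i j
  rcases i with i | i <;> rcases j with j | j <;>
    simp [Matrix.mul_apply, Matrix.add_apply, Matrix.fromRows_mul, Matrix.mul_fromCols, Matrix.one_apply]

/-- Stable equivalence of loops. -/
def SEq (A : Set X) (g : X → Matrix ι ι ℂ) (g' : X → Matrix κ κ ℂ) : Prop :=
  Lp A (Gl ι) 1 g ∧ Lp A (Gl κ) 1 g' ∧
  ∃ (M : Type) (_ : Fintype M) (_ : DecidableEq M) (J : Matrix M ι ℂ) (K : Matrix ι M ℂ)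
    (J' : Matrix M κ ℂ) (K' : Matrix κ M ℂ), K * J = 1 ∧ K' * J' = 1 ∧
    Ht A (Gl M) 1 (fun x => ext J K (g x)) (fun x => ext J' K' (g' x))

theorem SEq.symm {g : X → Matrix ι ι ℂ} {g' : X → Matrix κ κ ℂ} (h : SEq A g g') : SEq A g' g := by
  obtain ⟨a, b, M, i, j, J, K, J', K', h1, h2, h3⟩ := h
  exact ⟨b, a, M, i, j, J', K', J, K, h2, h1, h3.symm⟩

theorem Ht.seq {g g' : X → Matrix ι ι ℂ} (h : Ht A (Gl ι) 1 g g') : SEq A g g' :=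
  ⟨h.lp_left, h.lp_right, ι, inferInstance, inferInstance, 1, 1, 1, 1, by simp, by simp,
    h.ext (by simp)⟩

theorem seq_ext {g : X → Matrix ι ι ℂ} (hg : Lp A (Gl ι) 1 g) {J : Matrix M ι ℂ} {K : Matrix ι M ℂ}
    (h : K * J = 1) : SEq A g (fun x => ext J K (g x)) :=
  ⟨hg, hg.ext h, M, inferInstance, inferInstance, J, K, 1, 1, h, by simp,
    (Ht.refl (hg.ext h)).congr (fun _ => rfl) (fun x => by simp [ext])⟩

theorem SEq.trans {g : X → Matrix ι ι ℂ} {g' : X → Matrix κ κ ℂ} {g'' : X → Matrix μ μ ℂ}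
    (h : SEq A g g') (h' : SEq A g' g'') : SEq A g g'' := by
  obtain ⟨a, b, M, i, j, J, K, J', K', h1, h2, h3⟩ := h
  obtain ⟨a', b', N, i', j', J₁, K₁, J₁', K₁', h1', h2', h3'⟩ := h'
  refine ⟨a, b', M ⊕ N, inferInstance, inferInstance, i1 M N * J, K * p1 M N, i2 M N * J₁', K₁' * p2 M N,
    by rw [mid _ _ _ _ p1_i1, h1], by rw [mid _ _ _ _ p2_i2, h2'], ?_⟩
  have e1 := h3.ext (M := M ⊕ N) p1_i1
  have e2 := h3'.ext (M := M ⊕ N) p2_i2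
  simp only [ext_ext] at e1 e2
  refine e1.trans (Ht.trans (ht_ext_rot b ?_ ?_ ?_ ?_) e2)
  · rw [mid _ _ _ _ p1_i1, h2]
  · rw [mid _ _ _ _ p2_i2, h1']
  · exact mid0 _ _ _ _ p1_i2
  · exact mid0 _ _ _ _ p2_i1

/-- Stably null. -/
def SNull (A : Set X) (g : X → Matrix ι ι ℂ) : Prop := SEq A g (fun _ => (1 : Matrix Unit Unit ℂ))

theorem snull_one : SNull A (fun _ => (1 : Matrix M M ℂ)) := by
  refine ⟨lp_const Gl.one, lp_const Gl.one, M ⊕ Unit, inferInstance, inferInstance, i1 M Unit, p1 M Unit, i2 M Unit, p2 M Unit,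
    p1_i1, p2_i2, ?_⟩
  simp only [ext_one]
  exact Ht.refl (lp_const Gl.one)

theorem snull_of_ht {g : X → Matrix ι ι ℂ} (h : Ht A (Gl ι) 1 g (fun _ => 1)) : SNull A g :=
  h.seq.trans snull_one

theorem SNull.ex {g : X → Matrix ι ι ℂ} (h : SNull A g) :
    ∃ (M : Type) (_ : Fintype M) (_ : DecidableEq M),
      Ht A (Gl (ι ⊕ M)) 1 (fun x => ex (g x)) (fun _ => 1) := by
  obtain ⟨a, b, M, i, j, J, K, J', K', h1, h2, h3⟩ := h
  refine ⟨M, i, j, ?_⟩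
  simp only [ext_one] at h3
  have e1 := h3.ext (M := ι ⊕ M) p2_i2
  simp only [ext_ext, ext_one] at e1
  refine Ht.trans ?_ e1
  simp only [← ext_i1]
  refine ht_ext_rot a p1_i1 ?_ ?_ ?_
  · rw [mid _ _ _ _ p2_i2, h1]
  · rw [← Matrix.mul_assoc, p1_i2, Matrix.zero_mul]
  · rw [Matrix.mul_assoc, p2_i1, Matrix.mul_zero]

theorem Ht.reindex {g g' : X → Matrix ι ι ℂ} (h : Ht A (Gl ι) 1 g g') (e : ι ≃ κ) :
    Ht A (Gl κ) 1 (fun x => Matrix.reindex e e (g x)) (fun x => Matrix.reindex e e (g' x)) := by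
  refine h.map (φ := fun m => Matrix.reindex e e m) (Continuous.continuousOn ?_) ?_ ?_
  · exact continuous_id.matrix_reindex e e
  · intro m hm
    rw [mem_GL, Matrix.det_reindex_self]; exact hm
  · simp

theorem null_of_ex {k : ℕ} (N : ℕ) : ∀ {ι : Type} [Fintype ι] [DecidableEq ι] {M : Type} [Fintype M]
    [DecidableEq M], k + 2 < 2 * (Fintype.card ι + 1) → Fintype.card M = N →
    ∀ {g : Q k → Matrix ι ι ℂ}, Ht (bdQ k) (Gl (ι ⊕ M)) 1 (fun x => ex (g x)) (fun _ => 1) →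
      Ht (bdQ k) (Gl ι) 1 g (fun _ => 1) := by
  induction N with
  | zero =>
    intro ι _ _ M _ _ hk hM g h
    have : IsEmpty M := Fintype.card_eq_zero_iff.1 hM
    refine (h.reindex (Equiv.sumEmpty ι M)).congr (fun x => ?_) (fun x => ?_)
    · ext i j; simp
    · simp
  | succ N ih =>
    intro ι _ _ M _ _ hk hM g h
    have e : M ≃ Unit ⊕ Fin N := Fintype.equivOfCardEq (by simp [hM, add_comm])
    let f : ι ⊕ M ≃ (ι ⊕ Unit) ⊕ Fin N :=
      (Equiv.sumCongr (Equiv.refl ι) e).trans (Equiv.sumAssoc ι Unit (Fin N)).symm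
    have h' : Ht (bdQ k) (Gl ((ι ⊕ Unit) ⊕ Fin N)) 1 (fun x => ex (ex (g x))) (fun _ => 1) := by
      refine (h.reindex f).congr (fun x => ?_) (fun x => ?_)
      · ext i j
        rcases i with (i | i) | i <;> rcases j with (j | j) | j <;>
          simp [f, Matrix.one_apply]
      · simp
    have h2 := ih (by simp only [Fintype.card_sum, Fintype.card_unit]; omega) (by simp) h'
    refine unstab ?_ h2
    intro b hb
    have c1 : Lp (bdQ (k+1)) (nz _) (ev ι) (fun x => b (x 0, Fin.tail x)) := by
      rw [lp_cons]; simpa using hb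
    have c2 := sphere_null (k+1) (by
      rw [← Module.finrank_mul_finrank ℝ ℂ, Complex.finrank_real_complex]; simp; omega) (mem_nz.1 ev_ne) c1
    rw [ht_cons] at c2
    simpa using c2

theorem snull_null {k : ℕ} (hk : k + 2 < 2 * (Fintype.card ι + 1)) {g : Q k → Matrix ι ι ℂ}
    (h : SNull (bdQ k) g) : Ht (bdQ k) (Gl ι) 1 g (fun _ => 1) := by
  obtain ⟨M, i, j, h⟩ := h.ex
  exact null_of_ex _ hk rfl h

theorem Ht.mulr {g g' h h' : X → Matrix ι ι ℂ} (a : Ht A (Gl ι) 1 g g') (b : Ht A (Gl ι) 1 h h') :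
    Ht A (Gl ι) 1 (fun x => g x * h x) (fun x => g' x * h' x) :=
  a.map₂ b (φ := fun p => p.1 * p.2) (by fun_prop) (fun x hx y hy => Gl.mul hx hy) (by simp)

theorem Lp.mulr {g h : X → Matrix ι ι ℂ} (a : Lp A (Gl ι) 1 g) (b : Lp A (Gl ι) 1 h) :
    Lp A (Gl ι) 1 (fun x => g x * h x) := ((Ht.refl a).mulr (Ht.refl b)).lp_left

theorem Lp.inv {g : X → Matrix ι ι ℂ} (a : Lp A (Gl ι) 1 g) : Lp A (Gl ι) 1 (fun x => (g x)⁻¹) :=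
  a.map continuousOn_inv (fun _ h => Gl.inv h) inv_one

theorem seq_ht {k : ℕ} (hk : k + 2 < 2 * (Fintype.card ι + 1)) {g g' : Q k → Matrix ι ι ℂ}
    (h : SEq (bdQ k) g g') : Ht (bdQ k) (Gl ι) 1 g g' := by
  obtain ⟨a, b, M, i, j, J, K, J', K', h1, h2, h3⟩ := h
  have e1 := h3.ext (M := M ⊕ M) p1_i1
  simp only [ext_ext] at e1
  have e2 : Ht (bdQ k) (Gl (M ⊕ M)) 1 (fun x => PU.ext (i1 M M * J') (K' * p1 M M) (g' x))
      (fun x => PU.ext (i1 M M * J) (K * p1 M M) (g' x)) := by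
    refine (ht_ext_rot b (J' := i2 M M * J) (K' := K * p2 M M) ?_ ?_ ?_ ?_).trans (ht_ext_rot b ?_ ?_ ?_ ?_)
    · rw [mid _ _ _ _ p1_i1, h2]
    · rw [mid _ _ _ _ p2_i2, h1]
    · exact mid0 _ _ _ _ p1_i2
    · exact mid0 _ _ _ _ p2_i1
    · rw [mid _ _ _ _ p2_i2, h1]
    · rw [mid _ _ _ _ p1_i1, h1]
    · exact mid0 _ _ _ _ p2_i1
    · exact mid0 _ _ _ _ p1_i2
  have hJ : (K * p1 M M) * (i1 M M * J) = 1 := by rw [mid _ _ _ _ p1_i1, h1]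
  have e3 := (e1.trans e2).mulr (Ht.refl (b.inv.ext hJ))
  simp only [← ext_mul hJ] at e3
  have e4 : SNull (bdQ k) (fun x => g x * (g' x)⁻¹) := by
    refine (seq_ext (a.mulr b.inv) hJ).trans (e3.seq.trans ?_)
    refine (Ht.seq ?_).trans snull_one
    refine (Ht.refl (lp_const Gl.one)).congr (fun x => ?_) (fun x => rfl)
    rw [Gl.mul_inv (b.mem x), ext_one]
  have e5 := (snull_null hk e4).mulr (Ht.refl b)
  refine e5.congr (fun x => ?_) (fun x => by simp)
  rw [Matrix.mul_assoc, Gl.inv_mul (b.mem x), Matrix.mul_one]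

end st
end PU
end part9

section part10
open scoped unitInterval Topology Matrix
set_option linter.unusedVariables false
set_option linter.unusedSimpArgs false
set_option linter.unusedSectionVars false
namespace PU

section conn
variable {ι : Type} [Fintype ι] [DecidableEq ι]
variable {X : Type*} [TopologicalSpace X] {A : Set X}

abbrev Mx (ι : Type) := Matrix (ι ⊕ Unit) (ι ⊕ Unit) ℂ

/-- Matrices fixing the distinguished vector. -/
def Fx (ι : Type) [Fintype ι] [DecidableEq ι] : Set (Mx ι) := {g | g ∈ Gl _ ∧ g *ᵥ ev ι = ev ι}

theorem ex_ev (B : Matrix ι ι ℂ) : (ex B : Mx ι) *ᵥ ev ι = ev ι := by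
  rw [col_eq]; funext i; rcases i with i | ⟨⟩ <;> simp [ev]

theorem mul_ev {g h : Mx ι} {v : ι ⊕ Unit → ℂ} (hh : h *ᵥ ev ι = ev ι) (hg : g *ᵥ ev ι = v) :
    (g * h) *ᵥ ev ι = v := by rw [← Matrix.mulVec_mulVec, hh, hg]

theorem inv_ev {g : Mx ι} {v w : ι ⊕ Unit → ℂ} (hg : g ∈ Gl _) (h : g *ᵥ v = w) : g⁻¹ *ᵥ w = v := by
  rw [← h, Matrix.mulVec_mulVec, Gl.inv_mul hg, Matrix.one_mulVec]

theorem ht_fx {h : X → Mx ι} (hl : Lp A (Fx ι) 1 h) :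
    Ht A (Fx ι) 1 h (fun x => ex (h x).toBlocks₁₁) := by
  have ch := hl.cont
  have hb := hl.bd
  have hB : ∀ x, (h x).toBlocks₁₁ ∈ Gl ι := fun x => fix_mem (hl.mem x).2 (hl.mem x).1
  refine (Ht.mk (fun (s : I) x => Matrix.fromBlocks (h x).toBlocks₁₁ 0
    (((1 - (s:ℝ) : ℝ) : ℂ) • (h x).toBlocks₂₁) 1) ?_ ?_ ?_).congr ?_ ?_
  · have c2 : Continuous fun x => (h x).toBlocks₂₁ :=
      continuous_matrix fun i j => by simp only [Matrix.toBlocks₂₁, Matrix.of_apply]; fun_prop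
    refine Continuous.matrix_fromBlocks (cont_blk.comp (ch.comp continuous_snd)) continuous_const ?_
      continuous_const
    exact Continuous.smul (Complex.continuous_ofReal.comp
      (continuous_const.sub (continuous_subtype_val.comp continuous_fst))) (c2.comp continuous_snd)
  · intro s x
    refine ⟨?_, ?_⟩
    · rw [mem_GL, Matrix.det_fromBlocks_zero₁₂]
      have := hB x; rw [mem_GL] at this; simpa using this
    · rw [col_eq]; funext i; rcases i with i | ⟨⟩ <;> simp [ev]
  · intro s x hx
    simp only [hb x hx]
    rw [blk_one]
    have : (1 : Mx ι).toBlocks₂₁ = 0 := by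
      rw [← Matrix.fromBlocks_one, Matrix.toBlocks_fromBlocks₂₁]
    rw [this, smul_zero, Matrix.fromBlocks_one]
  · intro x
    simpa using fix_eq (hl.mem x).2
  · intro x
    simp

/-- The relation defining the connecting map. -/
structure CR {k : ℕ} (b : Q (k+1) → (ι ⊕ Unit → ℂ)) (u : I × Q k → Mx ι) : Prop where
  cont : Continuous u
  mem : ∀ p, u p ∈ Gl _
  zero : ∀ x, u (0, x) = 1
  bd : ∀ t, ∀ x ∈ bdQ k, u (t, x) = 1
  ev : ∀ t x, u (t, x) *ᵥ ev ι = b (Fin.cons t x)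

theorem cons_bd {k : ℕ} {b : Q (k+1) → (ι ⊕ Unit → ℂ)} (hb : Lp (bdQ (k+1)) (nz _) (ev ι) b)
    {t : I} {x : Q k} (h : (t, x) ∈ sus (bdQ k)) : b (Fin.cons t x) = ev ι :=
  hb.bd _ ((cons_mem_bdQ t x).2 h)

theorem CR.one {k : ℕ} {b : Q (k+1) → (ι ⊕ Unit → ℂ)} (hb : Lp (bdQ (k+1)) (nz _) (PU.ev ι) b)
    {u : I × Q k → Mx ι} (h : CR b u) : Lp (bdQ k) (Fx ι) 1 (fun x => u (1, x)) := by
  have := h.cont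
  exact ⟨by fun_prop, fun x => ⟨h.mem _, by rw [h.ev, cons_bd hb (Or.inr (Or.inl rfl))]⟩,
    fun x hx => h.bd _ _ hx⟩

theorem Lp.blk {h : X → Mx ι} (hl : Lp A (Fx ι) 1 h) :
    Lp A (Gl ι) 1 (fun x => (h x).toBlocks₁₁) :=
  hl.map cont_blk.continuousOn (fun x hx => fix_mem hx.2 hx.1) blk_one

theorem Ht.blk {h h' : X → Mx ι} (hl : Ht A (Fx ι) 1 h h') :
    Ht A (Gl ι) 1 (fun x => (h x).toBlocks₁₁) (fun x => (h' x).toBlocks₁₁) :=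
  hl.map cont_blk.continuousOn (fun x hx => fix_mem hx.2 hx.1) blk_one

theorem CR.uniq {k : ℕ} {b : Q (k+1) → (ι ⊕ Unit → ℂ)} (hb : Lp (bdQ (k+1)) (nz _) (PU.ev ι) b)
    {u w : I × Q k → Mx ι} (h : CR b u) (h' : CR b w) :
    Ht (bdQ k) (Fx ι) 1 (fun x => u (1, x)) (fun x => w (1, x)) := by
  have c1 := h.cont
  have c2 := h'.cont
  have c3 := cont_inv h.cont h.mem
  refine (Ht.mk (A := bdQ k) (S := Fx ι) (e := 1)
    (fun s x => u (1, x) * ((u (s, x))⁻¹ * w (s, x))) ?_ ?_ ?_).congr ?_ ?_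
  · exact Continuous.matrix_mul (by fun_prop) (Continuous.matrix_mul c3 c2)
  · intro s x
    refine ⟨Gl.mul (h.mem _) (Gl.mul (Gl.inv (h.mem _)) (h'.mem _)), ?_⟩
    refine mul_ev ?_ ((h.one hb).mem x).2
    rw [← Matrix.mulVec_mulVec, h'.ev]
    exact inv_ev (h.mem _) (h.ev _ _)
  · intro s x hx
    simp [h.bd _ x hx, h'.bd _ x hx]
  · intro x; simp [h.zero, h'.zero]
  · intro x
    rw [← Matrix.mul_assoc, Gl.mul_inv (h.mem _), Matrix.one_mul]

theorem cont_cons {k : ℕ} {f : X → I} {g : X → Q k} (hf : Continuous f) (hg : Continuous g) :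
    Continuous fun x => (Fin.cons (f x) (g x) : Q (k+1)) := continuous_consQ.comp (hf.prodMk hg)

theorem CR.tot {k : ℕ} {b : Q (k+1) → (ι ⊕ Unit → ℂ)} (hb : Lp (bdQ (k+1)) (nz _) (PU.ev ι) b) :
    ∃ u, CR b u := by
  obtain ⟨u, h1, h2, h3, h4, h5⟩ := transport_vec (K := Q k) (fun p => b (Fin.cons p.2 p.1))
    (hb.cont.comp (cont_cons continuous_snd continuous_fst)) (fun p => hb.mem _)
  refine ⟨fun p => u (p.2, p.1), by fun_prop, fun p => h3 _, fun x => h2 _, fun t x hx => ?_,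
    fun t x => ?_⟩
  · exact h5 x (fun t => by rw [cons_bd hb (Or.inr (Or.inr hx)), cons_bd hb (Or.inr (Or.inr hx))]) t
  · rw [← h4, cons_bd hb (Or.inl rfl)]

theorem CR.hfun {k : ℕ} {b b' : Q (k+1) → (ι ⊕ Unit → ℂ)} (hb : Ht (bdQ (k+1)) (nz _) (PU.ev ι) b b')
    {u w : I × Q k → Mx ι} (h : CR b u) (h' : CR b' w) :
    Ht (bdQ k) (Fx ι) 1 (fun x => u (1, x)) (fun x => w (1, x)) := by
  have l1 := hb.lp_left
  have l2 := hb.lp_right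
  obtain ⟨H, a1, a2, a3, a4, a5⟩ := hb
  have hbd : ∀ s t (x : Q k), (t, x) ∈ sus (bdQ k) → H (s, Fin.cons t x) = PU.ev ι :=
    fun s t x h => a5 s _ ((cons_mem_bdQ t x).2 h)
  obtain ⟨v, h1, h2, h3, h4, h5⟩ := transport_vec (K := I × Q k)
    (fun p => H (p.1.1, Fin.cons p.2 p.1.2))
    (a1.comp ((by fun_prop : Continuous fun p : (I × Q k) × I => p.1.1).prodMk
      (cont_cons continuous_snd (by fun_prop)))) (fun p => a2 _)
  have hv : ∀ s t (x : Q k), v ((s, x), t) *ᵥ PU.ev ι = H (s, Fin.cons t x) := by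
    intro s t x
    have := h4 (s, x) t
    simp only [hbd _ _ _ (Or.inl rfl)] at this
    exact this
  have hvb : ∀ s t, ∀ x ∈ bdQ k, v ((s, x), t) = 1 := fun s t x hx =>
    h5 (s, x) (fun t => by
      simp only
      rw [hbd _ _ _ (Or.inr (Or.inr hx)), hbd _ _ _ (Or.inr (Or.inr hx))]) t
  have k0 : CR b (fun p => v ((0, p.2), p.1)) := ⟨by fun_prop, fun p => h3 _, fun x => h2 _,
    fun t x hx => hvb _ _ _ hx, fun t x => by rw [hv, a3]⟩
  have k1 : CR b' (fun p => v ((1, p.2), p.1)) := ⟨by fun_prop, fun p => h3 _, fun x => h2 _,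
    fun t x hx => hvb _ _ _ hx, fun t x => by rw [hv, a4]⟩
  refine (h.uniq l1 k0).trans (Ht.trans ?_ (k1.uniq l2 h'))
  exact Ht.mk (fun s x => v ((s, x), 1)) (by fun_prop)
    (fun s x => ⟨h3 _, by rw [hv, hbd _ _ _ (Or.inr (Or.inl rfl))]⟩) (fun s x hx => hvb _ _ _ hx)

theorem tr_comp {E E' : Type*} [TopologicalSpace E] [TopologicalSpace E'] {k : ℕ} (φ : E → E')
    (i : Fin k) (f g : Q k → E) (x : Q k) :
    φ (tr i f g x) = tr i (fun x => φ (f x)) (fun x => φ (g x)) x := by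
  simp only [tr]; split_ifs <;> rfl

theorem tr_cons {E : Type*} [TopologicalSpace E] {k : ℕ} (i : Fin k) (f g : Q (k+1) → E)
    (t : I) (x : Q k) : tr i.succ f g (Fin.cons t x) =
      tr i (fun x => f (Fin.cons t x)) (fun x => g (Fin.cons t x)) x := by
  simp only [tr, Fin.cons_succ, Fin.cons_update]

theorem CR.tr {k : ℕ} {b b' : Q (k+1) → (ι ⊕ Unit → ℂ)} (i : Fin k)
    {u w : I × Q k → Mx ι} (h : CR b u) (h' : CR b' w) :
    CR (tr i.succ b b') (fun p => tr i (fun x => u (p.1, x)) (fun x => w (p.1, x)) p.2) := by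
  have c1 := h.cont
  have c2 := h'.cont
  let P : ℝ → I := Set.projIcc (0:ℝ) 1 zero_le_one
  have cP : Continuous P := continuous_projIcc
  have hz : ∀ x : Q k, ∀ t : I, t = 0 ∨ t = 1 → Function.update x i t ∈ bdQ k := by
    intro x t ht
    exact ⟨i, by simpa using ht⟩
  refine ⟨?_, ?_, ?_, ?_, ?_⟩
  · refine Continuous.if_le (f' := fun p : I × Q k => u (p.1, Function.update p.2 i (P (2 * p.2 i))))
      (g' := fun p => w (p.1, Function.update p.2 i (P (2 * p.2 i - 1))))
      (f := fun p => ((p.2 i : I) : ℝ)) (g := fun _ => 1 / 2) (by fun_prop) (by fun_prop)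
      (by fun_prop) (by fun_prop) ?_
    intro p hp
    rw [h.bd, h'.bd]
    · apply hz; left; rw [hp]; norm_num [P]
    · apply hz; right; rw [hp]; norm_num [P]
  · rintro ⟨t, x⟩
    simp only [PU.tr]; split_ifs
    · exact h.mem _
    · exact h'.mem _
  · intro x
    simp only [PU.tr]; split_ifs
    · exact h.zero _
    · exact h'.zero _
  · intro t x hx
    exact ((Lp.mk (S := Gl _) (by fun_prop) (fun x => h.mem _) (fun x hx => h.bd t x hx)).tr
      (f := fun x => u (t, x)) (g := fun x => w (t, x)) 
      (Lp.mk (S := Gl _) (by fun_prop) (fun x => h'.mem _) (fun x hx => h'.bd t x hx)) Gl.one i).bd x hx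
  · intro t x
    rw [tr_cons]
    simp only [← h.ev, ← h'.ev]
    exact tr_comp (fun m : Mx ι => m *ᵥ PU.ev ι) i _ _ x

theorem CR.kernel {k : ℕ} {b : Q (k+1) → (ι ⊕ Unit → ℂ)} (hb : Lp (bdQ (k+1)) (nz _) (PU.ev ι) b)
    {u : I × Q k → Mx ι} (h : CR b u)
    (hn : Ht (bdQ k) (Gl ι) 1 (fun x => (u (1, x)).toBlocks₁₁) (fun _ => 1)) :
    ∃ g, Lp (bdQ (k+1)) (Gl (ι ⊕ Unit)) 1 g ∧ ∀ x, g x *ᵥ PU.ev ι = b x := by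
  have e1 := ht_fx (h.one hb)
  have e2 : Ht (bdQ k) (Fx ι) 1 (fun x => PU.ex (u (1, x)).toBlocks₁₁) (fun _ => PU.ex 1) :=
    hn.map (φ := fun m => (PU.ex m : Mx ι)) cont_ex.continuousOn
      (S' := Fx ι) (fun m hm => And.intro (ex_mem.2 hm) (ex_ev m)) ex_one
  obtain ⟨N, n1, n2, n3, n4, n5⟩ := e1.trans e2
  have c1 := h.cont
  have c3 := cont_inv n1 (fun p => (n2 p).1)
  let g : I × Q k → Mx ι := fun p => u p * (N (σ p.1, p.2))⁻¹
  have cg : Continuous g := c1.matrix_mul (c3.comp (by fun_prop : Continuous fun p : I × Q k => (σ p.1, p.2)))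
  refine ⟨fun x => g (x 0, Fin.tail x), ?_, ?_⟩
  · rw [lp_cons]
    simp only [Fin.cons_zero, Fin.tail_cons]
    refine ⟨cg, fun p => Gl.mul (h.mem _) (Gl.inv (n2 _).1), ?_⟩
    rintro ⟨t, x⟩ (h0 | h0 | h0)
    · simp only at h0; subst h0
      simp [g, h.zero, n4, ex_one]
    · simp only at h0; subst h0
      simp only [g, unitInterval.symm_one, n3]
      exact Gl.mul_inv (h.mem _)
    · simp [g, h.bd t x h0, n5 _ x h0]
  · intro x
    refine mul_ev (inv_ev (n2 _).1 (n2 _).2) ?_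
    rw [h.ev, Fin.cons_self_tail]

theorem CR.of_loop {k : ℕ} {g : Q (k+1) → Mx ι} (hg : Lp (bdQ (k+1)) (Gl _) 1 g) :
    CR (fun x => g x *ᵥ PU.ev ι) (fun p => g (Fin.cons p.1 p.2)) :=
  ⟨hg.cont.comp continuous_consQ, fun p => hg.mem _,
    fun x => hg.bd _ ((cons_mem_bdQ _ _).2 (Or.inl rfl)),
    fun t x hx => hg.bd _ ((cons_mem_bdQ _ _).2 (Or.inr (Or.inr hx))), fun t x => rfl⟩

theorem lp_ev {k : ℕ} {g : Q k → Mx ι} (hg : Lp (bdQ k) (Gl _) 1 g) :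
    Lp (bdQ k) (nz _) (ev ι) (fun x => g x *ᵥ ev ι) :=
  hg.map (φ := fun m : Mx ι => m *ᵥ ev ι)
    (Continuous.continuousOn (continuous_id.matrix_mulVec continuous_const))
    (fun m hm => mulVec_ne hm ev_ne) (Matrix.one_mulVec _)

theorem ht_ev {k : ℕ} {g g' : Q k → Mx ι} (hg : Ht (bdQ k) (Gl _) 1 g g') :
    Ht (bdQ k) (nz _) (ev ι) (fun x => g x *ᵥ ev ι) (fun x => g' x *ᵥ ev ι) :=
  hg.map (φ := fun m : Mx ι => m *ᵥ ev ι)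
    (Continuous.continuousOn (continuous_id.matrix_mulVec continuous_const))
    (fun m hm => mulVec_ne hm ev_ne) (Matrix.one_mulVec _)

/-- The connecting homomorphism. -/
theorem exists_conn (ι : Type) [Fintype ι] [DecidableEq ι] (k : ℕ) :
    ∃ h : Pg (k+2) (ev_ne (ι := ι)) →* Pg (k+1) (Gl.one (ι := ι)),
      (∀ x, h x = 1 ↔ ∃ g, Lp (bdQ (k+2)) (Gl (ι ⊕ Unit)) 1 g ∧
        x = cls ev_ne (fun x => g x *ᵥ ev ι)) ∧
      ((∀ a, Lp (bdQ (k+1)) (Gl ι) 1 a → Ht (bdQ (k+1)) (Gl (ι ⊕ Unit)) 1 (fun x => ex (a x)) (fun _ => 1))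
        → Function.Surjective h) := by
  obtain ⟨h, hh⟩ := exists_hom (k := k+1) (l := k) (ev_ne (ι := ι)) (Gl.one (ι := ι))
    (fun b a => ∃ u, CR b u ∧ a = fun x => (u (1, x)).toBlocks₁₁) (Fin.succ 0) 0
    (by rintro f a hf ⟨u, hu, rfl⟩; exact (hu.one hf).blk)
    (by
      intro f hf
      obtain ⟨u, hu⟩ := CR.tot hf
      exact ⟨_, u, hu, rfl⟩)
    (by
      rintro f g a b hfg ⟨u, hu, rfl⟩ ⟨w, hw, rfl⟩
      exact (CR.hfun hfg hu hw).blk)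
    (by
      rintro f g a b hf hg ⟨u, hu, rfl⟩ ⟨w, hw, rfl⟩
      refine ⟨_, hu.tr 0 hw, ?_⟩
      funext x
      exact (tr_comp (fun m : Mx ι => m.toBlocks₁₁) 0 _ _ x).symm)
  refine ⟨h, fun x => ⟨fun hx => ?_, ?_⟩, fun hs y => ?_⟩
  · obtain ⟨b, hb, rfl⟩ := exists_cls x
    obtain ⟨u, hu⟩ := CR.tot hb
    rw [hh b _ hb ⟨u, hu, rfl⟩, cls_eq_one (hu.one hb).blk] at hx
    obtain ⟨g, hg, hgb⟩ := hu.kernel hb hx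
    exact ⟨g, hg, by rw [funext hgb]⟩
  · rintro ⟨g, hg, rfl⟩
    rw [hh _ (fun _ => 1) (lp_ev hg) ⟨_, CR.of_loop hg, ?_⟩, cls_one]
    funext x
    rw [hg.bd _ ((cons_mem_bdQ _ _).2 (Or.inr (Or.inl rfl))), blk_one]
  · obtain ⟨a, ha, rfl⟩ := exists_cls y
    obtain ⟨H, h1, h2, h3, h4, h5⟩ := hs a ha
    let u : I × Q (k+1) → Mx ι := fun p => H (σ p.1, p.2)
    let b : Q (k+2) → (ι ⊕ Unit → ℂ) := fun x => u (x 0, Fin.tail x) *ᵥ ev ι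
    have cu : Continuous u := by fun_prop
    have hu : CR b u := ⟨cu, fun p => h2 _, fun x => by simp [u, h4], fun t x hx => h5 _ x hx,
      fun t x => by simp [b]⟩
    have hb : Lp (bdQ (k+2)) (nz _) (ev ι) b := by
      rw [lp_cons]
      simp only [b, Fin.cons_zero, Fin.tail_cons]
      refine ⟨cu.matrix_mulVec continuous_const, fun p => mulVec_ne (h2 _) ev_ne, ?_⟩
      rintro ⟨t, x⟩ (h0 | h0 | h0)
      · simp only at h0; subst h0
        rw [hu.zero, Matrix.one_mulVec]
      · simp only at h0; subst h0
        simp only [u, unitInterval.symm_one, h3, ex_ev]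
      · rw [hu.bd t x h0, Matrix.one_mulVec]
    refine ⟨cls ev_ne b, ?_⟩
    rw [hh b a hb ⟨u, hu, ?_⟩]
    funext x
    simp only [u, unitInterval.symm_one, h3]
    simp

end conn
end PU
end part10

section part11
open scoped unitInterval Topology Matrix
set_option linter.unusedVariables false
set_option linter.unusedSimpArgs false
set_option linter.unusedSectionVars false
namespace PU

section fam
variable {ι κ : Type} [Fintype ι] [DecidableEq ι] [Fintype κ] [DecidableEq κ]
variable {Y : Type} [TopologicalSpace Y] {B : Set Y} {y0 : Y}

/-- Periodic families of invertible matrices, constant on `B`. -/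
structure Fam (B : Set Y) (y0 : Y) (T : I × Y → Matrix ι ι ℂ) : Prop where
  cont : Continuous T
  mem : ∀ p, T p ∈ Gl ι
  per : ∀ y, T (0, y) = T (1, y)
  bd : ∀ t, ∀ y ∈ B, T (t, y) = T (t, y0)

/-- The normalized loop of a family. -/
noncomputable def Ph (y0 : Y) (T : I × Y → Matrix ι ι ℂ) : I × Y → Matrix ι ι ℂ := fun p =>
  T (0, y0) * (T (0, p.2))⁻¹ * T p * (T (p.1, y0))⁻¹

theorem Fam.lp {T : I × Y → Matrix ι ι ℂ} (h : Fam B y0 T) : Lp (sus B) (Gl ι) 1 (Ph y0 T) := by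
  have c1 := h.cont
  have c2 := cont_inv h.cont h.mem
  refine ⟨?_, ?_, ?_⟩
  · unfold Ph
    exact ((continuous_const.matrix_mul (c2.comp (by fun_prop : Continuous fun p : I × Y => ((0 : I), p.2)))).matrix_mul
      c1).matrix_mul (c2.comp (by fun_prop : Continuous fun p : I × Y => (p.1, y0)))
  · intro p
    exact Gl.mul (Gl.mul (Gl.mul (h.mem _) (Gl.inv (h.mem _))) (h.mem _)) (Gl.inv (h.mem _))
  · rintro ⟨t, y⟩ (h0 | h0 | h0)
    · simp only at h0; subst h0
      simp only [Ph]
      rw [Matrix.mul_assoc (T (0, y0)), Gl.inv_mul (h.mem _), Matrix.mul_one, Gl.mul_inv (h.mem _)]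
    · simp only at h0; subst h0
      simp only [Ph, ← h.per]
      rw [Matrix.mul_assoc (T (0, y0)), Gl.inv_mul (h.mem _), Matrix.mul_one, Gl.mul_inv (h.mem _)]
    · simp only at h0
      simp only [Ph, h.bd _ y h0]
      rw [Gl.mul_inv (h.mem _), Matrix.one_mul, Gl.mul_inv (h.mem _)]

theorem Fam.ht {H : I → I × Y → Matrix ι ι ℂ} (hc : Continuous fun p : I × (I × Y) => H p.1 p.2)
    (h : ∀ s, Fam B y0 (H s)) : Ht (sus B) (Gl ι) 1 (Ph y0 (H 0)) (Ph y0 (H 1)) := by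
  have c2 := cont_inv hc (fun p => (h p.1).mem p.2)
  refine Ht.mk (fun s => Ph y0 (H s)) ?_ (fun s => (h s).lp.mem) (fun s => (h s).lp.bd)
  unfold Ph
  refine (Continuous.matrix_mul (Continuous.matrix_mul ?_ ?_) hc).matrix_mul ?_
  · exact hc.comp (by fun_prop : Continuous fun p : I × (I × Y) => (p.1, ((0 : I), y0)))
  · exact c2.comp (by fun_prop : Continuous fun p : I × (I × Y) => (p.1, ((0 : I), p.2.2)))
  · exact c2.comp (by fun_prop : Continuous fun p : I × (I × Y) => (p.1, (p.2.1, y0)))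

/-- Conjugating a loop by a constant matrix. -/
theorem ht_conj {X : Type*} [TopologicalSpace X] {A : Set X} {g : X → Matrix ι ι ℂ}
    (hg : Lp A (Gl ι) 1 g) {L : Matrix ι ι ℂ} (hL : L ∈ Gl ι) :
    Ht A (Gl ι) 1 g (fun x => L * g x * L⁻¹) := by
  obtain ⟨p, h1, h2, h3, h4⟩ := Gl.path hL
  have c := hg.cont
  have c2 := cont_inv h1 h2
  refine Ht.symm ((Ht.mk (A := A) (S := Gl ι) (e := 1) (fun s x => p s * g x * (p s)⁻¹) ?_ ?_ ?_).congr ?_ ?_)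
  · exact ((h1.comp continuous_fst).matrix_mul (c.comp continuous_snd)).matrix_mul
      (c2.comp continuous_fst)
  · exact fun s x => Gl.mul (Gl.mul (h2 s) (hg.mem x)) (Gl.inv (h2 s))
  · intro s x hx
    rw [hg.bd x hx, Matrix.mul_one, Gl.mul_inv (h2 s)]
  · intro x; rw [h3]
  · intro x; simp [h4]

theorem Fam.left {T : I × Y → Matrix ι ι ℂ} (h : Fam B y0 T) {L : Y → Matrix ι ι ℂ}
    (hL : Continuous L) (hm : ∀ y, L y ∈ Gl ι) (hb : ∀ y ∈ B, L y = L y0) :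
    Fam B y0 (fun p => L p.2 * T p) ∧
      SEq (sus B) (Ph y0 T) (Ph y0 (fun p => L p.2 * T p)) := by
  have c1 := h.cont
  have hf : Fam B y0 (fun p => L p.2 * T p) := ⟨by fun_prop, fun p => Gl.mul (hm _) (h.mem _),
    fun y => by simp only [h.per], fun t y hy => by simp only [h.bd t y hy, hb y hy]⟩
  refine ⟨hf, ((ht_conj h.lp (hm y0)).congr (fun _ => rfl) (fun p => ?_)).seq⟩
  simp only [Ph, Matrix.mul_inv_rev]
  calc _ = L y0 * T (0, y0) * (T (0, p.2))⁻¹ * ((L p.2)⁻¹ * L p.2) * T p * (T (p.1, y0))⁻¹ * (L y0)⁻¹ := by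
        simp only [Matrix.mul_assoc]
    _ = _ := by rw [Gl.inv_mul (hm _)]; simp only [Matrix.mul_assoc, Matrix.one_mul]

theorem ph_right {T : I × Y → Matrix ι ι ℂ} {R : I → Matrix ι ι ℂ} (hR : ∀ t, R t ∈ Gl ι) :
    Ph y0 (fun p => T p * R p.1) = Ph y0 T := by
  funext p
  simp only [Ph, Matrix.mul_inv_rev]
  calc _ = T (0, y0) * (R 0 * (R 0)⁻¹) * (T (0, p.2))⁻¹ * T p * (R p.1 * (R p.1)⁻¹) * (T (p.1, y0))⁻¹ := by
        simp only [Matrix.mul_assoc]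
    _ = _ := by rw [Gl.mul_inv (hR _), Gl.mul_inv (hR _)]; simp only [Matrix.mul_assoc, Matrix.one_mul]

theorem Fam.right {T : I × Y → Matrix ι ι ℂ} (h : Fam B y0 T) {R : I → Matrix ι ι ℂ}
    (hR : ∀ t, R t ∈ Gl ι) (hc : Continuous R) (h01 : R 0 = R 1) :
    Fam B y0 (fun p => T p * R p.1) := by
  have := h.cont
  exact ⟨by fun_prop, fun p => Gl.mul (h.mem _) (hR _), fun y => by simp only [h.per, h01],
    fun t y hy => by simp only [h.bd t y hy]⟩

theorem Fam.ex {T : I × Y → Matrix ι ι ℂ} (h : Fam B y0 T) :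
    Fam B y0 (fun p => (ex (T p) : Matrix (ι ⊕ κ) (ι ⊕ κ) ℂ)) :=
  ⟨cont_ex.comp h.cont, fun p => ex_mem.2 (h.mem p), fun y => by rw [h.per],
    fun t y hy => by rw [h.bd t y hy]⟩

theorem ex_mul (C D : Matrix ι ι ℂ) : (ex (C * D) : Matrix (ι ⊕ κ) (ι ⊕ κ) ℂ) = ex C * ex D := by
  simp [ex, Matrix.fromBlocks_multiply]

theorem ex_inv {C : Matrix ι ι ℂ} (h : C ∈ Gl ι) : (ex C : Matrix (ι ⊕ κ) (ι ⊕ κ) ℂ)⁻¹ = ex C⁻¹ :=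
  Matrix.inv_eq_right_inv (by rw [← ex_mul, Gl.mul_inv h, ex_one])

theorem seq_ex {X : Type*} [TopologicalSpace X] {A : Set X} {g : X → Matrix ι ι ℂ}
    (hg : Lp A (Gl ι) 1 g) : SEq A g (fun x => (ex (g x) : Matrix (ι ⊕ κ) (ι ⊕ κ) ℂ)) := by
  have := seq_ext hg (p1_i1 (M := ι) (μ := κ))
  simpa only [ext_i1] using this

theorem Fam.seq_ex {T : I × Y → Matrix ι ι ℂ} (h : Fam B y0 T) :
    SEq (sus B) (Ph y0 T) (Ph y0 (fun p => (PU.ex (T p) : Matrix (ι ⊕ κ) (ι ⊕ κ) ℂ))) := by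
  have := PU.seq_ex (κ := κ) h.lp
  convert this using 2 with p
  simp only [Ph, ex_mul, ex_inv (h.mem _)]

theorem lp_fam {g : I × Y → Matrix ι ι ℂ} (hy : y0 ∈ B) (hg : Lp (sus B) (Gl ι) 1 g) :
    Fam B y0 g ∧ Ph y0 g = g := by
  have h0 : ∀ y, g (0, y) = 1 := fun y => hg.bd _ (Or.inl rfl)
  have h1 : ∀ y, g (1, y) = 1 := fun y => hg.bd _ (Or.inr (Or.inl rfl))
  have h2 : ∀ t, ∀ y ∈ B, g (t, y) = 1 := fun t y h => hg.bd _ (Or.inr (Or.inr h))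
  refine ⟨⟨hg.cont, hg.mem, fun y => by rw [h0, h1], fun t y h => by rw [h2 t y h, h2 t y0 hy]⟩, ?_⟩
  funext p
  simp [Ph, h0, h2 _ y0 hy]

/-- The circle variable. -/
noncomputable def zz (t : I) : ℂ := Complex.exp (2 * Real.pi * (t : ℝ) * Complex.I)

theorem cont_zz : Continuous zz := by unfold zz; fun_prop
theorem norm_zz (t : I) : ‖zz t‖ = 1 := by
  have : (2 * Real.pi * (t : ℝ) * Complex.I : ℂ) = ((2 * Real.pi * (t : ℝ) : ℝ) : ℂ) * Complex.I := by
    push_cast; ring1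
  rw [zz, this, Complex.norm_exp_ofReal_mul_I]
theorem zz_ne (t : I) : zz t ≠ 0 := Complex.exp_ne_zero _
theorem zz_zero : zz 0 = 1 := by simp [zz]
theorem zz_one : zz 1 = 1 := by simp [zz]

/-- Polynomial families. -/
def PolyD (B : Set Y) (y0 : Y) : ℕ → (I × Y → Matrix ι ι ℂ) → Prop
  | 0, T => ∃ a : Y → Matrix ι ι ℂ, Continuous a ∧ (∀ y ∈ B, a y = a y0) ∧ ∀ p, T p = a p.2
  | d+1, T => ∃ a : Y → Matrix ι ι ℂ, Continuous a ∧ (∀ y ∈ B, a y = a y0) ∧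
      ∃ q, PolyD B y0 d q ∧ ∀ p, T p = a p.2 + zz p.1 • q p

theorem PolyD.basic {d : ℕ} : ∀ {T : I × Y → Matrix ι ι ℂ}, PolyD B y0 d T →
    Continuous T ∧ (∀ y, T (0, y) = T (1, y)) ∧ ∀ t, ∀ y ∈ B, T (t, y) = T (t, y0) := by
  have := cont_zz
  induction d with
  | zero =>
    rintro T ⟨a, h1, h2, h3⟩
    rw [funext h3]
    exact ⟨by fun_prop, fun _ => rfl, fun t y hy => h2 y hy⟩
  | succ d ih =>
    rintro T ⟨a, h1, h2, q, h3, h4⟩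
    obtain ⟨k1, k2, k3⟩ := ih h3
    rw [funext h4]
    exact ⟨by fun_prop, fun y => by simp only [zz_zero, zz_one, k2],
      fun t y hy => by simp only [k3 t y hy, h2 y hy]⟩

theorem PolyD.block {d : ℕ} : ∀ {T : I × Y → Matrix ι ι ℂ} (C : Matrix ι ι ℂ), PolyD B y0 d T →
    PolyD B y0 d (fun p => (Matrix.fromBlocks 0 (T p) C 0 : Matrix (ι ⊕ ι) (ι ⊕ ι) ℂ)) := by
  induction d with
  | zero =>
    rintro T C ⟨a, h1, h2, h3⟩
    exact ⟨fun y => Matrix.fromBlocks 0 (a y) C 0,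
      continuous_const.matrix_fromBlocks h1 continuous_const continuous_const,
      fun y hy => by simp only [h2 y hy], fun p => by simp only [h3]⟩
  | succ d ih =>
    rintro T C ⟨a, h1, h2, q, h3, h4⟩
    exact ⟨fun y => Matrix.fromBlocks 0 (a y) C 0,
      continuous_const.matrix_fromBlocks h1 continuous_const continuous_const,
      fun y hy => by simp only [h2 y hy], _, ih 0 h3, fun p => by
        simp only []
        rw [h4, Matrix.fromBlocks_smul, Matrix.fromBlocks_add]; simp⟩

theorem linearize (d : ℕ) : ∀ {ι : Type} [Fintype ι] [DecidableEq ι] {T : I × Y → Matrix ι ι ℂ},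
    PolyD B y0 (d+1) T → (∀ p, T p ∈ Gl ι) →
    ∃ (κ : Type) (_ : Fintype κ) (_ : DecidableEq κ) (T' : I × Y → Matrix κ κ ℂ),
      PolyD B y0 1 T' ∧ (∀ p, T' p ∈ Gl κ) ∧ SEq (sus B) (Ph y0 T) (Ph y0 T') := by
  have cz := cont_zz
  induction d with
  | zero =>
    intro ι _ _ T h hm
    obtain ⟨k1, k2, k3⟩ := h.basic
    exact ⟨ι, inferInstance, inferInstance, T, h, hm, (Ht.refl (Fam.lp ⟨k1, hm, k2, k3⟩)).seq⟩
  | succ d ih =>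
    intro ι _ _ T h hm
    obtain ⟨k1, k2, k3⟩ := h.basic
    have hF : Fam B y0 T := ⟨k1, hm, k2, k3⟩
    obtain ⟨a, h1, h2, q, hq, h4⟩ := h
    obtain ⟨j1, j2, j3⟩ := hq.basic
    let H : I → I × Y → Matrix (ι ⊕ ι) (ι ⊕ ι) ℂ := fun s p =>
      Matrix.fromBlocks 1 (((s:ℝ):ℂ) • q p) 0 1 * PU.ex (T p) *
        Matrix.fromBlocks 1 0 (-(((s:ℝ):ℂ) • zz p.1 • (1 : Matrix ι ι ℂ))) 1
    have hH : ∀ s, Fam B y0 (H s) := by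
      intro s
      refine ⟨?_, ?_, ?_, ?_⟩
      · refine Continuous.matrix_mul (Continuous.matrix_mul ?_ (cont_ex.comp k1)) ?_
        · exact continuous_const.matrix_fromBlocks (by fun_prop) continuous_const continuous_const
        · exact continuous_const.matrix_fromBlocks continuous_const (by fun_prop) continuous_const
      · intro p
        refine Gl.mul (Gl.mul ?_ (ex_mem.2 (hm p))) ?_
        · rw [mem_GL, Matrix.det_fromBlocks_zero₂₁]; simp
        · rw [mem_GL, Matrix.det_fromBlocks_zero₁₂]; simp
      · intro y; simp only [H, zz_zero, zz_one, j2, k2]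
      · intro t y hy; simp only [H, j3 t y hy, k3 t y hy]
    have hc : Continuous fun p : I × (I × Y) => H p.1 p.2 := by
      refine Continuous.matrix_mul (Continuous.matrix_mul ?_ (cont_ex.comp (k1.comp continuous_snd))) ?_
      · exact continuous_const.matrix_fromBlocks (by fun_prop) continuous_const continuous_const
      · exact continuous_const.matrix_fromBlocks continuous_const (by fun_prop) continuous_const
    have e1 := (Fam.ht hc hH).seq
    have e0 : H 0 = fun p => PU.ex (T p) := by
      funext p
      simp [H, Matrix.fromBlocks_one]
    have e2 : ∀ p, H 1 p = Matrix.fromBlocks (a p.2) (q p) (-(zz p.1 • (1 : Matrix ι ι ℂ))) 1 := by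
      intro p
      simp only [H, Matrix.fromBlocks_multiply]
      rw [h4]
      simp
    have hp : PolyD B y0 (d+1) (H 1) := by
      obtain ⟨b, b1, b2, q', b3, b4⟩ := hq
      refine ⟨fun y => Matrix.fromBlocks (a y) (b y) 0 1,
        h1.matrix_fromBlocks b1 continuous_const continuous_const,
        fun y hy => by simp only [h2 y hy, b2 y hy], _, b3.block (-1), fun p => ?_⟩
      rw [e2, b4, Matrix.fromBlocks_smul, Matrix.fromBlocks_add]
      simp
    obtain ⟨κ, i1, i2, T', t1, t2, t3⟩ := ih hp (hH 1).mem
    refine ⟨κ, i1, i2, T', t1, t2, SEq.trans (SEq.trans (hF.seq_ex (κ := ι)) ?_) t3⟩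
    rw [e0] at e1
    exact e1

end fam
end PU
end part11

section part12
open scoped unitInterval Topology Matrix
set_option linter.unusedVariables false
set_option linter.unusedSimpArgs false
set_option linter.unusedSectionVars false
namespace PU

section sw
variable {ι : Type} [Fintype ι] [DecidableEq ι]
variable {Y : Type} [MetricSpace Y] [CompactSpace Y] {B : Set Y} {y0 : Y}

noncomputable def evP (y : Y) (z : ℂ) (p : Polynomial C(Y, ℂ)) : ℂ :=
  Polynomial.eval₂ (ContinuousMap.evalStarAlgHom ℂ ℂ y : C(Y, ℂ) →+* ℂ) z p

/-- functions on the circle times `Y` which become polynomial after multiplication with a power -/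
def Good (f : C(Circle × Y, ℂ)) : Prop := ∃ (N : ℕ) (p : Polynomial C(Y, ℂ)),
  ∀ (z : Circle) (y : Y), (z : ℂ) ^ N * f (z, y) = evP y z p

theorem Good.add {f g : C(Circle × Y, ℂ)} (hf : Good f) (hg : Good g) : Good (f + g) := by
  obtain ⟨N, p, hp⟩ := hf
  obtain ⟨M, q, hq⟩ := hg
  refine ⟨N + M, Polynomial.X ^ M * p + Polynomial.X ^ N * q, fun z y => ?_⟩
  have e : evP y z (Polynomial.X ^ M * p + Polynomial.X ^ N * q) = (z:ℂ) ^ M * evP y z p + (z:ℂ) ^ N * evP y z q := by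
    simp [evP, Polynomial.eval₂_mul, Polynomial.eval₂_add, Polynomial.eval₂_pow]
  rw [e, ← hp, ← hq, ContinuousMap.add_apply]; ring1

theorem Good.mul {f g : C(Circle × Y, ℂ)} (hf : Good f) (hg : Good g) : Good (f * g) := by
  obtain ⟨N, p, hp⟩ := hf
  obtain ⟨M, q, hq⟩ := hg
  refine ⟨N + M, p * q, fun z y => ?_⟩
  have e : evP y z (p * q) = evP y z p * evP y z q := by
    simp [evP, Polynomial.eval₂_mul, Polynomial.eval₂_add, Polynomial.eval₂_pow]
  rw [e, ← hp, ← hq, ContinuousMap.mul_apply]; ring1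

theorem Good.pull (c : C(Y, ℂ)) : Good (c.comp ⟨Prod.snd, continuous_snd⟩ : C(Circle × Y, ℂ)) :=
  ⟨0, Polynomial.C c, fun z y => by simp [evP]⟩

noncomputable def zC : C(Circle × Y, ℂ) := ⟨fun p => (p.1 : ℂ), by fun_prop⟩

theorem good_dense : Dense {f : C(Circle × Y, ℂ) | Good f} := by
  set s : Set C(Circle × Y, ℂ) := {zC} ∪ Set.range (fun c : C(Y, ℂ) => c.comp ⟨Prod.snd, continuous_snd⟩) with hs
  have h1 : (StarAlgebra.adjoin ℂ s).SeparatesPoints := by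
    rintro ⟨z, y⟩ ⟨z', y'⟩ hne
    by_cases hy : y = y'
    · subst hy
      refine ⟨_, ⟨zC, StarAlgebra.subset_adjoin ℂ s (Or.inl rfl), rfl⟩, ?_⟩
      intro h
      apply hne
      have : z = z' := by
        simp only [zC, ContinuousMap.coe_mk] at h
        exact Circle.ext h
      rw [this]
    · refine ⟨_, ⟨_, StarAlgebra.subset_adjoin ℂ s (Or.inr ⟨⟨fun x => ((dist y x : ℝ) : ℂ), by fun_prop⟩, rfl⟩), rfl⟩, ?_⟩
      simp only [ContinuousMap.comp_apply, ContinuousMap.coe_mk, dist_self]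
      intro h
      exact hy (dist_eq_zero.1 (Complex.ofReal_injective h).symm)
  have h2 := ContinuousMap.starSubalgebra_topologicalClosure_eq_top_of_separatesPoints _ h1
  have h3 : Dense ((StarAlgebra.adjoin ℂ s : StarSubalgebra ℂ C(Circle × Y, ℂ)) : Set C(Circle × Y, ℂ)) := by
    intro f
    have : f ∈ (StarAlgebra.adjoin ℂ s).topologicalClosure := by rw [h2]; trivial
    exact this
  refine h3.mono ?_
  intro f hf
  have hf' : f ∈ Algebra.adjoin ℂ (s ∪ star s) := hf
  have hg : ∀ f ∈ s, Good f ∧ Good (star f) := by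
    rintro f (rfl | ⟨c, rfl⟩)
    · refine ⟨⟨0, Polynomial.X, fun z y => by simp [evP, zC]⟩, ⟨1, 1, fun z y => ?_⟩⟩
      simp [evP, zC, ContinuousMap.star_apply, Complex.mul_conj]
    · exact ⟨Good.pull c, Good.pull (star c)⟩
  refine Algebra.adjoin_induction (p := fun f _ => Good f) ?_ ?_ ?_ ?_ hf'
  · rintro f (h | h)
    · exact (hg f h).1
    · have := (hg _ h).2; rwa [star_star] at this
  · intro r
    exact ⟨0, Polynomial.C (algebraMap ℂ _ r), fun z y => by simp [evP]⟩
  · intro f g _ _ h h'; exact h.add h'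
  · intro f g _ _ h h'; exact h.mul h'

theorem approx1 {g : I × Y → ℂ} (hg : Continuous g) (hp : ∀ y, g (0, y) = g (1, y)) {ε : ℝ} (hε : 0 < ε) :
    ∃ (N : ℕ) (p : Polynomial C(Y, ℂ)), ∀ t y, ‖zz t ^ N * g (t, y) - evP y (zz t) p‖ < ε := by
  let q : I × Y → Circle × Y := fun p => (Circle.exp (2 * Real.pi * (p.1 : ℝ)), p.2)
  have qc : Continuous q := by fun_prop
  have qe : ∀ p, ((q p).1 : ℂ) = zz p.1 := by
    intro p; simp only [q, Circle.coe_exp, zz]; push_cast; rfl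
  have qs : Function.Surjective q := by
    rintro ⟨z, y⟩
    obtain ⟨t, ht⟩ : ∃ t : I, Circle.exp (2 * Real.pi * (t : ℝ)) = z := by
      obtain ⟨x, rfl⟩ := Circle.exp_surjective z
      have hpi := Real.two_pi_pos
      refine ⟨⟨Int.fract (x / (2 * Real.pi)), Int.fract_nonneg _, (Int.fract_lt_one _).le⟩, ?_⟩
      simp only []
      rw [← Int.self_sub_floor, mul_sub, mul_div_cancel₀ _ hpi.ne', mul_comm (2 * Real.pi), Circle.exp_sub]
      rw [Circle.exp_int_mul_two_pi, div_one]
    exact ⟨(t, y), by simp only [q, ht]⟩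
  have qq : Topology.IsQuotientMap q := qc.isClosedMap.isQuotientMap qc qs
  have hfac : ∀ a b, q a = q b → g a = g b := by
    rintro ⟨a, y⟩ ⟨b, y'⟩ h
    simp only [q, Prod.mk.injEq] at h
    obtain ⟨h1, rfl⟩ := h
    have hpi := Real.two_pi_pos
    obtain ⟨m, hm⟩ := Circle.exp_eq_exp.1 h1
    have hm' : (a : ℝ) = b + m := by
      have : 2 * Real.pi * (a:ℝ) = 2 * Real.pi * (b + m) := by rw [hm]; ring1
      exact mul_left_cancel₀ hpi.ne' this
    have ha := a.2; have hb := b.2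
    have m1 : m ≤ 1 := by
      have : (m : ℝ) ≤ 1 := by linarith [ha.2, hb.1]
      exact_mod_cast this
    have m2 : -1 ≤ m := by
      have : (-1 : ℝ) ≤ m := by linarith [ha.1, hb.2]
      exact_mod_cast this
    have : m = 0 ∨ m = 1 ∨ m = -1 := by omega
    rcases this with rfl | rfl | rfl
    · rw [show a = b from Subtype.ext (by simpa using hm')]
    · push_cast at hm'
      have e1 : a = 1 := Subtype.ext (by simp only [Set.Icc.coe_one]; linarith [ha.2, hb.1])
      have e2 : b = 0 := Subtype.ext (by simp only [Set.Icc.coe_zero]; linarith [ha.2, hb.1])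
      rw [e1, e2, hp]
    · push_cast at hm'
      have e1 : a = 0 := Subtype.ext (by simp only [Set.Icc.coe_zero]; linarith [ha.1, hb.2])
      have e2 : b = 1 := Subtype.ext (by simp only [Set.Icc.coe_one]; linarith [ha.1, hb.2])
      rw [e1, e2, hp]
  obtain ⟨G, hG⟩ : ∃ G : C(Circle × Y, ℂ), ∀ p, G (q p) = g p := by
    choose r hr using qs
    refine ⟨⟨fun z => g (r z), ?_⟩, fun p => hfac _ _ (hr _)⟩
    rw [qq.continuous_iff]
    exact hg.congr fun p => (hfac _ _ (hr _)).symm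
  obtain ⟨f, hf, hd⟩ := good_dense.exists_dist_lt G hε
  obtain ⟨N, p, hN⟩ := hf
  refine ⟨N, p, fun t y => ?_⟩
  have := hN (q (t, y)).1 y
  have e : (q (t,y)) = ((q (t,y)).1, y) := rfl
  rw [qe] at this
  rw [← this, ← hG, e, ← mul_sub, norm_mul, norm_pow, norm_zz, one_pow, one_mul, ← dist_eq_norm]
  exact (ContinuousMap.dist_apply_le_dist _).trans_lt hd

theorem polyD_sum (a : ℕ → Y → Matrix ι ι ℂ) (hc : ∀ k, Continuous (a k)) (hb : ∀ k, ∀ y ∈ B, a k y = a k y0) (d : ℕ) :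
    PolyD B y0 d (fun p => ∑ k ∈ Finset.range (d+1), zz p.1 ^ k • a k p.2) := by
  induction d generalizing a with
  | zero => exact ⟨a 0, hc 0, hb 0, fun p => by simp⟩
  | succ d ih =>
    refine ⟨a 0, hc 0, hb 0, _, ih (fun k => a (k+1)) (fun k => hc _) (fun k => hb _), fun p => ?_⟩
    simp only []
    rw [Finset.sum_range_succ' _ (d+1), Finset.smul_sum, add_comm]
    simp [pow_succ', smul_smul]

theorem approx {g : I × Y → Matrix ι ι ℂ} (hg : Continuous g) (hp : ∀ y, g (0, y) = g (1, y)) {ε : ℝ} (hε : 0 < ε) :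
    ∃ (N : ℕ) (d : ℕ) (a : ℕ → Y → Matrix ι ι ℂ), N < d ∧ (∀ k, Continuous (a k)) ∧
      ∀ t y i j, ‖zz t ^ N * g (t, y) i j - (∑ k ∈ Finset.range d, zz t ^ k • a k y) i j‖ < ε := by
  have h : ∀ i j, ∃ (N : ℕ) (p : Polynomial C(Y, ℂ)), ∀ t y, ‖zz t ^ N * g (t, y) i j - evP y (zz t) p‖ < ε := by
    intro i j
    exact approx1 (g := fun p => g p i j) (by fun_prop) (fun y => by simp only [hp]) hε
  choose N p h using h
  let M := ∑ i, ∑ j, N i j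
  have hM : ∀ i j, N i j ≤ M := fun i j =>
    (Finset.single_le_sum (f := fun j => N i j) (fun _ _ => Nat.zero_le _) (Finset.mem_univ j)).trans
      (Finset.single_le_sum (f := fun i => ∑ j, N i j) (fun _ _ => Nat.zero_le _) (Finset.mem_univ i))
  let p' : ι → ι → Polynomial C(Y, ℂ) := fun i j => Polynomial.X ^ (M - N i j) * p i j
  have h' : ∀ i j t y, ‖zz t ^ M * g (t, y) i j - evP y (zz t) (p' i j)‖ < ε := by
    intro i j t y
    have e : evP y (zz t) (p' i j) = zz t ^ (M - N i j) * evP y (zz t) (p i j) := by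
      simp [evP, p', Polynomial.eval₂_mul, Polynomial.eval₂_pow]
    rw [e, ← Nat.sub_add_cancel (hM i j), pow_add, mul_assoc, Nat.add_sub_cancel, ← mul_sub, norm_mul, norm_pow, norm_zz,
      one_pow, one_mul]
    exact h i j t y
  let D := ∑ i, ∑ j, (p' i j).natDegree
  have hD : ∀ i j, (p' i j).natDegree ≤ D := fun i j =>
    (Finset.single_le_sum (f := fun j => (p' i j).natDegree) (fun _ _ => Nat.zero_le _) (Finset.mem_univ j)).trans
      (Finset.single_le_sum (f := fun i => ∑ j, (p' i j).natDegree) (fun _ _ => Nat.zero_le _) (Finset.mem_univ i))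
  refine ⟨M, M + D + 1, fun k y => Matrix.of fun i j => (p' i j).coeff k y, by omega, fun k => ?_, fun t y i j => ?_⟩
  · exact continuous_matrix fun i j => ((p' i j).coeff k).continuous
  · have := h' i j t y
    rw [evP, Polynomial.eval₂_eq_sum_range' _ (show (p' i j).natDegree < M + D + 1 by have := hD i j; omega)] at this
    rw [Matrix.sum_apply]
    convert this using 4 with k
    simp [mul_comm]

theorem exists_poly {g : I × Y → Matrix ι ι ℂ} (hB : IsClosed B) (hy : y0 ∈ B) (hg : Lp (sus B) (Gl ι) 1 g) :
    ∃ (d : ℕ) (P : I × Y → Matrix ι ι ℂ), PolyD B y0 (d+1) P ∧ (∀ p, P p ∈ Gl ι) ∧ SEq (sus B) g (Ph y0 P) := by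
  obtain ⟨hF, hP⟩ := lp_fam hy hg
  have gc := hg.cont
  have cz := cont_zz
  have g2 : ∀ t, ∀ y ∈ B, g (t, y) = 1 := fun t y h => hg.bd _ (Or.inr (Or.inr h))
  obtain ⟨ε, hε, hU⟩ : ∃ ε > 0, ∀ (p : I × Y) (M : Matrix ι ι ℂ), (∀ i j, ‖g p i j - M i j‖ < ε) → M ∈ Gl ι := by
    let G : I × Y → (ι → ι → ℂ) := g
    have hG : Continuous G := gc
    have hK : IsCompact (Set.range G) := isCompact_range hG
    have hO : IsOpen {M : ι → ι → ℂ | (Matrix.of M).det ≠ 0} := by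
      apply isOpen_ne_fun _ continuous_const
      exact Continuous.matrix_det (continuous_matrix fun i j => (continuous_apply j).comp (continuous_apply i))
    obtain ⟨δ, hδ, hs⟩ := hK.exists_thickening_subset_open hO (by
      rintro _ ⟨p, rfl⟩
      exact (mem_GL).1 (hg.mem p))
    refine ⟨δ, hδ, fun p M hM => ?_⟩
    have : (fun i j => M i j) ∈ Metric.thickening δ (Set.range G) := by
      rw [Metric.mem_thickening_iff]
      refine ⟨G p, ⟨p, rfl⟩, ?_⟩
      rw [dist_comm, dist_pi_lt_iff hδ]
      intro i
      rw [dist_pi_lt_iff hδ]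
      intro j
      rw [dist_eq_norm]
      exact hM i j
    exact mem_GL.2 (hs this)
  obtain ⟨N, d, a, hNd, ac, ha⟩ := approx gc hF.per (half_pos hε)
  let Cs : Set Y := {y | ∃ t, ∃ i j, ε / 2 ≤ ‖g (t, y) i j - (1 : Matrix ι ι ℂ) i j‖}
  have hCs : IsClosed Cs := by
    have : Cs = ⋃ i, ⋃ j, Set.image Prod.snd {p : I × Y | ε / 2 ≤ ‖g p i j - (1 : Matrix ι ι ℂ) i j‖} := by
      ext y
      simp only [Cs, Set.mem_iUnion, Set.mem_image, Set.mem_ofPred_eq, Prod.exists]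
      constructor
      · rintro ⟨t, i, j, h⟩; exact ⟨i, j, t, y, h, rfl⟩
      · rintro ⟨i, j, t, y', h, rfl⟩; exact ⟨t, i, j, h⟩
    rw [this]
    refine isClosed_iUnion_of_finite fun i => isClosed_iUnion_of_finite fun j => ?_
    exact isClosedMap_snd_of_compactSpace _ (isClosed_le (by fun_prop) (by fun_prop))
  have hdis : Disjoint B Cs := by
    rw [Set.disjoint_left]
    rintro y hy ⟨t, i, j, h⟩
    rw [g2 t y hy] at h
    simp at h; linarith
  obtain ⟨ψ, ψ0, ψ1, ψI⟩ := exists_continuous_zero_one_of_isClosed hB hCs hdis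
  let b : ℕ → Y → Matrix ι ι ℂ := fun k y => ((ψ y : ℝ) : ℂ) • a k y + (if k = N then (1 - ((ψ y : ℝ) : ℂ)) • (1 : Matrix ι ι ℂ) else 0)
  have bc : ∀ k, Continuous (b k) := by
    intro k
    have := ac k
    by_cases h : k = N
    · simp only [b, h, if_true]; subst h; fun_prop
    · simp only [b, h, if_false]; fun_prop
  have bB : ∀ k, ∀ y ∈ B, b k y = b k y0 := by
    intro k y h
    have e1 : ψ y = 0 := ψ0 h
    have e2 : ψ y0 = 0 := ψ0 hy
    simp only [b, e1, e2]; simp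
  let P : I × Y → Matrix ι ι ℂ := fun p => ∑ k ∈ Finset.range d, zz p.1 ^ k • b k p.2
  obtain ⟨d', rfl⟩ : ∃ d', d = d' + 1 := ⟨d - 1, by omega⟩
  have hPe : ∀ p, P p = ((ψ p.2 : ℝ) : ℂ) • (∑ k ∈ Finset.range (d'+1), zz p.1 ^ k • a k p.2) +
      (1 - ((ψ p.2 : ℝ) : ℂ)) • zz p.1 ^ N • (1 : Matrix ι ι ℂ) := by
    intro p
    simp only [P, b, smul_add, Finset.sum_add_distrib, Finset.smul_sum]
    congr 1
    · exact Finset.sum_congr rfl fun k _ => smul_comm _ _ _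
    · rw [Finset.sum_eq_single N]
      · rw [if_pos rfl, smul_comm]
      · intro k _ h; rw [if_neg h, smul_zero]
      · intro h; exact absurd (Finset.mem_range.2 hNd) h
  have hPD : PolyD B y0 (d'+1) P := by
    have h1 := polyD_sum (B := B) (y0 := y0) (fun k => if k < d' + 1 then b k else fun _ => 0)
      (fun k => by split_ifs; exacts [bc k, continuous_const]) (fun k => by split_ifs; exacts [bB k, fun _ _ => rfl]) (d'+1)
    convert h1 using 2 with p
    rw [Finset.sum_range_succ _ (d'+1)]
    simp only [P, lt_irrefl, if_false, smul_zero, add_zero]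
    exact Finset.sum_congr rfl fun k hk => by rw [if_pos (Finset.mem_range.1 hk)]
  have hclose : ∀ p i j, ‖zz p.1 ^ N * g p i j - P p i j‖ < ε := by
    rintro ⟨t, y⟩ i j
    have hψ := ψI y
    have h1 := ha t y i j
    have e : zz t ^ N * g (t, y) i j - P (t, y) i j = ((ψ y : ℝ) : ℂ) * (zz t ^ N * g (t, y) i j - (∑ k ∈ Finset.range (d'+1), zz t ^ k • a k y) i j)
        + (1 - ((ψ y : ℝ) : ℂ)) * (zz t ^ N * (g (t, y) i j - (1 : Matrix ι ι ℂ) i j)) := by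
      rw [hPe]
      simp only [Matrix.add_apply, Matrix.smul_apply, smul_eq_mul]
      ring1
    have e1 : ‖((ψ y : ℝ) : ℂ)‖ = ψ y := by rw [Complex.norm_real, Real.norm_of_nonneg hψ.1]
    have e2 : ‖(1 - ((ψ y : ℝ) : ℂ))‖ = 1 - ψ y := by
      rw [← Complex.ofReal_one, ← Complex.ofReal_sub, Complex.norm_real, Real.norm_of_nonneg (by linarith [hψ.2])]
    have h2 : (1 - ψ y) * ‖g (t, y) i j - (1 : Matrix ι ι ℂ) i j‖ ≤ ε / 2 * (1 - ψ y) := by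
      by_cases hC : y ∈ Cs
      · have : ψ y = 1 := ψ1 hC
        rw [this]; simp
      · have : ‖g (t, y) i j - (1 : Matrix ι ι ℂ) i j‖ < ε / 2 := by
          by_contra! h
          exact hC ⟨t, i, j, h⟩
        nlinarith [hψ.2]
    rw [e]
    refine (norm_add_le _ _).trans_lt ?_
    rw [norm_mul, norm_mul, norm_mul, norm_pow, norm_zz, one_pow, one_mul, e1, e2]
    have := mul_le_mul_of_nonneg_left h1.le hψ.1
    linarith
  have hmem : ∀ (s : I) p, (1 - ((s:ℝ):ℂ)) • (g p * zz p.1 ^ N • (1 : Matrix ι ι ℂ)) + ((s:ℝ):ℂ) • P p ∈ Gl ι := by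
    intro s p
    have hz := zz_ne p.1
    have h1 : (zz p.1 ^ N)⁻¹ • ((1 - ((s:ℝ):ℂ)) • (g p * zz p.1 ^ N • (1 : Matrix ι ι ℂ)) + ((s:ℝ):ℂ) • P p) ∈ Gl ι := by
      refine hU p _ fun i j => ?_
      have e : g p i j - ((zz p.1 ^ N)⁻¹ • ((1 - ((s:ℝ):ℂ)) • (g p * zz p.1 ^ N • (1 : Matrix ι ι ℂ)) + ((s:ℝ):ℂ) • P p)) i j
          = (zz p.1 ^ N)⁻¹ * (((s:ℝ):ℂ) * (zz p.1 ^ N * g p i j - P p i j)) := by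
        simp only [Matrix.mul_smul, Matrix.mul_one, Matrix.smul_apply, Matrix.add_apply, smul_eq_mul]
        field_simp
        ring1
      rw [e, norm_mul, norm_inv, norm_pow, norm_zz, norm_mul, one_pow, inv_one, one_mul, Complex.norm_real, Real.norm_of_nonneg s.2.1]
      have := hclose p i j
      have h0 := norm_nonneg (zz p.1 ^ N * g p i j - P p i j)
      nlinarith [s.2.1, s.2.2]
    rw [mem_GL] at h1 ⊢
    intro h0
    apply h1
    rw [Matrix.det_smul, h0, mul_zero]
  obtain ⟨k1, k2, k3⟩ := hPD.basic
  have hR : ∀ t : I, zz t ^ N • (1 : Matrix ι ι ℂ) ∈ Gl ι := by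
    intro t
    rw [mem_GL, Matrix.det_smul, Matrix.det_one, mul_one]
    exact pow_ne_zero _ (pow_ne_zero _ (zz_ne t))
  have hF2 := hF.right (R := fun t => zz t ^ N • (1 : Matrix ι ι ℂ)) hR (by fun_prop) (by simp only [zz_zero, zz_one])
  have hht := Fam.ht (B := B) (y0 := y0) (H := fun s p => (1 - ((s:ℝ):ℂ)) • (g p * zz p.1 ^ N • (1 : Matrix ι ι ℂ)) + ((s:ℝ):ℂ) • P p)
    (by fun_prop) (fun s => ⟨by fun_prop, hmem s, fun y => by simp only [zz_zero, zz_one, k2, hF.per],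
      fun t y h => by simp only [k3 t y h, hF.bd t y h]⟩)
  refine ⟨d', P, hPD, fun p => by simpa using hmem 1 p, (hht.congr ?_ ?_).seq⟩
  · intro p
    have := ph_right (T := g) (y0 := y0) (R := fun t => zz t ^ N • (1 : Matrix ι ι ℂ)) hR
    rw [hP] at this
    refine Eq.trans (congrFun this p).symm ?_
    simp
  · intro p; simp
end sw
end PU
end part12

section part13
open scoped unitInterval Topology Matrix
set_option linter.unusedVariables false
set_option linter.unusedSimpArgs false
set_option linter.unusedSectionVars false
namespace PU

section spectral
variable {ι : Type} [Fintype ι] [DecidableEq ι]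

/-- The integral of a matrix function over the unit interval. -/
noncomputable def mint (f : ℝ → Matrix ι ι ℂ) : Matrix ι ι ℂ := Matrix.of fun i j => ∫ x in (0:ℝ)..1, f x i j

theorem mint_mul_left {f : ℝ → Matrix ι ι ℂ} (hf : Continuous f) (A : Matrix ι ι ℂ) :
    mint (fun x => A * f x) = A * mint f := by
  ext i j
  simp only [mint, Matrix.mul_apply, Matrix.of_apply]
  rw [intervalIntegral.integral_finsetSum]
  · simp only [intervalIntegral.integral_const_mul]
  · intro k _
    exact Continuous.intervalIntegrable (by fun_prop) _ _

theorem mint_mul_right {f : ℝ → Matrix ι ι ℂ} (hf : Continuous f) (A : Matrix ι ι ℂ) :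
    mint (fun x => f x * A) = mint f * A := by
  ext i j
  simp only [mint, Matrix.mul_apply, Matrix.of_apply]
  rw [intervalIntegral.integral_finsetSum]
  · simp only [intervalIntegral.integral_mul_const]
  · intro k _
    exact Continuous.intervalIntegrable (by fun_prop) _ _

theorem mint_add {f g : ℝ → Matrix ι ι ℂ} (hf : Continuous f) (hg : Continuous g) :
    mint (fun x => f x + g x) = mint f + mint g := by
  ext i j
  simp only [mint, Matrix.add_apply, Matrix.of_apply]
  rw [intervalIntegral.integral_add]
  · exact Continuous.intervalIntegrable (by fun_prop) _ _
  · exact Continuous.intervalIntegrable (by fun_prop) _ _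

noncomputable def ee (x : ℝ) : ℂ := (Real.fourierChar x : ℂ)
theorem cont_ee : Continuous ee := by unfold ee; fun_prop
theorem norm_ee (x : ℝ) : ‖ee x‖ = 1 := Circle.norm_coe _
theorem ee_add (x y : ℝ) : ee (x + y) = ee x * ee y := by simp [ee, AddChar.map_add_eq_mul]
theorem ee_eq (x : ℝ) : ee x = Complex.exp (2 * Real.pi * x * Complex.I) := by
  simp [ee, Real.fourierChar_apply]

/-- the resolvent -/
noncomputable def rs (Q : Matrix ι ι ℂ) (x : ℝ) : Matrix ι ι ℂ := (1 - Q + ee x • Q)⁻¹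
/-- its Fourier coefficients -/
noncomputable def cc (Q : Matrix ι ι ℂ) (n : ℤ) : Matrix ι ι ℂ := mint fun x => ee (-(x * n)) • rs Q x

def SpOk (Q : Matrix ι ι ℂ) : Prop := ∀ z : ℂ, ‖z‖ = 1 → 1 - Q + z • Q ∈ Gl ι

variable {Q : Matrix ι ι ℂ}

theorem cont_rs (h : SpOk Q) : Continuous (rs Q) := by
  have := cont_ee
  exact cont_inv (by fun_prop) (fun x => h _ (norm_ee x))

theorem int_ee (n : ℤ) : ∫ x in (0:ℝ)..1, ee (-(x * n)) = if n = 0 then 1 else 0 := by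
  split_ifs with h
  · subst h; simp [ee]
  · have hc : (-(2 * Real.pi * n * Complex.I) : ℂ) ≠ 0 := by
      simp [h, Real.pi_ne_zero, Complex.I_ne_zero]
    have := integral_exp_mul_complex (a := 0) (b := 1) hc
    have e : ∀ x : ℝ, ee (-(x * n)) = Complex.exp (-(2 * Real.pi * n * Complex.I) * x) := by
      intro x; rw [ee_eq]; congr 1; push_cast; ring1
    simp only [e]
    rw [this]
    have e2 : Complex.exp (-(2 * Real.pi * n * Complex.I) * ((1:ℝ):ℂ)) = 1 := by
      rw [Complex.exp_eq_one_iff]; exact ⟨-n, by push_cast; ring1⟩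
    rw [e2]; simp

theorem cc_rel (h : SpOk Q) (n : ℤ) : (1 - Q) * cc Q n + Q * cc Q (n - 1) = if n = 0 then 1 else 0 := by
  have c1 := cont_rs h
  have c2 := cont_ee
  unfold cc
  rw [← mint_mul_left (by fun_prop), ← mint_mul_left (by fun_prop), ← mint_add (by fun_prop) (by fun_prop)]
  have e : ∀ x : ℝ, (1 - Q) * ee (-(x * n)) • rs Q x + Q * ee (-(x * ((n - 1 : ℤ) : ℝ))) • rs Q x = ee (-(x * n)) • (1 : Matrix ι ι ℂ) := by
    intro x
    have e1 : ee (-(x * ((n - 1 : ℤ) : ℝ))) = ee (-(x * n)) * ee x := by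
      rw [← ee_add]; congr 1; push_cast; ring1
    have e2 : (1 - Q + ee x • Q) * rs Q x = 1 := Gl.mul_inv (h _ (norm_ee x))
    rw [e1]
    refine Eq.trans ?_ (congrArg (fun M => ee (-(x * n)) • M) e2)
    simp only [Matrix.mul_smul, Matrix.add_mul, smul_add, Matrix.smul_mul, smul_smul]
  simp only [e]
  ext i j
  simp only [mint, Matrix.of_apply, Matrix.smul_apply, smul_eq_mul, intervalIntegral.integral_mul_const, int_ee]
  split_ifs <;> simp

theorem cc_comm (h : SpOk Q) (n : ℤ) : Q * cc Q n = cc Q n * Q := by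
  have c1 := cont_rs h
  have c2 := cont_ee
  unfold cc
  rw [← mint_mul_left (by fun_prop), ← mint_mul_right (by fun_prop)]
  congr 1
  funext x
  have hx := h _ (norm_ee x)
  rw [Matrix.mul_smul, Matrix.smul_mul]
  congr 1
  have e : Q * (1 - Q + ee x • Q) = (1 - Q + ee x • Q) * Q := by
    simp only [Matrix.mul_add, Matrix.mul_sub, Matrix.add_mul, Matrix.sub_mul, Matrix.mul_one, Matrix.one_mul, Matrix.mul_smul, Matrix.smul_mul]
  calc Q * rs Q x = rs Q x * (1 - Q + ee x • Q) * Q * rs Q x := by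
        rw [rs, Gl.inv_mul hx, Matrix.one_mul]
    _ = rs Q x * (Q * (1 - Q + ee x • Q)) * rs Q x := by rw [e]; simp only [Matrix.mul_assoc]
    _ = rs Q x * Q * ((1 - Q + ee x • Q) * rs Q x) := by simp only [Matrix.mul_assoc]
    _ = _ := by rw [rs, Gl.mul_inv hx, Matrix.mul_one]

theorem cc_zero (h : SpOk Q) (s : ℤ) (u : ℤ) (hs : s ≠ 0) :
    Filter.Tendsto (fun k : ℕ => cc Q (u + s * k)) Filter.atTop (𝓝 0) := by
  refine tendsto_pi_nhds.2 fun i => tendsto_pi_nhds.2 fun j => ?_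
  have h1 := Real.tendsto_integral_exp_smul_cocompact ((Set.Ioc (0:ℝ) 1).indicator fun x => rs Q x i j)
  have h2 : Filter.Tendsto (fun k : ℕ => ((u + s * k : ℤ) : ℝ)) Filter.atTop (Filter.cocompact ℝ) := by
    have a1 : Filter.Tendsto (fun k : ℕ => (u + s * k : ℤ)) Filter.cofinite Filter.cofinite := by
      apply Function.Injective.tendsto_cofinite
      intro a b hab
      simp only [add_right_inj] at hab
      exact_mod_cast mul_left_cancel₀ hs hab
    rw [← Nat.cofinite_eq_atTop]
    exact Int.tendsto_coe_cofinite.comp a1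
  refine (h1.comp h2).congr fun k => ?_
  simp only [Function.comp, cc, mint, Matrix.of_apply]
  rw [intervalIntegral.integral_of_le zero_le_one, ← MeasureTheory.integral_indicator measurableSet_Ioc]
  congr 1
  funext x
  by_cases hx : x ∈ Set.Ioc (0:ℝ) 1
  · rw [Set.indicator_of_mem hx, Set.indicator_of_mem hx]
    rfl
  · rw [Set.indicator_of_notMem hx, Set.indicator_of_notMem hx, smul_zero]

/-- The spectral projection. -/
noncomputable def spr (Q : Matrix ι ι ℂ) : Matrix ι ι ℂ := Q * cc Q (-1)

theorem spr_compl (h : SpOk Q) : 1 - spr Q = (1 - Q) * cc Q 0 := by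
  have := cc_rel h 0
  rw [if_pos rfl] at this
  exact sub_eq_iff_eq_add.2 this.symm

theorem spr_comm (h : SpOk Q) : Commute Q (spr Q) := by
  have := cc_comm h (-1)
  show Q * (Q * _) = Q * _ * Q
  rw [this, ← Matrix.mul_assoc, this]

theorem spr_idem (h : SpOk Q) : spr Q * spr Q = spr Q := by
  have cm : ∀ n, (1 - Q) * cc Q n = cc Q n * (1 - Q) := by
    intro n; rw [Matrix.sub_mul, Matrix.mul_sub, cc_comm h, Matrix.one_mul, Matrix.mul_one]
  let e : ℕ → Matrix ι ι ℂ := fun n => Q * cc Q (-1 - n) * ((1 - Q) * cc Q n)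
  have he : ∀ n, e (n+1) = e n := by
    intro n
    have r1 := cc_rel h (n+1)
    have r2 := cc_rel h (-1 - n)
    rw [if_neg (by omega)] at r1 r2
    have r1' := eq_neg_of_add_eq_zero_left r1
    have r2' := eq_neg_of_add_eq_zero_right r2
    simp only [e]
    push_cast
    rw [show (-1 - ((n:ℤ) + 1)) = -1 - n - 1 by ring1, r1', r2', show ((n:ℤ) + 1 - 1) = n by ring1]
    rw [Matrix.neg_mul, Matrix.mul_neg, neg_neg]
    have hq : Commute Q (1 - Q) := (Commute.one_right Q).sub_right (Commute.refl Q)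
    rw [cm, Matrix.mul_assoc, ← Matrix.mul_assoc (1 - Q), ← hq.eq, cc_comm h (-1 - n)]
    simp only [Matrix.mul_assoc]
  have he0 : ∀ n, e n = e 0 := by
    intro n; induction n with
    | zero => rfl
    | succ n ih => rw [he, ih]
  have hl : Filter.Tendsto e Filter.atTop (𝓝 (Q * 0 * ((1 - Q) * 0))) := by
    have a1 := cc_zero h (-1) (-1) (by norm_num)
    have a2 := cc_zero h 1 0 (by norm_num)
    refine Filter.Tendsto.congr (f₁ := fun n : ℕ => Q * cc Q (-1 + -1 * n) * ((1 - Q) * cc Q (0 + 1 * n))) (fun n => ?_) ?_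
    · simp only [e]; congr 3; · congr 1; ring1
      · ring1
    · exact (a1.const_mul Q).mul (a2.const_mul (1 - Q))
  have h0 : e 0 = 0 := by
    have : Filter.Tendsto e Filter.atTop (𝓝 (e 0)) := tendsto_const_nhds.congr fun n => (he0 n).symm
    have := tendsto_nhds_unique this hl
    simpa using this
  have : spr Q * (1 - spr Q) = 0 := by
    rw [spr_compl h, spr]
    simpa [e] using h0
  rw [Matrix.mul_sub, Matrix.mul_one, sub_eq_zero] at this
  exact this.symm

theorem spr_path (h : SpOk Q) {z : ℂ} (hz : ‖z‖ = 1) {t : ℝ} (ht : t ∈ I) :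
    (z • Q + (t : ℂ) • (1 - Q)) * spr Q + ((t * z : ℂ) • Q + (1 - Q)) * (1 - spr Q) ∈ Gl ι := by
  have hz0 : z ≠ 0 := by rintro rfl; simp at hz
  have cm : ∀ n, (1 - Q) * cc Q n = cc Q n * (1 - Q) := by
    intro n; rw [Matrix.sub_mul, Matrix.mul_sub, cc_comm h, Matrix.one_mul, Matrix.mul_one]
  have hP := spr_idem h
  have hPP : spr Q * (1 - spr Q) = 0 := by rw [Matrix.mul_sub, Matrix.mul_one, hP, sub_self]
  have hPP' : (1 - spr Q) * spr Q = 0 := by rw [Matrix.sub_mul, Matrix.one_mul, hP, sub_self]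
  have hP1 : (1 - spr Q) * (1 - spr Q) = 1 - spr Q := by rw [Matrix.mul_sub, hPP', Matrix.mul_one, sub_zero]
  have hc : Commute (spr Q) Q := (spr_comm h).symm
  have hc1 : Commute (spr Q) (1 - Q) := (Commute.one_right _).sub_right hc
  have hA : Commute (spr Q) (z • Q + (t : ℂ) • (1 - Q)) := (hc.smul_right _).add_right (hc1.smul_right _)
  have hB : Commute (1 - spr Q) ((t * z : ℂ) • Q + (1 - Q)) :=
    (((Commute.one_left _).sub_left hc).smul_right _).add_right ((Commute.one_left _).sub_left hc1)
  have hA' : Commute (1 - spr Q) (z • Q + (t : ℂ) • (1 - Q)) := (Commute.one_left _).sub_left hA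
  have hB' : Commute (spr Q) ((t * z : ℂ) • Q + (1 - Q)) := (hc.smul_right _).add_right hc1
  rw [mem_GL]
  intro hdet
  obtain ⟨v, hv0, hv⟩ := Matrix.exists_mulVec_eq_zero_iff.2 hdet
  have k1 : (z • Q + (t : ℂ) • (1 - Q)) *ᵥ (spr Q *ᵥ v) = 0 := by
    have := congrArg (fun w => spr Q *ᵥ w) hv
    simp only [Matrix.mulVec_mulVec, Matrix.mulVec_zero] at this ⊢
    rw [← this, Matrix.mul_add, ← Matrix.mul_assoc, ← Matrix.mul_assoc, hA.eq, hB'.eq, Matrix.mul_assoc, hP, Matrix.mul_assoc, hPP]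
    simp
  have k2 : ((t * z : ℂ) • Q + (1 - Q)) *ᵥ ((1 - spr Q) *ᵥ v) = 0 := by
    have := congrArg (fun w => (1 - spr Q) *ᵥ w) hv
    simp only [Matrix.mulVec_mulVec, Matrix.mulVec_zero] at this ⊢
    rw [← this, Matrix.mul_add, ← Matrix.mul_assoc, ← Matrix.mul_assoc, hA'.eq, hB.eq, Matrix.mul_assoc, hPP', Matrix.mul_assoc, hP1]
    simp
  set v1 := spr Q *ᵥ v with hv1
  set v2 := (1 - spr Q) *ᵥ v with hv2
  have s1 : spr Q *ᵥ v1 = v1 := by rw [hv1, Matrix.mulVec_mulVec, hP]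
  have s2 : (1 - spr Q) *ᵥ v2 = v2 := by rw [hv2, Matrix.mulVec_mulVec, hP1]
  -- decay
  have key : ∀ (M : ℕ → Matrix ι ι ℂ) (w : ι → ℂ) (c : ℂ), ‖c‖ ≤ 1 → Filter.Tendsto M Filter.atTop (𝓝 0) →
      M 0 *ᵥ w = w → (∀ n, M n *ᵥ w = c • (M (n+1) *ᵥ w)) → w = 0 := by
    intro M w c hc hM h0 hn
    have hk : ∀ n : ℕ, w = c ^ n • (M n *ᵥ w) := by
      intro n; induction n with
      | zero => simp [h0]
      | succ n ih => rw [pow_succ, mul_smul, ← hn, ← ih]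
    have hl : Filter.Tendsto (fun n => M n *ᵥ w) Filter.atTop (𝓝 0) := by
      have : Continuous fun N : Matrix ι ι ℂ => N *ᵥ w := by fun_prop
      simpa [Function.comp_def] using (this.tendsto 0).comp hM
    have hl2 := hl.norm
    rw [norm_zero] at hl2
    have : ‖w‖ ≤ 0 := by
      refine ge_of_tendsto' hl2 fun n => ?_
      conv_lhs => rw [hk n]
      rw [norm_smul, norm_pow]
      exact mul_le_of_le_one_left (norm_nonneg _) (pow_le_one₀ (norm_nonneg _) hc)
    exact norm_le_zero_iff.1 this
  have nt : ‖(t : ℂ)‖ ≤ 1 := by rw [Complex.norm_real, Real.norm_of_nonneg ht.1]; exact ht.2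
  have z1 : v1 = 0 := by
    refine key (fun n => Q * cc Q (-1 - n)) v1 (z⁻¹ * t) (by rw [norm_mul, norm_inv, hz]; simpa using nt) ?_ ?_ ?_
    · have := (cc_zero h (-1) (-1) (by norm_num)).const_mul Q
      rw [Matrix.mul_zero] at this
      refine this.congr fun n => ?_
      congr 2; ring1
    · simpa [spr] using s1
    · intro n
      have r := cc_rel h (-1 - n)
      rw [if_neg (by omega)] at r
      have r' := eq_neg_of_add_eq_zero_right r
      push_cast
      rw [show (-1 - ((n:ℤ) + 1)) = -1 - n - 1 by ring1, r', cm, cc_comm h]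
      have k1' := eq_neg_of_add_eq_zero_left (show z • (Q *ᵥ v1) + (t:ℂ) • ((1 - Q) *ᵥ v1) = 0 by
        rw [← k1, Matrix.add_mulVec, Matrix.smul_mulVec, Matrix.smul_mulVec])
      rw [Matrix.neg_mulVec, ← Matrix.mulVec_mulVec, ← Matrix.mulVec_mulVec, mul_smul, smul_neg, ← Matrix.mulVec_smul _ (t:ℂ), ← Matrix.mulVec_neg, ← k1',
        Matrix.mulVec_smul, smul_smul, inv_mul_cancel₀ hz0, one_smul]
  have z2 : v2 = 0 := by
    refine key (fun n => (1 - Q) * cc Q n) v2 (t * z) (by rw [norm_mul, hz]; simpa using nt) ?_ ?_ ?_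
    · have := (cc_zero h 1 0 (by norm_num)).const_mul (1 - Q)
      rw [Matrix.mul_zero] at this
      refine this.congr fun n => ?_
      congr 2; ring1
    · have := spr_compl h
      simp only [Nat.cast_zero]
      rw [← this]; exact s2
    · intro n
      have r := cc_rel h (n + 1)
      rw [if_neg (by omega)] at r
      have r' := eq_neg_of_add_eq_zero_left r
      push_cast
      rw [r', show ((n:ℤ) + 1 - 1) = n by ring1, cm, cc_comm h]
      have k1' := eq_neg_of_add_eq_zero_right (show (t * z : ℂ) • (Q *ᵥ v2) + ((1 - Q) *ᵥ v2) = 0 by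
        rw [← k2, Matrix.add_mulVec, Matrix.smul_mulVec])
      rw [← Matrix.mulVec_mulVec, k1', Matrix.neg_mulVec, ← Matrix.mulVec_mulVec, Matrix.mulVec_neg, Matrix.mulVec_smul, smul_neg]
  apply hv0
  have : v = v1 + v2 := by rw [hv1, hv2, ← Matrix.add_mulVec]; simp
  rw [this, z1, z2, add_zero]

theorem cont_spr {Y : Type} [TopologicalSpace Y] {Q : Y → Matrix ι ι ℂ} (hQ : Continuous Q) (h : ∀ y, SpOk (Q y)) :
    Continuous fun y => spr (Q y) := by
  have c2 := cont_ee
  unfold spr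
  refine hQ.matrix_mul ?_
  refine continuous_matrix fun i j => ?_
  simp only [cc, mint, Matrix.of_apply]
  apply intervalIntegral.continuous_parametric_intervalIntegral_of_continuous'
  have c3 : Continuous fun p : Y × ℝ => rs (Q p.1) p.2 :=
    cont_inv (f := fun p : Y × ℝ => 1 - Q p.1 + ee p.2 • Q p.1) (by fun_prop) (fun p => h _ _ (norm_ee _))
  unfold Function.uncurry
  fun_prop

theorem zz_surj {z : ℂ} (hz : ‖z‖ = 1) : ∃ t : I, zz t = z := by
  obtain ⟨x, hx⟩ := Circle.exp_surjective ⟨z, by simpa [Submonoid.unitSphere] using hz⟩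
  have hpi := Real.two_pi_pos
  refine ⟨⟨Int.fract (x / (2 * Real.pi)), Int.fract_nonneg _, (Int.fract_lt_one _).le⟩, ?_⟩
  have : Circle.exp (2 * Real.pi * Int.fract (x / (2 * Real.pi))) = Circle.exp x := by
    rw [← Int.self_sub_floor, mul_sub, mul_div_cancel₀ _ hpi.ne', mul_comm (2 * Real.pi), Circle.exp_sub]
    rw [Circle.exp_int_mul_two_pi, div_one]
  rw [hx] at this
  have h2 := congrArg (fun c : Circle => (c : ℂ)) this
  simp only [Circle.coe_exp] at h2
  rw [zz, ← h2]
  push_cast; rfl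

/-- the clutching function of an idempotent -/
noncomputable def pz (z : ℂ) (P : Matrix ι ι ℂ) : Matrix ι ι ℂ := 1 - P + z • P

theorem pz_mul {P : Matrix ι ι ℂ} (hP : P * P = P) (z w : ℂ) : pz z P * pz w P = pz (z * w) P := by
  simp only [pz, Matrix.mul_add, Matrix.add_mul, Matrix.mul_sub, Matrix.sub_mul, Matrix.mul_one, Matrix.one_mul, Matrix.mul_smul,
    Matrix.smul_mul, hP, smul_smul, sub_self, smul_sub, smul_zero, add_zero, sub_zero, zero_add, mul_comm]
  first | done | abel

theorem pz_one (P : Matrix ι ι ℂ) : pz 1 P = 1 := by simp [pz]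

theorem pz_mem {P : Matrix ι ι ℂ} (hP : P * P = P) {z : ℂ} (hz : z ≠ 0) : pz z P ∈ Gl ι :=
  Gl.of_mul (B := pz z⁻¹ P) (by rw [pz_mul hP, mul_inv_cancel₀ hz, pz_one])

theorem pz_inv {P : Matrix ι ι ℂ} (hP : P * P = P) {z : ℂ} (hz : z ≠ 0) : (pz z P)⁻¹ = pz z⁻¹ P :=
  Matrix.inv_eq_right_inv (by rw [pz_mul hP, mul_inv_cancel₀ hz, pz_one])

theorem fam_pz {Y : Type} [TopologicalSpace Y] {B : Set Y} {y0 : Y} {P : Y → Matrix ι ι ℂ} (hc : Continuous P)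
    (hi : ∀ y, P y * P y = P y) (hb : ∀ y ∈ B, P y = P y0) : Fam B y0 (fun p => pz (zz p.1) (P p.2)) := by
  have cz := cont_zz
  exact ⟨by unfold pz; fun_prop, fun p => pz_mem (hi _) (zz_ne _), fun y => by simp only [zz_zero, zz_one],
    fun t y hy => by simp only [hb y hy]⟩

theorem proj_lin {κ : Type} [Fintype κ] [DecidableEq κ] {Y : Type} [TopologicalSpace Y] {B : Set Y} {y0 : Y} {Q : Y → Matrix κ κ ℂ}
    (hQ : Continuous Q) (hsp : ∀ y, SpOk (Q y)) (hQB : ∀ y ∈ B, Q y = Q y0) :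
    ∃ P : Y → Matrix κ κ ℂ, Continuous P ∧ (∀ y, P y * P y = P y) ∧
      (∀ y ∈ B, P y = P y0) ∧ SEq (sus B) (Ph y0 fun p => 1 - Q p.2 + zz p.1 • Q p.2) (Ph y0 fun p => pz (zz p.1) (P p.2)) := by
  have cz := cont_zz
  have hP := cont_spr hQ hsp
  have hPi : ∀ y, spr (Q y) * spr (Q y) = spr (Q y) := fun y => spr_idem (hsp y)
  have hPB : ∀ y ∈ B, spr (Q y) = spr (Q y0) := fun y h => by simp only [hQB y h]
  have hpath : ∀ (s : I) (p : I × Y), (zz p.1 • Q p.2 + (((s:ℝ)) : ℂ) • (1 - Q p.2)) * spr (Q p.2) +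
    ((((s:ℝ) : ℂ) * zz p.1) • Q p.2 + (1 - Q p.2)) * (1 - spr (Q p.2)) ∈ Gl κ :=
    fun (s : I) (p : I × Y) => spr_path (hsp p.2) (norm_zz p.1) s.2
  obtain ⟨P, hPd⟩ : ∃ P : Y → Matrix κ κ ℂ, ∀ y, spr (Q y) = P y := ⟨_, fun _ => rfl⟩
  simp only [hPd] at hP hPi hPB hpath
  refine ⟨P, hP, hPi, hPB, ?_⟩
  obtain ⟨H, hH⟩ : ∃ H : I → I × Y → Matrix κ κ ℂ, H = fun (s : I) (p : I × Y) => (zz p.1 • Q p.2 + (((s:ℝ)) : ℂ) • (1 - Q p.2)) * P p.2 +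
    ((((s:ℝ) : ℂ) * zz p.1) • Q p.2 + (1 - Q p.2)) * (1 - P p.2) := ⟨_, rfl⟩
  have hHc : Continuous fun p : I × (I × Y) => H p.1 p.2 := by simp only [hH]; fun_prop
  have hm : ∀ s p, H s p ∈ Gl κ := by
    intro s p
    rw [hH]; exact hpath s p
  have hHF : ∀ s, Fam B y0 (H s) := fun s => ⟨hHc.comp (by fun_prop : Continuous fun p : I × Y => (s, p)), hm s, fun y => by simp only [hH, zz_zero, zz_one],
    fun t y h => by simp only [hH, hQB y h, hPB y h]⟩
  have hht := Fam.ht (B := B) (y0 := y0) (H := H) hHc hHF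
  have e1 : H 1 = fun p => 1 - Q p.2 + zz p.1 • Q p.2 := by
    funext p
    simp only [hH, Set.Icc.coe_one, Complex.ofReal_one, one_smul, one_mul]
    rw [← Matrix.mul_add]
    simp [add_comm]
  obtain ⟨L, hL⟩ : ∃ L : Y → Matrix κ κ ℂ, L = fun y => Q y * P y + (1 - Q y) * (1 - P y) := ⟨_, rfl⟩
  have e0 : H 0 = fun p => L p.2 * pz (zz p.1) (P p.2) := by
    funext p
    have hi := hPi p.2
    have hi' : (1 - P p.2) * P p.2 = 0 := by rw [Matrix.sub_mul, Matrix.one_mul, hi, sub_self]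
    have hi'' : (1 - P p.2) * (1 - P p.2) = 1 - P p.2 := by rw [Matrix.mul_sub, hi', Matrix.mul_one, sub_zero]
    have hi3 : P p.2 * (1 - P p.2) = 0 := by rw [Matrix.mul_sub, Matrix.mul_one, hi, sub_self]
    simp only [hH, hL, pz, Matrix.mul_add, Matrix.add_mul, Matrix.mul_assoc, hi, hi', hi'', hi3, Matrix.mul_smul]
    simp
    abel
  have hF1 := fam_pz hP hPi (B := B) (y0 := y0) hPB
  have hLm : ∀ y, L y ∈ Gl κ := by
    intro y
    have := hm 0 (0, y)
    rw [e0] at this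
    simpa [zz_zero, pz_one] using this
  have hL2 := hF1.left (L := L) (by rw [hL]; fun_prop) hLm (fun y h => by simp only [hL, hQB y h, hPB y h])
  rw [e1, e0] at hht
  exact SEq.trans hht.seq.symm hL2.2.symm

theorem exists_proj {Y : Type} [MetricSpace Y] [CompactSpace Y] {B : Set Y} {y0 : Y} {g : I × Y → Matrix ι ι ℂ}
    (hB : IsClosed B) (hy : y0 ∈ B) (hg : Lp (sus B) (Gl ι) 1 g) :
    ∃ (κ : Type) (_ : Fintype κ) (_ : DecidableEq κ) (P : Y → Matrix κ κ ℂ), Continuous P ∧ (∀ y, P y * P y = P y) ∧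
      (∀ y ∈ B, P y = P y0) ∧ SEq (sus B) g (Ph y0 fun p => pz (zz p.1) (P p.2)) := by
  obtain ⟨d, T0, h1, h2, h3⟩ := exists_poly hB hy hg
  obtain ⟨κ, i1, i2, T, h4, h5, h6⟩ := linearize d h1 h2
  obtain ⟨k1, k2, k3⟩ := h4.basic
  have hF : Fam B y0 T := ⟨k1, h5, k2, k3⟩
  obtain ⟨a, ha, ha', q, ⟨b, hb, hb', hq⟩, hT⟩ := h4
  have cz := cont_zz
  have c0 : Continuous fun y => (T (0, y))⁻¹ := cont_inv (by fun_prop) (fun y => h5 _)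
  have hL := hF.left (L := fun y => (T (0, y))⁻¹) c0 (fun y => Gl.inv (h5 _)) (fun y h => by rw [k3 0 y h])
  obtain ⟨Q, hQd⟩ : ∃ Q : Y → Matrix κ κ ℂ, Q = fun y => (T (0, y))⁻¹ * b y := ⟨_, rfl⟩
  have hQ : Continuous Q := hQd ▸ c0.matrix_mul hb
  have hQe : ∀ p : I × Y, (T (0, p.2))⁻¹ * T p = 1 - Q p.2 + zz p.1 • Q p.2 := by
    intro p
    have e0 : T (0, p.2) = a p.2 + b p.2 := by rw [hT, hq, zz_zero, one_smul]
    have : T p = T (0, p.2) - b p.2 + zz p.1 • b p.2 := by rw [e0, hT, hq, add_sub_cancel_right]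
    conv_lhs => rw [this]
    rw [hQd, Matrix.mul_add, Matrix.mul_sub, Gl.inv_mul (h5 _), Matrix.mul_smul]
  have hsp : ∀ y, SpOk (Q y) := by
    intro y z hz
    obtain ⟨t, rfl⟩ := zz_surj hz
    rw [← hQe (t, y)]
    exact Gl.mul (Gl.inv (h5 _)) (h5 _)
  have hQB : ∀ y ∈ B, Q y = Q y0 := fun y h => by simp only [hQd, k3 0 y h, hb' y h]
  obtain ⟨P, p1, p2, p3, p4⟩ := proj_lin hQ hsp hQB
  rw [← funext hQe] at p4
  exact ⟨κ, i1, i2, P, p1, p2, p3, SEq.trans (SEq.trans h3 h6) (SEq.trans hL.2 p4)⟩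

end spectral
end PU
end part13

section part14
open scoped unitInterval Topology Matrix
set_option linter.unusedVariables false
set_option linter.unusedSimpArgs false
set_option linter.unusedSectionVars false
namespace PU

section step4
variable {ι κ : Type} [Fintype ι] [DecidableEq ι] [Fintype κ] [DecidableEq κ]

/-- The standard idempotent. -/
abbrev E1 (κ μ : Type) [Fintype κ] [DecidableEq κ] [Fintype μ] [DecidableEq μ] : Matrix (κ ⊕ μ) (κ ⊕ μ) ℂ :=
  Matrix.fromBlocks 1 0 0 0

theorem E1_idem {μ : Type} [Fintype μ] [DecidableEq μ] : E1 κ μ * E1 κ μ = E1 κ μ := by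
  simp [Matrix.fromBlocks_multiply]

theorem pz_conj {V P : Matrix ι ι ℂ} {V' : Matrix ι ι ℂ} (h : V * V' = 1) (z : ℂ) :
    pz z (V * P * V') = V * pz z P * V' := by
  simp only [pz, Matrix.mul_add, Matrix.add_mul, Matrix.mul_sub, Matrix.sub_mul, Matrix.mul_one, h,
    Matrix.mul_smul, Matrix.smul_mul]

theorem step4a {Y : Type} [TopologicalSpace Y] {B : Set Y} {y0 : Y} (hy : y0 ∈ B) {P : Y → Matrix κ κ ℂ}
    (hc : Continuous P) (hi : ∀ y, P y * P y = P y) (hb : ∀ y ∈ B, P y = P y0) :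
    ∃ P2 : Y → Matrix (κ ⊕ κ) (κ ⊕ κ) ℂ, Continuous P2 ∧ (∀ y, P2 y * P2 y = P2 y) ∧
      (∀ y ∈ B, P2 y = E1 κ κ) ∧
      SEq (sus B) (Ph y0 fun p => pz (zz p.1) (P p.2)) (Ph y0 fun p => pz (zz p.1) (P2 p.2)) := by
  obtain ⟨P0, hP0⟩ : ∃ P0, P0 = P y0 := ⟨_, rfl⟩
  have i0 : P0 * P0 = P0 := by rw [hP0, hi]
  obtain ⟨Q0, hQ0⟩ : ∃ Q0, Q0 = 1 - P0 := ⟨_, rfl⟩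
  have q0 : Q0 * Q0 = Q0 := by rw [hQ0]; simp [Matrix.mul_sub, Matrix.sub_mul, i0]
  have q1 : Q0 * P0 = 0 := by rw [hQ0]; simp [Matrix.mul_sub, Matrix.sub_mul, i0]
  have q2 : P0 * Q0 = 0 := by rw [hQ0]; simp [Matrix.mul_sub, Matrix.sub_mul, i0]
  have q3 : P0 + Q0 = 1 := by rw [hQ0]; abel
  have q4 : Q0 + P0 = 1 := by rw [hQ0]; abel
  obtain ⟨V, hV⟩ : ∃ V : Matrix (κ ⊕ κ) (κ ⊕ κ) ℂ, V = Matrix.fromBlocks P0 Q0 Q0 P0 := ⟨_, rfl⟩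
  have VV : V * V = 1 := by
    rw [hV, Matrix.fromBlocks_multiply, i0, q0, q1, q2, q3, q4, add_zero, Matrix.fromBlocks_one]
  obtain ⟨P1, hP1⟩ : ∃ P1 : Y → Matrix (κ ⊕ κ) (κ ⊕ κ) ℂ, P1 = fun y => Matrix.fromBlocks (P y) 0 0 Q0 := ⟨_, rfl⟩
  have c1 : Continuous P1 := by
    rw [hP1]; exact hc.matrix_fromBlocks continuous_const continuous_const continuous_const
  have i1 : ∀ y, P1 y * P1 y = P1 y := fun y => by
    simp [hP1, Matrix.fromBlocks_multiply, hi, q0]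
  have e1 : ∀ z y, pz z (P1 y) = ex (pz z (P y)) * Matrix.fromBlocks 1 0 0 (pz z Q0) := fun z y => by
    simp only [hP1, pz, ex, Matrix.fromBlocks_multiply, ← Matrix.fromBlocks_one, Matrix.fromBlocks_smul,
      Matrix.fromBlocks_add, sub_eq_add_neg, Matrix.fromBlocks_neg]
    simp
  refine ⟨fun y => V * P1 y * V, by fun_prop, ?_, ?_, ?_⟩
  · intro y
    calc _ = V * P1 y * (V * V) * P1 y * V := by simp only [Matrix.mul_assoc]
      _ = V * (P1 y * P1 y) * V := by rw [VV]; simp only [Matrix.mul_assoc, Matrix.one_mul]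
      _ = _ := by rw [i1]
  · intro y hy
    simp only [hP1, hb y hy, hV, ← hP0, Matrix.fromBlocks_multiply, i0, q0, q1, q2, q3, q4, add_zero, zero_add,
      Matrix.mul_zero, Matrix.zero_mul]
  · have f0 := fam_pz hc hi hb
    have s1 := f0.seq_ex (κ := κ)
    have hR : ∀ t, (Matrix.fromBlocks 1 0 0 (pz (zz t) Q0) : Matrix (κ ⊕ κ) (κ ⊕ κ) ℂ) ∈ Gl (κ ⊕ κ) := fun t => by
      rw [mem_GL, Matrix.det_fromBlocks_zero₂₁]
      simpa [mem_GL] using mem_GL.1 (pz_mem q0 (zz_ne t))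
    have s2 := ph_right (y0 := y0) (T := fun p : I × Y => (ex (pz (zz p.1) (P p.2)) : Matrix (κ ⊕ κ) (κ ⊕ κ) ℂ)) hR
    rw [← s2] at s1
    simp only [← e1] at s1
    have f1 := fam_pz c1 i1 (B := B) (y0 := y0) (fun y hy => by simp only [hP1, hb y hy])
    have Vm : V ∈ Gl _ := Gl.of_mul VV
    have s3 := (f1.left (L := fun _ => V) continuous_const (fun _ => Vm) (fun _ _ => rfl)).2
    have s4 := ph_right (y0 := y0) (T := fun p : I × Y => V * pz (zz p.1) (P1 p.2)) (R := fun _ => V) (fun _ => Vm)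
    rw [← s4] at s3
    simp only [← pz_conj VV] at s3
    exact s1.trans s3

/-- The commutator loop. -/
noncomputable def Ku {Y : Type} (E : Matrix ι ι ℂ) (u : Y → Matrix ι ι ℂ) : I × Y → Matrix ι ι ℂ := fun p =>
  u p.2 * pz (zz p.1) E * (u p.2)⁻¹ * (pz (zz p.1) E)⁻¹

theorem pz_comm {E u : Matrix ι ι ℂ} (h : u * E = E * u) (z : ℂ) : u * pz z E = pz z E * u := by
  simp only [pz, Matrix.mul_add, Matrix.add_mul, Matrix.mul_sub, Matrix.sub_mul, Matrix.mul_one, Matrix.one_mul, h,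
    Matrix.mul_smul, Matrix.smul_mul]

theorem ku_one {Y : Type} {E : Matrix ι ι ℂ} (hE : E * E = E) {u : Y → Matrix ι ι ℂ} {p : I × Y}
    (hu : u p.2 ∈ Gl ι) (h : p.1 = 0 ∨ p.1 = 1 ∨ u p.2 * E = E * u p.2) : Ku E u p = 1 := by
  have : u p.2 * pz (zz p.1) E = pz (zz p.1) E * u p.2 := by
    rcases h with h | h | h
    · rw [h, zz_zero, pz_one]; simp
    · rw [h, zz_one, pz_one]; simp
    · exact pz_comm h _
  rw [Ku, this, Matrix.mul_assoc (pz _ E), Gl.mul_inv hu, Matrix.mul_one, Gl.mul_inv (pz_mem hE (zz_ne _))]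

theorem ku_ht {Y : Type} [TopologicalSpace Y] {B : Set Y} {E : Matrix ι ι ℂ} (hE : E * E = E)
    {U : I → Y → Matrix ι ι ℂ} (hc : Continuous fun p : I × Y => U p.1 p.2) (hm : ∀ s y, U s y ∈ Gl ι)
    (hb : ∀ s, ∀ y ∈ B, U s y * E = E * U s y) : Ht (sus B) (Gl ι) 1 (Ku E (U 0)) (Ku E (U 1)) := by
  have c2 := cont_inv hc (fun p => hm p.1 p.2)
  have cz := cont_zz
  have cd : Continuous fun p : I × (I × Y) => pz (zz p.2.1) E := by unfold pz; fun_prop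
  have ci := cont_inv cd (fun p => pz_mem hE (zz_ne p.2.1))
  have cu : Continuous fun p : I × (I × Y) => U p.1 p.2.2 := hc.comp
    (by fun_prop : Continuous fun p : I × (I × Y) => (p.1, p.2.2))
  have cv : Continuous fun p : I × (I × Y) => (U p.1 p.2.2)⁻¹ := c2.comp
    (by fun_prop : Continuous fun p : I × (I × Y) => (p.1, p.2.2))
  refine Ht.mk (fun s => Ku E (U s)) ?_ ?_ ?_
  · exact ((cu.matrix_mul cd).matrix_mul cv).matrix_mul ci
  · intro s p
    exact Gl.mul (Gl.mul (Gl.mul (hm _ _) (pz_mem hE (zz_ne _))) (Gl.inv (hm _ _))) (Gl.inv (pz_mem hE (zz_ne _)))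
  · intro s p hp
    refine ku_one hE (hm _ _) ?_
    rcases hp with h | h | h
    · exact Or.inl h
    · exact Or.inr (Or.inl h)
    · exact Or.inr (Or.inr (hb s _ h))

theorem ku_lp {Y : Type} [TopologicalSpace Y] {B : Set Y} {E : Matrix ι ι ℂ} (hE : E * E = E)
    {U : Y → Matrix ι ι ℂ} (hc : Continuous U) (hm : ∀ y, U y ∈ Gl ι)
    (hb : ∀ y ∈ B, U y * E = E * U y) : Lp (sus B) (Gl ι) 1 (Ku E U) :=
  (ku_ht (U := fun _ => U) hE (by fun_prop) (fun _ => hm) (fun _ => hb)).lp_left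

theorem ku_right {Y : Type} {E : Matrix ι ι ℂ} {u R : Y → Matrix ι ι ℂ}
    (hR : ∀ y, R y ∈ Gl ι) (h : ∀ y, R y * E = E * R y) : Ku E (fun y => u y * R y) = Ku E u := by
  funext p
  simp only [Ku, Matrix.mul_inv_rev]
  calc _ = u p.2 * (R p.2 * pz (zz p.1) E) * (R p.2)⁻¹ * (u p.2)⁻¹ * (pz (zz p.1) E)⁻¹ := by simp only [Matrix.mul_assoc]
    _ = u p.2 * (pz (zz p.1) E) * (R p.2 * (R p.2)⁻¹) * (u p.2)⁻¹ * (pz (zz p.1) E)⁻¹ := by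
      rw [pz_comm (h _)]; simp only [Matrix.mul_assoc]
    _ = _ := by rw [Gl.mul_inv (hR _), Matrix.mul_one]

theorem ph_ku {Y : Type} {y0 : Y} {E : Matrix ι ι ℂ} {P u : Y → Matrix ι ι ℂ} (h0 : P y0 = E)
    (hu : ∀ y, u y ∈ Gl ι) (h : ∀ y, u y * E = P y * u y) : (Ph y0 fun p => pz (zz p.1) (P p.2)) = Ku E u := by
  funext p
  have e : P p.2 = u p.2 * E * (u p.2)⁻¹ := by
    rw [h, Matrix.mul_assoc, Gl.mul_inv (hu _), Matrix.mul_one]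
  simp only [Ph, zz_zero, pz_one, h0, Ku, e, pz_conj (Gl.mul_inv (hu p.2))]
  simp only [Matrix.mul_one, Gl.mul_inv (hu p.2), inv_one, Matrix.one_mul]

theorem pz_E (z : ℂ) : pz z (E1 κ κ) = Matrix.fromBlocks (z • 1) 0 0 1 := by
  simp only [pz, ← Matrix.fromBlocks_one, Matrix.fromBlocks_smul,
      Matrix.fromBlocks_add, sub_eq_add_neg, Matrix.fromBlocks_neg]
  simp

theorem pz_ex (z : ℂ) (E : Matrix ι ι ℂ) :
    (pz z (Matrix.fromBlocks E 0 0 0) : Matrix (ι ⊕ κ) (ι ⊕ κ) ℂ) = ex (pz z E) := by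
  simp only [pz, ex, ← Matrix.fromBlocks_one, Matrix.fromBlocks_smul,
      Matrix.fromBlocks_add, sub_eq_add_neg, Matrix.fromBlocks_neg]
  simp

theorem ku_ex {Y : Type} {E : Matrix ι ι ℂ} (hE : E * E = E) {u : Y → Matrix ι ι ℂ} (hu : ∀ y, u y ∈ Gl ι) (p : I × Y) :
    (ex (Ku E u p) : Matrix (ι ⊕ κ) (ι ⊕ κ) ℂ) = Ku (Matrix.fromBlocks E 0 0 0) (fun y => ex (u y)) p := by
  simp only [Ku, pz_ex, ex_mul, ex_inv (hu _), ex_inv (pz_mem hE (zz_ne _))]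

end step4
end PU
end part14

section part15
open scoped unitInterval Topology Matrix
set_option linter.unusedVariables false
set_option linter.unusedSimpArgs false
set_option linter.unusedSectionVars false
namespace PU

section step5
variable {ι κ : Type} [Fintype ι] [DecidableEq ι] [Fintype κ] [DecidableEq κ]

/-- Rotation of the first copy to the third. -/
noncomputable def Js (κ : Type) [Fintype κ] [DecidableEq κ] (s : ℝ) : Matrix ((κ ⊕ κ) ⊕ κ) (κ ⊕ κ) ℂ :=
  Matrix.fromRows (Matrix.fromBlocks ((Real.cos s : ℂ) • 1) 0 0 1) (Matrix.fromCols ((Real.sin s : ℂ) • 1) 0)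
noncomputable def Ks (κ : Type) [Fintype κ] [DecidableEq κ] (s : ℝ) : Matrix (κ ⊕ κ) ((κ ⊕ κ) ⊕ κ) ℂ :=
  Matrix.fromCols (Matrix.fromBlocks ((Real.cos s : ℂ) • 1) 0 0 1) (Matrix.fromRows ((Real.sin s : ℂ) • 1) 0)

theorem KJ (s : ℝ) : Ks κ s * Js κ s = 1 := by
  have h : Real.cos s * Real.cos s + Real.sin s * Real.sin s = 1 := by
    have := Real.cos_sq_add_sin_sq s
    nlinarith
  rw [Ks, Js, Matrix.fromCols_mul_fromRows, Matrix.fromBlocks_multiply, Matrix.fromRows_mul_fromCols, Matrix.fromBlocks_add,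
    ← Matrix.fromBlocks_one]
  congr 1 <;> simp [smul_smul, ← add_smul, h, -Complex.ofReal_cos, -Complex.ofReal_sin]

theorem continuous_Js : Continuous fun s => Js κ s := by
  unfold Js
  refine continuous_matrix fun i j => ?_
  rcases i with (i | i) | i <;> rcases j with j | j <;> simp <;> fun_prop

theorem continuous_Ks : Continuous fun s => Ks κ s := by
  unfold Ks
  refine continuous_matrix fun i j => ?_
  rcases j with (j | j) | j <;> rcases i with i | i <;> simp <;> fun_prop

/-- The big standard idempotent. -/
abbrev E3 (κ : Type) [Fintype κ] [DecidableEq κ] : Matrix ((κ ⊕ κ) ⊕ κ) ((κ ⊕ κ) ⊕ κ) ℂ :=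
  Matrix.fromBlocks (E1 κ κ) 0 0 0

theorem comm_of_zero {J : Matrix κ ι ℂ} {K : Matrix ι κ ℂ} {B : Matrix ι ι ℂ} {E : Matrix κ κ ℂ}
    (h1 : E * (J * (B - 1)) = 0) (h2 : (B - 1) * K * E = 0) : ext J K B * E = E * ext J K B := by
  simp only [ext, Matrix.add_mul, Matrix.mul_add, Matrix.one_mul, Matrix.mul_one]
  rw [← Matrix.mul_assoc, h1, Matrix.mul_assoc J, Matrix.mul_assoc J, h2]
  simp

theorem E3_Js : E3 κ * Js κ (Real.pi / 2) = 0 := by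
  rw [Js, Matrix.fromBlocks_mul_fromRows]
  simp [Matrix.fromBlocks_multiply]

theorem Ks_E3 : Ks κ (Real.pi / 2) * E3 κ = 0 := by
  rw [Ks, Matrix.fromCols_mul_fromBlocks]
  simp [Matrix.fromBlocks_multiply]

theorem E3_Js_blk (s : ℝ) (D : Matrix κ κ ℂ) : E3 κ * (Js κ s * (Matrix.fromBlocks 0 0 0 D : Matrix (κ ⊕ κ) (κ ⊕ κ) ℂ)) = 0 := by
  rw [Js, Matrix.fromRows_mul, Matrix.fromBlocks_mul_fromRows]
  simp [Matrix.fromBlocks_multiply]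

theorem blk_Ks_E3 (s : ℝ) (D : Matrix κ κ ℂ) : (Matrix.fromBlocks 0 0 0 D : Matrix (κ ⊕ κ) (κ ⊕ κ) ℂ) * Ks κ s * E3 κ = 0 := by
  rw [Ks, Matrix.mul_fromCols, Matrix.fromCols_mul_fromBlocks]
  simp [Matrix.fromBlocks_multiply]

/-- Ku only depends on the top-left block of the clutching. -/
theorem ku_seq {X : Type} [TopologicalSpace X] {A : Set X} {u v : I × X → Matrix (κ ⊕ κ) (κ ⊕ κ) ℂ}
    (cu : Continuous u) (cv : Continuous v) (mu : ∀ y, u y ∈ Gl _) (mv : ∀ y, v y ∈ Gl _)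
    (bu : ∀ y, y.1 = 0 ∨ y.2 ∈ A → u y = 1) (bv : ∀ y, y.1 = 0 ∨ y.2 ∈ A → v y = 1)
    (eu : ∀ x, u (1, x) * E1 κ κ = E1 κ κ * u (1, x)) (ev : ∀ x, v (1, x) * E1 κ κ = E1 κ κ * v (1, x))
    (hc : ∀ x, ∃ D, (v (1, x))⁻¹ * u (1, x) = Matrix.fromBlocks 1 0 0 D) :
    SEq (sus (sus A)) (Ku (E1 κ κ) u) (Ku (E1 κ κ) v) := by
  have cvi := cont_inv cv mv
  have e3 : E3 κ * E3 κ = E3 κ := by simp [Matrix.fromBlocks_multiply]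
  obtain ⟨c, hcd⟩ : ∃ c : I × X → Matrix (κ ⊕ κ) (κ ⊕ κ) ℂ, c = fun y => (v y)⁻¹ * u y := ⟨_, rfl⟩
  have cc : Continuous c := by rw [hcd]; fun_prop
  have cm : ∀ y, c y ∈ Gl _ := fun y => by rw [hcd]; exact Gl.mul (Gl.inv (mv y)) (mu y)
  obtain ⟨U, hU⟩ : ∃ U : I → I × X → Matrix ((κ ⊕ κ) ⊕ κ) ((κ ⊕ κ) ⊕ κ) ℂ, U = fun (s : I) (y : I × X) =>
    (ex (v y) : Matrix ((κ ⊕ κ) ⊕ κ) ((κ ⊕ κ) ⊕ κ) ℂ) * ext (Js κ (Real.pi / 2 * s)) (Ks κ (Real.pi / 2 * s)) (c y) := ⟨_, rfl⟩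
  have h := ku_ht (B := sus A) e3 (U := U) ?_ ?_ ?_
  · have k0 : ∀ p, Ku (E3 κ) (U 0) p = ex (Ku (E1 κ κ) u p) := fun p => by
      rw [ku_ex E1_idem mu]
      congr 1
      funext y
      have a1 : Js κ (Real.pi / 2 * (0 : I)) = i1 (κ ⊕ κ) κ := by simp [Js, Matrix.fromBlocks_one]
      have a2 : Ks κ (Real.pi / 2 * (0 : I)) = p1 (κ ⊕ κ) κ := by simp [Ks, Matrix.fromBlocks_one]
      simp only [hU, hcd]
      rw [a1, a2, ext_i1, ← ex_mul, ← Matrix.mul_assoc, Gl.mul_inv (mv y), Matrix.one_mul]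
    have k1 : ∀ p, Ku (E3 κ) (U 1) p = ex (Ku (E1 κ κ) v p) := fun p => by
      rw [ku_ex E1_idem mv]
      have := ku_right (E := E3 κ) (u := fun y => (ex (v y) : Matrix ((κ ⊕ κ) ⊕ κ) ((κ ⊕ κ) ⊕ κ) ℂ))
        (R := fun y => ext (Js κ (Real.pi / 2)) (Ks κ (Real.pi / 2)) (c y)) (fun y => ext_mem (KJ _) (cm y))
        (fun y => comm_of_zero (by rw [← Matrix.mul_assoc, E3_Js, Matrix.zero_mul]) (by rw [Matrix.mul_assoc, Ks_E3, Matrix.mul_zero]))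
      rw [← this, hU]
      simp only [Set.Icc.coe_one, mul_one]
    have bb : ∀ w : I × X → Matrix (κ ⊕ κ) (κ ⊕ κ) ℂ, (∀ y, y.1 = 0 ∨ y.2 ∈ A → w y = 1) →
        (∀ x, w (1, x) * E1 κ κ = E1 κ κ * w (1, x)) → ∀ y ∈ sus A, w y * E1 κ κ = E1 κ κ * w y := by
      rintro w h1 h2 ⟨t, x⟩ (h | h | h)
      · rw [h1 _ (Or.inl h)]; simp
      · simp only at h; subst h; exact h2 x
      · rw [h1 _ (Or.inr h)]; simp
    have s1 := seq_ex (κ := κ) (ku_lp (B := sus A) E1_idem cu mu (bb u bu eu))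
    have s2 := seq_ex (κ := κ) (ku_lp (B := sus A) E1_idem cv mv (bb v bv ev))
    exact (s1.trans ((h.congr (fun p => (k0 p).symm) (fun p => (k1 p).symm)).seq)).trans s2.symm
  · rw [hU]
    refine (cont_ex.comp (by fun_prop : Continuous fun p : I × (I × X) => v p.2)).matrix_mul (cont_ext3 ?_ ?_ (by fun_prop))
    · exact continuous_Js.comp (by fun_prop : Continuous fun p : I × (I × X) => Real.pi / 2 * (p.1 : ℝ))
    · exact continuous_Ks.comp (by fun_prop : Continuous fun p : I × (I × X) => Real.pi / 2 * (p.1 : ℝ))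
  · intro s y; rw [hU]; exact Gl.mul (ex_mem.2 (mv y)) (ext_mem (KJ _) (cm y))
  · have hz : ∀ s y, (y : I × X).1 = 0 ∨ y.2 ∈ A → U s y * E3 κ = E3 κ * U s y := fun s y hy => by
      simp only [hU, hcd, bu y hy, bv y hy]; simp [ext_one]
    rintro s ⟨t, x⟩ (h | h | h)
    · exact hz s _ (Or.inl h)
    · simp only at h; subst h
      obtain ⟨D, hD⟩ := hc x
      have g1 : (ex (v (1, x)) : Matrix ((κ ⊕ κ) ⊕ κ) ((κ ⊕ κ) ⊕ κ) ℂ) * E3 κ = E3 κ * ex (v (1, x)) := by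
        simp only [ex, E3, Matrix.fromBlocks_multiply, ev]; simp
      have g2 : c (1, x) - 1 = Matrix.fromBlocks 0 0 0 (D - 1) := by
        simp only [hcd, hD, ← Matrix.fromBlocks_one, sub_eq_add_neg, Matrix.fromBlocks_neg, Matrix.fromBlocks_add]
        simp
      have g3 := comm_of_zero (J := Js κ (Real.pi / 2 * s)) (K := Ks κ (Real.pi / 2 * s)) (B := c (1, x)) (E := E3 κ)
        (by rw [g2, E3_Js_blk]) (by rw [g2, blk_Ks_E3])
      simp only [hU]
      rw [Matrix.mul_assoc, g3, ← Matrix.mul_assoc, g1, Matrix.mul_assoc]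
    · exact hz s _ (Or.inr h)

end step5
end PU
end part15

section part16
open scoped unitInterval Topology Matrix
set_option linter.unusedVariables false
set_option linter.unusedSimpArgs false
set_option linter.unusedSectionVars false
namespace PU

section bott
variable {ι κ : Type} [Fintype ι] [DecidableEq ι] [Fintype κ] [DecidableEq κ]

/-- Two by two block matrices built from `α`. -/
noncomputable def Cm (a a' b : ℂ) (α : Matrix κ κ ℂ) : Matrix (κ ⊕ κ) (κ ⊕ κ) ℂ :=
  Matrix.fromBlocks (a • 1) (b • α⁻¹) (b • α) (a' • 1)

/-- Block rotations. -/
noncomputable def Ub (c s : ℂ) (α : Matrix κ κ ℂ) : Matrix (κ ⊕ κ) (κ ⊕ κ) ℂ :=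
  Matrix.fromBlocks (c • 1) (-s • α⁻¹) (s • α) (c • 1)

theorem cont_blocks {X : Type*} [TopologicalSpace X] {a b c d : X → ℂ} {α β γ δ : X → Matrix κ κ ℂ}
    (ha : Continuous a) (hb : Continuous b) (hc : Continuous c) (hd : Continuous d)
    (h1 : Continuous α) (h2 : Continuous β) (h3 : Continuous γ) (h4 : Continuous δ) :
    Continuous fun x => (Matrix.fromBlocks (a x • α x) (b x • β x) (c x • γ x) (d x • δ x) : Matrix (κ ⊕ κ) (κ ⊕ κ) ℂ) :=
  (ha.smul h1).matrix_fromBlocks (hb.smul h2) (hc.smul h3) (hd.smul h4)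

theorem cont_Cm {X : Type*} [TopologicalSpace X] {a a' b : X → ℂ} {α : X → Matrix κ κ ℂ}
    (ha : Continuous a) (ha' : Continuous a') (hb : Continuous b)
    (h1 : Continuous α) (hm : ∀ x, α x ∈ Gl κ) : Continuous fun x => Cm (a x) (a' x) (b x) (α x) :=
  cont_blocks ha hb hb ha' continuous_const (cont_inv h1 hm) h1 continuous_const

theorem cont_Ub {X : Type*} [TopologicalSpace X] {c s : X → ℂ} {α : X → Matrix κ κ ℂ}
    (ha : Continuous c) (hb : Continuous s)
    (h1 : Continuous α) (hm : ∀ x, α x ∈ Gl κ) : Continuous fun x => Ub (c x) (s x) (α x) :=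
  cont_blocks ha hb.neg hb ha continuous_const (cont_inv h1 hm) h1 continuous_const

theorem sone {x : ℂ} (h : x = 1) : x • (1 : Matrix κ κ ℂ) = 1 := by rw [h, one_smul]
theorem szero {x : ℂ} (h : x = 0) {N : Matrix κ κ ℂ} : x • N = 0 := by rw [h, zero_smul]

theorem Cm_inv {a a' b : ℂ} {α : Matrix κ κ ℂ} (h : a * a' - b * b = 1) (hα : α ∈ Gl κ) :
    Cm a a' b α * Cm a' a (-b) α = 1 := by
  rw [Cm, Cm, Matrix.fromBlocks_multiply, ← Matrix.fromBlocks_one]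
  simp only [Matrix.smul_mul, Matrix.mul_smul, smul_smul, Gl.inv_mul hα, Gl.mul_inv hα, Matrix.mul_one, Matrix.one_mul, ← add_smul]
  congr 1
  · exact sone (by rw [← h]; ring1)
  · exact szero (by ring1)
  · exact szero (by ring1)
  · exact sone (by rw [← h]; ring1)

theorem Ub_inv {c s : ℂ} {α : Matrix κ κ ℂ} (h : c * c + s * s = 1) (hα : α ∈ Gl κ) :
    Ub c s α * Ub c (-s) α = 1 := by
  rw [Ub, Ub, Matrix.fromBlocks_multiply, ← Matrix.fromBlocks_one]
  simp only [Matrix.smul_mul, Matrix.mul_smul, smul_smul, Gl.inv_mul hα, Gl.mul_inv hα, Matrix.mul_one, Matrix.one_mul, ← add_smul]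
  congr 1
  · exact sone (by rw [← h]; ring1)
  · exact szero (by ring1)
  · exact szero (by ring1)
  · exact sone (by rw [← h]; ring1)

theorem Ub_conj (c s z : ℂ) {α : Matrix κ κ ℂ} (hα : α ∈ Gl κ) :
    Ub c s α * pz z (E1 κ κ) * Ub c (-s) α = Cm (c * c * z + s * s) (s * s * z + c * c) (c * s * (z - 1)) α := by
  rw [Ub, Ub, pz_E, Cm, Matrix.fromBlocks_multiply, Matrix.fromBlocks_multiply]
  simp only [Matrix.smul_mul, Matrix.mul_smul, smul_smul, Gl.inv_mul hα, Gl.mul_inv hα, Matrix.mul_one, Matrix.one_mul, ← add_smul,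
    Matrix.mul_zero, Matrix.zero_mul, add_zero, zero_add, smul_zero]
  congr 1 <;> congr 1 <;> ring1

theorem Cm_smul (w a a' b : ℂ) (α : Matrix κ κ ℂ) : Cm (w * a) (w * a') (w * b) α = w • Cm a a' b α := by
  simp only [Cm, Matrix.fromBlocks_smul, smul_smul]

/-- coefficients -/
noncomputable def ca (p : ℝ × ℝ) : ℂ := Real.cos (Real.pi * p.1) + Complex.I * (Real.sin (Real.pi * p.1) * Real.cos (Real.pi * p.2))
noncomputable def ca' (p : ℝ × ℝ) : ℂ := Real.cos (Real.pi * p.1) - Complex.I * (Real.sin (Real.pi * p.1) * Real.cos (Real.pi * p.2))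
noncomputable def cb (p : ℝ × ℝ) : ℂ := Complex.I * (Real.sin (Real.pi * p.1) * Real.sin (Real.pi * p.2))

theorem cont_ca : Continuous ca := by unfold ca; fun_prop
theorem cont_ca' : Continuous ca' := by unfold ca'; fun_prop
theorem cont_cb : Continuous cb := by unfold cb; fun_prop

theorem sq1 (x : ℝ) : (Real.cos x : ℂ) * Real.cos x + Real.sin x * Real.sin x = 1 := by
  have := Real.cos_sq_add_sin_sq x
  exact_mod_cast (by nlinarith : Real.cos x * Real.cos x + Real.sin x * Real.sin x = 1)

theorem cdet (p : ℝ × ℝ) : ca p * ca' p - cb p * cb p = 1 := by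
  have h1 := sq1 (Real.pi * p.1)
  have h2 := sq1 (Real.pi * p.2)
  unfold ca ca' cb
  generalize (Real.cos (Real.pi * p.1) : ℂ) = C at *
  generalize (Real.sin (Real.pi * p.1) : ℂ) = S at *
  generalize (Real.cos (Real.pi * p.2) : ℂ) = c at *
  generalize (Real.sin (Real.pi * p.2) : ℂ) = s at *
  linear_combination h1 + S ^ 2 * h2 - (S ^ 2 * (c ^ 2 + s ^ 2)) * Complex.I_sq

/-- The explicit Bott map. -/
noncomputable def Bt {X : Type} (α : X → Matrix κ κ ℂ) (p : I × (I × X)) : Matrix (κ ⊕ κ) (κ ⊕ κ) ℂ :=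
  Cm (ca (p.1, p.2.1)) (ca' (p.1, p.2.1)) (cb (p.1, p.2.1)) (α p.2.2) *
    Cm (ca' (p.1, p.2.1)) (ca (p.1, p.2.1)) (-cb (p.1, p.2.1)) 1

theorem Bt_one {X : Type} {α : X → Matrix κ κ ℂ} {p : I × (I × X)} (h : cb (p.1, p.2.1) = 0 ∨ α p.2.2 = 1) : Bt α p = 1 := by
  have := Cm_inv (cdet (p.1, p.2.1)) (Gl.one (ι := κ))
  rw [Bt]
  rcases h with h | h
  · rw [h] at this ⊢
    rw [← this]
    simp [Cm]
  · rw [h, this]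

theorem cb_bd {X : Type} {A : Set X} {p : I × (I × X)} (hp : p ∈ sus (sus A)) : cb (p.1, p.2.1) = 0 ∨ p.2.2 ∈ A := by
  obtain ⟨t, s, x⟩ := p
  rcases hp with h | h | h | h | h
  · left; simp only at h; subst h; simp [cb]
  · left; simp only at h; subst h; simp [cb]
  · left; simp only at h; subst h; simp [cb]
  · left; simp only at h; subst h; simp [cb]
  · right; exact h

theorem Bt_ht {X : Type} [TopologicalSpace X] {A : Set X} {α β : X → Matrix κ κ ℂ} (h : Ht A (Gl κ) 1 α β) :
    Ht (sus (sus A)) (Gl (κ ⊕ κ)) 1 (Bt α) (Bt β) := by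
  obtain ⟨H, h1, h2, h3, h4, h5⟩ := h
  refine (Ht.mk (fun s => Bt (fun x => H (s, x))) ?_ ?_ ?_).congr ?_ ?_
  · have cP : Continuous fun p : I × (I × (I × X)) => ((p.2.1 : ℝ), (p.2.2.1 : ℝ)) := by fun_prop
    exact (cont_Cm (cont_ca.comp cP) (cont_ca'.comp cP) (cont_cb.comp cP) (by fun_prop) (fun p => h2 _)).matrix_mul
      (cont_Cm (cont_ca'.comp cP) (cont_ca.comp cP) (cont_cb.comp cP).neg continuous_const (fun _ => Gl.one))
  · intro s p
    exact Gl.mul (Gl.of_mul (Cm_inv (cdet _) (h2 _))) (Gl.of_mul' (Cm_inv (cdet _) Gl.one))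
  · intro s p hp
    refine Bt_one ((cb_bd hp).imp_right fun h => ?_)
    exact h5 s _ h
  · intro p; simp only [Bt, h3]
  · intro p; simp only [Bt, h4]

theorem Bt_lp {X : Type} [TopologicalSpace X] {A : Set X} {α : X → Matrix κ κ ℂ} (h : Lp A (Gl κ) 1 α) :
    Lp (sus (sus A)) (Gl (κ ⊕ κ)) 1 (Bt α) := (Bt_ht (Ht.refl h)).lp_left

theorem Bt_ext {M : Type} [Fintype M] [DecidableEq M] {X : Type} {α : X → Matrix κ κ ℂ} {J : Matrix M κ ℂ} {K : Matrix κ M ℂ}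
    (hJ : K * J = 1) (hα : ∀ x, α x ∈ Gl κ) (p : I × (I × X)) :
    Bt (fun x => ext J K (α x)) p = ext (Matrix.fromBlocks J 0 0 J) (Matrix.fromBlocks K 0 0 K) (Bt α p) := by
  simp only [Bt]
  obtain ⟨a, ha⟩ : ∃ a, a = ca (p.1, p.2.1) := ⟨_, rfl⟩
  obtain ⟨a', ha'⟩ : ∃ a, a = ca' (p.1, p.2.1) := ⟨_, rfl⟩
  obtain ⟨b, hb⟩ : ∃ a, a = cb (p.1, p.2.1) := ⟨_, rfl⟩
  have hd : a * a' - b * b = 1 := by rw [ha, ha', hb, cdet]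
  rw [← ha, ← ha', ← hb]
  generalize hβ : α p.2.2 = β
  have hm : β ∈ Gl κ := hβ ▸ hα _
  have e1 : Cm a a' b (ext J K β) = Cm a a' b 1 + Matrix.fromBlocks J 0 0 J * (Cm a a' b β - Cm a a' b 1) * Matrix.fromBlocks K 0 0 K := by
    unfold Cm
    rw [ext_inv hJ hm]
    simp only [sub_eq_add_neg, Matrix.fromBlocks_neg, Matrix.fromBlocks_add, Matrix.fromBlocks_multiply, ext]
    simp only [inv_one, Matrix.mul_zero, Matrix.zero_mul, add_zero, zero_add, Matrix.mul_smul, Matrix.smul_mul, Matrix.mul_add,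
      Matrix.add_mul, smul_add, Matrix.mul_neg, Matrix.neg_mul, smul_neg, add_neg_cancel, Matrix.mul_one, Matrix.one_mul]
  have e2 : (Matrix.fromBlocks K 0 0 K : Matrix (κ ⊕ κ) (M ⊕ M) ℂ) * Cm a' a (-b) (1 : Matrix M M ℂ) = Cm a' a (-b) (1 : Matrix κ κ ℂ) * Matrix.fromBlocks K 0 0 K := by
    simp [Cm, Matrix.fromBlocks_multiply]
  have i1 := Cm_inv hd (Gl.one (ι := M))
  have i2 := Cm_inv hd (Gl.one (ι := κ))
  rw [e1, Matrix.add_mul, i1, ext, Matrix.mul_assoc, e2]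
  congr 1
  rw [← i2]
  simp only [Matrix.mul_sub, Matrix.sub_mul, Matrix.mul_assoc]

theorem Bt_seq {μ : Type} [Fintype μ] [DecidableEq μ] {X : Type} [TopologicalSpace X] {A : Set X} {α : X → Matrix κ κ ℂ} {β : X → Matrix μ μ ℂ}
    (h : SEq A α β) : SEq (sus (sus A)) (Bt α) (Bt β) := by
  obtain ⟨h1, h2, M, i1, i2, J, K, J', K', h3, h4, h5⟩ := h
  refine ⟨Bt_lp h1, Bt_lp h2, M ⊕ M, inferInstance, inferInstance, Matrix.fromBlocks J 0 0 J, Matrix.fromBlocks K 0 0 K,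
    Matrix.fromBlocks J' 0 0 J', Matrix.fromBlocks K' 0 0 K', by simp [Matrix.fromBlocks_multiply, h3], by simp [Matrix.fromBlocks_multiply, h4], ?_⟩
  exact (Bt_ht h5).congr (fun p => (Bt_ext h3 h1.mem p).symm) (fun p => (Bt_ext h4 h2.mem p).symm)

/-- Conjugating a loop by a family of matrices. -/
theorem ht_conj_fam {X : Type*} [TopologicalSpace X] {A : Set X} {g : X → Matrix ι ι ℂ}
    (hg : Lp A (Gl ι) 1 g) {L L' : I → X → Matrix ι ι ℂ} (hc : Continuous fun p : I × X => L p.1 p.2)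
    (hc' : Continuous fun p : I × X => L' p.1 p.2) (h : ∀ s x, L s x * L' s x = 1) :
    Ht A (Gl ι) 1 (fun x => L 0 x * g x * L' 0 x) (fun x => L 1 x * g x * L' 1 x) := by
  have := hg.cont
  refine Ht.mk (fun s x => L s x * g x * L' s x) (by fun_prop) (fun s x => Gl.mul (Gl.mul (Gl.of_mul (h s x)) (hg.mem x)) (Gl.of_mul' (h s x))) ?_
  intro s x hx
  rw [hg.bd x hx, Matrix.mul_one, h]

end bott
end PU
end part16

section part17
open scoped unitInterval Topology Matrix
set_option linter.unusedVariables false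
set_option linter.unusedSimpArgs false
set_option linter.unusedSectionVars false
namespace PU

section bott2
variable {ι κ : Type} [Fintype ι] [DecidableEq ι] [Fintype κ] [DecidableEq κ]

theorem Cm_half (φ θ : I) {α : Matrix κ κ ℂ} (hα : α ∈ Gl κ) :
    Ub (Real.cos (Real.pi / 2 * θ)) (Real.sin (Real.pi / 2 * θ)) α * pz (zz φ) (E1 κ κ) *
      Ub (Real.cos (Real.pi / 2 * θ)) (-Real.sin (Real.pi / 2 * θ)) α =
    Complex.exp (Real.pi * (φ : ℝ) * Complex.I) • Cm (ca (φ, θ)) (ca' (φ, θ)) (cb (φ, θ)) α := by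
  rw [Ub_conj _ _ _ hα, ← Cm_smul]
  have h1 := sq1 (Real.pi * φ)
  have h2 := sq1 (Real.pi / 2 * θ)
  have hw : Complex.exp (Real.pi * (φ : ℝ) * Complex.I) = Real.cos (Real.pi * φ) + Real.sin (Real.pi * φ) * Complex.I := by
    rw [Complex.exp_mul_I]; push_cast; rfl
  have hz : zz φ = (Real.cos (Real.pi * φ) + Real.sin (Real.pi * φ) * Complex.I) ^ 2 := by
    rw [← hw, zz, ← Complex.exp_nat_mul]; congr 1; push_cast; ring1
  have t1 : (Real.cos (Real.pi * θ) : ℂ) = Real.cos (Real.pi / 2 * θ) * Real.cos (Real.pi / 2 * θ) - Real.sin (Real.pi / 2 * θ) * Real.sin (Real.pi / 2 * θ) := by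
    rw [show Real.pi * (θ : ℝ) = Real.pi / 2 * θ + Real.pi / 2 * θ by ring1, Real.cos_add]; push_cast; rfl
  have t2 : (Real.sin (Real.pi * θ) : ℂ) = 2 * (Real.cos (Real.pi / 2 * θ) * Real.sin (Real.pi / 2 * θ)) := by
    rw [show Real.pi * (θ : ℝ) = Real.pi / 2 * θ + Real.pi / 2 * θ by ring1, Real.sin_add]; push_cast; ring1
  simp only [ca, ca', cb, hw, hz, t1, t2]
  generalize (Real.cos (Real.pi * φ) : ℂ) = C at *
  generalize (Real.sin (Real.pi * φ) : ℂ) = S at *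
  generalize (Real.cos (Real.pi / 2 * θ) : ℂ) = c at *
  generalize (Real.sin (Real.pi / 2 * θ) : ℂ) = s at *
  have hI := Complex.I_sq
  congr 1
  · linear_combination (-s * s) * h1 + (C * C + C * S * Complex.I) * h2 + (s * s * S * S) * hI
  · linear_combination (-c * c) * h1 + (C * C + C * S * Complex.I) * h2 + (c * c * S * S) * hI
  · linear_combination (c * s) * h1 + (-c * s * S * S) * hI

/-- The model clutching function. -/
noncomputable def ua {X : Type} (α : X → Matrix κ κ ℂ) (y : I × X) : Matrix (κ ⊕ κ) (κ ⊕ κ) ℂ :=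
  Ub (Real.cos (Real.pi / 2 * y.1)) (-Real.sin (Real.pi / 2 * y.1)) 1 *
    Ub (Real.cos (Real.pi / 2 * y.1)) (Real.sin (Real.pi / 2 * y.1)) (α y.2)

theorem Ub_inv' {c s : ℂ} {α : Matrix κ κ ℂ} (h : c * c + s * s = 1) (hα : α ∈ Gl κ) :
    Ub c (-s) α * Ub c s α = 1 := by
  have := Ub_inv (s := -s) (c := c) (by rw [← h]; ring1) hα
  rwa [neg_neg] at this

theorem ku_bt {X : Type} [TopologicalSpace X] {A : Set X} {α : X → Matrix κ κ ℂ} (h : Lp A (Gl κ) 1 α) :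
    Ht (sus (sus A)) (Gl _) 1 (Bt α) (Ku (E1 κ κ) (ua α)) := by
  obtain ⟨cs, hcs⟩ : ∃ cs : I → I × (I × X) → ℂ, cs = fun (r : I) (p : I × (I × X)) => (Real.cos (Real.pi / 2 * (r * p.2.1)) : ℂ) := ⟨_, rfl⟩
  obtain ⟨sn, hsn⟩ : ∃ cs : I → I × (I × X) → ℂ, cs = fun (r : I) (p : I × (I × X)) => (Real.sin (Real.pi / 2 * (r * p.2.1)) : ℂ) := ⟨_, rfl⟩
  have c1 : Continuous fun p : I × (I × (I × X)) => cs p.1 p.2 := by rw [hcs]; fun_prop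
  have c2 : Continuous fun p : I × (I × (I × X)) => sn p.1 p.2 := by rw [hsn]; fun_prop
  have hh : ∀ r p, cs r p * cs r p + sn r p * sn r p = 1 := fun r p => by
    rw [hcs, hsn]; exact sq1 _
  refine (ht_conj_fam (Bt_lp h) (L := fun r p => Ub (cs r p) (-sn r p) 1) (L' := fun r p => Ub (cs r p) (sn r p) 1)
    (cont_Ub c1 c2.neg continuous_const (fun _ => Gl.one)) (cont_Ub c1 c2 continuous_const (fun _ => Gl.one))
    (fun r p => Ub_inv' (hh r p) Gl.one)).congr ?_ ?_
  · intro p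
    have e : ∀ s : ℂ, s = 0 → Ub 1 s (1 : Matrix κ κ ℂ) = 1 := fun s hs => by
      rw [hs]; simp [Ub, Matrix.fromBlocks_one]
    have a1 : cs 0 p = 1 := by rw [hcs]; simp
    have a2 : sn 0 p = 0 := by rw [hsn]; simp
    simp only [a1, a2]
    rw [e _ rfl, e _ neg_zero]; simp
  · rintro ⟨φ, θ, x⟩
    have a1 : cs 1 (φ, θ, x) = Real.cos (Real.pi / 2 * θ) := by rw [hcs]; simp
    have a2 : sn 1 (φ, θ, x) = Real.sin (Real.pi / 2 * θ) := by rw [hsn]; simp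
    simp only [a1, a2, Ku, ua, Bt]
    have hh := sq1 (Real.pi / 2 * θ)
    have v1 := Ub_inv hh (h.mem x)
    have v2 := Ub_inv' hh (Gl.one (ι := κ))
    have v3 := Ub_inv hh (Gl.one (ι := κ))
    have b1 := Cm_half φ θ (h.mem x)
    have b2 := Cm_half (κ := κ) φ θ Gl.one
    have dm : pz (zz φ) (E1 κ κ) ∈ Gl _ := pz_mem E1_idem (zz_ne φ)
    have w0 : Complex.exp (Real.pi * (φ : ℝ) * Complex.I) ≠ 0 := Complex.exp_ne_zero _
    have i3 := Cm_inv (cdet (φ, θ)) (Gl.one (ι := κ))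
    generalize Complex.exp (Real.pi * (φ : ℝ) * Complex.I) = w at *
    generalize Cm (ca (φ, θ)) (ca' (φ, θ)) (cb (φ, θ)) (α x) = Ca at *
    generalize Cm (ca (φ, θ)) (ca' (φ, θ)) (cb (φ, θ)) (1 : Matrix κ κ ℂ) = C1 at *
    generalize Cm (ca' (φ, θ)) (ca (φ, θ)) (-cb (φ, θ)) (1 : Matrix κ κ ℂ) = C2 at *
    generalize Ub (Real.cos (Real.pi / 2 * θ) : ℂ) (Real.sin (Real.pi / 2 * θ) : ℂ) (α x) = U at *
    generalize Ub (Real.cos (Real.pi / 2 * θ) : ℂ) (-Real.sin (Real.pi / 2 * θ) : ℂ) (α x) = U' at *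
    generalize Ub (Real.cos (Real.pi / 2 * θ) : ℂ) (Real.sin (Real.pi / 2 * θ) : ℂ) (1 : Matrix κ κ ℂ) = V at *
    generalize Ub (Real.cos (Real.pi / 2 * θ) : ℂ) (-Real.sin (Real.pi / 2 * θ) : ℂ) (1 : Matrix κ κ ℂ) = V' at *
    generalize pz (zz φ) (E1 κ κ) = D at *
    have ei : (V' * U)⁻¹ = U' * V := Matrix.inv_eq_right_inv (by
      calc _ = V' * (U * U') * V := by simp only [Matrix.mul_assoc]
        _ = _ := by rw [v1, Matrix.mul_one, v2])
    have c2 : w⁻¹ • C2 = V * D⁻¹ * V' := by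
      have e1 : V * D * V' * (V * D⁻¹ * V') = 1 := by
        calc _ = V * D * (V' * V) * D⁻¹ * V' := by simp only [Matrix.mul_assoc]
          _ = V * (D * D⁻¹) * V' := by rw [v2, Matrix.mul_one, Matrix.mul_assoc V]
          _ = 1 := by rw [Gl.mul_inv dm, Matrix.mul_one, v3]
      have e2 : V * D * V' * (w⁻¹ • C2) = 1 := by
        rw [b2, Matrix.smul_mul, Matrix.mul_smul, smul_smul, mul_inv_cancel₀ w0, one_smul, i3]
      exact (Matrix.inv_eq_right_inv e2).symm.trans (Matrix.inv_eq_right_inv e1)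
    have c3 : Ca * C2 = U * D * U' * (V * D⁻¹ * V') := by
      rw [b1, ← c2, Matrix.smul_mul, Matrix.mul_smul, smul_smul, mul_inv_cancel₀ w0, one_smul]
    rw [ei, c3]
    calc _ = V' * U * D * (U' * V) * D⁻¹ * 1 := by simp only [Matrix.mul_one]
      _ = _ := by rw [← v2]; simp only [Matrix.mul_assoc]

theorem fromBlocks_comm {κ : Type} [Fintype κ] [DecidableEq κ] {w : Matrix (κ ⊕ κ) (κ ⊕ κ) ℂ} (h : w * E1 κ κ = E1 κ κ * w) :
    w = Matrix.fromBlocks w.toBlocks₁₁ 0 0 w.toBlocks₂₂ := by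
  rw [← Matrix.fromBlocks_toBlocks w, E1, Matrix.fromBlocks_multiply, Matrix.fromBlocks_multiply] at h
  simp only [Matrix.mul_one, Matrix.one_mul, Matrix.mul_zero, Matrix.zero_mul, add_zero, zero_add] at h
  obtain ⟨_, h1, h2, _⟩ := Matrix.fromBlocks_inj.1 h
  conv_lhs => rw [← Matrix.fromBlocks_toBlocks w, ← h1, h2]

theorem main_bott {X : Type} [MetricSpace X] [CompactSpace X] [Nonempty X] {A : Set X} (hA : IsClosed A)
    {g : I × (I × X) → Matrix ι ι ℂ} (hg : Lp (sus (sus A)) (Gl ι) 1 g) :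
    ∃ (κ : Type) (_ : Fintype κ) (_ : DecidableEq κ) (α : X → Matrix κ κ ℂ), Lp A (Gl κ) 1 α ∧
      SEq (sus (sus A)) g (Bt α) := by
  obtain ⟨x0⟩ := ‹Nonempty X›
  have hy : ((0 : I), x0) ∈ sus A := Or.inl rfl
  obtain ⟨κ, _, _, P, h1, h2, h3, h4⟩ := exists_proj (isClosed_sus hA) hy hg
  obtain ⟨P2, k1, k2, k3, k4⟩ := step4a hy h1 h2 h3
  obtain ⟨u, u1, u2, u3, u4, u5⟩ := transport_idem (fun q : X × I => P2 (q.2, q.1)) (by fun_prop) (fun q => k2 _)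
  simp only [] at u4 u5
  have z0 : ∀ x, P2 (0, x) = E1 κ κ := fun x => k3 _ (Or.inl rfl)
  have z1 : ∀ x, P2 (1, x) = E1 κ κ := fun x => k3 _ (Or.inr (Or.inl rfl))
  have zA : ∀ t, ∀ x ∈ A, P2 (t, x) = E1 κ κ := fun t x hx => k3 _ (Or.inr (Or.inr hx))
  obtain ⟨v, hv⟩ : ∃ v : I × X → Matrix (κ ⊕ κ) (κ ⊕ κ) ℂ, v = fun y => u (y.2, y.1) := ⟨_, rfl⟩
  have cv : Continuous v := by rw [hv]; fun_prop
  have mv : ∀ y, v y ∈ Gl _ := fun y => by rw [hv]; exact u3 _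
  have ev : ∀ x, v (1, x) * E1 κ κ = E1 κ κ * v (1, x) := fun x => by
    have := u4 x 1
    rw [z0, z1] at this
    rw [hv]; exact this
  have bv : ∀ y, y.1 = 0 ∨ y.2 ∈ A → v y = 1 := by
    rintro ⟨t, x⟩ (h | h)
    · simp only at h; subst h; rw [hv]; exact u2 x
    · rw [hv]; exact u5 x (fun t => by rw [zA t x h, zA 0 x h]) t
  have kk : (Ph ((0 : I), x0) fun p => pz (zz p.1) (P2 p.2)) = Ku (E1 κ κ) v := by
    refine ph_ku (z0 x0) mv ?_
    rintro ⟨t, x⟩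
    have := u4 x t
    rw [z0] at this
    rw [hv]; exact this
  obtain ⟨α, hα⟩ : ∃ α : X → Matrix κ κ ℂ, α = fun x => (v (1, x)).toBlocks₁₁ := ⟨_, rfl⟩
  obtain ⟨δ, hδ⟩ : ∃ α : X → Matrix κ κ ℂ, α = fun x => (v (1, x)).toBlocks₂₂ := ⟨_, rfl⟩
  have vv : ∀ x, v (1, x) = Matrix.fromBlocks (α x) 0 0 (δ x) := fun x => by
    rw [hα, hδ]; exact fromBlocks_comm (ev x)
  have αl : Lp A (Gl κ) 1 α := by
    refine ⟨?_, ?_, ?_⟩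
    · rw [hα]; exact cont_blk.comp (by fun_prop : Continuous fun x => v (1, x))
    · intro x
      have := mv (1, x)
      rw [vv, mem_GL, Matrix.det_fromBlocks_zero₂₁] at this
      exact left_ne_zero_of_mul this
    · intro x hx
      rw [hα]; simp only []
      rw [bv _ (Or.inr hx), blk_one]
  refine ⟨κ, inferInstance, inferInstance, α, αl, ?_⟩
  rw [kk] at k4
  have αc := αl.cont
  have uc : Continuous (ua α) := by
    unfold ua
    exact (cont_Ub (by fun_prop) (by fun_prop) continuous_const (fun _ => Gl.one)).matrix_mul
      (cont_Ub (by fun_prop) (by fun_prop) (by fun_prop) (fun _ => αl.mem _))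
  have um : ∀ y, ua α y ∈ Gl _ := fun y =>
    Gl.mul (Gl.of_mul (Ub_inv' (sq1 _) Gl.one)) (Gl.of_mul (Ub_inv (sq1 _) (αl.mem _)))
  have ub : ∀ y, y.1 = 0 ∨ y.2 ∈ A → ua α y = 1 := by
    rintro ⟨t, x⟩ (h | h)
    · simp only at h; subst h
      simp [ua, Ub, Matrix.fromBlocks_one]
    · simp only [ua, αl.bd x h]
      exact Ub_inv' (sq1 _) Gl.one
  have u1' : ∀ x, ua α (1, x) = Matrix.fromBlocks (α x) 0 0 (α x)⁻¹ := fun x => by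
    simp only [ua, Ub, Matrix.fromBlocks_multiply]
    simp
  have s5 := ku_seq cv uc mv um bv ub ev (fun x => by rw [u1']; simp [Matrix.fromBlocks_multiply]) (fun x => by
    refine ⟨α x * δ x, ?_⟩
    have : (ua α (1, x))⁻¹ = Matrix.fromBlocks (α x)⁻¹ 0 0 (α x) := Matrix.inv_eq_right_inv (by
      rw [u1', Matrix.fromBlocks_multiply]; simp [Gl.mul_inv (αl.mem x), Gl.inv_mul (αl.mem x), Matrix.fromBlocks_one])
    rw [this, vv, Matrix.fromBlocks_multiply]
    simp [Gl.inv_mul (αl.mem x)])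
  exact ((h4.trans k4).trans s5).trans (ku_bt αl).symm.seq

end bott2
end PU
end part17

section part18
open scoped unitInterval Topology Matrix
set_option linter.unusedVariables false
set_option linter.unusedSimpArgs false
set_option linter.unusedSectionVars false
namespace PU

section gen
variable {M : Type} [Fintype M] [DecidableEq M]

theorem exists_swap (j l : M) : ∃ B : Matrix M M ℂ, B ∈ Gl M ∧ ∀ a : ℂ,
    B * Matrix.diagonal (Function.update (1 : M → ℂ) j a) = Matrix.diagonal (Function.update (1 : M → ℂ) l a) * B := by
  refine ⟨(1 : Matrix M M ℂ).submatrix (Equiv.swap j l) id, ?_, ?_⟩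
  · rw [mem_GL, Matrix.det_permute]
    simp
  · intro a
    ext i k
    rw [Matrix.mul_diagonal, Matrix.diagonal_mul]
    simp only [Matrix.submatrix_apply, id, Matrix.one_apply]
    split_ifs with h
    · rw [← h, one_mul, mul_one]
      by_cases hi : i = l
      · subst hi; simp
      · rw [Function.update_of_ne hi, Function.update_of_ne]
        · rfl
        · intro h2; apply hi; have := congrArg (Equiv.swap j l) h2; simpa using this
    · simp

theorem prod_update (a : ℂ) (L : List M) (hn : L.Nodup) (i : M) :
    (L.map fun j => Function.update (1 : M → ℂ) j a i).prod = if i ∈ L then a else 1 := by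
  induction L with
  | nil => simp
  | cons x L ih =>
    obtain ⟨h1, h2⟩ := List.nodup_cons.1 hn
    rw [List.map_cons, List.prod_cons, ih h2]
    by_cases hx : i = x
    · subst hx; simp [h1]
    · simp [Function.update_of_ne hx, hx]

theorem exists_D (l : M) : ∃ D : I × ℂ → Matrix M M ℂ, Continuous D ∧ (∀ a, D (0, a) = a • 1) ∧
    (∀ a, D (1, a) = Matrix.diagonal (Function.update (1 : M → ℂ) l (a ^ Fintype.card M))) ∧
    ∀ t a, a ≠ 0 → D (t, a) ∈ Gl M := by
  choose B hB hB2 using fun j => exists_swap (M := M) j l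
  choose p p1 p2 p3 p4 using fun j => Gl.path (hB j)
  have pi : ∀ j, Continuous fun t => (p j t)⁻¹ := fun j => cont_inv (p1 j) (p2 j)
  obtain ⟨T, hT⟩ : ∃ T : M → I × ℂ → Matrix M M ℂ, T = fun (j : M) (q : I × ℂ) => p j (unitInterval.symm q.1) *
    Matrix.diagonal (Function.update (1 : M → ℂ) j q.2) * (p j (unitInterval.symm q.1))⁻¹ := ⟨_, rfl⟩
  have cT : ∀ j, Continuous (T j) := fun j => by
    rw [hT]
    have c1 := p1 j
    have c2 : Continuous fun q : I × ℂ => (p j (unitInterval.symm q.1))⁻¹ :=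
      (pi j).comp (by fun_prop : Continuous fun q : I × ℂ => unitInterval.symm q.1)
    have c3 : Continuous fun q : I × ℂ => (Matrix.diagonal (Function.update (1 : M → ℂ) j q.2)) :=
      Continuous.matrix_diagonal (by fun_prop)
    exact ((c1.comp (by fun_prop)).matrix_mul c3).matrix_mul c2
  refine ⟨fun q => ((Finset.univ : Finset M).toList.map fun j => T j q).prod, ?_, ?_, ?_, ?_⟩
  · exact continuous_list_prod _ fun j _ => cT j
  · intro a
    have : ∀ j, T j (0, a) = Matrix.diagonalRingHom M ℂ (Function.update (1 : M → ℂ) j a) := fun j => by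
      rw [hT]; simp [p4]
    simp only [this]
    rw [← Function.comp_def (Matrix.diagonalRingHom M ℂ), ← List.map_map, ← map_list_prod]
    rw [← Matrix.diagonal_one, ← Matrix.diagonal_smul]
    show Matrix.diagonal _ = _
    congr 1
    funext i
    have e1 := map_list_prod (Pi.evalMonoidHom (fun _ : M => ℂ) i) ((Finset.univ : Finset M).toList.map fun j => Function.update (1 : M → ℂ) j a)
    rw [Pi.evalMonoidHom_apply] at e1
    rw [e1, List.map_map]
    simp only [Function.comp_def, Pi.evalMonoidHom_apply]
    rw [prod_update a _ (Finset.nodup_toList _)]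
    simp
  · intro a
    have : ∀ j, T j (1, a) = Matrix.diagonal (Function.update (1 : M → ℂ) l a) := fun j => by
      rw [hT]; simp only [unitInterval.symm_one, p3]
      rw [hB2, Matrix.mul_assoc, Gl.mul_inv (hB j), Matrix.mul_one]
    simp only [this]
    rw [List.map_const', List.prod_replicate, Matrix.diagonal_pow]
    congr 1
    funext i
    simp only [Finset.length_toList, Finset.card_univ, Pi.pow_apply]
    by_cases hi : i = l
    · subst hi; simp
    · simp [Function.update_of_ne hi]
  · intro t a ha
    have hj : ∀ j, T j (t, a) ∈ Gl M := fun j => by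
      rw [hT]
      refine Gl.mul (Gl.mul (p2 _ _) ?_) (Gl.inv (p2 _ _))
      rw [mem_GL, Matrix.det_diagonal, Finset.prod_ne_zero_iff]
      intro i _
      by_cases hi : i = j
      · subst hi; simpa using ha
      · simp [Function.update_of_ne hi]
    generalize (Finset.univ : Finset M).toList = L
    induction L with
    | nil => simpa using Gl.one
    | cons x L ih => simp only [] at ih ⊢; rw [List.map_cons, List.prod_cons]; exact Gl.mul (hj x) ih

/-- Generators: homogeneous maps to the linear group. -/
structure Gen (l : M) (F : (M → ℂ) → Matrix M M ℂ) (d : ℕ) : Prop where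
  cont : ContinuousOn F (nz (M → ℂ))
  mem : ∀ w, w ≠ 0 → F w ∈ Gl M
  hom : ∀ (r : ℝ) w, 0 < r → F (r • w) = F w
  base : F (Pi.single l 1) = 1
  deg : Deg (Pi.single l 1 : M → ℂ) (fun y => ‖y‖ • (F y *ᵥ Pi.single l 1)) d

/-- A homogeneous bounded extension by zero is continuous. -/
theorem cont_scale0 {W E : Type*} [NormedAddCommGroup W] [NormedSpace ℝ W] [FiniteDimensional ℝ W]
    [NormedAddCommGroup E] [NormedSpace ℝ E]
    {F : W → E} (hc : ContinuousOn F (nz W)) (hom : ∀ (r : ℝ) w, 0 < r → F (r • w) = F w) :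
    Continuous fun y => ‖y‖ • F y := by
  rw [continuous_iff_continuousAt]
  intro y
  by_cases hy : y = 0
  · subst hy
    have hs : Metric.sphere (0 : W) 1 ⊆ nz W := fun w hw => by
      rw [mem_nz]; rintro rfl; simp at hw
    have : ProperSpace W := FiniteDimensional.proper_real W
    obtain ⟨C, hC⟩ := ((isCompact_sphere (0 : W) 1).image_of_continuousOn (hc.mono hs)).isBounded.exists_norm_le
    have hb : ∀ w : W, ‖‖w‖ • F w‖ ≤ ‖w‖ * C := fun w => by
      rw [norm_smul, norm_norm]
      by_cases hw : w = 0
      · simp [hw]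
      · have hp : 0 < ‖w‖ := norm_pos_iff.2 hw
        refine mul_le_mul_of_nonneg_left ?_ hp.le
        rw [← hom ‖w‖⁻¹ w (inv_pos.2 hp)]
        refine hC _ ⟨_, ?_, rfl⟩
        simp [norm_smul, hp.ne']
    have h0 : ‖(0 : W)‖ • F 0 = 0 := by simp
    rw [ContinuousAt, h0]
    refine squeeze_zero_norm hb ?_
    have : Continuous fun w : W => ‖w‖ * C := by fun_prop
    simpa using this.tendsto 0
  · have : ContinuousAt F y := hc.continuousAt ((isOpen_compl_singleton (x := (0:W))).mem_nhds hy)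
    exact continuous_norm.continuousAt.smul this

theorem cont_scale {W ι κ : Type*} [NormedAddCommGroup W] [NormedSpace ℝ W] [FiniteDimensional ℝ W]
    {F : W → Matrix ι κ ℂ} (hc : ContinuousOn F (nz W)) (hom : ∀ (r : ℝ) w, 0 < r → F (r • w) = F w) :
    Continuous fun y => ‖y‖ • F y := by
  refine continuous_matrix fun i j => ?_
  have := cont_scale0 (F := fun w => F w i j) ?_ (fun r w hr => by simp only [hom r w hr])
  · exact this
  · exact (continuous_apply_apply i j).comp_continuousOn hc
end gen
end PU
end part18

section part19
open scoped unitInterval Topology Matrix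
set_option linter.unusedVariables false
set_option linter.unusedSimpArgs false
set_option linter.unusedSectionVars false
namespace PU

section gen
variable {M N ι : Type} [Fintype M] [DecidableEq M] [Fintype N] [DecidableEq N] [Fintype ι] [DecidableEq ι]

theorem ht_quot {K : Type*} [TopologicalSpace K] (k0 : K) (H : I → K → Matrix N N ℂ)
    (hc : Continuous fun p : I × K => H p.1 p.2) (hm : ∀ s k, H s k ∈ Gl N) :
    Ht {k0} (Gl N) 1 (fun w => H 0 w * (H 0 k0)⁻¹) (fun w => H 1 w * (H 1 k0)⁻¹) := by
  refine Ht.mk (fun s w => H s w * (H s k0)⁻¹) ?_ (fun s w => Gl.mul (hm _ _) (Gl.inv (hm _ _))) ?_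
  · have c2 : Continuous fun p : I × K => H p.1 k0 := hc.comp (by fun_prop : Continuous fun p : I × K => (p.1, k0))
    exact hc.matrix_mul (cont_inv c2 fun p => hm _ _)
  · rintro s w rfl
    exact Gl.mul_inv (hm _ _)

theorem ht_push {K : Type*} [TopologicalSpace K] (k0 : K) (T : K → Matrix N N ℂ) (hc : Continuous T)
    (hm : ∀ k, T k ∈ Gl N) {J : Matrix N ι ℂ} {L : Matrix ι N ℂ} (h : L * J = 1)
    (hp : ∀ k, T k * (1 - J * L) = 1 - J * L) :
    (∀ k, L * T k * J ∈ Gl ι) ∧ Ht {k0} (Gl N) 1 (fun w => T w * (T k0)⁻¹)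
      (fun w => ext J L (L * T w * J * (L * T k0 * J)⁻¹)) := by
  obtain ⟨P, hP⟩ : ∃ P, P = 1 - J * L := ⟨_, rfl⟩
  rw [← hP] at hp
  have LP : L * P = 0 := by rw [hP, Matrix.mul_sub, Matrix.mul_one, ← Matrix.mul_assoc, h, Matrix.one_mul, sub_self]
  have PJ : P * J = 0 := by rw [hP, Matrix.sub_mul, Matrix.one_mul, Matrix.mul_assoc, h, Matrix.mul_one, sub_self]
  have PP : P * P = P := by
    nth_rw 1 [hP]; rw [Matrix.sub_mul, Matrix.one_mul, Matrix.mul_assoc, LP, Matrix.mul_zero, sub_zero]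
  have one : (1 : Matrix N N ℂ) = P + J * L := by rw [hP]; simp
  obtain ⟨V, hV⟩ : ∃ V : K → Matrix N N ℂ, V = fun k => P * T k * J * L := ⟨_, rfl⟩
  have VV : ∀ k, V k * V k = 0 := fun k => by
    rw [hV]
    have : P * T k * J * L * (P * T k * J * L) = P * T k * J * (L * P) * (T k * J * L) := by simp only [Matrix.mul_assoc]
    simp only []
    rw [this, LP]; simp
  have dec : ∀ k, ext J L (L * T k * J) * (1 + V k) = T k := fun k => by
    have e1 : ext J L (L * T k * J) = P + J * (L * T k * J) * L := by
      rw [ext, Matrix.mul_sub, Matrix.sub_mul, Matrix.mul_one, hP]; abel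
    have e2 : (P + J * (L * T k * J) * L) * V k = P * T k * J * L := by
      rw [hV, Matrix.add_mul]
      have a1 : P * (P * T k * J * L) = (P * P) * T k * J * L := by simp only [Matrix.mul_assoc]
      have a2 : J * (L * T k * J) * L * (P * T k * J * L) = J * (L * T k * J) * (L * P) * (T k * J * L) := by
        simp only [Matrix.mul_assoc]
      simp only []
      rw [a1, a2, LP, PP]; simp
    rw [e1, Matrix.mul_add, Matrix.mul_one, e2]
    have e3 : T k = P * T k * J * L + J * (L * T k * J) * L + P := by
      calc T k = (P + J * L) * T k * (P + J * L) := by rw [← one]; simp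
        _ = (P + J * L) * T k * (J * L) + (P + J * L) * (T k * P) := by
          rw [Matrix.mul_add, add_comm, Matrix.mul_assoc _ (T k) P]
        _ = _ := by rw [hp, Matrix.add_mul, Matrix.add_mul, Matrix.add_mul, PP, Matrix.mul_assoc J L P, LP]; simp [Matrix.mul_assoc]
    refine Eq.trans ?_ e3.symm; abel
  have gm : ∀ k, L * T k * J ∈ Gl ι := fun k => by
    have h1 : ext J L (L * T k * J) ∈ Gl N := by
      intro h0
      have := hm k
      rw [mem_GL, ← dec k, Matrix.det_mul, h0, zero_mul] at this
      exact this rfl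
    refine mem_GL.2 fun h0 => ?_
    obtain ⟨v, hv, hv2⟩ := Matrix.exists_mulVec_eq_zero_iff.2 h0
    refine mulVec_ne h1 (v := J *ᵥ v) ?_ ?_
    · intro h3
      apply hv
      have := congrArg (L *ᵥ ·) h3
      simpa [Matrix.mulVec_mulVec, h] using this
    · rw [ext, Matrix.mulVec_mulVec, Matrix.add_mul, Matrix.mul_assoc (J * _), h, Matrix.mul_one, Matrix.one_mul,
        Matrix.mul_sub, Matrix.mul_one, add_sub_cancel, ← Matrix.mulVec_mulVec, hv2, Matrix.mulVec_zero]
  refine ⟨gm, ?_⟩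
  have cV : Continuous V := by rw [hV]; fun_prop
  have m1 : ∀ (s : ℂ) k, 1 + s • V k ∈ Gl N := fun s k => by
    refine Gl.of_mul (B := 1 - s • V k) ?_
    rw [Matrix.mul_sub, Matrix.mul_one, Matrix.add_mul, Matrix.one_mul, Matrix.smul_mul, Matrix.mul_smul, VV]
    simp
  have key := ht_quot k0 (fun (s : I) k => ext J L (L * T k * J) * (1 + ((unitInterval.symm s : ℝ) : ℂ) • V k))
    ((cont_ext3 continuous_const continuous_const (by fun_prop)).matrix_mul (by fun_prop))
    (fun s k => Gl.mul (ext_mem h (gm k)) (m1 _ _))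
  refine key.congr (fun x => ?_) (fun x => ?_)
  · simp [dec]
  · simp only [ext_mul h, ← ext_inv h (gm k0)]; simp

/-- The Clifford-type map. -/
noncomputable def Cc (F : (M → ℂ) → Matrix M M ℂ) (w : M ⊕ Unit → ℂ) : Matrix (M ⊕ M) (M ⊕ M) ℂ :=
  Matrix.fromBlocks (w (Sum.inr ()) • 1) (Complex.I • ‖w ∘ Sum.inl‖ • (F (w ∘ Sum.inl))⁻¹)
    (Complex.I • ‖w ∘ Sum.inl‖ • F (w ∘ Sum.inl)) ((starRingEnd ℂ) (w (Sum.inr ())) • 1)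

variable {l : M} {F : (M → ℂ) → Matrix M M ℂ} {d : ℕ}

theorem Gen.contR (h : Gen l F d) : Continuous fun y => ‖y‖ • F y := cont_scale h.cont h.hom

theorem Gen.contR' (h : Gen l F d) : Continuous fun y => ‖y‖ • (F y)⁻¹ := by
  refine cont_scale (F := fun y => (F y)⁻¹) ?_ fun r w hr => by simp only [h.hom r w hr]
  exact continuousOn_inv.comp h.cont fun w hw => h.mem w hw

theorem Gen.contC (h : Gen l F d) : Continuous (Cc F) := by
  have h1 := h.contR
  have h2 := h.contR'
  have c0 : Continuous fun w : M ⊕ Unit → ℂ => w ∘ Sum.inl := by fun_prop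
  have h3 := h1.comp c0
  have h4 := h2.comp c0
  unfold Cc
  refine Continuous.matrix_fromBlocks (by fun_prop) (h4.const_smul Complex.I) (h3.const_smul Complex.I) ?_
  have : Continuous fun w : M ⊕ Unit → ℂ => (starRingEnd ℂ) (w (Sum.inr ())) :=
    Complex.continuous_conj.comp (by fun_prop)
  exact this.smul continuous_const

theorem Gen.homC (h : Gen l F d) (r : ℝ) (hr : 0 < r) (w : M ⊕ Unit → ℂ) : Cc F (r • w) = (r : ℂ) • Cc F w := by
  have e : (r • w) ∘ Sum.inl = r • (w ∘ Sum.inl) := rfl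
  rw [Cc, Cc, e, h.hom r _ hr, Matrix.fromBlocks_smul, norm_smul, Real.norm_of_nonneg hr.le]
  have e2 : ∀ x : ℝ, ∀ B : Matrix M M ℂ, (r * x) • B = (r : ℂ) • x • B := fun x B => by
    rw [mul_smul]; rfl
  congr 1
  · simp [mul_smul]
  · rw [e2, smul_comm]
  · rw [e2, smul_comm]
  · simp [mul_smul]

theorem Gen.memC (h : Gen l F d) {w : M ⊕ Unit → ℂ} (hw : w ≠ 0) : Cc F w ∈ Gl (M ⊕ M) := by
  obtain ⟨y, hy⟩ : ∃ y, y = w ∘ Sum.inl := ⟨_, rfl⟩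
  obtain ⟨a, ha⟩ : ∃ a, a = w (Sum.inr ()) := ⟨_, rfl⟩
  have hpos : (Complex.normSq a + ‖y‖ * ‖y‖ : ℝ) ≠ 0 := by
    intro h0
    have h1 := Complex.normSq_nonneg a
    have h2 := mul_self_nonneg ‖y‖
    have h3 : a = 0 := Complex.normSq_eq_zero.1 (by linarith)
    have h4 : y = 0 := by
      have : ‖y‖ * ‖y‖ = 0 := by linarith
      simpa using this
    apply hw
    funext i
    rcases i with i | ⟨⟩
    · exact congrFun (hy.symm.trans h4) i
    · exact ha.symm.trans h3
  have c1 : (‖y‖ • F y) * (‖y‖ • (F y)⁻¹) = ((‖y‖ * ‖y‖ : ℝ) : ℂ) • 1 := by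
    by_cases h0 : y = 0
    · simp [h0]
    · rw [Matrix.smul_mul, Matrix.mul_smul, Gl.mul_inv (h.mem y h0), smul_smul]; rfl
  have c2 : (‖y‖ • (F y)⁻¹) * (‖y‖ • F y) = ((‖y‖ * ‖y‖ : ℝ) : ℂ) • 1 := by
    by_cases h0 : y = 0
    · simp [h0]
    · rw [Matrix.smul_mul, Matrix.mul_smul, Gl.inv_mul (h.mem y h0), smul_smul]; rfl
  have key : Cc F w * (Matrix.fromBlocks ((starRingEnd ℂ) a • 1) (-Complex.I • ‖y‖ • (F y)⁻¹)
      (-Complex.I • ‖y‖ • F y) (a • 1) : Matrix _ _ ℂ) = ((Complex.normSq a + ‖y‖ * ‖y‖ : ℝ) : ℂ) • 1 := by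
    rw [Cc, ← hy, ← ha, Matrix.fromBlocks_multiply, ← Matrix.fromBlocks_one, Matrix.fromBlocks_smul]
    simp only [Matrix.smul_mul _ (_ • _ : Matrix M M ℂ), Matrix.smul_mul Complex.I, Matrix.mul_smul _ Complex.I,
      Matrix.mul_smul _ (-Complex.I), c1, c2, Matrix.mul_one, Matrix.one_mul, smul_smul, ← add_smul,
      Matrix.smul_mul a, Matrix.smul_mul (starRingEnd ℂ a), Matrix.mul_smul _ a, Matrix.mul_smul _ (starRingEnd ℂ a), smul_zero]
    have i2 := Complex.I_mul_I
    congr 1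
    · congr 1; push_cast; rw [Complex.normSq_eq_conj_mul_self]; linear_combination (-(‖y‖ : ℂ) * ‖y‖) * i2
    · exact szero (by ring1)
    · exact szero (by ring1)
    · congr 1; push_cast; rw [Complex.normSq_eq_conj_mul_self]; linear_combination (-(‖y‖ : ℂ) * ‖y‖) * i2
  refine Gl.of_mul (B := ((Complex.normSq a + ‖y‖ * ‖y‖ : ℝ) : ℂ)⁻¹ • (Matrix.fromBlocks ((starRingEnd ℂ) a • 1) (-Complex.I • ‖y‖ • (F y)⁻¹)
      (-Complex.I • ‖y‖ • F y) (a • 1) : Matrix _ _ ℂ)) ?_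
  rw [Matrix.mul_smul, key, smul_smul, inv_mul_cancel₀ (by exact_mod_cast hpos), one_smul]
end gen
end PU
end part19

section part20
open scoped unitInterval Topology Matrix
set_option linter.unusedVariables false
set_option linter.unusedSimpArgs false
set_option linter.unusedSectionVars false
namespace PU

section gen
variable {M N ι : Type} [Fintype M] [DecidableEq M] [Fintype N] [DecidableEq N] [Fintype ι] [DecidableEq ι]
variable {l : M} {F : (M → ℂ) → Matrix M M ℂ} {d : ℕ}

set_option maxHeartbeats 1000000 in
theorem Gen.partA (h : Gen l F d) (k0 : Metric.sphere (0 : M ⊕ Unit → ℂ) 1) :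
    ∃ (G : Metric.sphere (0 : M ⊕ Unit → ℂ) 1 → Matrix (M ⊕ Unit) (M ⊕ Unit) ℂ)
      (J : Matrix (M ⊕ M) (M ⊕ Unit) ℂ) (L : Matrix (M ⊕ Unit) (M ⊕ M) ℂ),
      Continuous G ∧ (∀ w, G w ∈ Gl _) ∧ L * J = 1 ∧
      (∀ w, G w *ᵥ ev M = Sum.elim ((‖w.1 ∘ Sum.inl‖ • F (w.1 ∘ Sum.inl)) *ᵥ Pi.single l 1)
        (fun _ => (w.1 (Sum.inr ())) ^ Fintype.card M)) ∧
      Ht {k0} (Gl (M ⊕ M)) 1 (fun w => Cc F w.1 * (Cc F k0.1)⁻¹) (fun w => ext J L (G w * (G k0)⁻¹)) := by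
  obtain ⟨D, D1, D2, D3, D4⟩ := exists_D l
  have hR := h.contR
  obtain ⟨R, hRd⟩ : ∃ R : (M → ℂ) → Matrix M M ℂ, R = fun y => ‖y‖ • F y := ⟨_, rfl⟩
  rw [← hRd] at hR
  have Rm : ∀ y, y ≠ 0 → R y ∈ Gl M := fun y hy => by
    rw [hRd]
    have : ‖y‖ • F y = (‖y‖ • (1 : Matrix M M ℂ)) * F y := by simp
    simp only []
    rw [this]
    refine Gl.mul ?_ (h.mem y hy)
    refine Gl.of_mul (B := ‖y‖⁻¹ • (1 : Matrix M M ℂ)) ?_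
    rw [Matrix.smul_mul, Matrix.one_mul, smul_smul, mul_inv_cancel₀ (norm_ne_zero_iff.2 hy), one_smul]
  obtain ⟨Δ, hΔ⟩ : ∃ Δ : I → Matrix M M ℂ, Δ = fun t : I => Matrix.diagonal (Function.update (fun _ => (1 - (t : ℝ) : ℂ)) l 1) := ⟨_, rfl⟩
  have cΔ : Continuous Δ := by
    rw [hΔ]; exact Continuous.matrix_diagonal (by fun_prop)
  obtain ⟨ph, hph⟩ : ∃ ph : I → ℂ, ph = fun t : I => Complex.exp (Complex.I * (Real.pi / 2 * (1 - (t : ℝ)) : ℂ)) := ⟨_, rfl⟩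
  have cph : Continuous ph := by rw [hph]; fun_prop
  obtain ⟨f, hf⟩ : ∃ f : Metric.sphere (0 : M ⊕ Unit → ℂ) 1 × I → Matrix (M ⊕ M) M ℂ, f = fun p =>
    Matrix.fromRows (D (p.2, p.1.1 (Sum.inr ()))) (ph p.2 • (R (p.1.1 ∘ Sum.inl) * Δ p.2)) := ⟨_, rfl⟩
  have cf : Continuous f := by
    have cv : Continuous fun p : Metric.sphere (0 : M ⊕ Unit → ℂ) 1 × I => p.1.1 := continuous_subtype_val.comp continuous_fst
    have c1 : Continuous fun p : Metric.sphere (0 : M ⊕ Unit → ℂ) 1 × I => D (p.2, p.1.1 (Sum.inr ())) :=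
      D1.comp (continuous_snd.prodMk ((continuous_apply (Sum.inr ())).comp cv))
    have c0 : Continuous fun p : Metric.sphere (0 : M ⊕ Unit → ℂ) 1 × I => (p.1.1 ∘ Sum.inl : M → ℂ) :=
      (Pi.continuous_precomp' (Sum.inl : M → M ⊕ Unit)).comp cv
    have c2 : Continuous fun p : Metric.sphere (0 : M ⊕ Unit → ℂ) 1 × I => ph p.2 • (R (p.1.1 ∘ Sum.inl) * Δ p.2) :=
      (cph.comp continuous_snd).smul ((hR.comp c0).matrix_mul (cΔ.comp continuous_snd))
    rw [hf]
    refine continuous_matrix fun i j => ?_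
    rcases i with i | i
    · exact (continuous_apply_apply i j).comp c1
    · exact (continuous_apply_apply i j).comp c2
  have inj : ∀ p, ((f p)ᴴ * f p).det ≠ 0 := by
    rintro ⟨w, t⟩
    refine frame_of_inj ?_
    have hz : ∀ v, f (w, t) *ᵥ v = 0 → v = 0 := by
      intro v hv
      rw [hf] at hv
      simp only [Matrix.fromRows_mulVec] at hv
      have h1 : D (t, w.1 (Sum.inr ())) *ᵥ v = 0 := funext fun i => congrFun hv (Sum.inl i)
      have h2 : (ph t • (R (w.1 ∘ Sum.inl) * Δ t)) *ᵥ v = 0 := funext fun i => congrFun hv (Sum.inr i)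
      by_cases ha : w.1 (Sum.inr ()) = 0
      · have hy : w.1 ∘ Sum.inl ≠ 0 := fun h0 => by
          have h5 := w.2
          have : w.1 = 0 := by
            funext i; rcases i with i | ⟨⟩
            · exact congrFun h0 i
            · exact ha
          rw [this] at h5; simp at h5
        rw [Matrix.smul_mulVec, ← Matrix.mulVec_mulVec] at h2
        have h3 : R (w.1 ∘ Sum.inl) *ᵥ (Δ t *ᵥ v) = 0 := by
          refine (smul_eq_zero.1 h2).resolve_left ?_
          rw [hph]; exact Complex.exp_ne_zero _
        have h4 : Δ t *ᵥ v = 0 := by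
          by_contra hne; exact mulVec_ne (Rm _ hy) hne h3
        rw [hΔ] at h4
        have h6 : ∀ i, Function.update (fun _ => (1 - (t : ℝ) : ℂ)) l 1 i * v i = 0 := fun i => by
          have := congrFun h4 i
          simpa only [Matrix.mulVec_diagonal, Pi.zero_apply] using this
        have hl : v l = 0 := by simpa using h6 l
        by_cases ht : t = 1
        · rw [ht, D3] at h1
          funext i
          by_cases hi : i = l
          · subst hi; simpa using hl
          · have := congrFun h1 i
            simpa [Matrix.mulVec_diagonal, Function.update_of_ne hi] using this
        · funext i
          by_cases hi : i = l
          · subst hi; simpa using hl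
          · have := h6 i
            rw [Function.update_of_ne hi] at this
            refine (mul_eq_zero.1 this).resolve_left fun h0 => ht ?_
            have : ((t : ℝ) : ℂ) = 1 := (sub_eq_zero.1 h0).symm
            exact Subtype.ext (by exact_mod_cast this)
      · by_contra hne
        exact mulVec_ne (D4 t _ ha) hne h1
    intro v v' hv
    have := hz (v - v') (by rw [Matrix.mulVec_sub, sub_eq_zero]; exact hv)
    exact sub_eq_zero.1 this
  obtain ⟨u, u1, u2, u3, u4, -⟩ := transport_frame f cf inj
  have f0 : ∀ w : Metric.sphere (0 : M ⊕ Unit → ℂ) 1, f (w, 0) = Cc F w.1 * i1 M M := fun w => by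
    rw [hf, Cc, i1, Matrix.fromBlocks_mul_fromRows]
    simp only [D2, hph, hΔ, hRd]
    have e1 : Matrix.diagonal (Function.update (fun _ : M => (1 - (((0 : I) : ℝ) : ℂ) : ℂ)) l 1) = 1 := by
      rw [← Matrix.diagonal_one]; congr 1; funext i
      by_cases hi : i = l
      · subst hi; simp
      · simp [Function.update_of_ne hi]
    have e2 : Complex.exp (Complex.I * (Real.pi / 2 * (1 - (((0 : I) : ℝ) : ℂ)))) = Complex.I := by
      simp only [Set.Icc.coe_zero, Complex.ofReal_zero, sub_zero, mul_one]
      rw [mul_comm, Complex.exp_pi_div_two_mul_I]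
    rw [e1, e2]; simp
  obtain ⟨c, hc⟩ : ∃ c : Matrix M Unit ℂ, c = Matrix.of fun i _ => if i = l then 1 else 0 := ⟨_, rfl⟩
  have cc : cᵀ * c = 1 := by
    ext i j; rw [hc]; simp [Matrix.mul_apply]
  have cc2 : c * cᵀ = Matrix.diagonal (Pi.single l 1) := by
    ext i j
    rw [hc]; simp [Matrix.mul_apply, Matrix.diagonal_apply, Pi.single_apply]
    by_cases hi : i = l
    · by_cases hj : j = l
      · simp [hi, hj]
      · simp [hi, hj, Ne.symm hj]
    · by_cases hj : j = l
      · simp [hi, hj]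
      · simp [hi, hj]
  obtain ⟨J, hJ⟩ : ∃ J : Matrix (M ⊕ M) (M ⊕ Unit) ℂ, J = Matrix.fromBlocks 0 c 1 0 := ⟨_, rfl⟩
  obtain ⟨L, hL⟩ : ∃ L : Matrix (M ⊕ Unit) (M ⊕ M) ℂ, L = Matrix.fromBlocks 0 1 cᵀ 0 := ⟨_, rfl⟩
  have LJ : L * J = 1 := by
    rw [hL, hJ, Matrix.fromBlocks_multiply]; simp [cc, Matrix.fromBlocks_one]
  obtain ⟨T, hT⟩ : ∃ T : Metric.sphere (0 : M ⊕ Unit → ℂ) 1 → Matrix (M ⊕ M) (M ⊕ M) ℂ, T = fun w => u (w, 1) * Cc F w.1 := ⟨_, rfl⟩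
  have wne : ∀ w : Metric.sphere (0 : M ⊕ Unit → ℂ) 1, w.1 ≠ 0 := fun w h0 => by
    have := w.2; rw [h0] at this; simp at this
  have cC : Continuous fun w : Metric.sphere (0 : M ⊕ Unit → ℂ) 1 => Cc F w.1 := h.contC.comp continuous_subtype_val
  have Tc : Continuous T := by rw [hT]; fun_prop
  have Tm : ∀ w, T w ∈ Gl _ := fun w => by rw [hT]; exact Gl.mul (u3 _) (h.memC (wne w))
  have Ti : ∀ w, T w * i1 M M = f (w, 1) := fun w => by
    rw [hT]; simp only []
    rw [Matrix.mul_assoc, ← f0, u4]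
  have f1 : ∀ w, f (w, 1) = Matrix.fromRows (Matrix.diagonal (Function.update (1 : M → ℂ) l (w.1 (Sum.inr ()) ^ Fintype.card M)))
      (R (w.1 ∘ Sum.inl) * Matrix.diagonal (Pi.single l 1)) := fun w => by
    rw [hf]; simp only [D3, hph, hΔ]
    have e1 : (Function.update (fun _ : M => (1 - (((1 : I) : ℝ) : ℂ) : ℂ)) l 1) = Pi.single l 1 := by
      rw [Pi.single]; congr 1; funext i; simp
    rw [e1]; simp
  have hp : ∀ w, T w * (1 - J * L) = 1 - J * L := fun w => by
    have e1 : 1 - J * L = i1 M M * (((1 : Matrix M M ℂ) - Matrix.diagonal (Pi.single l 1)) * p1 M M : Matrix M (M ⊕ M) ℂ) := by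
      rw [hL, hJ, Matrix.fromBlocks_multiply, ← Matrix.fromBlocks_one, sub_eq_add_neg, Matrix.fromBlocks_neg,
        Matrix.fromBlocks_add, ← cc2, i1, p1, Matrix.mul_fromCols, Matrix.fromRows_mul_fromCols]
      simp [sub_eq_add_neg]
    have e2 : f (w, 1) * ((1 : Matrix M M ℂ) - Matrix.diagonal (Pi.single l 1)) = i1 M M * ((1 : Matrix M M ℂ) - Matrix.diagonal (Pi.single l 1)) := by
      rw [f1, i1, Matrix.fromRows_mul, Matrix.fromRows_mul, Matrix.mul_assoc, Matrix.zero_mul, Matrix.one_mul,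
        ← Matrix.diagonal_one, Matrix.diagonal_sub, Matrix.diagonal_mul_diagonal, Matrix.diagonal_mul_diagonal]
      congr 1
      · congr 1; funext i
        by_cases hi : i = l
        · subst hi; simp
        · simp [Function.update_of_ne hi]
      · convert Matrix.mul_zero _
        rw [← Matrix.diagonal_zero]; congr 1; funext i
        by_cases hi : i = l
        · subst hi; simp
        · simp [Pi.single_eq_of_ne hi]
    rw [e1, ← Matrix.mul_assoc, Ti, ← Matrix.mul_assoc, e2, Matrix.mul_assoc]
  obtain ⟨gm, gh⟩ := ht_push k0 T Tc Tm LJ hp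
  refine ⟨fun w => L * T w * J, J, L, by fun_prop, gm, LJ, fun w => ?_, ?_⟩
  · have e1 : J *ᵥ ev M = i1 M M *ᵥ Pi.single l 1 := by
      rw [hJ, i1, ev]
      funext i
      rcases i with i | i
      · have : (1 : Matrix M M ℂ) i l = if i = l then 1 else 0 := Matrix.one_apply
        simp [hc, Matrix.fromBlocks, Matrix.fromRows]
        exact this.symm
      · simp [hc, Matrix.fromBlocks, Matrix.fromRows]
        rfl
    rw [← Matrix.mulVec_mulVec, e1, Matrix.mulVec_mulVec, Matrix.mul_assoc, Ti, f1, hL, Matrix.fromBlocks_mul_fromRows, Matrix.fromRows_mulVec]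
    simp only [Matrix.zero_mul, Matrix.one_mul, zero_add, add_zero]
    rw [← Matrix.mulVec_mulVec, ← Matrix.mulVec_mulVec]
    have e2 : Matrix.diagonal (Pi.single l (1:ℂ)) *ᵥ Pi.single l 1 = Pi.single l 1 := by
      rw [Matrix.diagonal_mulVec_single]; simp
    rw [e2]
    congr 1
    · rw [hRd]
    · funext i
      rw [Matrix.diagonal_mulVec_single, hc]
      simp
  · have := ht_quot k0 (fun (s : I) w => u (w, s) * Cc F w.1) ((u1.comp (by fun_prop)).matrix_mul (cC.comp continuous_snd))
      (fun s w => Gl.mul (u3 _) (h.memC (wne w)))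
    refine Ht.trans (this.congr (fun x => ?_) (fun x => rfl)) (gh.congr (fun x => by rw [hT]) (fun x => rfl))
    simp [u2]
end gen
end PU
end part20

section part21
open scoped unitInterval Topology Matrix
set_option linter.unusedVariables false
set_option linter.unusedSimpArgs false
set_option linter.unusedSectionVars false
namespace PU

section gen
variable {M : Type} [Fintype M] [DecidableEq M]
variable {l : M} {F : (M → ℂ) → Matrix M M ℂ} {d : ℕ}

theorem norm_single_one (l : M) : ‖(Pi.single l 1 : M → ℂ)‖ = 1 := by
  rw [Pi.norm_single]; simp

theorem single_ne (l : M) : (Pi.single l 1 : M → ℂ) ∈ nz (M → ℂ) := by simp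

theorem elim_single (l : M) : (Sum.elim (Pi.single l 1) (fun _ => 0) : M ⊕ Unit → ℂ) = Pi.single (Sum.inl l) 1 := by
  funext i
  rcases i with i | i
  · simp [Pi.single_apply]
  · simp

theorem cont_elim {X : Type*} [TopologicalSpace X] {y : X → M → ℂ} {a : X → ℂ} (hy : Continuous y) (ha : Continuous a) :
    Continuous fun x => (Sum.elim (y x) (fun _ => a x) : M ⊕ Unit → ℂ) := by
  refine continuous_pi fun i => ?_
  rcases i with i | i
  · exact (continuous_apply i).comp hy
  · exact ha

theorem Gen.Cc_eq (h : Gen l F d) (p : ℝ × ℝ) {b : ℝ} (hb : 0 ≤ b) (hcb : cb p = Complex.I * b) {x : M → ℂ} (hx : x ≠ 0) :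
    Cc F (Sum.elim (b • ‖x‖⁻¹ • x) (fun _ => ca p)) = Cm (ca p) (ca' p) (cb p) (F x) := by
  have e1 : (Sum.elim (b • ‖x‖⁻¹ • x) (fun _ => ca p) : M ⊕ Unit → ℂ) ∘ Sum.inl = b • ‖x‖⁻¹ • x := rfl
  have hp : 0 < ‖x‖ := norm_pos_iff.2 hx
  have e2 : ‖b • ‖x‖⁻¹ • x‖ = b := by
    rw [norm_smul, norm_smul, norm_inv, norm_norm, inv_mul_cancel₀ hp.ne', mul_one, Real.norm_of_nonneg hb]
  have e3 : (starRingEnd ℂ) (ca p) = ca' p := by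
    unfold ca ca'
    simp only [map_add, map_mul, Complex.conj_ofReal, Complex.conj_I]; ring1
  rw [Cc, e1, e2, Cm, hcb]
  simp only [Sum.elim_inr, e3]
  rcases hb.eq_or_lt with h0 | h0
  · rw [← h0]; simp
  · rw [h.hom _ _ h0, h.hom _ _ (inv_pos.2 hp), mul_smul, mul_smul]; rfl

set_option maxHeartbeats 1000000 in
theorem Gen.partB (h : Gen l F d) {X : Type} [TopologicalSpace X] [CompactSpace X] {A : Set X} {x : X → M → ℂ}
    (hx : Lp A (nz _) (Pi.single l 1) x) : ∃ Q : I × (I × X) → (M ⊕ Unit → ℂ),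
      Lp (sus (sus A)) (nz _) (Pi.single (Sum.inl l) 1) Q ∧
      Ht (sus (sus A)) (Gl (M ⊕ M)) 1 (Bt fun z => F (x z))
        (fun p => Cc F (Q p) * (Cc F (Pi.single (Sum.inl l) 1))⁻¹) := by
  obtain ⟨b, hb⟩ : ∃ b : I × (I × X) → ℝ, b = fun p => Real.sin (Real.pi * p.1) * Real.sin (Real.pi * p.2.1) := ⟨_, rfl⟩
  have sn : ∀ t : I, 0 ≤ Real.sin (Real.pi * t) := fun t =>
    Real.sin_nonneg_of_nonneg_of_le_pi (mul_nonneg Real.pi_pos.le t.2.1) (by nlinarith [t.2.2, Real.pi_pos])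
  have b0 : ∀ p, 0 ≤ b p := fun p => by rw [hb]; exact mul_nonneg (sn _) (sn _)
  have cbd : ∀ p : I × (I × X), cb (p.1, p.2.1) = Complex.I * b p := fun p => by rw [hb, cb]; push_cast; rfl
  have bc : Continuous b := by rw [hb]; fun_prop
  have cac : Continuous fun p : I × (I × X) => ca (p.1, p.2.1) := cont_ca.comp (by fun_prop)
  have xc := hx.cont
  obtain ⟨q, hq⟩ : ∃ q : I × (I × X) → (M ⊕ Unit → ℂ), q = fun p =>
    Sum.elim (b p • ‖x p.2.2‖⁻¹ • x p.2.2) (fun _ => ca (p.1, p.2.1)) := ⟨_, rfl⟩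
  obtain ⟨q0, hq0⟩ : ∃ q : I × (I × X) → (M ⊕ Unit → ℂ), q = fun p =>
    Sum.elim (b p • (Pi.single l 1 : M → ℂ)) (fun _ => ca (p.1, p.2.1)) := ⟨_, rfl⟩
  have qc : Continuous q := by
    rw [hq]
    refine cont_elim ?_ cac
    have : Continuous fun p : I × (I × X) => ‖x p.2.2‖⁻¹ := Continuous.inv₀ (by fun_prop) fun p => norm_ne_zero_iff.2 (hx.mem _)
    fun_prop
  have q0c : Continuous q0 := by rw [hq0]; exact cont_elim (by fun_prop) cac
  have sl := norm_single_one l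
  have e0 : ∀ p, q0 p = Sum.elim (b p • ‖(Pi.single l 1 : M → ℂ)‖⁻¹ • (Pi.single l 1 : M → ℂ)) (fun _ => ca (p.1, p.2.1)) := fun p => by
    rw [hq0, sl]; simp
  have C1 : ∀ p, Cc F (q p) = Cm (ca (p.1, p.2.1)) (ca' (p.1, p.2.1)) (cb (p.1, p.2.1)) (F (x p.2.2)) := fun p => by
    rw [hq]; exact h.Cc_eq (p.1, p.2.1) (b0 p) (cbd p) (hx.mem _)
  have C0 : ∀ p, Cc F (q0 p) = Cm (ca (p.1, p.2.1)) (ca' (p.1, p.2.1)) (cb (p.1, p.2.1)) 1 := fun p => by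
    rw [e0, h.Cc_eq (p.1, p.2.1) (b0 p) (cbd p) (single_ne l), h.base]
  have cne : ∀ p : I × (I × X), b p = 0 → ca (p.1, p.2.1) ≠ 0 := fun p hb h0 => by
    have := cdet (p.1, p.2.1)
    rw [h0, cbd, hb] at this; simp at this
  have qne : ∀ p, q p ≠ 0 := fun p h0 => by
    have h1 : ca (p.1, p.2.1) = 0 := by
      have := congrFun h0 (Sum.inr ()); rw [hq] at this; exact this
    refine cne p ?_ h1
    by_contra hbp
    have h2 : b p • ‖x p.2.2‖⁻¹ • x p.2.2 = 0 := by
      funext i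
      have := congrFun h0 (Sum.inl i); rw [hq] at this; exact this
    have h3 := hx.mem p.2.2
    rw [smul_smul] at h2
    exact (mul_ne_zero hbp (inv_ne_zero (norm_ne_zero_iff.2 h3))) ((smul_eq_zero.1 h2).resolve_right h3)
  obtain ⟨γ, hγ⟩ : ∃ γ : (I × (I × X)) × I → (M ⊕ Unit → ℂ), γ = fun p =>
    (1 - (p.2 : ℝ)) • q0 p.1 + (p.2 : ℝ) • (Pi.single (Sum.inl l) 1 : M ⊕ Unit → ℂ) := ⟨_, rfl⟩
  have γc : Continuous γ := by rw [hγ]; fun_prop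
  have γn : ∀ p, γ p ≠ 0 := by
    rintro ⟨p, r⟩ h0
    rw [hγ] at h0
    have h1 := congrFun h0 (Sum.inr ())
    have h2 := congrFun h0 (Sum.inl l)
    rw [hq0] at h1 h2
    simp only [Pi.add_apply, Pi.smul_apply, Sum.elim_inr, Sum.elim_inl, Pi.single_eq_same, Pi.zero_apply,
      Complex.real_smul, mul_one] at h2 h1
    rw [Pi.single_eq_of_ne (by simp), mul_zero, add_zero] at h1
    have h3 : (1 - (r : ℝ)) * b p + r = 0 := by exact_mod_cast h2
    have h4 : 0 ≤ (1 - (r : ℝ)) * b p := mul_nonneg (by linarith [r.2.2]) (b0 p)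
    have h5 : (r : ℝ) = 0 := by linarith [r.2.1]
    rw [h5] at h3 h1
    exact cne p (by linarith) (by simpa using h1)
  have γ0 : ∀ p, γ (p, 0) = q0 p := fun p => by rw [hγ]; simp
  have γ1 : ∀ p, γ (p, 1) = Pi.single (Sum.inl l) 1 := fun p => by rw [hγ]; simp
  obtain ⟨u, u1, u2, u3, u4, -⟩ := transport_vec γ γc γn
  have bd : ∀ p ∈ sus (sus A), q p = q0 p := fun p hp => by
    rw [hq, hq0]
    rcases cb_bd hp with h1 | h1
    · have : b p = 0 := by rw [cbd] at h1; simpa using h1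
      simp [this]
    · simp [hx.bd _ h1, sl]
  refine ⟨fun p => u (p, 1) *ᵥ q p, ⟨by fun_prop, fun p => mulVec_ne (u3 _) (qne p), fun p hp => ?_⟩, ?_⟩
  · rw [bd p hp, ← γ0, u4, γ1]
  have cC := h.contC
  have key := Ht.mk (A := sus (sus A)) (S := Gl (M ⊕ M)) (e := 1) (fun (s : I) (p : I × (I × X)) => Cc F (u (p, s) *ᵥ q p) * (Cc F (γ (p, s)))⁻¹) ?_
    (fun s p => Gl.mul (h.memC (mulVec_ne (u3 _) (qne p))) (Gl.inv (h.memC (γn _)))) (fun s p hp => by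
      rw [bd p hp, ← γ0, u4]; exact Gl.mul_inv (h.memC (γn _)))
  · refine key.congr (fun p => ?_) (fun p => by rw [γ1])
    rw [u2, γ0, Matrix.one_mulVec, C1, C0, Bt]
    congr 1
    exact (Matrix.inv_eq_right_inv (Cm_inv (cdet _) Gl.one)).symm
  · have c1 : Continuous fun p : I × (I × (I × X)) => u (p.2, p.1) *ᵥ q p.2 := by fun_prop
    have c2 : Continuous fun p : I × (I × (I × X)) => γ (p.2, p.1) := by fun_prop
    exact (cC.comp c1).matrix_mul (cont_inv (cC.comp c2) fun p => h.memC (γn _))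

theorem exists_nrm {W : Type*} [NormedAddCommGroup W] [NormedSpace ℝ W] (k0 : Metric.sphere (0 : W) 1) :
    ∃ ν : W → Metric.sphere (0 : W) 1, ContinuousOn ν (nz W) ∧ ∀ w, w ≠ 0 → (ν w).1 = ‖w‖⁻¹ • w := by
  classical
  have hs : ∀ w : W, w ≠ 0 → ‖w‖⁻¹ • w ∈ Metric.sphere (0 : W) 1 := fun w hw => by
    simp [norm_smul, norm_ne_zero_iff.2 hw]
  refine ⟨fun w => if hw : w ≠ 0 then ⟨‖w‖⁻¹ • w, hs w hw⟩ else k0, ?_, fun w hw => by simp [hw]⟩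
  rw [Topology.IsInducing.subtypeVal.continuousOn_iff]
  refine ContinuousOn.congr (f := fun w : W => ‖w‖⁻¹ • w) ?_ fun w hw => ?_
  · exact (continuous_norm.continuousOn.inv₀ fun w hw => norm_ne_zero_iff.2 hw).smul continuousOn_id
  · have : w ≠ 0 := hw
    simp [this]
end gen
end PU
end part21

section part22
open scoped unitInterval Topology Matrix
set_option linter.unusedVariables false
set_option linter.unusedSimpArgs false
set_option linter.unusedSectionVars false
namespace PU

section gen
variable {M : Type} [Fintype M] [DecidableEq M]
variable {l : M} {F : (M → ℂ) → Matrix M M ℂ} {d : ℕ}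

/-- Splitting off a coordinate. -/
noncomputable def splitL (M : Type) [Fintype M] : (ℂ × (M → ℂ)) ≃L[ℝ] (M ⊕ Unit → ℂ) :=
  LinearEquiv.toContinuousLinearEquiv
  { toFun := fun p => Sum.elim p.2 (fun _ => p.1)
    invFun := fun w => (w (Sum.inr ()), w ∘ Sum.inl)
    map_add' := fun p q => by funext i; rcases i with i | i <;> rfl
    map_smul' := fun r p => by funext i; rcases i with i | i <;> rfl
    left_inv := fun p => rfl
    right_inv := fun w => by funext i; rcases i with i | i <;> rfl }

theorem splitL_apply (p : ℂ × (M → ℂ)) : splitL M p = Sum.elim p.2 (fun _ => p.1) := rfl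

theorem Gen.degStep (h : Gen l F d) : Deg (Pi.single (Sum.inl l) 1 : M ⊕ Unit → ℂ)
    (fun w => Sum.elim (‖w ∘ Sum.inl‖ • (F (w ∘ Sum.inl) *ᵥ Pi.single l 1))
      (fun _ => ‖w‖ • (‖w‖⁻¹ • w) (Sum.inr ()) ^ Fintype.card M)) (Fintype.card M * d) := by
  obtain ⟨n, hn⟩ : ∃ n, n = Fintype.card M := ⟨_, rfl⟩
  have n0 : n ≠ 0 := by rw [hn]; have : Nonempty M := ⟨l⟩; exact Fintype.card_ne_zero
  rw [← hn]
  obtain ⟨ψ, hψ⟩ : ∃ ψ : (M → ℂ) → (M → ℂ), ψ = fun y => ‖y‖ • (F y *ᵥ Pi.single l 1) := ⟨_, rfl⟩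
  have hd := h.deg
  rw [← hψ] at hd
  have ψc := hd.cont
  have h1 := ((deg_pw_prod n (single_ne l)).comp (hd.prod' (V := ℂ))).conj (splitL M)
    (e' := Pi.single (Sum.inl l) 1) (ψ' := fun w => Sum.elim (ψ (w ∘ Sum.inl)) (fun _ => pw n (w (Sum.inr ())))) (elim_single l)
    (fun p => rfl)
  obtain ⟨c, hc⟩ : ∃ c : (M ⊕ Unit → ℂ) → ℂ, c = fun w => ‖w‖ • (‖w‖⁻¹ • w) (Sum.inr ()) ^ n := ⟨_, rfl⟩
  have cc : Continuous c := by
    rw [hc]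
    refine cont_scale0 (F := fun w : M ⊕ Unit → ℂ => (‖w‖⁻¹ • w) (Sum.inr ()) ^ n) ?_ ?_
    · have c1 : ContinuousOn (fun w : M ⊕ Unit → ℂ => ‖w‖⁻¹ • w) (nz _) :=
        (continuous_norm.continuousOn.inv₀ fun w hw => norm_ne_zero_iff.2 hw).smul continuousOn_id
      exact ((continuous_apply (Sum.inr ())).comp_continuousOn c1).pow n
    · intro r w hr
      have : ‖r • w‖⁻¹ • (r • w) = ‖w‖⁻¹ • w := by
        rw [norm_smul, Real.norm_of_nonneg hr.le, smul_smul, mul_inv, mul_right_comm, inv_mul_cancel₀ hr.ne', one_mul]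
      simp only [this]
  have pf : ∀ a : ℂ, pw n a = ((‖a‖ * (‖a‖⁻¹) ^ n : ℝ) : ℂ) * a ^ n := fun a => by
    rw [pw, div_pow]; push_cast; rw [inv_pow, div_eq_mul_inv]; ring1
  have cf : ∀ w, c w = ((‖w‖ * (‖w‖⁻¹) ^ n : ℝ) : ℂ) * w (Sum.inr ()) ^ n := fun w => by
    rw [hc]; simp only [Pi.smul_apply, Complex.real_smul]; push_cast; rw [mul_pow]; ring1
  have nl := norm_single_one (Sum.inl l : M ⊕ Unit)
  have pc := continuous_pw (n := n)
  have ψ0 : ψ 0 = 0 := hd.zero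
  have key := Deg.homotopy (e := (Pi.single (Sum.inl l) 1 : M ⊕ Unit → ℂ)) (d := n * d) (fun (s : I) w => Sum.elim (ψ (w ∘ Sum.inl))
    (fun _ => ((1 - (s : ℝ) : ℝ) : ℂ) * pw n (w (Sum.inr ())) + ((s : ℝ) : ℂ) * c w)) ?_ ?_ ?_ ?_ ?_
  · convert key using 1
    funext w
    simp [hψ, hc]
  · have c0 : Continuous fun p : I × (M ⊕ Unit → ℂ) => p.2 ∘ Sum.inl := (Pi.continuous_precomp' (Sum.inl : M → M ⊕ Unit)).comp continuous_snd
    refine cont_elim (ψc.comp c0) ?_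
    fun_prop
  · intro s
    have : (0 : M ⊕ Unit → ℂ) ∘ Sum.inl = (0 : M → ℂ) := rfl
    simp only [this, ψ0]
    funext i
    rcases i with i | i
    · rfl
    · simp [pf, cf]
  · intro s w hw h0
    have h2 : ψ (w ∘ Sum.inl) = 0 := funext fun i => congrFun h0 (Sum.inl i)
    have h3 : ((1 - (s : ℝ) : ℝ) : ℂ) * pw n (w (Sum.inr ())) + ((s : ℝ) : ℂ) * c w = 0 := congrFun h0 (Sum.inr ())
    have h4 : w ∘ Sum.inl = 0 := by by_contra hne; exact hd.ne _ hne h2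
    have h5 : w (Sum.inr ()) ≠ 0 := fun h6 => hw (by
      funext i
      rcases i with i | i
      · exact congrFun h4 i
      · exact h6)
    rw [pf, cf, ← mul_assoc, ← mul_assoc, ← add_mul] at h3
    have h6 := (mul_eq_zero.1 h3).resolve_right (pow_ne_zero n h5)
    have p1 : 0 < ‖w (Sum.inr ())‖ := norm_pos_iff.2 h5
    have p2 : 0 < ‖w‖ := norm_pos_iff.2 hw
    have q1 : 0 < ‖w (Sum.inr ())‖ * (‖w (Sum.inr ())‖⁻¹) ^ n := by positivity
    have q2 : 0 < ‖w‖ * (‖w‖⁻¹) ^ n := by positivity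
    have h7 : (1 - (s : ℝ)) * (‖w (Sum.inr ())‖ * (‖w (Sum.inr ())‖⁻¹) ^ n) + s * (‖w‖ * (‖w‖⁻¹) ^ n) = 0 := by
      exact_mod_cast h6
    have s0 := s.2.1
    have s1 := s.2.2
    have t1 : 0 ≤ (1 - (s : ℝ)) * (‖w (Sum.inr ())‖ * (‖w (Sum.inr ())‖⁻¹) ^ n) := mul_nonneg (by linarith) q1.le
    have t2 : 0 ≤ s * (‖w‖ * (‖w‖⁻¹) ^ n) := mul_nonneg s0 q2.le
    have t3 : (s : ℝ) = 0 := (mul_eq_zero.1 (by linarith : (s : ℝ) * (‖w‖ * (‖w‖⁻¹) ^ n) = 0)).resolve_right q2.ne'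
    rw [t3] at h7
    linarith
  · intro s
    have e1 : (Pi.single (Sum.inl l) 1 : M ⊕ Unit → ℂ) ∘ Sum.inl = Pi.single l 1 := by
      funext i; simp [Pi.single_apply]
    have e2 : (Pi.single (Sum.inl l) 1 : M ⊕ Unit → ℂ) (Sum.inr ()) = 0 := by simp
    have e3 : ψ (Pi.single l 1) = Pi.single l 1 := hd.base
    rw [e1, e2, e3, ← elim_single]
    congr 1
    funext _
    rw [pf, cf]; simp [n0]
  · convert h1 using 1
    funext w
    simp

theorem Gen.step (h : Gen l F d) : ∃ F' : (M ⊕ Unit → ℂ) → Matrix (M ⊕ Unit) (M ⊕ Unit) ℂ,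
    Gen (Sum.inl l) F' (Fintype.card M * d) ∧
    ∀ {X : Type} [TopologicalSpace X] [CompactSpace X] {A : Set X} {x : X → M → ℂ},
      Lp A (nz _) (Pi.single l 1) x → ∃ Q : I × (I × X) → (M ⊕ Unit → ℂ),
        Lp (sus (sus A)) (nz _) (Pi.single (Sum.inl l) 1) Q ∧
        SEq (sus (sus A)) (Bt fun z => F (x z)) (fun p => F' (Q p)) := by
  have n0 : Fintype.card M ≠ 0 := by have : Nonempty M := ⟨l⟩; exact Fintype.card_ne_zero
  have nl := norm_single_one (Sum.inl l : M ⊕ Unit)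
  obtain ⟨k0, hk0⟩ : ∃ k0 : Metric.sphere (0 : M ⊕ Unit → ℂ) 1, k0.1 = Pi.single (Sum.inl l) 1 := ⟨⟨(Pi.single (Sum.inl l) 1 : M ⊕ Unit → ℂ), by rw [mem_sphere_zero_iff_norm]; exact nl⟩, rfl⟩
  obtain ⟨G, J, L, G1, G2, LJ, G3, G4⟩ := h.partA k0
  obtain ⟨ν, ν1, ν2⟩ := exists_nrm k0
  have νe : ν (Pi.single (Sum.inl l) 1) = k0 := Subtype.ext (by rw [ν2 _ (single_ne _), hk0, nl]; simp)
  have νh : ∀ (r : ℝ) w, 0 < r → ν (r • w) = ν w := fun r w hr => by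
    by_cases hw : w = 0
    · rw [hw, smul_zero]
    · refine Subtype.ext ?_
      rw [ν2 _ hw, ν2 _ (smul_ne_zero hr.ne' hw), norm_smul, Real.norm_of_nonneg hr.le, smul_smul, mul_inv, mul_right_comm,
        inv_mul_cancel₀ hr.ne', one_mul]
  have e1 : (Pi.single (Sum.inl l) 1 : M ⊕ Unit → ℂ) ∘ Sum.inl = Pi.single l 1 := by
    funext i; simp [Pi.single_apply]
  have Gk : G k0 *ᵥ ev M = Pi.single (Sum.inl l) 1 := by
    rw [G3, hk0, e1, norm_single_one, h.base, one_smul, Matrix.one_mulVec, ← elim_single]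
    congr 1
    funext _
    simp [n0]
  have Gi : (G k0)⁻¹ *ᵥ Pi.single (Sum.inl l) 1 = ev M := by
    rw [← Gk, Matrix.mulVec_mulVec, Gl.inv_mul (G2 _), Matrix.one_mulVec]
  refine ⟨fun w => G (ν w) * (G k0)⁻¹, ⟨?_, ?_, ?_, ?_, ?_⟩, ?_⟩
  · exact (G1.comp_continuousOn ν1).mul continuousOn_const
  · exact fun w _ => Gl.mul (G2 _) (Gl.inv (G2 _))
  · intro r w hr; simp only [νh r w hr]
  · simp only [νe]; exact Gl.mul_inv (G2 _)
  · convert h.degStep using 1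
    funext w
    rw [← Matrix.mulVec_mulVec, Gi, G3]
    by_cases hw : w = 0
    · subst hw
      funext i
      have : (0 : M ⊕ Unit → ℂ) ∘ Sum.inl = (0 : M → ℂ) := rfl
      rcases i with i | i <;> simp [this]
    · rw [ν2 w hw]
      have p2 : 0 < ‖w‖ := norm_pos_iff.2 hw
      have e2 : (‖w‖⁻¹ • w) ∘ Sum.inl = ‖w‖⁻¹ • (w ∘ Sum.inl) := rfl
      rw [e2, h.hom _ _ (inv_pos.2 p2), norm_smul, norm_inv, norm_norm]
      funext i
      rcases i with i | i
      · simp only [Pi.smul_apply, Sum.elim_inl, Matrix.smul_mulVec, smul_smul]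
        rw [← mul_assoc, mul_inv_cancel₀ p2.ne', one_mul]
      · rfl
  · intro X _ _ A x hx
    obtain ⟨Q, hQ, hB⟩ := h.partB hx
    refine ⟨Q, hQ, ?_⟩
    have hl : Lp (sus (sus A)) (Gl (M ⊕ Unit)) 1 (fun p => G (ν (Q p)) * (G k0)⁻¹) := by
      refine hQ.map (φ := fun w => G (ν w) * (G k0)⁻¹) ((G1.comp_continuousOn ν1).mul continuousOn_const)
        (fun w _ => Gl.mul (G2 _) (Gl.inv (G2 _))) ?_
      simp only [νe]; exact Gl.mul_inv (G2 _)
    have hQc := hQ.cont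
    have cn : Continuous fun p => ‖Q p‖⁻¹ := Continuous.inv₀ (by fun_prop) fun p => norm_ne_zero_iff.2 (hQ.mem p)
    have s1 : Ht (sus (sus A)) (nz _) (Pi.single (Sum.inl l) 1) Q (fun p => (ν (Q p)).1) := by
      refine (Ht.mk (fun (s : I) p => ((1 - (s : ℝ)) + s * ‖Q p‖⁻¹) • Q p) ?_ ?_ ?_).congr (fun p => by simp)
        (fun p => by rw [ν2 _ (hQ.mem p)]; simp)
      · have cn2 : Continuous fun p : I × (I × (I × X)) => ‖Q p.2‖⁻¹ := cn.comp continuous_snd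
        have c3 : Continuous fun p : I × (I × (I × X)) => ((1 - (p.1 : ℝ)) + p.1 * ‖Q p.2‖⁻¹) := by fun_prop
        exact c3.smul (hQc.comp continuous_snd)
      · intro s p
        have p2 : 0 < ‖Q p‖⁻¹ := inv_pos.2 (norm_pos_iff.2 (hQ.mem p))
        refine smul_ne_zero (ne_of_gt ?_) (hQ.mem p)
        rcases s.2.1.eq_or_lt with h0 | h0
        · rw [← h0]; simp
        · have := mul_pos h0 p2
          linarith [s.2.2]
      · intro s p hp
        rw [hQ.bd p hp, nl]; simp
    have s2 := s1.map (φ := fun w => Cc F w * (Cc F (Pi.single (Sum.inl l) 1))⁻¹) (S' := Gl (M ⊕ M)) (e' := 1)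
      (h.contC.mul continuous_const).continuousOn (fun w hw => Gl.mul (h.memC hw) (Gl.inv (h.memC (single_ne _))))
      (Gl.mul_inv (h.memC (single_ne _)))
    have s3 := G4.comp (B := sus (sus A)) (φ := fun p => ν (Q p)) (ν1.comp_continuous hQc hQ.mem) (fun p hp => by
      rw [hQ.bd p hp, νe]; rfl)
    rw [hk0] at s3
    exact (hB.trans (s2.trans s3)).seq.trans (seq_ext hl LJ).symm

theorem gen_base : Gen (M := Unit) () (fun w => Matrix.diagonal fun i => ((‖w ()‖⁻¹ : ℝ) : ℂ) * w i) 1 := by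
  have nn : ∀ w : Unit → ℂ, w ≠ 0 → w () ≠ 0 := fun w hw h0 => hw (by funext i; exact h0)
  have e1 : (Pi.single () 1 : Unit → ℂ) = 1 := by funext i; simp
  have e2 : ∀ w : Unit → ℂ, ‖w‖ = ‖w ()‖ := fun w => by
    rw [Pi.norm_def]; simp
  refine ⟨?_, ?_, ?_, ?_, ?_⟩
  · refine (Continuous.matrix_diagonal continuous_id).comp_continuousOn ?_
    refine continuousOn_pi.2 fun i => ?_
    refine ContinuousOn.mul ?_ (continuous_apply i).continuousOn
    refine Complex.continuous_ofReal.comp_continuousOn (ContinuousOn.inv₀ (by fun_prop) fun w hw => norm_ne_zero_iff.2 (nn w hw))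
  · intro w hw
    rw [mem_GL, Matrix.det_diagonal]
    simpa using nn w hw
  · intro r w hr
    congr 1
    funext i
    simp only [Pi.smul_apply, Complex.real_smul, norm_mul, Complex.norm_real, Real.norm_of_nonneg hr.le]
    have : (r : ℂ) ≠ 0 := by exact_mod_cast hr.ne'
    push_cast; rw [mul_inv]; field_simp
  · rw [e1, ← Matrix.diagonal_one]; simp
  · have : (fun y : Unit → ℂ => ‖y‖ • (Matrix.diagonal (fun i => ((‖y ()‖⁻¹ : ℝ) : ℂ) * y i) *ᵥ (Pi.single () 1))) = fun y => y := by
      funext y i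
      rw [e1, Pi.smul_apply, Matrix.mulVec_diagonal, e2]
      by_cases hy : y = 0
      · subst hy; simp
      · have h0 : (‖y ()‖ : ℂ) ≠ 0 := by exact_mod_cast norm_ne_zero_iff.2 (nn y hy)
        simp only [Pi.one_apply, mul_one, Complex.real_smul]
        push_cast
        rw [← mul_assoc, mul_inv_cancel₀ h0, one_mul]
    rw [this]
    refine ⟨continuous_id, rfl, fun w hw => hw, single_ne _, rfl, ?_, fun k _ f hf => by rw [pow_one]⟩
    rw [Module.finrank_pi_fintype]; simp
end gen
end PU
end part22

section part23
open scoped unitInterval Topology Matrix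
set_option linter.unusedVariables false
set_option linter.unusedSimpArgs false
set_option linter.unusedSectionVars false
namespace PU

section cubes
variable {ι κ M : Type} [Fintype ι] [DecidableEq ι] [Fintype κ] [DecidableEq κ] [Fintype M] [DecidableEq M]

theorem SEq.comp {X Y : Type*} [TopologicalSpace X] [TopologicalSpace Y] {A : Set X} {g : X → Matrix ι ι ℂ} {g' : X → Matrix κ κ ℂ}
    (h : SEq A g g') {B : Set Y} {φ : Y → X} (hc : Continuous φ) (hm : ∀ y ∈ B, φ y ∈ A) :
    SEq B (fun y => g (φ y)) (fun y => g' (φ y)) := by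
  obtain ⟨a, b, M, i, j, J, K, J', K', h1, h2, h3⟩ := h
  exact ⟨a.comp hc hm, b.comp hc hm, M, i, j, J, K, J', K', h1, h2, h3.comp hc hm⟩

theorem seq_reindex {X : Type*} [TopologicalSpace X] {A : Set X} {g : X → Matrix ι ι ℂ} (hg : Lp A (Gl ι) 1 g) (e : ι ≃ κ) :
    SEq A g (fun x => Matrix.reindex e e (g x)) := by
  have h1 : ((1 : Matrix ι ι ℂ).submatrix id e.symm) * ((1 : Matrix ι ι ℂ).submatrix e.symm id) = 1 := by
    rw [Matrix.submatrix_mul_equiv]; simp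
  have h2 := seq_ext hg h1
  convert h2 using 2 with x
  have h3 : ((1 : Matrix ι ι ℂ).submatrix e.symm id) * ((1 : Matrix ι ι ℂ).submatrix id e.symm) = 1 := by
    rw [← Matrix.submatrix_mul _ _ _ _ _ Function.bijective_id]; simp
  rw [PU.ext, Matrix.mul_sub, Matrix.sub_mul, Matrix.mul_one, h3, add_sub_cancel]
  ext i j
  simp [Matrix.mul_apply, Matrix.one_apply]

/-- Splitting two coordinates. -/
def spl {k : ℕ} (x : Q (k+2)) : I × (I × Q k) := (x 0, (x 1, fun i => x i.succ.succ))

theorem cont_spl {k : ℕ} : Continuous (spl (k := k)) := by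
  refine (continuous_apply 0).prodMk ((continuous_apply 1).prodMk (continuous_pi fun i => continuous_apply _))

theorem spl_mem {k : ℕ} (x : Q (k+2)) (hx : x ∈ bdQ (k+2)) : spl x ∈ sus (sus (bdQ k)) := by
  rcases tail_mem x hx with h | h | h
  · exact Or.inl h
  · exact Or.inr (Or.inl h)
  · exact Or.inr (Or.inr (tail_mem _ h))

theorem spl_cons {k : ℕ} (x : Q (k+2)) : (Fin.cons (spl x).1 (Fin.cons (spl x).2.1 (spl x).2.2 : Q (k+1)) : Q (k+2)) = x := by
  funext i
  refine Fin.cases rfl (fun i => ?_) i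
  refine Fin.cases rfl (fun i => ?_) i
  rfl

theorem bott_cube {k : ℕ} {g : Q (k+2) → Matrix ι ι ℂ} (hg : Lp (bdQ (k+2)) (Gl ι) 1 g) :
    ∃ (κ : Type) (_ : Fintype κ) (_ : DecidableEq κ) (α : Q k → Matrix κ κ ℂ), Lp (bdQ k) (Gl κ) 1 α ∧
      SEq (bdQ (k+2)) g (fun x => Bt α (spl x)) := by
  have h1 : Lp (sus (sus (bdQ k))) (Gl ι) 1 (fun p => g (Fin.cons p.1 (Fin.cons p.2.1 p.2.2 : Q (k+1)))) := by
    refine hg.comp (φ := fun p : I × (I × Q k) => (Fin.cons p.1 (Fin.cons p.2.1 p.2.2 : Q (k+1)) : Q (k+2))) ?_ ?_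
    · exact continuous_consQ.comp (continuous_fst.prodMk (continuous_consQ.comp continuous_snd))
    · rintro p (h | h | h)
      · exact (cons_mem_bdQ _ _).2 (Or.inl h)
      · exact (cons_mem_bdQ _ _).2 (Or.inr (Or.inl h))
      · exact (cons_mem_bdQ _ _).2 (Or.inr (Or.inr ((cons_mem_bdQ _ _).2 h)))
  obtain ⟨κ, i, j, α, h2, h3⟩ := main_bott (isClosed_bdQ k) h1
  refine ⟨κ, i, j, α, h2, ?_⟩
  have h4 := h3.comp (B := bdQ (k+2)) cont_spl spl_mem
  simpa only [spl_cons] using h4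

theorem seven (n : ℕ) : ∀ {ι : Type} [Fintype ι] [DecidableEq ι] {g : Q (2 * n) → Matrix ι ι ℂ},
    Lp (bdQ (2 * n)) (Gl ι) 1 g → SNull (bdQ (2 * n)) g := by
  induction n with
  | zero =>
    intro ι _ _ g hg
    obtain ⟨p, p1, p2, p3, p4⟩ := Gl.path (hg.mem (fun i => 0))
    refine snull_of_ht ?_
    have e0 : ∀ x : Q (2 * 0), x = fun i => 0 := fun x => by funext i; exact i.elim0
    refine (Ht.mk (fun s _ => p s) (by fun_prop) (fun s _ => p2 s) ?_).congr (fun x => ?_) (fun x => ?_)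
    · rintro s x ⟨i, -⟩; exact i.elim0
    · rw [p3, e0 x]
    · exact p4.symm
  | succ n ih =>
    intro ι _ _ g hg
    obtain ⟨κ, _, _, α, h2, h3⟩ := bott_cube (k := 2 * n) hg
    have h4 := (Bt_seq (ih h2)).comp (B := bdQ (2*n+2)) cont_spl spl_mem
    refine (h3.trans h4).trans ?_
    have : (fun y : Q (2*n+2) => Bt (fun _ : Q (2*n) => (1 : Matrix Unit Unit ℂ)) (spl y)) = fun _ => 1 := by
      funext y; exact Bt_one (Or.inr rfl)
    rw [this]
    exact snull_one

theorem odd_unit {g : Q 1 → Matrix Unit Unit ℂ} (hg : Lp (bdQ 1) (Gl Unit) 1 g) :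
    ∃ x, Lp (bdQ 1) (nz (Unit → ℂ)) (Pi.single () 1) x ∧
      SEq (bdQ 1) g (fun z => Matrix.diagonal fun i => ((‖x z ()‖⁻¹ : ℝ) : ℂ) * x z i) := by
  have hc := hg.cont
  have hn : ∀ z, g z () () ≠ 0 := fun z => by
    have := hg.mem z
    rw [mem_GL, Matrix.det_unique] at this
    exact this
  refine ⟨fun z i => g z i (), ⟨by fun_prop, ?_, ?_⟩, Ht.seq ?_⟩
  · intro z h0
    exact hn z (congrFun h0 ())
  · intro z hz
    rw [hg.bd z hz]; funext i; simp
  · have cn : Continuous fun p : I × Q 1 => ‖g p.2 () ()‖⁻¹ :=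
      Continuous.inv₀ (by fun_prop) fun p => norm_ne_zero_iff.2 (hn p.2)
    refine (Ht.mk (fun (s : I) z => ((1 - (s : ℝ)) + s * ‖g z () ()‖⁻¹) • g z) ?_ ?_ ?_).congr (fun p => by simp)
        (fun z => ?_)
    · have c3 : Continuous fun p : I × Q 1 => ((1 - (p.1 : ℝ)) + p.1 * ‖g p.2 () ()‖⁻¹) := by fun_prop
      exact c3.smul (hc.comp continuous_snd)
    · intro s z
      have p2 : 0 < ‖g z () ()‖⁻¹ := inv_pos.2 (norm_pos_iff.2 (hn z))
      rw [mem_GL, Matrix.det_unique]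
      refine smul_ne_zero (r := (1 - (s : ℝ)) + s * ‖g z () ()‖⁻¹) (ne_of_gt ?_) (hn z)
      rcases s.2.1.eq_or_lt with h0 | h0
      · rw [← h0]; simp
      · have := mul_pos h0 p2
        linarith [s.2.2]
    · intro s z hz
      rw [hg.bd z hz]; simp
    · ext i j; simp

theorem odd_base (N : ℕ) : ∀ {ι : Type} [Fintype ι] [DecidableEq ι] {g : Q 1 → Matrix ι ι ℂ}, Fintype.card ι = N →
    Lp (bdQ 1) (Gl ι) 1 g → ∃ x, Lp (bdQ 1) (nz (Unit → ℂ)) (Pi.single () 1) x ∧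
      SEq (bdQ 1) g (fun z => Matrix.diagonal fun i => ((‖x z ()‖⁻¹ : ℝ) : ℂ) * x z i) := by
  induction N with
  | zero =>
    intro ι _ _ g hc hg
    have : IsEmpty ι := Fintype.card_eq_zero_iff.1 hc
    obtain ⟨x, hx, h⟩ := odd_unit (g := fun _ => 1) (lp_const Gl.one)
    refine ⟨x, hx, ?_⟩
    have e : g = fun _ => 1 := by funext z; exact Subsingleton.elim _ _
    rw [e]
    exact SEq.trans snull_one h
  | succ N ih =>
    intro ι _ _ g hc hg
    by_cases hN : N = 0
    · have e : ι ≃ Unit := Fintype.equivOfCardEq (by simp [hc, hN])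
      have h1 := seq_reindex hg e
      obtain ⟨x, hx, h⟩ := odd_unit h1.2.1
      exact ⟨x, hx, h1.trans h⟩
    · have e : ι ≃ Fin N ⊕ Unit := Fintype.equivOfCardEq (by simp [hc])
      have h1 := seq_reindex hg e
      have h2 := h1.2.1
      obtain ⟨g', h3, h4⟩ := peel h2 (sphere_null 1 (by
        rw [← Module.finrank_mul_finrank ℝ ℂ, Complex.finrank_real_complex]; simp; omega) (mem_nz.1 ev_ne) (lp_ev h2))
      obtain ⟨x, hx, h⟩ := ih (by simp) h3
      exact ⟨x, hx, (h1.trans h4.seq).trans ((seq_ex h3).symm.trans h)⟩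

theorem sodd (n : ℕ) : ∃ (M : Type) (_ : Fintype M) (_ : DecidableEq M) (l : M) (F : (M → ℂ) → Matrix M M ℂ),
    Fintype.card M = n + 1 ∧ Gen l F n.factorial ∧
    ∀ {ι : Type} [Fintype ι] [DecidableEq ι] {g : Q (2 * n + 1) → Matrix ι ι ℂ}, Lp (bdQ (2 * n + 1)) (Gl ι) 1 g →
      ∃ x, Lp (bdQ (2 * n + 1)) (nz (M → ℂ)) (Pi.single l 1) x ∧ SEq (bdQ (2 * n + 1)) g (fun z => F (x z)) := by
  induction n with
  | zero =>
    exact ⟨Unit, inferInstance, inferInstance, (), _, by simp, gen_base, fun {ι} _ _ {g} hg => odd_base _ rfl hg⟩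
  | succ n ih =>
    obtain ⟨M, _, _, l, F, h1, h2, h3⟩ := ih
    obtain ⟨F', h4, h5⟩ := h2.step
    refine ⟨M ⊕ Unit, inferInstance, inferInstance, Sum.inl l, F', by simp [h1], ?_, ?_⟩
    · rw [Nat.factorial_succ, ← h1]; exact h4
    · intro ι _ _ g hg
      obtain ⟨κ, _, _, α, k2, k3⟩ := bott_cube (k := 2 * n + 1) hg
      obtain ⟨x, hx, k4⟩ := h3 k2
      obtain ⟨R, hR, k5⟩ := h5 hx
      refine ⟨fun y => R (spl y), hR.comp cont_spl spl_mem, ?_⟩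
      exact k3.trans (((Bt_seq k4).trans k5).comp cont_spl spl_mem)

end cubes
end PU
end part23

section part24
open scoped unitInterval Topology Matrix
set_option linter.unusedVariables false
set_option linter.unusedSimpArgs false
set_option linter.unusedSectionVars false
namespace PU

section fin
variable {ι M : Type} [Fintype ι] [DecidableEq ι] [Fintype M] [DecidableEq M]

/-- Relabelling coordinates. -/
noncomputable def coordL {M N : Type} [Fintype M] [Fintype N] (ρ : M ≃ N) : (M → ℂ) ≃L[ℝ] (N → ℂ) :=
  LinearEquiv.toContinuousLinearEquiv (LinearEquiv.funCongrLeft ℝ ℂ ρ.symm)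

theorem coordL_apply {M N : Type} [Fintype M] [Fintype N] (ρ : M ≃ N) (w : M → ℂ) : coordL ρ w = w ∘ ρ.symm := rfl

theorem finrank_cpi (ι : Type) [Fintype ι] : Module.finrank ℝ (ι → ℂ) = 2 * Fintype.card ι := by
  rw [← Module.finrank_mul_finrank ℝ ℂ, Complex.finrank_real_complex]; simp

theorem reindex_mulVec {ρ : M ≃ ι ⊕ Unit} (B : Matrix M M ℂ) {l : M} (hl : ρ l = Sum.inr ()) :
    Matrix.reindex ρ ρ B *ᵥ ev ι = coordL ρ (B *ᵥ Pi.single l 1) := by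
  funext i
  have : ρ.symm (Sum.inr ()) = l := by rw [← hl]; simp
  rw [coordL_apply, ev]
  simp [this]

theorem coordL_single {ρ : M ≃ ι ⊕ Unit} {l : M} (hl : ρ l = Sum.inr ()) :
    coordL ρ (Pi.single l 1) = ev ι := by
  rw [← Matrix.one_mulVec (Pi.single l 1 : M → ℂ), ← reindex_mulVec _ hl]
  have : Matrix.reindex ρ ρ (1 : Matrix M M ℂ) = 1 := by simp
  rw [this, Matrix.one_mulVec]

theorem gcol {l : M} {F : (M → ℂ) → Matrix M M ℂ} {d : ℕ} (h : Gen l F d) {ρ : M ≃ ι ⊕ Unit} (hl : ρ l = Sum.inr ())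
    {k : ℕ} (hk : k + 2 = 2 * (Fintype.card ι + 1)) {x : Q (k+1) → M → ℂ} (hx : Lp (bdQ (k+1)) (nz _) (Pi.single l 1) x) :
    cls (ev_ne (ι := ι)) (fun z => Matrix.reindex ρ ρ (F (x z)) *ᵥ ev ι) = cls (ev_ne (ι := ι)) (fun z => coordL ρ (x z)) ^ d := by
  have hd : Deg (ev ι) (fun w => coordL ρ (‖(coordL ρ).symm w‖ • (F ((coordL ρ).symm w) *ᵥ Pi.single l 1))) d :=
    h.deg.conj (coordL ρ) (coordL_single hl) (fun w => by simp)
  have h1 : Lp (bdQ (k+1)) (nz _) (ev ι) (fun z => coordL ρ (x z)) :=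
    hx.map (φ := coordL ρ) (coordL ρ).continuous.continuousOn (fun w hw => by simpa using hw) (coordL_single hl)
  have h2 := hd.deg k (by rw [finrank_cpi]; simp; omega) _ h1
  rw [← h2]
  refine Ht.cls_eq ?_
  have cF : Continuous fun z => F (x z) := h.cont.comp_continuous hx.cont hx.mem
  have cx := hx.cont
  have hne : ∀ z, F (x z) *ᵥ Pi.single l 1 ≠ 0 := fun z => mulVec_ne (h.mem _ (hx.mem z)) (single_ne l)
  refine (Ht.mk (fun (s : I) z => ((1 - (s : ℝ)) + s * ‖x z‖) • coordL ρ (F (x z) *ᵥ Pi.single l 1)) ?_ ?_ ?_).congr (fun z => ?_) (fun z => ?_)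
  · have c3 : Continuous fun p : I × Q (k+1) => ((1 - (p.1 : ℝ)) + p.1 * ‖x p.2‖) := by fun_prop
    refine c3.smul ((coordL ρ).continuous.comp ?_)
    exact (cF.comp continuous_snd).matrix_mulVec continuous_const
  · intro s z
    have p2 : 0 < ‖x z‖ := norm_pos_iff.2 (hx.mem z)
    refine smul_ne_zero (r := (1 - (s : ℝ)) + s * ‖x z‖) (ne_of_gt ?_) (by simpa using hne z)
    rcases s.2.1.eq_or_lt with h0 | h0
    · rw [← h0]; simp
    · have := mul_pos h0 p2
      linarith [s.2.2]
  · intro s z hz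
    rw [hx.bd z hz, h.base, norm_single_one, Matrix.one_mulVec, coordL_single hl]; simp
  · rw [reindex_mulVec _ hl]; simp
  · simp

theorem gl_conn (n k : ℕ) (hn : 1 ≤ n) (hk : k + 1 = 2 * n) :
    ∃ h : Pg (k+2) (ev_ne (ι := Fin n)) →* Pg (k+1) (Gl.one (ι := Fin n)), Function.Surjective h ∧
      ∀ x, h x = 1 ↔ ∃ y, x = y ^ n.factorial := by
  obtain ⟨h, h1, h2⟩ := exists_conn (Fin n) k
  refine ⟨h, h2 fun a ha => ?_, fun x => ?_⟩
  · have hl : Lp (bdQ (k+1)) (Gl (Fin n ⊕ Unit)) 1 (fun x => ex (a x)) :=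
      ha.map (φ := fun B => ex B) cont_ex.continuousOn (fun B hB => ex_mem.2 hB) ex_one
    have : ∀ {j : ℕ}, j = 2 * n → ∀ {g : Q j → Matrix (Fin n ⊕ Unit) (Fin n ⊕ Unit) ℂ}, Lp (bdQ j) (Gl _) 1 g → SNull (bdQ j) g := by
      rintro j rfl g hg; exact seven n hg
    exact snull_null (by simp; omega) (this hk hl)
  · rw [h1]
    obtain ⟨M, _, _, l, F, c1, c2, c3⟩ := sodd n
    obtain ⟨e0⟩ : Nonempty (M ≃ Fin n ⊕ Unit) := ⟨Fintype.equivOfCardEq (by simp [c1])⟩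
    obtain ⟨ρ, hl⟩ : ∃ ρ : M ≃ Fin n ⊕ Unit, ρ l = Sum.inr () :=
      ⟨e0.trans (Equiv.swap (e0 l) (Sum.inr ())), by simp⟩
    have c4 : ∀ {j : ℕ}, j = 2 * n + 1 → ∀ {g : Q j → Matrix (Fin n ⊕ Unit) (Fin n ⊕ Unit) ℂ}, Lp (bdQ j) (Gl _) 1 g → 
      ∃ x, Lp (bdQ j) (nz (M → ℂ)) (Pi.single l 1) x ∧ SEq (bdQ j) g (fun z => F (x z)) := by
      rintro j rfl g hg; exact c3 hg
    constructor
    · rintro ⟨g, hg, rfl⟩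
      obtain ⟨x, hx, hs⟩ := c4 (j := k + 2) (by omega) hg
      have hs2 := hs.trans (seq_reindex hs.2.1 ρ)
      have h3 := seq_ht (by simp; omega) hs2
      refine ⟨cls (ev_ne (ι := Fin n)) (fun z => coordL ρ (x z)), ?_⟩
      rw [← gcol c2 hl (by simp; omega) hx]
      exact (ht_ev h3).cls_eq
    · rintro ⟨y, rfl⟩
      obtain ⟨b, hb, rfl⟩ := exists_cls y
      have hx : Lp (bdQ (k+2)) (nz _) (Pi.single l 1) (fun z => (coordL ρ).symm (b z)) :=
        hb.map (φ := (coordL ρ).symm) (coordL ρ).symm.continuous.continuousOn (fun w hw => by simpa using hw)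
          (by rw [← coordL_single hl]; simp)
      have hF : Lp (bdQ (k+2)) (Gl M) 1 (fun z => F ((coordL ρ).symm (b z))) :=
        hx.map (φ := F) c2.cont (fun w hw => c2.mem w hw) c2.base
      refine ⟨fun z => Matrix.reindex ρ ρ (F ((coordL ρ).symm (b z))), ((Ht.refl hF).reindex ρ).lp_left, ?_⟩
      rw [gcol c2 hl (by simp; omega) hx]
      simp

theorem gl_main (n k : ℕ) (hn : 1 ≤ n) (hk : k + 1 = 2 * n) :
    Nat.card (Pg (k+1) (Gl.one (ι := Fin n))) = n.factorial ∧ IsCyclic (Pg (k+1) (Gl.one (ι := Fin n))) ∧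
    ∃ h : Pg (k+2) (ev_ne (ι := Fin n)) →* Pg (k+1) (Gl.one (ι := Fin n)), Function.Surjective h := by
  obtain ⟨h, h1, h2⟩ := gl_conn n k hn hk
  have hf : Module.finrank ℝ (Fin n ⊕ Unit → ℂ) = k + 3 := by rw [finrank_cpi]; simp; omega
  have cy := sphere_cyclic (k+1) hf (ev_ne (ι := Fin n))
  have inf := sphere_infinite k hf (ev_ne (ι := Fin n))
  have cy2 : IsCyclic (Pg (k+1) (Gl.one (ι := Fin n))) := isCyclic_of_surjective h h1
  refine ⟨?_, cy2, h, h1⟩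
  obtain ⟨g, hg⟩ := cy.exists_generator
  have og : orderOf g = 0 := Infinite.orderOf_eq_zero_of_forall_mem_zpowers hg
  have hz : ∀ i : ℤ, g ^ i = 1 → i = 0 := fun i hi => by
    have := orderOf_dvd_iff_zpow_eq_one.2 hi
    rw [og] at this
    simpa using this
  have hgen : ∀ y, y ∈ Subgroup.zpowers (h g) := fun y => by
    obtain ⟨x, rfl⟩ := h1 y
    obtain ⟨i, rfl⟩ := hg x
    exact ⟨i, by simp⟩
  rw [← orderOf_eq_card_of_forall_mem_zpowers hgen]
  refine Nat.dvd_antisymm ?_ ?_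
  · refine orderOf_dvd_of_pow_eq_one ?_
    rw [← map_pow, h2]; exact ⟨g, rfl⟩
  · have h3 := pow_orderOf_eq_one (h g)
    rw [← map_pow, h2] at h3
    obtain ⟨y, hy⟩ := h3
    obtain ⟨i, rfl⟩ := hg y
    simp only [] at hy
    have : g ^ ((orderOf (h g) : ℤ) - i * (n.factorial : ℤ)) = 1 := by
      rw [zpow_sub, zpow_mul, zpow_natCast, zpow_natCast, hy, mul_inv_cancel]
    have h4 := hz _ this
    have h5 : (orderOf (h g) : ℤ) = n.factorial * i := by linarith
    exact Int.natCast_dvd_natCast.1 ⟨i, h5⟩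

end fin
end PU
end part24

section part25
open scoped unitInterval Topology Matrix
set_option linter.unusedVariables false
set_option linter.unusedSimpArgs false
set_option linter.unusedSectionVars false
namespace PU

section polar
open scoped ComplexOrder Matrix.Norms.L2Operator
variable {ι : Type} [Fintype ι] [DecidableEq ι]

/-- inverse square root -/
noncomputable def isq (t : ℝ) : ℝ := (Real.sqrt t)⁻¹

theorem cont_isq : ContinuousOn isq (Set.Ioi 0) :=
  ContinuousOn.inv₀ Real.continuous_sqrt.continuousOn fun t ht => (Real.sqrt_pos.2 ht).ne'

/-- the positive matrix -/
noncomputable def pol (B : Matrix ι ι ℂ) : Matrix ι ι ℂ := cfc isq (Bᴴ * B)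

theorem pos_spec {B : Matrix ι ι ℂ} (hB : B ∈ Gl ι) : spectrum ℝ (Bᴴ * B) ⊆ Set.Ioi 0 := by
  intro t ht
  have h1 : (Bᴴ * B).PosDef := Matrix.PosDef.conjTranspose_mul_self B
    (Matrix.mulVec_injective_of_isUnit ((Matrix.isUnit_iff_isUnit_det _).2 (Gl.isUnit hB)))
  rw [h1.isHermitian.spectrum_real_eq_range_eigenvalues] at ht
  obtain ⟨i, rfl⟩ := ht
  exact h1.eigenvalues_pos i

theorem sa_mul (B : Matrix ι ι ℂ) : IsSelfAdjoint (Bᴴ * B) := by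
  rw [← Matrix.star_eq_conjTranspose]; exact IsSelfAdjoint.star_mul_self B

theorem cont_pol : ContinuousOn (pol (ι := ι)) (Gl ι) := by
  refine ContinuousOn.cfc_of_mem_nhdsSet (s := Set.Ioi 0) (p := IsSelfAdjoint) isq ?_ ?_ (fun B _ => sa_mul B) cont_isq
  · rw [isOpen_Ioi.mem_nhdsSet]
    exact Set.iUnion₂_subset fun B hB => pos_spec hB
  · exact Continuous.continuousOn (by fun_prop)

theorem pol_sa (B : Matrix ι ι ℂ) : (pol B)ᴴ = pol B := by
  have : IsSelfAdjoint (cfc isq (Bᴴ * B)) := cfc_predicate _ _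
  exact this

theorem pol_one {B : Matrix ι ι ℂ} (h : Bᴴ * B = 1) : pol B = 1 := by
  rw [pol, h, cfc_apply_one]
  simp [isq]

theorem pol_mul {B : Matrix ι ι ℂ} (hB : B ∈ Gl ι) : pol B * (Bᴴ * B) * pol B = 1 := by
  have c := cont_isq.mono (pos_spec hB)
  have sa := sa_mul B
  obtain ⟨P, hP⟩ : ∃ P, P = Bᴴ * B := ⟨_, rfl⟩
  have hs := pos_spec hB
  rw [pol]
  rw [← hP] at sa c hs ⊢
  conv_lhs => enter [1, 2]; rw [← cfc_id ℝ P sa]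
  rw [← cfc_mul isq id P c continuousOn_id, ← cfc_mul (fun x => isq x * id x) isq P (c.mul continuousOn_id) c]
  rw [← cfc_one ℝ P sa]
  refine cfc_congr fun t ht => ?_
  have : 0 < t := hs ht
  simp only [isq, id, Pi.one_apply]
  rw [mul_right_comm, ← mul_inv, Real.mul_self_sqrt this.le, inv_mul_cancel₀ this.ne']

theorem pol_unit {B : Matrix ι ι ℂ} (hB : B ∈ Gl ι) (s : I) : ((1 - (s : ℝ)) • (1 : Matrix ι ι ℂ) + (s : ℝ) • pol B) ∈ Gl ι := by
  have c := cont_isq.mono (pos_spec hB)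
  have sa := sa_mul B
  have hs := pos_spec hB
  have : (1 - (s : ℝ)) • (1 : Matrix ι ι ℂ) + (s : ℝ) • pol B = cfc (fun t => (1 - (s : ℝ)) * 1 + s * isq t) (Bᴴ * B) := by
    rw [cfc_add _ _ _ (by fun_prop) (by fun_prop), cfc_const_mul _ _ _ (by fun_prop), cfc_const_mul _ _ _ c, ← pol]
    rw [cfc_const_one ℝ _ sa]
  rw [this]
  have h2 : IsUnit (cfc (fun t => (1 - (s : ℝ)) * 1 + s * isq t) (Bᴴ * B)) := by
    rw [isUnit_cfc_iff _ _ (by fun_prop) sa]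
    intro t ht
    have p2 : 0 < isq t := inv_pos.2 (Real.sqrt_pos.2 (hs ht))
    refine ne_of_gt ?_
    rcases s.2.1.eq_or_lt with h0 | h0
    · rw [← h0]; simp
    · have := mul_pos h0 p2
      linarith [s.2.2]
  rw [mem_GL]
  exact ((Matrix.isUnit_iff_isUnit_det _).1 h2).ne_zero

end polar

/-- the unitary group as a set -/
abbrev Us (ι : Type) [Fintype ι] [DecidableEq ι] : Set (Matrix ι ι ℂ) := (Matrix.unitaryGroup ι ℂ : Set (Matrix ι ι ℂ))

section transfer
variable {ι : Type} [Fintype ι] [DecidableEq ι]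

theorem us_gl : Us ι ⊆ Gl ι := fun B hB => Gl.of_mul (B := star B) (Matrix.mem_unitaryGroup_iff.1 hB)

theorem us_one : (1 : Matrix ι ι ℂ) ∈ Us ι := one_mem (Matrix.unitaryGroup ι ℂ)

theorem pol_us {B : Matrix ι ι ℂ} (hB : B ∈ Gl ι) : B * pol B ∈ Us ι := by
  refine Matrix.mem_unitaryGroup_iff'.2 ?_
  rw [Matrix.star_eq_conjTranspose, Matrix.conjTranspose_mul, pol_sa, ← pol_mul hB]
  simp only [Matrix.mul_assoc]

theorem pol_of_us {B : Matrix ι ι ℂ} (hB : B ∈ Us ι) : pol B = 1 :=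
  pol_one (Matrix.mem_unitaryGroup_iff'.1 hB)

/-- General deformation retractions induce isomorphisms. -/
theorem retr_equiv {E : Type*} [TopologicalSpace E] {S T : Set E} {e : E} (hT : T ⊆ S) (heS : e ∈ S) (heT : e ∈ T)
    (r : E → E) (hr : ContinuousOn r S) (hm : Set.MapsTo r S T) (hrT : ∀ x ∈ T, r x = x)
    (hh : ∀ {k : ℕ} {f : Q k → E}, Lp (bdQ k) S e f → Ht (bdQ k) S e f (fun x => r (f x))) (k : ℕ) :
    ∃ h : Pg (k+1) heS →* Pg (k+1) heT, Function.Bijective h := by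
  obtain ⟨h, h1⟩ := exists_ind (k := k) heS heT r hr hm (hrT e heT)
  refine ⟨h, ?_, ?_⟩
  · rw [injective_iff_map_eq_one]
    intro x hx
    obtain ⟨f, hf, rfl⟩ := exists_cls x
    have hrf : Lp (bdQ (k+1)) T e (fun x => r (f x)) := hf.map hr hm (hrT e heT)
    rw [h1 f hf, cls_eq_one hrf] at hx
    rw [cls_eq_one hf]
    exact (hh hf).trans (hx.map (φ := fun x => x) continuousOn_id hT rfl)
  · intro y
    obtain ⟨f, hf, rfl⟩ := exists_cls y
    have hf' : Lp (bdQ (k+1)) S e f := hf.map (φ := fun x => x) continuousOn_id hT rfl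
    refine ⟨cls heS f, ?_⟩
    rw [h1 f hf']
    congr 1
    funext x
    exact hrT _ (hf.mem x)

theorem gl_us (ι : Type) [Fintype ι] [DecidableEq ι] (k : ℕ) :
    ∃ h : Pg (k+1) (Gl.one (ι := ι)) →* Pg (k+1) (us_one (ι := ι)), Function.Bijective h := by
  refine retr_equiv us_gl Gl.one us_one (fun B => B * pol B) (continuousOn_id.mul cont_pol) (fun B hB => pol_us hB)
    (fun B hB => by rw [pol_of_us hB, mul_one]) ?_ k
  intro k f hf
  have cf := hf.cont
  have cp : Continuous fun z => pol (f z) := cont_pol.comp_continuous hf.cont hf.mem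
  refine (Ht.mk (fun (s : I) z => f z * ((1 - (s : ℝ)) • (1 : Matrix ι ι ℂ) + (s : ℝ) • pol (f z))) ?_ ?_ ?_).congr
    (fun z => by simp) (fun z => by simp)
  · have c2 : Continuous fun p : I × Q k => pol (f p.2) := cp.comp continuous_snd
    have c3 : Continuous fun p : I × Q k => (p.1 : ℝ) := by fun_prop
    exact (cf.comp continuous_snd).mul (((continuous_const.sub c3).smul continuous_const).add (c3.smul c2))
  · exact fun s z => Gl.mul (hf.mem z) (pol_unit (hf.mem z) s)
  · intro s z hz
    rw [hf.bd z hz, pol_of_us us_one, one_mul, ← add_smul]; simp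

/-- The Euclidean sphere and the punctured space. -/
theorem sph_nz {W : Type} [NormedAddCommGroup W] [NormedSpace ℝ W] {e : W} (he : e ∈ nz W) (he' : e ∈ Metric.sphere (0 : W) 1) (k : ℕ) :
    ∃ h : Pg (k+1) he →* Pg (k+1) he', Function.Bijective h := by
  have hn : ∀ w ∈ Metric.sphere (0 : W) 1, ‖w‖ = 1 := fun w hw => mem_sphere_zero_iff_norm.1 hw
  have ci : ContinuousOn (fun w : W => ‖w‖⁻¹) (nz W) := ContinuousOn.inv₀ (by fun_prop) fun w hw => norm_ne_zero_iff.2 hw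
  refine retr_equiv (fun w hw => ?_) he he' (fun w => ‖w‖⁻¹ • w) (ci.smul continuousOn_id) (fun w hw => ?_)
    (fun w hw => by rw [hn w hw]; simp) ?_ k
  · rw [mem_nz, ← norm_ne_zero_iff, hn w hw]; exact one_ne_zero
  · rw [mem_sphere_zero_iff_norm, norm_smul, norm_inv, norm_norm, inv_mul_cancel₀ (norm_ne_zero_iff.2 hw)]
  · intro k f hf
    have cf := hf.cont
    have cp : Continuous fun z => ‖f z‖⁻¹ := ci.comp_continuous hf.cont hf.mem
    refine (Ht.mk (fun (s : I) z => ((1 - (s : ℝ)) + (s : ℝ) * ‖f z‖⁻¹) • f z) ?_ ?_ ?_).congr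
      (fun z => by simp) (fun z => by simp)
    · have c2 : Continuous fun p : I × Q k => ‖f p.2‖⁻¹ := cp.comp continuous_snd
      have c3 : Continuous fun p : I × Q k => ((1 - (p.1 : ℝ)) + p.1 * ‖f p.2‖⁻¹) := by fun_prop
      exact c3.smul (cf.comp continuous_snd)
    · intro s z
      have p2 : 0 < ‖f z‖⁻¹ := inv_pos.2 (norm_pos_iff.2 (hf.mem z))
      refine smul_ne_zero (r := (1 - (s : ℝ)) + s * ‖f z‖⁻¹) (ne_of_gt ?_) (hf.mem z)
      rcases s.2.1.eq_or_lt with h0 | h0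
      · rw [← h0]; simp
      · have := mul_pos h0 p2
        linarith [s.2.2]
    · intro s z hz
      rw [hf.bd z hz, hn e he']; simp

end transfer
end PU
end part25

section part26
open scoped unitInterval Topology Matrix
set_option linter.unusedVariables false
set_option linter.unusedSimpArgs false
set_option linter.unusedSectionVars false
namespace PU

theorem final_aux (n m j : ℕ) (hn : 1 ≤ n) (hm : m + 1 = 2 * n) (hj : j = m + 1)
    (b : Metric.sphere (0 : EuclideanSpace ℂ (Fin (n + 1))) 1) :
    Nat.card (Pg (m+1) (us_one (ι := Fin n))) = n.factorial ∧ IsCyclic (Pg (m+1) (us_one (ι := Fin n))) ∧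
    ∃ h : Pg (j+1) b.2 →* Pg (m+1) (us_one (ι := Fin n)), Function.Surjective h := by
  subst hj
  obtain ⟨h1, h2, h, h3⟩ := gl_main n m hn hm
  obtain ⟨u, hu⟩ := gl_us (Fin n) m
  refine ⟨?_, isCyclic_of_surjective u hu.2, ?_⟩
  · rw [← h1]; exact (Nat.card_congr (Equiv.ofBijective u hu)).symm
  · have hb : b.1 ∈ nz (EuclideanSpace ℂ (Fin (n+1))) := by
      rw [mem_nz, ← norm_ne_zero_iff, mem_sphere_zero_iff_norm.1 b.2]; exact one_ne_zero
    obtain ⟨a, ha⟩ := sph_nz hb b.2 (m+1)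
    obtain ⟨L, hL⟩ := exists_equiv (W := EuclideanSpace ℂ (Fin (n+1))) (W' := Fin n ⊕ Unit → ℂ) (by
      rw [finrank_cpi, ← Module.finrank_mul_finrank ℝ ℂ, Complex.finrank_real_complex]; simp) (mem_nz.1 hb) (mem_nz.1 (ev_ne (ι := Fin n)))
    obtain ⟨c, -⟩ := lin_equiv (k := m+1) L hb ev_ne hL
    refine ⟨(u.comp h).comp (c.toMonoidHom.comp (MulEquiv.ofBijective a ha).symm.toMonoidHom), ?_⟩
    exact (hu.2.comp h3).comp (c.surjective.comp (MulEquiv.ofBijective a ha).symm.surjective)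

theorem exists_p (n : ℕ) : ∃ p : C(Matrix.unitaryGroup (Fin (n + 1)) ℂ, Metric.sphere (0 : EuclideanSpace ℂ (Fin (n + 1))) 1),
      (∀ g i, ((p g : EuclideanSpace ℂ (Fin (n + 1))) i = (g : Matrix (Fin (n + 1)) (Fin (n + 1)) ℂ) i (Fin.last n))) := by
  refine ⟨⟨fun g => ⟨WithLp.toLp 2 fun i => (g : Matrix (Fin (n + 1)) (Fin (n + 1)) ℂ) i (Fin.last n), ?_⟩, ?_⟩, fun g i => rfl⟩
  · rw [mem_sphere_zero_iff_norm]
    have h1 := congrFun (congrFun (Matrix.mem_unitaryGroup_iff'.1 g.2) (Fin.last n)) (Fin.last n)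
    rw [Matrix.mul_apply, Matrix.one_apply_eq] at h1
    have h2 : ∑ i, ‖(g : Matrix (Fin (n + 1)) (Fin (n + 1)) ℂ) i (Fin.last n)‖ ^ 2 = 1 := by
      have : (((∑ i, ‖(g : Matrix (Fin (n + 1)) (Fin (n + 1)) ℂ) i (Fin.last n)‖ ^ 2 : ℝ)) : ℂ) = 1 := by
        rw [← h1]
        push_cast
        refine Finset.sum_congr rfl fun i _ => ?_
        rw [Matrix.star_apply, ← Complex.conj_mul']
        rfl
      exact_mod_cast this
    rw [EuclideanSpace.norm_eq]
    simp only [h2, Real.sqrt_one]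
  · refine Continuous.subtype_mk ?_ _
    refine (PiLp.continuous_toLp 2 _).comp (continuous_pi fun i => ?_)
    exact (continuous_apply_apply i (Fin.last n)).comp continuous_subtype_val

end PU
end part26

open scoped unitInterval

/-- `π_{2n}(U(n))` is a cyclic group of order `n!`, generated by the image
of the connecting homomorphism `∂ : π_{2n+1}(S^{2n+1}) → π_{2n}(U(n))` of the fibration
`U(n) → U(n+1) → S^{2n+1}` (where the projection `p : U(n+1) → S^{2n+1}` sends a
unitary matrix to its last column); in particular there is a surjective homomorphism
`π_{2n+1}(S^{2n+1}) →* π_{2n}(U(n))`. -/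
theorem pi_2n_unitary_group (n m : ℕ) (hn : 1 ≤ n) (hm : m + 1 = 2 * n) :
    Nat.card (HomotopyGroup (Fin (m + 1)) (Matrix.unitaryGroup (Fin n) ℂ) 1) =
      n.factorial ∧
    IsCyclic (HomotopyGroup (Fin (m + 1)) (Matrix.unitaryGroup (Fin n) ℂ) 1) ∧
    ∃ p : C(Matrix.unitaryGroup (Fin (n + 1)) ℂ,
        Metric.sphere (0 : EuclideanSpace ℂ (Fin (n + 1))) 1),
      (∀ g : Matrix.unitaryGroup (Fin (n + 1)) ℂ, ∀ i : Fin (n + 1),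
        ((p g : EuclideanSpace ℂ (Fin (n + 1))) i =
          (g : Matrix (Fin (n + 1)) (Fin (n + 1)) ℂ) i (Fin.last n))) ∧
      ∃ conn : HomotopyGroup (Fin (2 * n + 1))
            (Metric.sphere (0 : EuclideanSpace ℂ (Fin (n + 1))) 1) (p 1) →*
          HomotopyGroup (Fin (m + 1)) (Matrix.unitaryGroup (Fin n) ℂ) 1,
        Function.Surjective conn := by
  obtain ⟨p, hp⟩ := PU.exists_p n
  obtain ⟨h1, h2, h3⟩ := PU.final_aux n m (2 * n) hn hm hm.symm (p 1)
  exact ⟨h1, h2, p, hp, h3⟩
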